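/- Let Δ ∈ ℕ and let p be a polynomial. Let (G_n) be a sequence of finite connected simple graphs with |V_n| even, |V_n| → ∞, all vertex degrees at most Δ, and such that for every n, every vertex x and every integer r ≥ 1 the ball of radius r around x in G_n has at most p(r) vertices. Let ε_n ∈ (0,1) satisfy ε_n → 0 and log(1/ε_n)/log|V_n| → 0. Then, with η_n a uniformly random perfect matching of V_n, the random walks on (G_n*) exhibit cutoff with high probability at a time of order (1/ε_n)·log|V_n|/log(1/ε_n): there exist constants 0 < c' ≤ C', a sequence t_n with c'·(1/ε_n)·log|V_n|/log(1/ε_n) ≤ t_n ≤ C'·(1/ε_n)·log|V_n|/log(1/ε_n) and a sequence s_n with s_n/t_n → 0 such that for every θ ∈ (0,1) there exists c(θ) with P(t_n − c(θ)·s_n ≤ t_mix^{G_n*}(θ) ≤ t_n + c(θ)·s_n) → 1 as n → ∞. -/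

import Mathlib

open Filter

noncomputable section

/-- A perfect matching of a vertex set: a fixed-point-free involution. -/
def IsPerfectMatchingFn {V : Type*} (η : V → V) : Prop :=
  Function.Involutive η ∧ ∀ x, η x ≠ x

/-- Probability that a uniformly random perfect matching satisfies the event `E`. -/
noncomputable def matchingProb (V : Type*) (E : (V → V) → Prop) : ℝ :=
  (Nat.card {η : V → V // IsPerfectMatchingFn η ∧ E η} : ℝ) /
    (Nat.card {η : V → V // IsPerfectMatchingFn η} : ℝ)

/-- Transition matrix of the simple random walk on a finite graph. -/
noncomputable def srwMatrix {V : Type*} [Fintype V] (G : SimpleGraph V) [DecidableRel G.Adj] :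
    Matrix V V ℝ :=
  fun x y => if G.Adj x y then ((G.degree x : ℝ))⁻¹ else 0

/-- Stationary distribution of the simple random walk: `deg x / (2|E|)`. -/
noncomputable def srwPi {V : Type*} [Fintype V] [DecidableEq V] (G : SimpleGraph V)
    [DecidableRel G.Adj] : V → ℝ :=
  fun x => (G.degree x : ℝ) / (2 * G.edgeFinset.card)

/-- The lazy version `(I + P)/2` of a transition matrix `P`. -/
noncomputable def lazyMatrix {V : Type*} [Fintype V] [DecidableEq V] (P : Matrix V V ℝ) :
    Matrix V V ℝ :=
  (2 : ℝ)⁻¹ • (1 + P)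

/-- Transition matrix of the random walk on the weighted graph `G*` obtained from `G`
by adding the matching edges `{x, η x}` with weight `ε`. -/
noncomputable def starMatrix {V : Type*} [Fintype V] [DecidableEq V] (G : SimpleGraph V)
    [DecidableRel G.Adj] (η : V → V) (ε : ℝ) : Matrix V V ℝ :=
  fun x y => ((if G.Adj x y then (1 : ℝ) else 0) + ε * (if η x = y then 1 else 0)) /
    ((G.degree x : ℝ) + ε)

/-- Stationary distribution of the random walk on `G*`. -/
noncomputable def starPi {V : Type*} [Fintype V] [DecidableEq V] (G : SimpleGraph V)
    [DecidableRel G.Adj] (ε : ℝ) : V → ℝ :=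
  fun x => ((G.degree x : ℝ) + ε) / (2 * G.edgeFinset.card + ε * Fintype.card V)

/-- The chain with transition matrix `P` and stationary distribution `stat` is mixed within
total variation distance `θ` from every starting state at time `t`. -/
def mixedAt {V : Type*} [Fintype V] [DecidableEq V] (P : Matrix V V ℝ) (stat : V → ℝ)
    (θ : ℝ) (t : ℕ) : Prop :=
  ∀ x, (2 : ℝ)⁻¹ * ∑ y, |(P ^ t) x y - stat y| ≤ θ

/-- Total variation mixing time (`sInf` over `ℕ`, so `0` if the chain never mixes). -/
noncomputable def tmix {V : Type*} [Fintype V] [DecidableEq V] (P : Matrix V V ℝ)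
    (stat : V → ℝ) (θ : ℝ) : ℕ :=
  sInf {t | mixedAt P stat θ t}

/-- Entropy of a probability vector. -/
noncomputable def entropy {V : Type*} [Fintype V] (p : V → ℝ) : ℝ :=
  ∑ y, Real.negMulLog (p y)

/-- A family of Markov chains indexed by `n`, with mixing-time function `tm n θ`,
exhibits cutoff. -/
def hasCutoff (tm : ℕ → ℝ → ℕ) : Prop :=
  ∃ t s : ℕ → ℝ, (∀ n, 0 < t n) ∧ (∀ n, 0 ≤ s n) ∧
    Tendsto (fun n => s n / t n) atTop (nhds 0) ∧
    ∀ θ ∈ Set.Ioo (0 : ℝ) 1, ∃ c : ℝ,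
      ∀ n, t n - c * s n ≤ (tm n θ : ℝ) ∧ (tm n θ : ℝ) ≤ t n + c * s n

/-- Number of vertices within graph distance `s` of `o`. -/
noncomputable def ballCard {V : Type*} (G : SimpleGraph V) (o : V) (s : ℝ) : ℕ :=
  Nat.card {y : V | (G.dist o y : ℝ) ≤ s}

/-- A vertex-transitive graph. -/
def IsVertexTransitive {V : Type*} (G : SimpleGraph V) : Prop :=
  ∀ x y : V, ∃ φ : G ≃g G, φ x = y

namespace StarCutoff

open Finset Real

set_option linter.unusedSectionVars false

variable {V : Type*} [Fintype V] [DecidableEq V] {G : SimpleGraph V} [DecidableRel G.Adj]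
  {Q : V → V → ℝ} {η : V → V} {ε : ℝ}

local notation "IsPM" => IsPerfectMatchingFn
local notation "nV" => Fintype.card V
local notation "Pairs" => List (V × V)

lemma mul_le_left {a b c : ℝ} (h : b ≤ c) (ha : 0 ≤ a) : a * b ≤ a * c :=
  _root_.mul_le_mul_of_nonneg_left h ha

lemma mul_le_right {a b c : ℝ} (h : b ≤ c) (ha : 0 ≤ a) : b * a ≤ c * a :=
  _root_.mul_le_mul_of_nonneg_right h ha

open Classical in
/-- The finite set of perfect matchings of `V`. -/
def matchings (V : Type*) [Fintype V] [DecidableEq V] : Finset (V → V) :=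
  univ.filter IsPM

/-- Perfect matchings containing all the pairs in the list `E`. -/
def ext (E : Pairs) : Finset (V → V) := (matchings V).filter fun η => ∀ p ∈ E, η p.1 = p.2

def touched (E : Pairs) : Finset V := (E.map Prod.fst ++ E.map Prod.snd).toFinset

lemma mem_matchings {η : V → V} : η ∈ matchings V ↔ IsPM η := by simp [matchings]

lemma mem_ext {E : Pairs} {η : V → V} :
    η ∈ ext E ↔ IsPM η ∧ ∀ p ∈ E, η p.1 = p.2 := by
  simp [ext, mem_matchings]

lemma ext_nil : ext ([] : Pairs) = matchings V := by simp [ext]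

lemma mem_touched {E : Pairs} {v : V} : v ∈ touched E ↔ ∃ p ∈ E, v = p.1 ∨ v = p.2 := by
  simp only [touched, List.mem_toFinset, List.mem_append, List.mem_map]
  constructor
  · rintro (⟨p, hp, rfl⟩ | ⟨p, hp, rfl⟩)
    · exact ⟨p, hp, Or.inl rfl⟩
    · exact ⟨p, hp, Or.inr rfl⟩
  · rintro ⟨p, hp, rfl | rfl⟩
    · exact Or.inl ⟨p, hp, rfl⟩
    · exact Or.inr ⟨p, hp, rfl⟩

lemma card_touched_le (E : Pairs) : (touched E).card ≤ 2 * E.length := by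
  refine (List.toFinset_card_le _).trans ?_
  simp; omega

lemma mem_ext_cons {E : Pairs} {η : V → V} {a b : V} :
    η ∈ ext ((a, b) :: E) ↔ η ∈ ext E ∧ η a = b := by
  simp only [mem_ext, List.mem_cons, forall_eq_or_imp]
  tauto

lemma mem_ext_cons_self {E : Pairs} {η : V → V} {a : V} (h : η ∈ ext E) :
    η ∈ ext ((a, η a) :: E) := mem_ext_cons.2 ⟨h, rfl⟩

lemma apply_mem_touched {E : Pairs} {η : V → V} (h : η ∈ ext E) {v : V}
    (hv : v ∈ touched E) : η v ∈ touched E := by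
  rw [mem_ext] at h
  rw [mem_touched] at hv ⊢
  obtain ⟨p, hp, rfl | rfl⟩ := hv
  · exact ⟨p, hp, Or.inr (h.2 p hp)⟩
  · exact ⟨p, hp, Or.inl (by rw [← h.2 p hp, h.1.1])⟩

lemma apply_notMem_touched {E : Pairs} {η : V → V} (h : η ∈ ext E) {v : V}
    (hv : v ∉ touched E) : η v ∉ touched E := by
  intro h'
  have := apply_mem_touched h h'
  rw [(mem_ext.1 h).1.1] at this
  exact hv this

/-- Splitting a sum over matchings according to the partner of `a`. -/
lemma sum_ext_reveal (E : Pairs) (a : V) (f : (V → V) → ℝ) :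
    ∑ η ∈ ext E, f η = ∑ b, ∑ η ∈ ext ((a, b) :: E), f η := by
  rw [← sum_fiberwise (ext E) (fun η => η a) f]
  refine sum_congr rfl fun b _ => sum_congr ?_ fun _ _ => rfl
  ext η
  simp [mem_ext_cons]

lemma ext_cons_eq_empty {E : Pairs} {a b : V} (ha : a ∉ touched E)
    (hb : b ∈ touched E ∨ a = b) : ext ((a, b) :: E) = ∅ := by
  rw [eq_empty_iff_forall_notMem]
  intro η hη
  rw [mem_ext_cons] at hη
  rcases hb with hb | hb
  · exact apply_notMem_touched hη.1 ha (hη.2 ▸ hb)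
  · exact (mem_ext.1 hη.1).1.2 a (hη.2.trans hb.symm)

lemma card_ext_cons_le_of_notMem {E : Pairs} {a b b' : V} (hb : b ∉ touched E)
    (hb' : b' ∉ touched E) (hab : a ≠ b) (hab' : a ≠ b') :
    (ext ((a, b) :: E)).card ≤ (ext ((a, b') :: E)).card := by
  set s := Equiv.swap b b'
  refine card_le_card_of_injOn (fun η => s ∘ η ∘ s) ?_ ?_
  · intro η hη
    have hη' := mem_ext_cons.1 (mem_coe.1 hη)
    obtain ⟨h1, h2⟩ := hη'
    have hs : ∀ v ∈ touched E, s v = v := fun v hv =>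
      Equiv.swap_apply_of_ne_of_ne (fun h => hb (h ▸ hv)) (fun h => hb' (h ▸ hv))
    have hinv : ∀ v, s (s v) = v := fun v => by simp [s]
    refine mem_coe.2 (mem_ext_cons.2 ⟨mem_ext.2 ⟨⟨?_, ?_⟩, ?_⟩, ?_⟩)
    · intro v
      simp [Function.comp, hinv, (mem_ext.1 h1).1.1 (s v)]
    · intro v h
      have : η (s v) = s v := by
        have := congrArg s h
        simpa [Function.comp, hinv] using this
      exact (mem_ext.1 h1).1.2 _ this
    · intro p hp
      have e1 := hs _ (mem_touched.2 ⟨p, hp, Or.inl rfl⟩)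
      have e2 := hs _ (mem_touched.2 ⟨p, hp, Or.inr rfl⟩)
      simp [Function.comp, e1, (mem_ext.1 h1).2 p hp, e2]
    · have := Equiv.swap_apply_of_ne_of_ne hab hab'
      simp [Function.comp, this, h2, s]
  · intro η _ η' _ h
    have hinv : ∀ v, s (s v) = v := fun v => by simp [s]
    funext v
    have := congrFun h (s v)
    simp only [Function.comp, hinv] at this
    exact s.injective this

/-- Conditionally on the pairs in `E`, the partner of an untouched vertex takes any given value
with probability at most `1 / (n - 2|E| - 1)`. -/
lemma card_ext_cons_le {E : Pairs} {a b : V} (ha : a ∉ touched E) :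
    ((nV : ℝ) - 2 * E.length - 1) * (ext ((a, b) :: E)).card ≤ (ext E).card := by
  by_cases hb : b ∈ touched E ∨ a = b
  · rw [ext_cons_eq_empty ha hb]; simp
  push Not at hb
  have h1 : ((ext E).card : ℝ) = ∑ b', ((ext ((a, b') :: E)).card : ℝ) := by
    have := sum_ext_reveal E a (fun _ => 1)
    simpa using this
  set W : Finset V := univ \ (insert a (touched E))
  have h2 : (W.card : ℝ) * (ext ((a, b) :: E)).card ≤ (ext E).card := by
    rw [h1, ← nsmul_eq_mul, ← sum_const]
    refine (sum_le_sum ?_).trans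
      (Finset.sum_le_sum_of_subset_of_nonneg (Finset.subset_univ W) fun _ _ _ => by positivity)
    intro b' hb'
    simp only [W, Finset.mem_sdiff, Finset.mem_univ, Finset.mem_insert, not_or, true_and] at hb'
    exact_mod_cast card_ext_cons_le_of_notMem hb.1 hb'.2 hb.2 (Ne.symm hb'.1)
  have h3 : nV ≤ W.card + (2 * E.length + 1) := by
    have : W.card + (insert a (touched E)).card = (Finset.univ : Finset V).card :=
      Finset.card_sdiff_add_card_eq_card (Finset.subset_univ (insert a (touched E)))
    have h4 := card_insert_le a (touched E)
    have h5 := card_touched_le E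
    rw [card_univ] at this
    omega
  have h3' : (nV : ℝ) ≤ W.card + (2 * E.length + 1) := by exact_mod_cast h3
  refine le_trans ?_ h2
  gcongr
  linarith

lemma matchings_nonempty (h : Even nV) : (matchings V).Nonempty := by
  obtain ⟨k, hk⟩ := h
  have e : V ≃ Fin k ⊕ Fin k := by
    refine Fintype.equivOfCardEq ?_
    simp [hk]
  refine ⟨fun v => e.symm (e v).swap, mem_matchings.2 ⟨fun v => by simp, fun v h => ?_⟩⟩
  have : (e v).swap = e v := by
    have := congrArg e h
    simpa using this
  rcases hv : e v with x | x <;> rw [hv] at this <;> simp at this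

lemma matchingProb_eq (E : (V → V) → Prop) [DecidablePred E] :
    matchingProb V E = (((matchings V).filter E).card : ℝ) / (matchings V).card := by
  classical
  unfold matchingProb
  congr 2
  · rw [Nat.card_eq_fintype_card, Fintype.card_subtype]
    congr 1
    ext η
    simp [mem_matchings]
  · rw [Nat.card_eq_fintype_card, Fintype.card_subtype]
    rfl

/-- `Z` depends on at most `N` revealed pairs beyond `E`, in the form needed to decouple it
from a quantity whose conditional averages are bounded. -/
def IsCert (E : Pairs) (N : ℕ) (Z : (V → V) → ℝ) : Prop :=
  ∀ X : (V → V) → ℝ, (∀ η, 0 ≤ X η) → ∀ M : ℝ, (∀ E' : Pairs, E'.length ≤ E.length + N →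
      ∑ η ∈ ext E', X η ≤ M * (ext E').card) →
    ∑ η ∈ ext E, Z η * X η ≤ M * ∑ η ∈ ext E, Z η

lemma IsCert.const (E : Pairs) (N : ℕ) {c : ℝ} (hc : 0 ≤ c) {Z : (V → V) → ℝ}
    (hZ : ∀ η ∈ ext E, Z η = c) : IsCert E N Z := by
  intro X _ M hM
  rw [sum_congr rfl fun η hη => by rw [hZ η hη], sum_congr rfl hZ,
    ← mul_sum, sum_const, nsmul_eq_mul]
  have := hM E (by omega)
  nlinarith

lemma IsCert.congr {E : Pairs} {N : ℕ} {Z Z' : (V → V) → ℝ} (h : IsCert E N Z)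
    (hZ : ∀ η ∈ ext E, Z' η = Z η) : IsCert E N Z' := by
  intro X hX M hM
  rw [sum_congr rfl fun η hη => by rw [hZ η hη], sum_congr rfl hZ]
  exact h X hX M hM

lemma IsCert.sum {ι : Type*} (s : Finset ι) {E : Pairs} {N : ℕ} {q : ι → ℝ} (hq : ∀ i, 0 ≤ q i)
    {Z : ι → (V → V) → ℝ} (h : ∀ i, IsCert E N (Z i)) :
    IsCert E N (fun η => ∑ i ∈ s, q i * Z i η) := by
  intro X hX M hM
  have e1 : ∑ η ∈ ext E, (∑ i ∈ s, q i * Z i η) * X η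
      = ∑ i ∈ s, q i * ∑ η ∈ ext E, Z i η * X η := by
    simp_rw [sum_mul, mul_sum]
    rw [sum_comm]
    simp_rw [mul_assoc]
  have e2 : M * ∑ η ∈ ext E, (∑ i ∈ s, q i * Z i η) = ∑ i ∈ s, q i * (M * ∑ η ∈ ext E, Z i η) := by
    simp_rw [mul_sum]
    rw [sum_comm]
    refine sum_congr rfl fun i _ => sum_congr rfl fun η _ => by ring
  rw [e1, e2]
  exact sum_le_sum fun i _ => mul_le_left (h i X hX M hM) (hq i)

lemma IsCert.reveal {E : Pairs} {N : ℕ} (a : V) {Z : V → (V → V) → ℝ}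
    (h : ∀ b, IsCert ((a, b) :: E) N (Z b)) :
    IsCert E (N + 1) (fun η => Z (η a) η) := by
  intro X hX M hM
  rw [sum_ext_reveal E a, sum_ext_reveal E a, mul_sum]
  refine sum_le_sum fun b _ => ?_
  have h1 : ∀ η ∈ ext ((a, b) :: E), η a = b := fun η hη => (mem_ext_cons.1 hη).2
  have e1 : ∑ η ∈ ext ((a, b) :: E), Z (η a) η * X η = ∑ η ∈ ext ((a, b) :: E), Z b η * X η :=
    sum_congr rfl fun η hη => by rw [h1 η hη]
  have e2 : ∑ η ∈ ext ((a, b) :: E), Z (η a) η = ∑ η ∈ ext ((a, b) :: E), Z b η :=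
    sum_congr rfl fun η hη => by rw [h1 η hη]
  rw [e1, e2]
  refine h b X hX M fun E' hE' => hM E' ?_
  simp at hE'
  omega

/-- Moment bound: if, given any few revealed pairs, `D` is at most `β` plus a certified quantity
of small conditional mean, then the high moments of `D` on `𝒜` are small. -/
lemma replica (𝒜 : (V → V) → Prop) [DecidablePred 𝒜] (D : (V → V) → ℝ) (hD : ∀ η, 0 ≤ D η)
    {β γ : ℝ} (hβ : 0 ≤ β) (hγ : 0 ≤ γ) (N L : ℕ) (Z : Pairs → (V → V) → ℝ)
    (hDZ : ∀ E : Pairs, E.length ≤ L * N → ∀ η ∈ ext E, 𝒜 η → D η ≤ β + Z E η)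
    (hcert : ∀ E : Pairs, E.length ≤ L * N → IsCert E N (Z E))
    (hmean : ∀ E : Pairs, E.length ≤ L * N → ∑ η ∈ ext E, Z E η ≤ γ * (ext E).card) :
    ∑ η ∈ matchings V, (if 𝒜 η then D η ^ L else 0) ≤ (β + γ) ^ L * (matchings V).card := by
  have key : ∀ l, l ≤ L → ∀ E : Pairs, E.length + l * N ≤ L * N →
      ∑ η ∈ ext E, (if 𝒜 η then D η ^ l else 0) ≤ (β + γ) ^ l * (ext E).card := by
    intro l
    induction l with
    | zero =>
      intro _ E _
      simp only [pow_zero, one_mul]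
      rw [← nsmul_one, ← sum_const]
      exact sum_le_sum fun η _ => by split_ifs <;> simp
    | succ l ih =>
      intro hl E hE
      have hE1 : E.length + l * N ≤ L * N := by rw [add_mul] at hE; omega
      have hE0 : E.length ≤ L * N := by omega
      have hX : ∀ η, 0 ≤ (if 𝒜 η then D η ^ l else 0) := fun η => by
        split_ifs
        · exact pow_nonneg (hD η) l
        · exact le_rfl
      have s1 : ∑ η ∈ ext E, (if 𝒜 η then D η ^ (l + 1) else 0) ≤
          ∑ η ∈ ext E, (β * (if 𝒜 η then D η ^ l else 0)
            + Z E η * (if 𝒜 η then D η ^ l else 0)) := by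
        refine sum_le_sum fun η hη => ?_
        split_ifs with h
        · have := hDZ E hE0 η hη h
          rw [pow_succ, ← add_mul, mul_comm]
          exact mul_le_right this (pow_nonneg (hD η) l)
        · simp
      rw [sum_add_distrib, ← mul_sum] at s1
      have s2 := hcert E hE0 _ hX ((β + γ) ^ l) (fun E' hE' => ih (by omega) E' (by
        rw [add_mul] at hE; omega))
      have s3 := mul_le_left (ih (by omega) E hE1) hβ
      have s4 := mul_le_left (hmean E hE0) (pow_nonneg (add_nonneg hβ hγ) l)
      calc _ ≤ _ := s1
        _ ≤ β * ((β + γ) ^ l * (ext E).card) + (β + γ) ^ l * (γ * (ext E).card) :=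
          add_le_add s3 (s2.trans s4)
        _ = _ := by ring
  have := key L le_rfl [] (by simp)
  rwa [ext_nil] at this

lemma card_le_of_replica (𝒜 : (V → V) → Prop) [DecidablePred 𝒜] (D : (V → V) → ℝ)
    (hD : ∀ η, 0 ≤ D η)
    {β γ δ : ℝ} (hβ : 0 ≤ β) (hγ : 0 ≤ γ) (hδ : 0 < δ) (N L : ℕ)
    (Z : Pairs → (V → V) → ℝ)
    (hDZ : ∀ E : Pairs, E.length ≤ L * N → ∀ η ∈ ext E, 𝒜 η → D η ≤ β + Z E η)
    (hcert : ∀ E : Pairs, E.length ≤ L * N → IsCert E N (Z E))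
    (hmean : ∀ E : Pairs, E.length ≤ L * N → ∑ η ∈ ext E, Z E η ≤ γ * (ext E).card) :
    (((matchings V).filter fun η => 𝒜 η ∧ δ < D η).card : ℝ)
      ≤ ((β + γ) / δ) ^ L * (matchings V).card := by
  classical
  have h := replica 𝒜 D hD hβ hγ N L Z hDZ hcert hmean
  rw [div_pow, div_mul_eq_mul_div, le_div_iff₀ (pow_pos hδ L)]
  refine le_trans ?_ h
  rw [← nsmul_eq_mul, ← sum_const, sum_filter]
  refine sum_le_sum fun η _ => ?_
  split_ifs with h1 h2 h2
  · exact pow_le_pow_left₀ hδ.le h1.2.le L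
  · exact absurd h1.1 h2
  · exact pow_nonneg (hD η) L
  · exact le_rfl

open Classical in
/-- Fraction of the perfect matchings satisfying `𝒜`. -/
def pr (𝒜 : (V → V) → Prop) : ℝ := (((matchings V).filter 𝒜).card : ℝ) / (matchings V).card

lemma matchingProb_eq_pr (𝒜 : (V → V) → Prop) : matchingProb V 𝒜 = pr 𝒜 := by
  classical
  rw [matchingProb_eq, pr]

lemma pr_nonneg (𝒜 : (V → V) → Prop) : 0 ≤ pr 𝒜 := by unfold pr; positivity

lemma pr_mono {𝒜 ℬ : (V → V) → Prop} (h : ∀ η, IsPM η → 𝒜 η → ℬ η) :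
    pr 𝒜 ≤ pr ℬ := by
  classical
  unfold pr
  gcongr with η hη
  exact h η (mem_matchings.1 hη)

lemma pr_le_one (𝒜 : (V → V) → Prop) : pr 𝒜 ≤ 1 := by
  classical
  unfold pr
  refine div_le_one_of_le₀ ?_ (by positivity)
  exact_mod_cast card_filter_le _ _

lemma pr_or_le (𝒜 ℬ : (V → V) → Prop) : pr (fun η => 𝒜 η ∨ ℬ η) ≤ pr 𝒜 + pr ℬ := by
  classical
  unfold pr
  rw [← add_div]
  gcongr
  have : (matchings V).filter (fun η => 𝒜 η ∨ ℬ η)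
      ⊆ (matchings V).filter 𝒜 ∪ (matchings V).filter ℬ := by grind
  have h2 := (card_le_card this).trans (card_union_le _ _)
  norm_cast
  refine le_trans (le_of_eq ?_) h2
  congr!

lemma pr_exists_le {ι : Type*} (s : Finset ι) (𝒜 : ι → (V → V) → Prop) :
    pr (fun η => ∃ i ∈ s, 𝒜 i η) ≤ ∑ i ∈ s, pr (𝒜 i) := by
  classical
  induction s using Finset.induction_on with
  | empty => simp [pr]
  | insert i s hi ih =>
    rw [sum_insert hi]
    refine le_trans ?_ (add_le_add_right ih _)
    refine le_trans (pr_mono ?_) (pr_or_le _ _)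
    intro η _ h
    simpa using h

lemma pr_exists_le_mul {ι : Type*} (s : Finset ι) (𝒜 : ι → (V → V) → Prop) {c : ℝ}
    (h : ∀ i ∈ s, pr (𝒜 i) ≤ c) :
    pr (fun η => ∃ i ∈ s, 𝒜 i η) ≤ s.card * c := by
  refine (pr_exists_le s 𝒜).trans ((sum_le_sum h).trans ?_)
  rw [sum_const, nsmul_eq_mul]

lemma pr_compl (h : Even nV) (𝒜 : (V → V) → Prop) : pr (fun η => ¬ 𝒜 η) = 1 - pr 𝒜 := by
  classical
  have hpos : (0 : ℝ) < (matchings V).card := by exact_mod_cast (matchings_nonempty h).card_pos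
  unfold pr
  rw [eq_sub_iff_add_eq, ← add_div, div_eq_one_iff_eq hpos.ne']
  have := card_filter_add_card_filter_not (s := matchings V) 𝒜
  rw [add_comm]
  norm_cast
  convert this

lemma pr_le_of_card_le {𝒜 : (V → V) → Prop} [DecidablePred 𝒜] {c : ℝ} (hc : 0 ≤ c)
    (h : (((matchings V).filter 𝒜).card : ℝ) ≤ c * (matchings V).card) : pr 𝒜 ≤ c := by
  unfold pr
  refine div_le_of_le_mul₀ (by positivity) hc ?_
  refine le_trans (le_of_eq ?_) h
  congr!

lemma pr_le_of_sum_le {𝒜 : (V → V) → Prop} {f : (V → V) → ℝ} {b c : ℝ} (hc : 0 ≤ c) (hb : 0 < b)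
    (hf : ∀ η ∈ matchings V, 0 ≤ f η)
    (h𝒜 : ∀ η ∈ matchings V, 𝒜 η → b ≤ f η)
    (h : ∑ η ∈ matchings V, f η ≤ b * c * (matchings V).card) : pr 𝒜 ≤ c := by
  classical
  refine pr_le_of_card_le hc ?_
  have : b * ((matchings V).filter 𝒜).card ≤ ∑ η ∈ matchings V, f η := by
    rw [mul_comm, ← nsmul_eq_mul, ← sum_const, sum_filter]
    refine sum_le_sum fun η hη => ?_
    split_ifs with h1
    · exact h𝒜 η hη h1
    · exact hf η hη
  have h2 := this.trans h
  rw [mul_assoc] at h2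
  exact le_of_mul_le_mul_left h2 hb

/-- Symmetric doubly stochastic kernels. -/
structure IsDS (Q : V → V → ℝ) : Prop where
  nonneg : ∀ x y, 0 ≤ Q x y
  symm : ∀ x y, Q x y = Q y x
  row : ∀ x, ∑ y, Q x y = 1

lemma IsDS.col {Q : V → V → ℝ} (hQ : IsDS Q) (y : V) : ∑ x, Q x y = 1 := by
  rw [← hQ.row y]; exact sum_congr rfl fun x _ => hQ.symm x y

def Qop (Q : V → V → ℝ) (f : V → ℝ) : V → ℝ := fun x => ∑ a, Q x a * f a

/-- One `Q`-step followed by a crossing of the matching. -/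
def Kop (Q : V → V → ℝ) (η : V → V) (f : V → ℝ) : V → ℝ := fun x => ∑ a, Q x a * f (η a)

lemma Kop_mono (hQ : IsDS Q) {f g : V → ℝ} (h : ∀ x, f x ≤ g x) (x : V) :
    Kop Q η f x ≤ Kop Q η g x :=
  sum_le_sum fun a _ => mul_le_left (h _) (hQ.nonneg x a)

lemma Kop_nonneg (hQ : IsDS Q) {f : V → ℝ} (h : ∀ x, 0 ≤ f x) (x : V) : 0 ≤ Kop Q η f x :=
  sum_nonneg fun a _ => mul_nonneg (hQ.nonneg x a) (h _)

lemma Kop_const (hQ : IsDS Q) (c : ℝ) : Kop Q η (fun _ => c) = fun _ => c := by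
  funext x
  simp [Kop, ← sum_mul, hQ.row]

lemma Kop_add (f g : V → ℝ) : Kop Q η (fun x => f x + g x) = fun x => Kop Q η f x + Kop Q η g x := by
  funext x
  simp [Kop, mul_add, sum_add_distrib]

lemma Kop_sub (f g : V → ℝ) : Kop Q η (fun x => f x - g x) = fun x => Kop Q η f x - Kop Q η g x := by
  funext x
  simp [Kop, mul_sub, sum_sub_distrib]

lemma Kop_mul (c : ℝ) (f : V → ℝ) : Kop Q η (fun x => c * f x) = fun x => c * Kop Q η f x := by
  funext x
  simp only [Kop, mul_sum]
  exact sum_congr rfl fun _ _ => by ring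

lemma Kop_sum {ι : Type*} (s : Finset ι) (f : ι → V → ℝ) :
    Kop Q η (fun x => ∑ i ∈ s, f i x) = fun x => ∑ i ∈ s, Kop Q η (f i) x := by
  funext x
  simp only [Kop, mul_sum]
  exact sum_comm

def Kpow (Q : V → V → ℝ) (η : V → V) (m : ℕ) (f : V → ℝ) : V → ℝ := (Kop Q η)^[m] f

@[simp] lemma Kpow_zero (f : V → ℝ) : Kpow Q η 0 f = f := rfl

lemma Kpow_succ (m : ℕ) (f : V → ℝ) : Kpow Q η (m + 1) f = Kop Q η (Kpow Q η m f) :=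
  Function.iterate_succ_apply' _ _ _

lemma Kpow_succ' (m : ℕ) (f : V → ℝ) : Kpow Q η (m + 1) f = Kpow Q η m (Kop Q η f) :=
  Function.iterate_succ_apply _ _ _

lemma Kpow_add (m k : ℕ) (f : V → ℝ) : Kpow Q η (m + k) f = Kpow Q η m (Kpow Q η k f) :=
  Function.iterate_add_apply _ _ _ _

lemma Kpow_mono (hQ : IsDS Q) (m : ℕ) {f g : V → ℝ} (h : ∀ x, f x ≤ g x) (x : V) :
    Kpow Q η m f x ≤ Kpow Q η m g x := by
  induction m generalizing x with
  | zero => exact h x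
  | succ m ih => rw [Kpow_succ, Kpow_succ]; exact Kop_mono hQ ih x

lemma Kpow_const (hQ : IsDS Q) (m : ℕ) (c : ℝ) : Kpow Q η m (fun _ => c) = fun _ => c := by
  induction m with
  | zero => rfl
  | succ m ih => rw [Kpow_succ, ih, Kop_const hQ]

lemma Kpow_nonneg (hQ : IsDS Q) (m : ℕ) {f : V → ℝ} (h : ∀ x, 0 ≤ f x) (x : V) :
    0 ≤ Kpow Q η m f x := by
  have := Kpow_mono (η := η) hQ m h x
  rwa [Kpow_const hQ] at this

lemma Kpow_le (hQ : IsDS Q) (m : ℕ) {f : V → ℝ} {c : ℝ} (h : ∀ x, f x ≤ c) (x : V) :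
    Kpow Q η m f x ≤ c := by
  have := Kpow_mono (η := η) hQ m h x
  rwa [Kpow_const hQ] at this

lemma le_Kpow (hQ : IsDS Q) (m : ℕ) {f : V → ℝ} {c : ℝ} (h : ∀ x, c ≤ f x) (x : V) :
    c ≤ Kpow Q η m f x := by
  have := Kpow_mono (η := η) hQ m h x
  rwa [Kpow_const hQ] at this

lemma Kpow_add_fun (m : ℕ) (f g : V → ℝ) :
    Kpow Q η m (fun x => f x + g x) = fun x => Kpow Q η m f x + Kpow Q η m g x := by
  induction m with
  | zero => rfl
  | succ m ih => rw [Kpow_succ, Kpow_succ, Kpow_succ, ih, Kop_add]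

lemma Kpow_sub_fun (m : ℕ) (f g : V → ℝ) :
    Kpow Q η m (fun x => f x - g x) = fun x => Kpow Q η m f x - Kpow Q η m g x := by
  induction m with
  | zero => rfl
  | succ m ih => rw [Kpow_succ, Kpow_succ, Kpow_succ, ih, Kop_sub]

lemma Kpow_mul (m : ℕ) (c : ℝ) (f : V → ℝ) :
    Kpow Q η m (fun x => c * f x) = fun x => c * Kpow Q η m f x := by
  induction m with
  | zero => rfl
  | succ m ih => rw [Kpow_succ, Kpow_succ, ih, Kop_mul]

lemma Kpow_sum {ι : Type*} (s : Finset ι) (m : ℕ) (f : ι → V → ℝ) :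
    Kpow Q η m (fun x => ∑ i ∈ s, f i x) = fun x => ∑ i ∈ s, Kpow Q η m (f i) x := by
  induction m with
  | zero => rfl
  | succ m ih => simp_rw [Kpow_succ]; rw [ih, Kop_sum]

/-- `m` steps of the crossing chain, with the crossed pairs recorded in the list `E`. -/
def rev (Q : V → V → ℝ) (η : V → V) (Φ : Pairs → V → ℝ) : ℕ → Pairs → V → ℝ
  | 0, E, x => Φ E x
  | m + 1, E, x => ∑ a, Q x a * rev Q η Φ m ((a, η a) :: E) (η a)

lemma rev_mono (hQ : IsDS Q) {Φ Ψ : Pairs → V → ℝ} (m : ℕ) {E : Pairs}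
    (hE : η ∈ ext E) (h : ∀ E' u, η ∈ ext E' → E'.length = E.length + m → Φ E' u ≤ Ψ E' u)
    (x : V) : rev Q η Φ m E x ≤ rev Q η Ψ m E x := by
  induction m generalizing E x with
  | zero => exact h E x hE rfl
  | succ m ih =>
    refine sum_le_sum fun a _ => mul_le_left ?_ (hQ.nonneg x a)
    refine ih (mem_ext_cons_self hE) (fun E' u h1 h2 => h E' u h1 ?_) _
    simp at h2; omega

lemma rev_add (Φ Ψ : Pairs → V → ℝ) (m : ℕ) (E : Pairs) (x : V) :
    rev Q η (fun E u => Φ E u + Ψ E u) m E x = rev Q η Φ m E x + rev Q η Ψ m E x := by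
  induction m generalizing E x with
  | zero => rfl
  | succ m ih => simp [rev, ih, mul_add, sum_add_distrib]

lemma rev_fun (f : V → ℝ) (m : ℕ) (E : Pairs) (x : V) :
    rev Q η (fun _ u => f u) m E x = Kpow Q η m f x := by
  induction m generalizing E x with
  | zero => rfl
  | succ m ih => simp only [rev, ih]; rw [Kpow_succ]; rfl

lemma rev_nonneg (hQ : IsDS Q) {Φ : Pairs → V → ℝ} (h : ∀ E u, 0 ≤ Φ E u) (m : ℕ)
    (E : Pairs) (x : V) : 0 ≤ rev Q η Φ m E x := by
  induction m generalizing E x with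
  | zero => exact h E x
  | succ m ih => exact sum_nonneg fun a _ => mul_nonneg (hQ.nonneg x a) (ih _ _)

lemma isCert_rev (hQ : IsDS Q) (Φ : (V → V) → Pairs → V → ℝ) (m k : ℕ) (E : Pairs) (x : V)
    (h : ∀ E' u, E'.length = E.length + m → IsCert E' k (fun η => Φ η E' u)) :
    IsCert E (k + m) (fun η => rev Q η (Φ η) m E x) := by
  induction m generalizing E x with
  | zero => exact h E x rfl
  | succ m ih =>
    refine IsCert.sum univ (hQ.nonneg x) fun a => ?_
    refine IsCert.reveal a (Z := fun b η => rev Q η (Φ η) m ((a, b) :: E) b) fun b => ?_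
    refine ih _ _ fun E' u hE' => h E' u ?_
    simp at hE'; omega

lemma sum_rev_le (hQ : IsDS Q) (Φ : (V → V) → Pairs → V → ℝ) (m : ℕ) {γ : ℝ} (E : Pairs) (x : V)
    (h : ∀ E' u, E'.length = E.length + m → ∑ η ∈ ext E', Φ η E' u ≤ γ * (ext E').card) :
    ∑ η ∈ ext E, rev Q η (Φ η) m E x ≤ γ * (ext E).card := by
  induction m generalizing E x with
  | zero => exact h E x rfl
  | succ m ih =>
    simp only [rev]
    rw [sum_comm]
    have : ∀ a, ∑ η ∈ ext E, Q x a * rev Q η (Φ η) m ((a, η a) :: E) (η a)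
        ≤ Q x a * (γ * (ext E).card) := by
      intro a
      rw [← mul_sum]
      refine mul_le_left ?_ (hQ.nonneg x a)
      have hc : ((ext E).card : ℝ) = ∑ b, ((ext ((a, b) :: E)).card : ℝ) := by
        have := sum_ext_reveal E a (fun _ => 1)
        simpa using this
      rw [sum_ext_reveal E a, hc, mul_sum]
      refine sum_le_sum fun b _ => ?_
      rw [sum_congr rfl (g := fun η => rev Q η (Φ η) m ((a, b) :: E) b)
        fun η hη => by rw [(mem_ext_cons.1 hη).2]]
      refine ih _ _ fun E' u hE' => h E' u ?_
      simp at hE'; omega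
    refine (sum_le_sum fun a _ => this a).trans ?_
    rw [← sum_mul, hQ.row, one_mul]

/-- Interaction of the endpoint with the recorded pairs. -/
lemma rev_list_sum_le (hQ : IsDS Q) (ψ : V × V → V → ℝ) (S : ℕ → ℝ)
    (hS : ∀ l p u, Kpow Q η l (ψ p) u ≤ S l) (m : ℕ) (E : Pairs) (x : V) :
    rev Q η (fun E u => (E.map fun p => ψ p u).sum) m E x ≤
      (E.map fun p => Kpow Q η m (ψ p) x).sum + ∑ l ∈ range m, S l := by
  induction m generalizing E x with
  | zero => simp [rev]
  | succ m ih =>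
    have e : ∀ E : Pairs, ∑ a, Q x a * (E.map fun p => Kpow Q η m (ψ p) (η a)).sum
        = (E.map fun p => Kpow Q η (m + 1) (ψ p) x).sum := by
      intro E
      induction E with
      | nil => simp
      | cons p E ihE =>
        simp only [List.map_cons, List.sum_cons, mul_add, sum_add_distrib, ihE]
        rw [Kpow_succ]; rfl
    calc rev Q η (fun E u => (E.map fun p => ψ p u).sum) (m + 1) E x
        ≤ ∑ a, Q x a * ((E.map fun p => Kpow Q η m (ψ p) (η a)).sum
            + (S m + ∑ l ∈ range m, S l)) := by
          refine sum_le_sum fun a _ => mul_le_left ?_ (hQ.nonneg x a)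
          refine (ih _ _).trans ?_
          simp only [List.map_cons, List.sum_cons]
          have := hS m (a, η a) (η a)
          linarith
      _ = _ := by
          simp only [mul_add (Q x _), sum_add_distrib]
          rw [e, ← sum_mul, ← sum_mul, hQ.row, sum_range_succ]
          ring

section BiluLinial

variable {C : Type*} [Fintype C] [DecidableEq C]

lemma bilin_le_of_indicator {W : C → C → ℝ} {A B : Finset C} {κ h h' : ℝ}
    (hκ : ∀ A' ⊆ A, ∀ B' ⊆ B, ∑ c ∈ A', ∑ d ∈ B', W c d ≤ κ)
    {φ ψ : C → ℝ} (hφ0 : ∀ c ∈ A, 0 ≤ φ c) (hφ : ∀ c ∈ A, φ c ≤ h)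
    (hψ0 : ∀ c ∈ B, 0 ≤ ψ c) (hψ : ∀ c ∈ B, ψ c ≤ h') (hh : 0 ≤ h) (hh' : 0 ≤ h') :
    ∑ c ∈ A, ∑ d ∈ B, W c d * φ c * ψ d ≤ h * h' * κ := by
  have lin : ∀ (S : Finset C) (w f : C → ℝ) (k : ℝ), (∀ c ∈ S, 0 ≤ f c) → (∀ c ∈ S, f c ≤ k) →
      ∑ c ∈ S, f c * w c ≤ k * ∑ c ∈ S.filter (fun c => 0 < w c), w c := by
    intro S w f k h0 hk
    rw [mul_sum, sum_filter]
    refine sum_le_sum fun c hc => ?_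
    split_ifs with hw
    · exact mul_le_right (hk c hc) hw.le
    · exact mul_nonpos_of_nonneg_of_nonpos (h0 c hc) (not_lt.1 hw)
  set A' := A.filter (fun c => 0 < ∑ d ∈ B, ψ d * W c d)
  have s1 : ∑ c ∈ A, ∑ d ∈ B, W c d * φ c * ψ d ≤ h * ∑ c ∈ A', ∑ d ∈ B, ψ d * W c d := by
    refine le_trans (le_of_eq ?_) (lin A (fun c => ∑ d ∈ B, ψ d * W c d) φ h hφ0 hφ)
    refine sum_congr rfl fun c _ => ?_
    rw [mul_sum]
    exact sum_congr rfl fun d _ => by ring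
  have s2 : ∑ c ∈ A', ∑ d ∈ B, ψ d * W c d
      ≤ h' * ∑ d ∈ B.filter (fun d => 0 < ∑ c ∈ A', W c d), ∑ c ∈ A', W c d := by
    refine le_trans (le_of_eq ?_) (lin B (fun d => ∑ c ∈ A', W c d) ψ h' hψ0 hψ)
    rw [sum_comm]
    exact sum_congr rfl fun d _ => by rw [mul_sum]
  have s3 := hκ A' (filter_subset _ _) (B.filter (fun d => 0 < ∑ c ∈ A', W c d)) (filter_subset _ _)
  rw [sum_comm] at s3
  calc _ ≤ _ := s1
    _ ≤ h * (h' * κ) := by gcongr; exact s2.trans (by gcongr)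
    _ = _ := by ring

lemma sum_levels {D : Finset C} (k : C → ℤ) (f : C → ℝ) :
    ∑ i ∈ D.image k, ∑ c ∈ D.filter (fun c => k c = i), f c = ∑ c ∈ D, f c :=
  sum_fiberwise_of_maps_to (fun _ hc => mem_image_of_mem k hc) f

/-- A bilinear form with small discrepancy on pairs of sets and bounded row and column sums has
small norm on nonnegative vectors. -/
lemma bilin_le_of_discrepancy_nonneg {W : C → C → ℝ} {μ : C → ℝ} (hμ : ∀ c, 0 ≤ μ c) {β : ℝ}
    (hβ : 0 ≤ β)
    (hdisc : ∀ A B : Finset C, ∑ c ∈ A, ∑ d ∈ B, W c d ≤ β * √((∑ c ∈ A, μ c) * ∑ d ∈ B, μ d))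
    (hrow : ∀ c, ∑ d, |W c d| ≤ 2 * μ c) (hcol : ∀ d, ∑ c, |W c d| ≤ 2 * μ d)
    (b : ℕ) (hb : 1 < b) (φ ψ : C → ℝ) (hφ : ∀ c, 0 ≤ φ c) (hψ : ∀ c, 0 ≤ ψ c) :
    ∑ c, ∑ d, W c d * φ c * ψ d ≤
      (3 / 2 * β * b ^ 2 + 2 / b) * (∑ c, μ c * φ c ^ 2 + ∑ c, μ c * ψ c ^ 2) := by
  classical
  have hb0 : (0 : ℝ) < b := by positivity
  have hb1 : (1 : ℝ) ≤ b := by exact_mod_cast hb.le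
  set k : C → ℤ := fun c => Int.log b (φ c)
  set l : C → ℤ := fun c => Int.log b (ψ c)
  set A : Finset C := univ.filter fun c => 0 < φ c
  set B : Finset C := univ.filter fun c => 0 < ψ c
  have hA : ∀ f : C → ℝ, (∀ c, φ c = 0 → f c = 0) → ∑ c, f c = ∑ c ∈ A, f c := fun f hf => by
    rw [sum_filter]
    refine sum_congr rfl fun c _ => ?_
    split_ifs with h
    · rfl
    · exact hf c (le_antisymm (not_lt.1 h) (hφ c))
  have hB : ∀ f : C → ℝ, (∀ c, ψ c = 0 → f c = 0) → ∑ c, f c = ∑ c ∈ B, f c := fun f hf => by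
    rw [sum_filter]
    refine sum_congr rfl fun c _ => ?_
    split_ifs with h
    · rfl
    · exact hf c (le_antisymm (not_lt.1 h) (hψ c))
  have hk1 : ∀ c ∈ A, (b : ℝ) ^ (k c) ≤ φ c := fun c hc =>
    Int.zpow_log_le_self hb (mem_filter.1 hc).2
  have hk2 : ∀ c, φ c ≤ (b : ℝ) ^ (k c + 1) := fun c => (Int.lt_zpow_succ_log_self hb _).le
  have hl1 : ∀ c ∈ B, (b : ℝ) ^ (l c) ≤ ψ c := fun c hc =>
    Int.zpow_log_le_self hb (mem_filter.1 hc).2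
  have hl2 : ∀ c, ψ c ≤ (b : ℝ) ^ (l c + 1) := fun c => (Int.lt_zpow_succ_log_self hb _).le
  set Nφ := ∑ c, μ c * φ c ^ 2
  set Nψ := ∑ c, μ c * ψ c ^ 2
  -- pairs on neighbouring levels
  set near : C → C → Prop := fun c d => k c - l d ∈ Set.Icc (-1 : ℤ) 1
  have split : ∑ c, ∑ d, W c d * φ c * ψ d
      = ∑ c ∈ A, ∑ d ∈ B, (if near c d then W c d * φ c * ψ d else 0)
        + ∑ c, ∑ d, (if near c d then 0 else W c d * φ c * ψ d) := by
    have e : ∑ c ∈ A, ∑ d ∈ B, (if near c d then W c d * φ c * ψ d else 0)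
        = ∑ c, ∑ d, (if near c d then W c d * φ c * ψ d else 0) := by
      rw [hA _ (fun c hc => sum_eq_zero fun d _ => by simp [hc])]
      refine sum_congr rfl fun c _ => ?_
      rw [hB _ (fun d hd => by simp [hd])]
    rw [e, ← sum_add_distrib]
    refine sum_congr rfl fun c _ => ?_
    rw [← sum_add_distrib]
    refine sum_congr rfl fun d _ => ?_
    split_ifs <;> simp
  have far : ∑ c, ∑ d, (if near c d then 0 else W c d * φ c * ψ d) ≤ 2 / b * (Nφ + Nψ) := by
    have pt : ∀ c d, (if near c d then 0 else W c d * φ c * ψ d)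
        ≤ |W c d| * φ c ^ 2 / b + |W c d| * ψ d ^ 2 / b := by
      intro c d
      have n1 : 0 ≤ |W c d| * φ c ^ 2 / b := by positivity
      have n2 : 0 ≤ |W c d| * ψ d ^ 2 / b := by positivity
      split_ifs with h
      · positivity
      rcases (hφ c).eq_or_lt with h0 | h0
      · rw [← h0]; simp; positivity
      rcases (hψ d).eq_or_lt with h0' | h0'
      · rw [← h0']; simp; positivity
      have hc : c ∈ A := by simp [A, h0]
      have hd : d ∈ B := by simp [B, h0']
      have w : W c d * φ c * ψ d ≤ |W c d| * (φ c * ψ d) := by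
        rw [mul_assoc]; exact mul_le_right (le_abs_self _) (by positivity)
      simp only [near, Set.mem_Icc, not_and_or, not_le] at h
      rcases h with h | h
      · have : φ c ≤ ψ d / b := by
          rw [le_div_iff₀ hb0]
          calc φ c * b ≤ (b : ℝ) ^ (k c + 1) * b := by gcongr; exact hk2 c
            _ = (b : ℝ) ^ (k c + 1 + 1) := by rw [zpow_add_one₀ hb0.ne' (k c + 1)]
            _ ≤ (b : ℝ) ^ (l d) := zpow_le_zpow_right₀ hb1 (by omega)
            _ ≤ ψ d := hl1 d hd
        have h3 : |W c d| * (φ c * ψ d) ≤ |W c d| * ψ d ^ 2 / b := by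
          rw [mul_div_assoc]
          refine mul_le_left ?_ (abs_nonneg _)
          calc φ c * ψ d ≤ ψ d / b * ψ d := by gcongr
            _ = ψ d ^ 2 / b := by ring
        linarith
      · have : ψ d ≤ φ c / b := by
          rw [le_div_iff₀ hb0]
          calc ψ d * b ≤ (b : ℝ) ^ (l d + 1) * b := by gcongr; exact hl2 d
            _ = (b : ℝ) ^ (l d + 1 + 1) := by rw [zpow_add_one₀ hb0.ne' (l d + 1)]
            _ ≤ (b : ℝ) ^ (k c) := zpow_le_zpow_right₀ hb1 (by omega)
            _ ≤ φ c := hk1 c hc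
        have h3 : |W c d| * (φ c * ψ d) ≤ |W c d| * φ c ^ 2 / b := by
          rw [mul_div_assoc]
          refine mul_le_left ?_ (abs_nonneg _)
          calc φ c * ψ d ≤ φ c * (φ c / b) := by gcongr
            _ = φ c ^ 2 / b := by ring
        linarith
    calc _ ≤ ∑ c, ∑ d, (|W c d| * φ c ^ 2 / b + |W c d| * ψ d ^ 2 / b) :=
          sum_le_sum fun c _ => sum_le_sum fun d _ => pt c d
      _ = (∑ c, (∑ d, |W c d|) * (φ c ^ 2 / b)) + ∑ d, (∑ c, |W c d|) * (ψ d ^ 2 / b) := by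
          simp_rw [sum_add_distrib, sum_mul, mul_div_assoc]
          congr 1
          rw [sum_comm]
      _ ≤ (∑ c, (2 * μ c) * (φ c ^ 2 / b)) + ∑ d, (2 * μ d) * (ψ d ^ 2 / b) := by
          gcongr with c _ d _
          · exact hrow c
          · exact hcol d
      _ = _ := by
          simp only [Nφ, Nψ, mul_add, mul_sum]
          congr 1 <;> exact sum_congr rfl fun c _ => by ring
  have nearb : ∑ c ∈ A, ∑ d ∈ B, (if near c d then W c d * φ c * ψ d else 0)
      ≤ 3 / 2 * β * b ^ 2 * (Nφ + Nψ) := by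
    set I := A.image k
    set J := B.image l
    set Ai : ℤ → Finset C := fun i => A.filter fun c => k c = i
    set Bj : ℤ → Finset C := fun j => B.filter fun c => l c = j
    set p : ℤ → ℝ := fun i => ∑ c ∈ Ai i, b ^ 2 * (μ c * φ c ^ 2)
    set q : ℤ → ℝ := fun j => ∑ c ∈ Bj j, b ^ 2 * (μ c * ψ c ^ 2)
    have hp0 : ∀ i, 0 ≤ p i := fun i => sum_nonneg fun c _ => by have := hμ c; positivity
    have hq0 : ∀ i, 0 ≤ q i := fun i => sum_nonneg fun c _ => by have := hμ c; positivity
    have hp : ∀ i, ((b : ℝ) ^ (i + 1)) ^ 2 * ∑ c ∈ Ai i, μ c ≤ p i := fun i => by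
      rw [mul_sum]
      refine sum_le_sum fun c hc => ?_
      obtain ⟨hc1, hc2⟩ := mem_filter.1 hc
      have h1 := hk1 c hc1
      rw [hc2] at h1
      have : ((b : ℝ) ^ (i + 1)) ^ 2 ≤ b ^ 2 * φ c ^ 2 := by
        rw [zpow_add_one₀ hb0.ne', mul_pow, mul_comm]
        gcongr
      calc _ ≤ b ^ 2 * φ c ^ 2 * μ c := mul_le_right this (hμ c)
        _ = _ := by ring
    have hq : ∀ j, ((b : ℝ) ^ (j + 1)) ^ 2 * ∑ c ∈ Bj j, μ c ≤ q j := fun i => by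
      rw [mul_sum]
      refine sum_le_sum fun c hc => ?_
      obtain ⟨hc1, hc2⟩ := mem_filter.1 hc
      have h1 := hl1 c hc1
      rw [hc2] at h1
      have : ((b : ℝ) ^ (i + 1)) ^ 2 ≤ b ^ 2 * ψ c ^ 2 := by
        rw [zpow_add_one₀ hb0.ne', mul_pow, mul_comm]
        gcongr
      calc _ ≤ b ^ 2 * ψ c ^ 2 * μ c := mul_le_right this (hμ c)
        _ = _ := by ring
    have block : ∀ i j, ∑ c ∈ Ai i, ∑ d ∈ Bj j, W c d * φ c * ψ d ≤ β / 2 * (p i + q j) := by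
      intro i j
      set mA := ∑ c ∈ Ai i, μ c
      set mB := ∑ d ∈ Bj j, μ d
      have hmA : 0 ≤ mA := sum_nonneg fun c _ => hμ c
      have hmB : 0 ≤ mB := sum_nonneg fun c _ => hμ c
      have h1 := bilin_le_of_indicator (W := W) (A := Ai i) (B := Bj j)
        (κ := β * √(mA * mB)) (h := (b : ℝ) ^ (i + 1)) (h' := (b : ℝ) ^ (j + 1))
        (fun A' hA' B' hB' => (hdisc A' B').trans (by
          gcongr
          · exact sum_nonneg fun c _ => hμ c
          · exact sum_le_sum_of_subset_of_nonneg hA' fun c _ _ => hμ c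
          · exact sum_le_sum_of_subset_of_nonneg hB' fun c _ _ => hμ c))
        (φ := φ) (ψ := ψ) (fun c _ => hφ c)
        (fun c hc => by have := hk2 c; rwa [(mem_filter.1 hc).2] at this)
        (fun c _ => hψ c)
        (fun c hc => by have := hl2 c; rwa [(mem_filter.1 hc).2] at this)
        (by positivity) (by positivity)
      refine h1.trans ?_
      rw [sqrt_mul hmA]
      set x := (b : ℝ) ^ (i + 1)
      set y := (b : ℝ) ^ (j + 1)
      have h2 := hp i
      have h3 := hq j
      have h4 := sq_sqrt hmA
      have h5 := sq_sqrt hmB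
      set u := √mA
      set v := √mB
      have h6 : x * y * (u * v) ≤ (p i + q j) / 2 := by
        have := sq_nonneg (x * u - y * v)
        nlinarith
      calc x * y * (β * (u * v)) = β * (x * y * (u * v)) := by ring
        _ ≤ β * ((p i + q j) / 2) := by gcongr
        _ = _ := by ring
    have e1 : ∑ c ∈ A, ∑ d ∈ B, (if near c d then W c d * φ c * ψ d else 0)
        = ∑ i ∈ I, ∑ j ∈ J, if i - j ∈ Set.Icc (-1 : ℤ) 1 then
            ∑ c ∈ Ai i, ∑ d ∈ Bj j, W c d * φ c * ψ d else 0 := by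
      rw [← sum_levels (D := A) k]
      refine sum_congr rfl fun i _ => ?_
      have : ∀ c ∈ Ai i, ∑ d ∈ B, (if near c d then W c d * φ c * ψ d else 0)
          = ∑ j ∈ J, if i - j ∈ Set.Icc (-1 : ℤ) 1 then ∑ d ∈ Bj j, W c d * φ c * ψ d else 0 := by
        intro c hc
        rw [← sum_levels (D := B) l]
        refine sum_congr rfl fun j _ => ?_
        have hnear : ∀ d ∈ Bj j, (near c d ↔ i - j ∈ Set.Icc (-1 : ℤ) 1) := fun d hd => by
          simp only [near, (mem_filter.1 hc).2, (mem_filter.1 hd).2]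
        split_ifs with hij
        · exact sum_congr rfl fun d hd => if_pos ((hnear d hd).2 hij)
        · exact sum_eq_zero fun d hd => if_neg (fun h => hij ((hnear d hd).1 h))
      rw [sum_congr rfl this, sum_comm]
      refine sum_congr rfl fun j _ => ?_
      split_ifs
      · rfl
      · simp
    have hI : ∑ i ∈ I, p i = b ^ 2 * Nφ := by
      rw [sum_levels (D := A) k, ← mul_sum]
      simp only [Nφ]
      rw [hA _ (fun c hc => by simp [hc])]
    have hJ : ∑ i ∈ J, q i = b ^ 2 * Nψ := by
      rw [sum_levels (D := B) l, ← mul_sum]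
      simp only [Nψ]
      rw [hB _ (fun c hc => by simp [hc])]
    have three : ∀ (S : Finset ℤ) (i : ℤ),
        ((S.filter fun j => i - j ∈ Set.Icc (-1 : ℤ) 1).card : ℝ) ≤ 3 := by
      intro S i
      have : (S.filter fun j => i - j ∈ Set.Icc (-1 : ℤ) 1) ⊆ {i - 1, i, i + 1} := fun j hj => by
        have := (mem_filter.1 hj).2
        simp only [Set.mem_Icc] at this
        simp only [mem_insert, mem_singleton]
        omega
      have := (card_le_card this).trans card_le_three
      exact_mod_cast this
    have three' : ∀ (S : Finset ℤ) (j : ℤ),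
        ((S.filter fun i => i - j ∈ Set.Icc (-1 : ℤ) 1).card : ℝ) ≤ 3 := by
      intro S i
      have : (S.filter fun j => j - i ∈ Set.Icc (-1 : ℤ) 1) ⊆ {i - 1, i, i + 1} := fun j hj => by
        have := (mem_filter.1 hj).2
        simp only [Set.mem_Icc] at this
        simp only [mem_insert, mem_singleton]
        omega
      have := (card_le_card this).trans card_le_three
      exact_mod_cast this
    rw [e1]
    calc _ ≤ ∑ i ∈ I, ∑ j ∈ J, ((if i - j ∈ Set.Icc (-1 : ℤ) 1 then β / 2 * p i else 0)
            + (if i - j ∈ Set.Icc (-1 : ℤ) 1 then β / 2 * q j else 0)) := by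
          refine sum_le_sum fun i _ => sum_le_sum fun j _ => ?_
          split_ifs
          · exact (block i j).trans (by rw [mul_add])
          · simp
      _ = ∑ i ∈ I, ((J.filter fun j => i - j ∈ Set.Icc (-1 : ℤ) 1).card : ℝ) * (β / 2 * p i)
          + ∑ j ∈ J, ((I.filter fun i => i - j ∈ Set.Icc (-1 : ℤ) 1).card : ℝ) * (β / 2 * q j) := by
          simp_rw [sum_add_distrib]
          congr 1
          · refine sum_congr rfl fun i _ => ?_
            rw [← sum_filter, sum_const, nsmul_eq_mul]
          · rw [sum_comm]
            refine sum_congr rfl fun i _ => ?_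
            rw [← sum_filter, sum_const, nsmul_eq_mul]
      _ ≤ ∑ i ∈ I, 3 * (β / 2 * p i) + ∑ j ∈ J, 3 * (β / 2 * q j) := by
          gcongr with i _ j _
          · have := hp0 i; positivity
          · exact three J i
          · have := hq0 j; positivity
          · exact three' I j
      _ = _ := by
          simp_rw [← mul_sum]
          rw [hI, hJ]; ring
  rw [split]
  calc _ ≤ 3 / 2 * β * b ^ 2 * (Nφ + Nψ) + 2 / b * (Nφ + Nψ) := add_le_add nearb far
    _ = _ := by ring

lemma le_of_forall_scale {w K p q : ℝ} (hK : 0 ≤ K) (hp : 0 ≤ p) (hq : 0 ≤ q)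
    (h : ∀ s : ℝ, 0 < s → s * w ≤ K * (s ^ 2 * p + q)) :
    w ≤ 2 * K * (√p * √q) := by
  rcases le_or_gt w 0 with hw | hw
  · exact hw.trans (by positivity)
  have hd : discrim (K * p) (-w) (K * q) ≤ 0 := by
    refine discrim_le_zero fun s => ?_
    rcases le_or_gt s 0 with hs | hs
    · have := mul_nonneg (mul_nonneg hK hp) (mul_self_nonneg s)
      nlinarith [mul_nonneg hK hq]
    · have := h s hs
      nlinarith
  rw [discrim] at hd
  have h1 : w ^ 2 ≤ (2 * K * (√p * √q)) ^ 2 := by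
    have : (2 * K * (√p * √q)) ^ 2 = 4 * K ^ 2 * (√p ^ 2 * √q ^ 2) := by ring
    rw [this, sq_sqrt hp, sq_sqrt hq]
    nlinarith
  exact le_of_sq_le_sq h1 (by positivity)

lemma abs_bilin_le_of_discrepancy {W : C → C → ℝ} {μ : C → ℝ} (hμ : ∀ c, 0 ≤ μ c) {β : ℝ}
    (hβ : 0 ≤ β)
    (hdisc : ∀ A B : Finset C, |∑ c ∈ A, ∑ d ∈ B, W c d| ≤ β * √((∑ c ∈ A, μ c) * ∑ d ∈ B, μ d))
    (hrow : ∀ c, ∑ d, |W c d| ≤ 2 * μ c) (hcol : ∀ d, ∑ c, |W c d| ≤ 2 * μ d)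
    (b : ℕ) (hb : 1 < b) (φ ψ : C → ℝ) :
    |∑ c, ∑ d, W c d * φ c * ψ d| ≤ 4 * (3 / 2 * β * b ^ 2 + 2 / b) *
        (√(∑ c, μ c * φ c ^ 2) * √(∑ c, μ c * ψ c ^ 2)) := by
  set K := 3 / 2 * β * b ^ 2 + 2 / b
  have posneg : ∀ x : ℝ, x⁺ ^ 2 + x⁻ ^ 2 = x ^ 2 := fun x => by
    rcases le_total 0 x with h | h
    · simp [posPart_of_nonneg h, negPart_of_nonneg h]
    · simp [posPart_of_nonpos h, negPart_of_nonpos h]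
  have quad : ∀ φ ψ : C → ℝ, ∑ c, ∑ d, W c d * φ c * ψ d
      ≤ 2 * K * (∑ c, μ c * φ c ^ 2 + ∑ c, μ c * ψ c ^ 2) := by
    intro φ ψ
    have hd1 : ∀ A B : Finset C, ∑ c ∈ A, ∑ d ∈ B, W c d
      ≤ β * √((∑ c ∈ A, μ c) * ∑ d ∈ B, μ d) := fun A B =>
        (le_abs_self _).trans (hdisc A B)
    have hd2 : ∀ A B : Finset C, ∑ c ∈ A, ∑ d ∈ B, -W c d
      ≤ β * √((∑ c ∈ A, μ c) * ∑ d ∈ B, μ d) := fun A B => by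
        simp only [sum_neg_distrib]
        exact (neg_le_abs _).trans (hdisc A B)
    have pos := fun φ ψ => bilin_le_of_discrepancy_nonneg hμ hβ hd1 hrow hcol b hb φ ψ
    have neg := fun φ ψ => bilin_le_of_discrepancy_nonneg (W := fun c d => -W c d) hμ hβ hd2
      (by simpa using hrow) (by simpa using hcol) b hb φ ψ
    have h1 := pos (fun c => (φ c)⁺) (fun c => (ψ c)⁺) (fun c => posPart_nonneg _)
      (fun c => posPart_nonneg _)
    have h2 := pos (fun c => (φ c)⁻) (fun c => (ψ c)⁻) (fun c => negPart_nonneg _)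
      (fun c => negPart_nonneg _)
    have h3 := neg (fun c => (φ c)⁺) (fun c => (ψ c)⁻) (fun c => posPart_nonneg _)
      (fun c => negPart_nonneg _)
    have h4 := neg (fun c => (φ c)⁻) (fun c => (ψ c)⁺) (fun c => negPart_nonneg _)
      (fun c => posPart_nonneg _)
    have e1 : ∀ φ : C → ℝ, ∑ c, μ c * φ c ^ 2 = ∑ c, μ c * (φ c)⁺ ^ 2 + ∑ c, μ c * (φ c)⁻ ^ 2 := by
      intro φ
      rw [← sum_add_distrib]
      exact sum_congr rfl fun c _ => by rw [← mul_add, posneg]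
    have e2 : ∑ c, ∑ d, W c d * φ c * ψ d =
        ∑ c, ∑ d, W c d * (φ c)⁺ * (ψ d)⁺ + ∑ c, ∑ d, W c d * (φ c)⁻ * (ψ d)⁻
        + ∑ c, ∑ d, -W c d * (φ c)⁺ * (ψ d)⁻ + ∑ c, ∑ d, -W c d * (φ c)⁻ * (ψ d)⁺ := by
      simp only [← sum_add_distrib]
      refine sum_congr rfl fun c _ => sum_congr rfl fun d _ => ?_
      conv_lhs => rw [← posPart_sub_negPart (φ c), ← posPart_sub_negPart (ψ d)]
      ring
    rw [e2, e1 φ, e1 ψ]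
    change _ ≤ K * _ at h1
    change _ ≤ K * _ at h2
    change _ ≤ K * _ at h3
    change _ ≤ K * _ at h4
    linarith
  have one : ∀ φ ψ : C → ℝ, ∑ c, ∑ d, W c d * φ c * ψ d ≤ 4 * K *
        (√(∑ c, μ c * φ c ^ 2) * √(∑ c, μ c * ψ c ^ 2)) := by
    intro φ ψ
    refine (le_of_forall_scale (K := 2 * K) (p := ∑ c, μ c * φ c ^ 2)
      (q := ∑ c, μ c * ψ c ^ 2) (by positivity)
      (sum_nonneg fun c _ => mul_nonneg (hμ c) (sq_nonneg _))
      (sum_nonneg fun c _ => mul_nonneg (hμ c) (sq_nonneg _)) ?_).trans (le_of_eq (by ring))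
    intro s _
    have := quad (fun c => s * φ c) ψ
    refine le_trans (le_of_eq ?_) (this.trans (le_of_eq ?_))
    · rw [mul_sum]
      refine sum_congr rfl fun c _ => ?_
      rw [mul_sum]
      exact sum_congr rfl fun d _ => by ring
    · congr 2
      rw [mul_sum]
      exact sum_congr rfl fun c _ => by ring
  rw [abs_le']
  refine ⟨one φ ψ, ?_⟩
  have := one (fun c => -φ c) ψ
  simpa using this

end BiluLinial

/-- Number of vertices of `S` matched into `T`. -/
def eST (S T : Finset V) (η : V → V) : ℕ := (S.filter fun x => η x ∈ T).card

/-- Number of ways of choosing `j` successive fresh pairs from `S` to `T`. -/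
def freshCount (S T : Finset V) (η : V → V) : ℕ → Pairs → ℝ
  | 0, _ => 1
  | j + 1, E => ∑ a ∈ S \ touched E, if η a ∈ T then freshCount S T η j ((a, η a) :: E) else 0

lemma freshCount_nonneg (S T : Finset V) (η : V → V) (j : ℕ) (E : Pairs) :
    0 ≤ freshCount S T η j E := by
  induction j generalizing E with
  | zero => simp [freshCount]
  | succ j ih => exact sum_nonneg fun a _ => by split_ifs; exacts [ih _, le_rfl]

lemma le_freshCount (S T : Finset V) (η : V → V) {J : ℕ} {d : ℝ} (hd : 2 * J ≤ d)
    (he : d ≤ eST S T η) (j : ℕ) (E : Pairs) (hj : E.length + j ≤ J) :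
    (d - 2 * J) ^ j ≤ freshCount S T η j E := by
  induction j generalizing E with
  | zero => simp [freshCount]
  | succ j ih =>
    have hc : d - 2 * J ≤ (((S \ touched E).filter fun a => η a ∈ T).card : ℝ) := by
      have h1 : eST S T η ≤ ((S \ touched E).filter fun a => η a ∈ T).card + (touched E).card := by
        unfold eST
        rw [← filter_union_filter_not_eq (fun a => a ∉ touched E) (S.filter fun x => η x ∈ T)]
        refine (card_union_le _ _).trans (add_le_add ?_ ?_)
        · refine card_le_card fun a => ?_
          simp only [Finset.mem_filter, Finset.mem_sdiff]; tauto
        · refine card_le_card fun a => ?_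
          simp only [mem_filter, not_not]; tauto
      have h2 := card_touched_le E
      have h3 : eST S T η ≤ ((S \ touched E).filter fun a => η a ∈ T).card + 2 * J := by omega
      have h4 : (eST S T η : ℝ) ≤ ((S \ touched E).filter fun a => η a ∈ T).card + 2 * J := by
        exact_mod_cast h3
      linarith
    rw [freshCount, ← sum_filter, pow_succ, mul_comm]
    calc (d - 2 * J) * (d - 2 * J) ^ j
        ≤ (((S \ touched E).filter fun a => η a ∈ T).card : ℝ) * (d - 2 * J) ^ j := by gcongr
      _ = ∑ a ∈ (S \ touched E).filter fun a => η a ∈ T, (d - 2 * J) ^ j := by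
          rw [sum_const, nsmul_eq_mul]
      _ ≤ _ := sum_le_sum fun a _ => ih _ (by simp; omega)

lemma sum_freshCount_le (S T : Finset V) {J : ℕ} (hJ : (2 * J + 1 : ℝ) < nV)
    (j : ℕ) (E : Pairs) (hj : E.length + j ≤ J) :
    ∑ η ∈ ext E, freshCount S T η j E
      ≤ (S.card * T.card / ((nV : ℝ) - 2 * J - 1)) ^ j * (ext E).card := by
  have hpos : (0 : ℝ) < (nV : ℝ) - 2 * J - 1 := by linarith
  induction j generalizing E with
  | zero => simp [freshCount]
  | succ j ih =>
    simp only [freshCount]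
    rw [sum_comm]
    set ρ := (S.card * T.card / ((nV : ℝ) - 2 * J - 1)) ^ j
    have key : ∀ a ∈ S \ touched E,
        ∑ η ∈ ext E, (if η a ∈ T then freshCount S T η j ((a, η a) :: E) else 0)
        ≤ T.card * (ρ * ((ext E).card / ((nV : ℝ) - 2 * J - 1))) := by
      intro a ha
      rw [sum_ext_reveal E a]
      have : ∀ b, ∑ η ∈ ext ((a, b) :: E),
          (if η a ∈ T then freshCount S T η j ((a, η a) :: E) else 0)
          ≤ if b ∈ T then ρ * ((ext E).card / ((nV : ℝ) - 2 * J - 1)) else 0 := by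
        intro b
        rw [sum_congr rfl (g := fun η => if b ∈ T then
          freshCount S T η j ((a, b) :: E) else 0) fun η hη => by rw [(mem_ext_cons.1 hη).2]]
        split_ifs
        · refine (ih _ (by simp; omega)).trans ?_
          gcongr
          rw [le_div_iff₀ hpos, mul_comm]
          refine le_trans ?_ (card_ext_cons_le (b := b) (mem_sdiff.1 ha).2)
          gcongr
          exact_mod_cast (by omega : E.length ≤ J)
        · simp
      refine (sum_le_sum fun b _ => this b).trans ?_
      rw [← sum_filter, sum_const, nsmul_eq_mul]
      simp
    refine (sum_le_sum key).trans ?_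
    rw [sum_const, nsmul_eq_mul]
    calc ((S \ touched E).card : ℝ) * (T.card * (ρ * ((ext E).card / ((nV : ℝ) - 2 * J - 1))))
        ≤ (S.card : ℝ) * (T.card * (ρ * ((ext E).card / ((nV : ℝ) - 2 * J - 1)))) := by
          gcongr
          exact sdiff_subset
      _ = _ := by rw [pow_succ]; ring

/-- Upper tail for the number of pairs between `S` and `T`. -/
lemma pr_eST_le (S T : Finset V) {J : ℕ} {d : ℝ} (hJ : (2 * J + 1 : ℝ) < nV) (hd : 2 * J < d) :
    pr (fun η => d ≤ eST S T η) ≤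
      (S.card * T.card / (((nV : ℝ) - 2 * J - 1) * (d - 2 * J))) ^ J := by
  have hpos : (0 : ℝ) < (nV : ℝ) - 2 * J - 1 := by linarith
  have hd' : 0 < d - 2 * J := by linarith
  refine pr_le_of_sum_le (f := fun η => freshCount S T η J []) (b := (d - 2 * J) ^ J)
    (by positivity) (by positivity) (fun η _ => freshCount_nonneg S T η J [])
    (fun η _ h => le_freshCount S T η hd.le h J [] (by simp)) ?_
  have := sum_freshCount_le S T hJ J [] (by simp)
  rw [ext_nil] at this
  refine this.trans (le_of_eq ?_)
  rw [← mul_pow]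
  congr 2
  field_simp

section Discrepancy

lemma mul_log_mono {c x y : ℝ} (hx : 0 < x) (hxy : x ≤ y) (hyc : y ≤ c) :
    x * (1 + log (c / x)) ≤ y * (1 + log (c / y)) := by
  have hy := hx.trans_le hxy
  have hc := hy.trans_le hyc
  have h1 : 0 ≤ log (c / y) := log_nonneg (by rwa [le_div_iff₀ hy, one_mul])
  have h2 : log (c / x) = log (c / y) + log (y / x) := by
    rw [← log_mul (by positivity) (by positivity)]
    congr 1; field_simp
  have h3 : x * log (y / x) ≤ y - x := by
    have := log_le_sub_one_of_pos (show 0 < y / x by positivity)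
    calc x * log (y / x) ≤ x * (y / x - 1) := by gcongr
      _ = y - x := by field_simp
  rw [h2]
  nlinarith

lemma pr_eST_le_exp (S T : Finset V) {lam : ℝ} (h32 : 32 ≤ lam) (hn : lam ≤ nV) :
    pr (fun η => (S.card * T.card : ℝ) / nV + lam ≤ eST S T η) ≤ exp (-lam ^ 2 / (128 * nV)) := by
  set n : ℝ := (nV : ℝ)
  set J := ⌊lam / 16⌋₊
  have hJ1 : (J : ℝ) ≤ lam / 16 := Nat.floor_le (by linarith)
  have hJ2 : lam / 16 < J + 1 := Nat.lt_floor_add_one _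
  have hS : (S.card : ℝ) ≤ n := Nat.cast_le.2 (card_le_univ S)
  have hT : (T.card : ℝ) ≤ n := Nat.cast_le.2 (card_le_univ T)
  have hn0 : 0 < n := by linarith
  obtain ⟨d, hd⟩ : ∃ d : ℝ, d = S.card * T.card / n := ⟨_, rfl⟩
  have hd0 : 0 ≤ d := by rw [hd]; positivity
  have hst : (S.card * T.card : ℝ) = d * n := by rw [hd]; field_simp
  have hdn : d ≤ n := by rw [hd, div_le_iff₀ hn0]; exact mul_le_mul hS hT (Nat.cast_nonneg _) hn0.le
  rw [← hd]
  refine (pr_eST_le S T (J := J) (d := d + lam) (by change _ < n; linarith) (by linarith)).trans ?_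
  change (S.card * T.card / ((n - 2 * J - 1) * (d + lam - 2 * J))) ^ J ≤ _
  have hden : 0 < (n - 2 * J - 1) * (d + lam - 2 * J) := mul_pos (by linarith) (by linarith)
  have hratio : S.card * T.card / ((n - 2 * J - 1) * (d + lam - 2 * J)) ≤ 1 - lam / (4 * n) := by
    rw [div_le_iff₀ hden, hst]
    have a1 : (n - lam / 8 - 1) * (d + lam - lam / 8) ≤ (n - 2 * J - 1) * (d + lam - 2 * J) := by
      apply mul_le_mul <;> linarith
    have a2 : 0 ≤ 1 - lam / (4 * n) := by rw [sub_nonneg, div_le_one (by positivity)]; linarith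
    refine le_trans ?_ (mul_le_left a1 a2)
    have a3 : 1 - lam / (4 * n) = (4 * n - lam) / (4 * n) := by field_simp
    rw [a3, div_mul_eq_mul_div, le_div_iff₀ (by positivity)]
    have k1 : d * n * (4 * n) ≤ (4 * n - lam) * ((n - lam / 8 - 1) * (d + lam - lam / 8)) := by
      have b1 : n - lam * (5 / 32) ≤ n - lam / 8 - 1 := by linarith
      have b2 : (4 * n - lam) * ((n - lam * (5 / 32)) * (d + lam - lam / 8))
          ≤ (4 * n - lam) * ((n - lam / 8 - 1) * (d + lam - lam / 8)) := by
        apply mul_le_left _ (by linarith)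
        apply mul_le_right b1 (by linarith)
      refine le_trans ?_ b2
      have c1 : n * (4 * n - lam * (52 / 32)) ≤ (4 * n - lam) * (n - lam * (5 / 32)) := by
        nlinarith [sq_nonneg lam]
      have c2 : n * (4 * n - lam * (52 / 32)) * (d + lam * (7 / 8))
          ≤ (4 * n - lam) * (n - lam * (5 / 32)) * (d + lam * (7 / 8)) := by
        apply mul_le_right c1; linarith
      have c3 : d * (4 * n) ≤ (4 * n - lam * (52 / 32)) * (d + lam * (7 / 8)) := by nlinarith
      nlinarith
    linarith
  have hJ3 : lam / 32 ≤ J := by linarith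
  calc _ ≤ (exp (-(lam / (4 * n)))) ^ J := by
        refine pow_le_pow_left₀ (div_nonneg (mul_nonneg (Nat.cast_nonneg _) (Nat.cast_nonneg _)) hden.le) ?_ J
        exact hratio.trans (by have := add_one_le_exp (-(lam / (4 * n))); linarith)
    _ = exp (-(lam / (4 * n)) * J) := by rw [← exp_nat_mul, mul_comm]
    _ ≤ _ := by
        apply exp_le_exp.2
        have : lam / (4 * n) * (lam / 32) ≤ lam / (4 * n) * J := by gcongr
        have e : lam / (4 * n) * (lam / 32) = lam ^ 2 / (128 * n) := by field_simp; ring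
        rw [e] at this
        have e2 : -lam ^ 2 / (128 * n) = -(lam ^ 2 / (128 * n)) := by ring
        rw [e2]; linarith

lemma pr_eST_small_le (S T : Finset V) {α y : ℝ} (hα : 0 < α) (hα8 : α ≤ 1 / 8)
    (hy : y ^ 2 = S.card * T.card) (hy4 : 4 ≤ α * y) (hyn : y ≤ α ^ 3 * nV) :
    pr (fun η => α * y ≤ eST S T η) ≤ exp (-(α * y / 16) * (1 + log (α * nV / y))) := by
  set n : ℝ := (nV : ℝ)
  have hy0 : 0 < y := by
    by_contra h
    nlinarith
  set J := ⌊α * y / 4⌋₊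
  have hJ1 : (J : ℝ) ≤ α * y / 4 := Nat.floor_le (by positivity)
  have hJ2 : α * y / 4 < J + 1 := Nat.lt_floor_add_one _
  have hn0 : 0 < n := by
    by_contra h
    have : α ^ 3 * n ≤ 0 := mul_nonpos_of_nonneg_of_nonpos (by positivity) (not_lt.1 h)
    linarith
  have ha3 : α ^ 3 ≤ 1 / 512 := by
    calc α ^ 3 ≤ (1 / 8) ^ 3 := by gcongr
      _ = _ := by norm_num
  have hyn' : y ≤ n / 512 := by nlinarith
  have hαy : α * y ≤ y / 8 := by nlinarith
  refine (pr_eST_le S T (J := J) (d := α * y) (by change _ < n; linarith) (by linarith)).trans ?_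
  change (S.card * T.card / ((n - 2 * J - 1) * (α * y - 2 * J))) ^ J ≤ _
  set ξ := α * n / y
  have hξ : 64 ≤ ξ := by
    rw [le_div_iff₀ hy0]
    have : α ^ 2 ≤ 1 / 64 := by
      calc α ^ 2 ≤ (1 / 8) ^ 2 := by gcongr
        _ = _ := by norm_num
    nlinarith [mul_nonneg hα.le hn0.le]
  have hratio : S.card * T.card / ((n - 2 * J - 1) * (α * y - 2 * J)) ≤ 4 / ξ := by
    rw [← hy]
    have h1 : n / 2 * (α * y / 2) ≤ (n - 2 * J - 1) * (α * y - 2 * J) := by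
      apply mul_le_mul <;> nlinarith
    calc y ^ 2 / ((n - 2 * J - 1) * (α * y - 2 * J)) ≤ y ^ 2 / (n / 2 * (α * y / 2)) := by gcongr
      _ = 4 / ξ := by simp only [ξ]; field_simp; ring
  have hlog : (1 + log ξ) / 2 ≤ log (ξ / 4) := by
    have h1 : log (ξ / 4) = log ξ - log 4 := log_div (by positivity) (by norm_num)
    have h2 : log 64 ≤ log ξ := log_le_log (by norm_num) hξ
    have h3 : log 64 = 3 * log 4 := by rw [show (64 : ℝ) = 4 ^ 3 by norm_num, log_pow]; norm_num
    have h4 : log 4 = 2 * log 2 := by rw [show (4 : ℝ) = 2 ^ 2 by norm_num, log_pow]; norm_num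
    have h5 := log_two_gt_d9
    rw [h1]; linarith
  have hlog0 : 0 ≤ 1 + log ξ := by have := log_nonneg (show 1 ≤ ξ by linarith); linarith
  have hden : 0 < (n - 2 * J - 1) * (α * y - 2 * J) := mul_pos (by linarith) (by linarith)
  calc _ ≤ (4 / ξ) ^ J := by gcongr
    _ = exp (-log (ξ / 4) * J) := by
        rw [mul_comm, exp_nat_mul, exp_neg, exp_log (by positivity), inv_div]
    _ ≤ _ := by
        apply exp_le_exp.2
        have hJ3 : α * y / 8 ≤ J := by
          have : (1 : ℝ) ≤ J := by
            exact_mod_cast Nat.one_le_floor_iff _ |>.2 (by linarith : (1 : ℝ) ≤ α * y / 4)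
          linarith
        have := mul_le_mul hlog hJ3 (by positivity) (le_trans (by positivity) hlog)
        linarith

variable {C : Type*} [Fintype C] [DecidableEq C]

def cellUnion (c : V → C) (A : Finset C) : Finset V := univ.filter fun x => c x ∈ A

def cellSize (c : V → C) (i : C) : ℝ := (univ.filter fun x => c x = i).card

lemma sum_comp_cell (c : V → C) (A : Finset C) (f : V → ℝ) :
    ∑ x ∈ cellUnion c A, f x = ∑ i ∈ A, ∑ x ∈ univ.filter (fun x => c x = i), f x := by
  rw [cellUnion, ← sum_fiberwise_of_maps_to (g := c) (t := A) (fun x hx => (mem_filter.1 hx).2)]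
  refine sum_congr rfl fun i hi => sum_congr ?_ fun _ _ => rfl
  ext x
  simp only [mem_filter, mem_univ, true_and]
  constructor
  · exact fun h => h.2
  · exact fun h => ⟨h ▸ hi, h⟩

lemma card_cellUnion (c : V → C) (A : Finset C) :
    ((cellUnion c A).card : ℝ) = ∑ i ∈ A, cellSize c i := by
  have := sum_comp_cell c A (fun _ => 1)
  simpa [cellSize] using this

lemma card_mul_le_card_cellUnion {c : V → C} {M : ℝ} (hM : ∀ i, M ≤ cellSize c i)
    (A : Finset C) : A.card * M ≤ (cellUnion c A).card := by
  rw [card_cellUnion, ← nsmul_eq_mul, ← sum_const]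
  exact sum_le_sum fun i _ => hM i

lemma cellUnion_univ (c : V → C) : cellUnion c univ = univ := by simp [cellUnion]

lemma card_cells_mul_le {c : V → C} {M : ℝ} (hM : ∀ i, M ≤ cellSize c i) :
    Fintype.card C * M ≤ nV := by
  have := card_mul_le_card_cellUnion hM univ
  rwa [cellUnion_univ] at this

lemma card_cellUnion_eq_le {c : V → C} {M : ℝ} (hM0 : 0 < M) (hM : ∀ i, M ≤ cellSize c i)
    (s : ℕ) (hs : 0 < s) (hsn : s ≤ nV) :
    (((univ : Finset (Finset C)).filter fun A => (cellUnion c A).card = s).card : ℝ)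
      ≤ exp (s / M * (1 + log (nV / s))) := by
  set n : ℝ := (nV : ℝ)
  have hs0 : (0 : ℝ) < s := by exact_mod_cast hs
  have hn : (s : ℝ) ≤ n := Nat.cast_le.2 hsn
  have hn0 : 0 < n := by linarith
  set θ : ℝ := s / n
  have hθ0 : 0 < θ := by positivity
  have hθ1 := div_le_one_of_le₀ hn hn0.le
  set F := (univ : Finset (Finset C)).filter fun A => (cellUnion c A).card = s
  have h1 : (F.card : ℝ) * θ ^ ((s : ℝ) / M) ≤ (θ + 1) ^ (Fintype.card C) := by
    have := sum_pow_mul_eq_add_pow θ 1 (univ : Finset C)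
    simp only [one_pow, mul_one, powerset_univ, card_univ] at this
    rw [← this, ← nsmul_eq_mul, ← sum_const]
    refine le_trans (sum_le_sum (g := fun A => θ ^ A.card) fun A hA => ?_)
      (sum_le_sum_of_subset_of_nonneg (subset_univ F) fun _ _ _ => by positivity)
    rw [← rpow_natCast]
    refine rpow_le_rpow_of_exponent_ge hθ0 hθ1 ?_
    rw [le_div_iff₀ hM0]
    have := card_mul_le_card_cellUnion hM A
    rwa [(mem_filter.1 hA).2] at this
  have h2 : (θ + 1) ^ (Fintype.card C) ≤ exp (s / M) := by
    calc (θ + 1) ^ (Fintype.card C) ≤ (exp θ) ^ (Fintype.card C) := by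
          gcongr; exact add_one_le_exp θ
      _ = exp (Fintype.card C * θ) := by rw [← exp_nat_mul]
      _ ≤ _ := by
          apply exp_le_exp.2
          have := card_cells_mul_le hM
          rw [le_div_iff₀ hM0]
          calc Fintype.card C * θ * M = (Fintype.card C * M) * θ := by ring
            _ ≤ n * θ := by gcongr
            _ = s := by simp only [θ]; field_simp
  have h3 : θ ^ ((s : ℝ) / M) = exp (-(s / M * log (n / s))) := by
    rw [rpow_def_of_pos hθ0]
    congr 1
    have : log θ = - log (n / s) := by rw [← log_inv, inv_div]
    rw [this]; ring
  rw [h3] at h1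
  have h4 := h1.trans h2
  rw [exp_neg, ← div_eq_mul_inv, div_le_iff₀ (exp_pos _), ← exp_add] at h4
  refine h4.trans (le_of_eq ?_)
  ring_nf

/-- Sparse pairs of unions of cells have few pairs between them. -/
def smallDisc (c : V → C) (α : ℝ) (η : V → V) : Prop := ∀ A B : Finset C,
    √((cellUnion c A).card * (cellUnion c B).card) ≤ α ^ 3 * nV →
    (eST (cellUnion c A) (cellUnion c B) η : ℝ) ≤
      α * √((cellUnion c A).card * (cellUnion c B).card)

lemma eST_le_left (S T : Finset V) (η : V → V) : eST S T η ≤ S.card := card_filter_le _ _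

lemma eST_le_right {η : V → V} (hη : IsPM η) (S T : Finset V) : eST S T η ≤ T.card :=
  card_le_card_of_injOn η (fun _ hx => (mem_filter.1 (mem_coe.1 hx)).2) hη.1.injective.injOn

lemma pr_exists_cellUnion_le {c : V → C} {M α : ℝ} (hM : ∀ i, M ≤ cellSize c i)
    (hα : 0 < α) (hα8 : α ≤ 1 / 8) (hαM : 64 ≤ α ^ 2 * M)
    (hMn : M * √nV ≤ α * nV) (hM0 : 0 < M)
    (hαM2 : 512 ≤ α * M) (s t : ℕ) (hs : 1 ≤ s ∧ s ≤ nV)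
    (ht : 1 ≤ t ∧ t ≤ nV) (hyM : M ≤ √((s : ℝ) * t))
    (hyn : √((s : ℝ) * t) ≤ α ^ 3 * nV)
    (hsy : s ≤ √((s : ℝ) * t) / α) (hty : t ≤ √((s : ℝ) * t) / α) :
    pr (fun η => ∃ AB ∈ ((univ : Finset (Finset C)).filter
      fun A => (cellUnion c A).card = s) ×ˢ ((univ : Finset (Finset C)).filter
      fun A => (cellUnion c A).card = t),
      α * √((s : ℝ) * t) ≤ eST (cellUnion c AB.1) (cellUnion c AB.2) η) ≤
      1 / (nV : ℝ) ^ 4 := by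
  set n : ℝ := (nV : ℝ)
  have hn1 : (1 : ℝ) ≤ n := Nat.one_le_cast.2 (hs.1.trans hs.2)
  have hn0 : 0 < n := by linarith
  set y := √((s : ℝ) * t)
  have hysq : y ^ 2 = s * t := sq_sqrt (by positivity)
  have hy0 : 0 < y := by linarith
  have hs0 : (0 : ℝ) < s := by exact_mod_cast hs.1
  have ht0 : (0 : ℝ) < t := by exact_mod_cast ht.1
  have hyαn : y / α ≤ n := by
    rw [div_le_iff₀ hα]
    refine hyn.trans ?_
    rw [mul_comm]
    gcongr
    calc α ^ 3 = α * α ^ 2 := by ring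
      _ ≤ α * 1 := by gcongr; nlinarith
      _ = α := mul_one α
  set ℓ := 1 + log (α * n / y)
  have e1 : n / (y / α) = α * n / y := by field_simp
  have cS := (card_cellUnion_eq_le (c := c) hM0 hM s hs.1 hs.2).trans (exp_le_exp.2 (by
    calc (s : ℝ) / M * (1 + log (n / s)) = (s * (1 + log (n / s))) / M := by ring
      _ ≤ (y / α * (1 + log (n / (y / α)))) / M := by
          gcongr ?_ / M
          exact mul_log_mono hs0 hsy hyαn
      _ = y / (α * M) * ℓ := by rw [e1, show 1 + log (α * n / y) = ℓ from rfl]; field_simp))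
  have cT := (card_cellUnion_eq_le (c := c) hM0 hM t ht.1 ht.2).trans (exp_le_exp.2 (by
    calc (t : ℝ) / M * (1 + log (n / t)) = (t * (1 + log (n / t))) / M := by ring
      _ ≤ (y / α * (1 + log (n / (y / α)))) / M := by
          gcongr ?_ / M
          exact mul_log_mono ht0 hty hyαn
      _ = y / (α * M) * ℓ := by rw [e1, show 1 + log (α * n / y) = ℓ from rfl]; field_simp))
  have hb := pr_exists_le_mul (((univ : Finset (Finset C)).filter
    fun A => (cellUnion c A).card = s) ×ˢ ((univ : Finset (Finset C)).filter
    fun A => (cellUnion c A).card = t))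
    (fun AB η => α * y ≤ eST (cellUnion c AB.1) (cellUnion c AB.2) η)
    (c := exp (-(α * y / 16) * ℓ)) (by
      intro AB hAB
      obtain ⟨hA, hB⟩ := mem_product.1 hAB
      refine pr_eST_small_le _ _ hα hα8 ?_ ?_ hyn
      · rw [(mem_filter.1 hA).2, (mem_filter.1 hB).2]; exact hysq
      · nlinarith)
  refine hb.trans ?_
  rw [card_product]
  push_cast
  have hℓ : 0 ≤ ℓ := by
    have : 0 ≤ log (α * n / y) := log_nonneg (by
      rw [le_div_iff₀ hy0, one_mul]
      rw [div_le_iff₀ hα] at hyαn; linarith)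
    linarith
  calc _ ≤ exp (y / (α * M) * ℓ) * exp (y / (α * M) * ℓ) * exp (-(α * y / 16) * ℓ) := by gcongr
    _ = exp ((2 * (y / (α * M)) - α * y / 16) * ℓ) := by rw [← exp_add, ← exp_add]; congr 1; ring
    _ ≤ exp (-(4 * log n)) := by
        apply exp_le_exp.2
        have d1 : y / (α * M) ≤ α * y / 64 := by
          rw [div_le_div_iff₀ (by positivity) (by norm_num)]
          nlinarith
        have d2 : (2 * (y / (α * M)) - α * y / 16) * ℓ ≤ -(α / 32) * (y * ℓ) := by nlinarith
        have d3 : M * (1 + log (α * n / M)) ≤ y * ℓ :=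
          mul_log_mono hM0 hyM (by rw [div_le_iff₀ hα] at hyαn; linarith)
        have d4 : log n / 2 ≤ log (α * n / M) := by
          rw [← log_sqrt hn0.le]
          apply log_le_log (sqrt_pos.2 hn0)
          rw [le_div_iff₀ hM0]; linarith
        have d5 : 0 ≤ log n := log_nonneg hn1
        have d6 : M * (log n / 2) ≤ y * ℓ := le_trans (by gcongr; linarith) d3
        have d7 : α / 32 * (M * (log n / 2)) ≤ α / 32 * (y * ℓ) := by gcongr
        nlinarith
    _ = 1 / n ^ 4 := by
        rw [exp_neg, ← log_rpow hn0, exp_log (by positivity), one_div]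
        norm_num

lemma pr_not_smallDisc_le {c : V → C} {M α : ℝ} (hM : ∀ i, M ≤ cellSize c i)
    (hα : 0 < α) (hα8 : α ≤ 1 / 8) (hαM : 64 ≤ α ^ 2 * M)
    (hMn : M * √nV ≤ α * nV) :
    pr (fun η => ¬ smallDisc c α η) ≤ 4 / (nV : ℝ) ^ 2 := by
  classical
  set N := nV
  set n : ℝ := (N : ℝ)
  have hM0 : 0 < M := by
    by_contra h
    have : α ^ 2 * M ≤ 0 := mul_nonpos_of_nonneg_of_nonpos (by positivity) (not_lt.1 h)
    linarith
  have hαM2 : 512 ≤ α * M := by nlinarith [mul_pos hα hM0]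
  rcases Nat.eq_zero_or_pos N with hN | hN
  · have : ∀ η : V → V, smallDisc c α η := by
      intro η A B _
      have : IsEmpty V := Fintype.card_eq_zero_iff.1 hN
      have e : eST (cellUnion c A) (cellUnion c B) η = 0 := by
        unfold eST
        rw [card_eq_zero]; exact eq_empty_of_isEmpty _
      rw [e]; simp; positivity
    have h0 : pr (fun η => ¬ smallDisc c α η) ≤ 0 := by simp [pr, this]
    exact h0.trans (by positivity)
  set bad : ℕ × ℕ → (V → V) → Prop := fun p η => ∃ AB ∈ ((univ : Finset (Finset C)).filter
      fun A => (cellUnion c A).card = p.1) ×ˢ ((univ : Finset (Finset C)).filter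
      fun A => (cellUnion c A).card = p.2),
      α * √(p.1 * p.2) ≤ eST (cellUnion c AB.1) (cellUnion c AB.2) η
  set Idx := (Finset.Icc 1 N ×ˢ Finset.Icc 1 N).filter fun p : ℕ × ℕ =>
    M ≤ √(p.1 * p.2) ∧ √(p.1 * p.2) ≤ α ^ 3 * n ∧
      p.1 ≤ √(p.1 * p.2) / α ∧ p.2 ≤ √(p.1 * p.2) / α
  have step1 : pr (fun η => ¬ smallDisc c α η) ≤ pr (fun η => ∃ p ∈ Idx, bad p η) := by
    refine pr_mono fun η hη h => ?_
    simp only [smallDisc, not_forall, not_le] at h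
    obtain ⟨A, B, h1, h2⟩ := h
    set s := (cellUnion c A).card
    set t := (cellUnion c B).card
    set y := √((s : ℝ) * t)
    have hy0 : 0 ≤ y := sqrt_nonneg _
    have hysq : y ^ 2 = s * t := sq_sqrt (by positivity)
    have hes : (eST (cellUnion c A) (cellUnion c B) η : ℝ) ≤ s := by
      exact_mod_cast eST_le_left _ _ _
    have het : (eST (cellUnion c A) (cellUnion c B) η : ℝ) ≤ t := by
      exact_mod_cast eST_le_right hη _ _
    have hs0 : (0 : ℝ) < s := by nlinarith [mul_nonneg hα.le hy0]
    have ht0 : (0 : ℝ) < t := by nlinarith [mul_nonneg hα.le hy0]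
    have hsM : M ≤ s := by
      have hA : 1 ≤ A.card := by
        by_contra h
        have : A = ∅ := card_eq_zero.1 (by omega)
        simp [s, this, cellUnion] at hs0
      have := card_mul_le_card_cellUnion hM A
      have h1 : (1 : ℝ) ≤ A.card := by exact_mod_cast hA
      calc M = 1 * M := (one_mul M).symm
        _ ≤ A.card * M := by gcongr
        _ ≤ _ := this
    have htM : M ≤ t := by
      have hA : 1 ≤ B.card := by
        by_contra h
        have : B = ∅ := card_eq_zero.1 (by omega)
        simp [t, this, cellUnion] at ht0
      have := card_mul_le_card_cellUnion hM B
      have h1 : (1 : ℝ) ≤ B.card := by exact_mod_cast hA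
      calc M = 1 * M := (one_mul M).symm
        _ ≤ B.card * M := by gcongr
        _ ≤ _ := this
    refine ⟨(s, t), mem_filter.2 ⟨mem_product.2 ⟨mem_Icc.2 ⟨?_, ?_⟩,
      mem_Icc.2 ⟨?_, ?_⟩⟩, ?_, h1, ?_, ?_⟩, (A, B), ?_, ?_⟩
    · exact_mod_cast hs0
    · exact card_le_univ _
    · exact_mod_cast ht0
    · exact card_le_univ _
    · apply le_sqrt_of_sq_le
      nlinarith
    · change (s : ℝ) ≤ y / α
      rw [le_div_iff₀ hα]
      have : α * y < t := by linarith
      by_contra hc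
      have h6 : y < s * α := not_le.1 hc
      have : y * (α * y) < (s * α) * t := by apply mul_lt_mul'' h6 this hy0 (by positivity)
      nlinarith
    · change (t : ℝ) ≤ y / α
      rw [le_div_iff₀ hα]
      have : α * y < s := by linarith
      by_contra hc
      have h6 : y < t * α := not_le.1 hc
      have : y * (α * y) < (t * α) * s := by apply mul_lt_mul'' h6 this hy0 (by positivity)
      nlinarith
    · simp [s, t]
    · exact h2.le
  have step2 : ∀ p ∈ Idx, pr (bad p) ≤ 1 / n ^ 4 := by
    rintro ⟨s, t⟩ hp
    obtain ⟨hp1, hyM, hyn, hsy, hty⟩ := mem_filter.1 hp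
    obtain ⟨hs, ht⟩ := mem_product.1 hp1
    exact pr_exists_cellUnion_le hM hα hα8 hαM hMn hM0 hαM2 s t (mem_Icc.1 hs)
      (mem_Icc.1 ht) hyM hyn hsy hty
  refine step1.trans ((pr_exists_le_mul Idx bad step2).trans ?_)
  have hcard : (Idx.card : ℝ) ≤ n ^ 2 := by
    have : Idx.card ≤ N * N := by
      refine (card_filter_le _ _).trans ?_
      rw [card_product]; simp
    have h2 : (Idx.card : ℝ) ≤ N * N := by exact_mod_cast this
    rw [sq]; exact h2
  calc (Idx.card : ℝ) * (1 / n ^ 4) ≤ n ^ 2 * (1 / n ^ 4) := by gcongr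
    _ = 1 / n ^ 2 := by field_simp
    _ ≤ _ := by gcongr; norm_num

end Discrepancy

section SignedDiscrepancy

variable {C : Type*} [Fintype C] [DecidableEq C]

lemma eST_eq_sum (S T : Finset V) (η : V → V) :
    (eST S T η : ℝ) = ∑ x, (if x ∈ S then 1 else 0) * (if η x ∈ T then 1 else 0) := by
  rw [eST, card_filter]
  push_cast
  simp_rw [ite_mul, one_mul, zero_mul]
  rw [← sum_filter]
  simp

lemma eST_compl (S T : Finset V) (η : V → V) : (eST S T η : ℝ) + eST S Tᶜ η = S.card := by
  unfold eST
  rw [← Nat.cast_add]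
  congr 1
  simp only [mem_compl]
  exact card_filter_add_card_filter_not _

lemma pr_abs_eST_le_exp (S T : Finset V) {lam : ℝ} (h32 : 32 ≤ lam) (hn : lam ≤ nV) :
    pr (fun η => lam ≤ |(eST S T η : ℝ) - (S.card * T.card : ℝ) / nV|) ≤
      2 * exp (-lam ^ 2 / (128 * nV)) := by
  have hn0 : (0 : ℝ) < nV := by linarith
  have h1 := pr_eST_le_exp S T h32 hn
  have h2 := pr_eST_le_exp S Tᶜ h32 hn
  rw [two_mul]
  refine le_trans (le_trans (pr_mono ?_) (pr_or_le _ _)) (add_le_add h1 h2)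
  intro η _ h
  rcases le_abs.1 h with h | h
  · left; linarith
  · right
    have e := eST_compl S T η
    have e2 : (S.card * (Tᶜ).card : ℝ) / nV = S.card - (S.card * T.card : ℝ) / nV := by
      rw [card_compl, Nat.cast_sub (card_le_univ _)]
      field_simp
    rw [e2]; linarith

/-- The part of `S` on which `σ` takes the value `s`. -/
def signPart (σ : V → ℝ) (S : Finset V) (s : Bool) : Finset V :=
  S.filter fun x => σ x = if s then 1 else -1

/-- Dense pairs of signed unions of cells have the expected number of pairs between them. -/
def largeDisc (c : V → C) (σ : V → ℝ) (α : ℝ) (η : V → V) : Prop := ∀ (A B : Finset C) (s t : Bool),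
    |(eST (signPart σ (cellUnion c A) s) (signPart σ (cellUnion c B) t) η : ℝ)
      - ((signPart σ (cellUnion c A) s).card * (signPart σ (cellUnion c B) t).card : ℝ)
        / nV| ≤ α ^ 4 * nV

lemma pr_not_largeDisc_le {c : V → C} {M α : ℝ} (hM : ∀ i, M ≤ cellSize c i) (σ : V → ℝ)
    (hα : 0 < α) (hα1 : α ≤ 1) (hαM : 400 ≤ α ^ 8 * M) (hn : 32 ≤ α ^ 4 * nV) :
    pr (fun η => ¬ largeDisc c σ α η) ≤ 8 * exp (-(nV / M)) := by
  classical
  have hM0 : 0 < M := by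
    by_contra h
    have : α ^ 8 * M ≤ 0 := mul_nonpos_of_nonneg_of_nonpos (by positivity) (not_lt.1 h)
    linarith
  obtain ⟨n, hnn⟩ : ∃ n : ℝ, n = nV := ⟨_, rfl⟩
  have hn0 : 0 < n := by
    by_contra h
    have : α ^ 4 * n ≤ 0 := mul_nonpos_of_nonneg_of_nonpos (by positivity) (not_lt.1 h)
    rw [← hnn] at hn
    linarith
  have key := pr_exists_le_mul (univ : Finset ((Finset C × Finset C) × (Bool × Bool)))
    (fun p η => α ^ 4 * nV ≤
      |(eST (signPart σ (cellUnion c p.1.1) p.2.1) (signPart σ (cellUnion c p.1.2) p.2.2) η : ℝ)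
      - ((signPart σ (cellUnion c p.1.1) p.2.1).card
          * (signPart σ (cellUnion c p.1.2) p.2.2).card : ℝ) / nV|)
    (c := 2 * exp (-(α ^ 4 * n) ^ 2 / (128 * n))) (by
      intro p _
      rw [hnn]
      refine pr_abs_eST_le_exp _ _ hn ?_
      exact mul_le_of_le_one_left (Nat.cast_nonneg _) (pow_le_one₀ hα.le hα1))
  have card : ((univ : Finset ((Finset C × Finset C) × (Bool × Bool))).card : ℝ)
      = 4 * (2 ^ Fintype.card C * 2 ^ Fintype.card C) := by
    rw [card_univ]
    simp only [Fintype.card_prod, Fintype.card_finset, Fintype.card_bool]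
    push_cast; ring
  rw [card] at key
  refine (pr_mono ?_).trans (key.trans ?_)
  · intro η _ h
    simp only [largeDisc, not_forall, not_le] at h
    obtain ⟨A, B, s, t, h⟩ := h
    exact ⟨((A, B), (s, t)), mem_univ _, h.le⟩
  rw [← hnn]
  have h1 : (2 : ℝ) ^ Fintype.card C ≤ exp (n / M) := by
    calc (2 : ℝ) ^ Fintype.card C ≤ (exp 1) ^ Fintype.card C := by
          gcongr; have := add_one_le_exp 1; linarith
      _ = exp (Fintype.card C) := by rw [← exp_nat_mul, mul_one]
      _ ≤ _ := by
          apply exp_le_exp.2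
          rw [le_div_iff₀ hM0, hnn]; exact card_cells_mul_le hM
  calc 4 * ((2 : ℝ) ^ Fintype.card C * 2 ^ Fintype.card C)
        * (2 * exp (-(α ^ 4 * n) ^ 2 / (128 * n)))
      ≤ 4 * (exp (n / M) * exp (n / M)) * (2 * exp (-(α ^ 4 * n) ^ 2 / (128 * n))) := by gcongr
    _ = 8 * exp (n / M + n / M + -(α ^ 4 * n) ^ 2 / (128 * n)) := by rw [exp_add, exp_add]; ring
    _ ≤ _ := by
        gcongr
        have e : -(α ^ 4 * n) ^ 2 / (128 * n) = -(α ^ 8 * M * (n / M) / 128) := by field_simp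
        rw [e]
        have : 400 * (n / M) ≤ α ^ 8 * M * (n / M) := by gcongr
        have : 0 < n / M := by positivity
        linarith

lemma sign_mul_ind {σ : V → ℝ} (hσ : ∀ x, σ x = 1 ∨ σ x = -1) (S : Finset V) (x : V) :
    σ x * (if x ∈ S then 1 else 0) = (if x ∈ signPart σ S true then 1 else 0)
      - (if x ∈ signPart σ S false then 1 else 0) := by
  unfold signPart
  by_cases hx : x ∈ S <;> rcases hσ x with h | h <;> simp [hx, h] <;> norm_num

def signW (c : V → C) (σ : V → ℝ) (η : V → V) (i j : C) : ℝ :=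
  ∑ x, (σ x * (if c x = i then 1 else 0)) * (σ (η x) * (if c (η x) = j then 1 else 0))
    - (∑ x, σ x * (if c x = i then 1 else 0)) * (∑ x, σ x * (if c x = j then 1 else 0)) / nV

lemma sum_signW (c : V → C) (σ : V → ℝ) (η : V → V) (f g : C → ℝ) :
    ∑ i, ∑ j, signW c σ η i j * f i * g j = ∑ x, (σ x * f (c x)) * (σ (η x) * g (c (η x)))
        - (∑ x, σ x * f (c x)) * (∑ x, σ x * g (c x)) / nV := by
  have e1 : ∀ (h : C → ℝ) (x : V), σ x * h (c x) = ∑ i, σ x * (if c x = i then 1 else 0) * h i := by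
    intro h x; simp
  simp_rw [e1 f, e1 g]
  rw [sum_comm (s := univ (α := V)), sum_comm (s := univ (α := V))]
  simp_rw [← sum_mul]
  rw [sum_mul_sum, sum_div]
  have e2 : ∑ x : V, (∑ i, σ x * (if c x = i then 1 else 0) * f i)
      * (∑ i, σ (η x) * (if c (η x) = i then 1 else 0) * g i)
      = ∑ i, ∑ j, (∑ x, (σ x * (if c x = i then 1 else 0))
        * (σ (η x) * (if c (η x) = j then 1 else 0))) * f i * g j := by
    simp_rw [sum_mul_sum, sum_mul]
    rw [sum_comm]
    refine sum_congr rfl fun i _ => ?_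
    rw [sum_comm]
    refine sum_congr rfl fun j _ => sum_congr rfl fun x _ => ?_
    ring
  rw [e2, ← sum_sub_distrib]
  refine sum_congr rfl fun i _ => ?_
  rw [sum_div, ← sum_sub_distrib]
  refine sum_congr rfl fun j _ => ?_
  rw [signW]; ring

lemma abs_signW_le {σ : V → ℝ} (hσ : ∀ x, σ x = 1 ∨ σ x = -1) (c : V → C) (η : V → V) (i j : C) :
    |signW c σ η i j| ≤ ∑ x, (if c x = i then 1 else 0) * (if c (η x) = j then 1 else 0)
      + cellSize c i * cellSize c j / nV := by
  have hσ1 : ∀ x, |σ x| = 1 := fun x => by rcases hσ x with h | h <;> simp [h]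
  have h2 : ∀ i, |∑ x, σ x * (if c x = i then 1 else 0)| ≤ cellSize c i := fun i => by
    refine (abs_sum_le_sum_abs _ _).trans (le_of_eq ?_)
    simp_rw [abs_mul, hσ1, one_mul]
    rw [cellSize, card_filter]
    push_cast
    refine sum_congr rfl fun x _ => ?_
    split_ifs <;> simp
  refine (abs_sub _ _).trans (add_le_add ?_ ?_)
  · refine (abs_sum_le_sum_abs _ _).trans (le_of_eq ?_)
    refine sum_congr rfl fun x _ => ?_
    simp_rw [abs_mul, hσ1, one_mul]
    split_ifs <;> simp
  · rw [abs_div, abs_mul, abs_of_nonneg (Nat.cast_nonneg (α := ℝ) nV)]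
    gcongr
    · exact Nat.cast_nonneg _
    · exact h2 i
    · exact h2 j

lemma sum_cellSize (c : V → C) : ∑ i, cellSize c i = nV := by
  rw [← card_cellUnion, cellUnion_univ, card_univ]

lemma cellSize_eq_sum (c : V → C) (i : C) : cellSize c i = ∑ x, if c x = i then (1:ℝ) else 0 := by
  rw [cellSize, card_filter]; push_cast; rfl

lemma sum_cell_eq (c : V → C) (f : C → ℝ) : ∑ x, f (c x) = ∑ i, cellSize c i * f i := by
  simp_rw [cellSize_eq_sum, sum_mul]
  rw [sum_comm]
  simp

lemma signW_disc {c : V → C} {σ : V → ℝ} (hσ : ∀ x, σ x = 1 ∨ σ x = -1) {α : ℝ} {η : V → V}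
    (hα : 0 < α) (hα1 : α ≤ 1) (hs : smallDisc c α η) (hl : largeDisc c σ α η)
    (A B : Finset C) :
    |∑ i ∈ A, ∑ j ∈ B, signW c σ η i j| ≤
      4 * α * √((∑ i ∈ A, cellSize c i) * ∑ j ∈ B, cellSize c j) := by
  rw [← card_cellUnion, ← card_cellUnion]
  have hmem : ∀ (A : Finset C) (x : V), (if c x ∈ A then (1:ℝ) else 0)
      = if x ∈ cellUnion c A then 1 else 0 := by
    intro A x; simp [cellUnion]
  have e : ∑ i ∈ A, ∑ j ∈ B, signW c σ η i j = ∑ x, (σ x * (if x ∈ cellUnion c A then 1 else 0))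
          * (σ (η x) * (if η x ∈ cellUnion c B then 1 else 0))
        - (∑ x, σ x * (if x ∈ cellUnion c A then 1 else 0))
          * (∑ x, σ x * (if x ∈ cellUnion c B then 1 else 0)) / nV := by
    have := sum_signW c σ η (fun i => if i ∈ A then 1 else 0) (fun i => if i ∈ B then 1 else 0)
    simp only [hmem] at this
    rw [← this]
    simp
  set S := cellUnion c A
  set T := cellUnion c B
  obtain ⟨n, hnn⟩ : ∃ n : ℝ, n = nV := ⟨_, rfl⟩
  have hn0 : 0 ≤ n := by rw [hnn]; positivity
  have hy2 := sq_sqrt (show (0:ℝ) ≤ S.card * T.card by positivity)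
  set y := √((S.card : ℝ) * T.card)
  by_cases hsmall : y ≤ α ^ 3 * nV
  · have h1 := hs A B hsmall
    have hσ1 : ∀ x, |σ x| = 1 := fun x => by rcases hσ x with h | h <;> simp [h]
    have h2 : ∀ S : Finset V, |∑ x, σ x * (if x ∈ S then 1 else 0)| ≤ S.card := fun S => by
      refine (abs_sum_le_sum_abs _ _).trans (le_of_eq ?_)
      simp_rw [abs_mul, hσ1, one_mul]
      have : ∀ x, |(if x ∈ S then (1:ℝ) else 0)| = if x ∈ S then 1 else 0 := by
        intro x; split_ifs <;> simp
      simp [this]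
    rw [e]
    refine (abs_sub _ _).trans ?_
    have h3 : |∑ x, (σ x * (if x ∈ S then 1 else 0)) * (σ (η x) * (if η x ∈ T then 1 else 0))|
        ≤ eST S T η := by
      rw [eST_eq_sum]
      refine (abs_sum_le_sum_abs _ _).trans (le_of_eq ?_)
      refine sum_congr rfl fun x _ => ?_
      simp_rw [abs_mul, hσ1, one_mul]
      split_ifs <;> simp
    have h4 : |(∑ x, σ x * (if x ∈ S then 1 else 0)) * (∑ x, σ x * (if x ∈ T then 1 else 0))
        / nV| ≤ y ^ 2 / n := by
      rw [abs_div, abs_mul, abs_of_nonneg (Nat.cast_nonneg (α := ℝ) nV), hy2, hnn]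
      gcongr
      · exact h2 S
      · exact h2 T
    rw [← hnn] at hsmall
    have h5 : y ^ 2 / n ≤ α ^ 3 * y := by
      rcases hn0.eq_or_lt with h | h
      · rw [← h, div_zero]; positivity
      rw [div_le_iff₀ h]
      nlinarith
    have h6 : α ^ 3 * y ≤ α * y := by
      gcongr
      calc α ^ 3 = α * α ^ 2 := by ring
        _ ≤ α * 1 := by gcongr; exact pow_le_one₀ hα.le hα1
        _ = α := mul_one α
    linarith
  · have hl' := hl A B
    rw [← hnn] at hl' hsmall
    have e3 : ∑ i ∈ A, ∑ j ∈ B, signW c σ η i j =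
        (((eST (signPart σ S true) (signPart σ T true) η : ℝ)
          - ((signPart σ S true).card * (signPart σ T true).card : ℝ) / n)
        - ((eST (signPart σ S true) (signPart σ T false) η : ℝ)
          - ((signPart σ S true).card * (signPart σ T false).card : ℝ) / n))
        - (((eST (signPart σ S false) (signPart σ T true) η : ℝ)
          - ((signPart σ S false).card * (signPart σ T true).card : ℝ) / n)
        - ((eST (signPart σ S false) (signPart σ T false) η : ℝ)
          - ((signPart σ S false).card * (signPart σ T false).card : ℝ) / n)) := by
      rw [e]
      simp_rw [sign_mul_ind hσ]
      simp_rw [eST_eq_sum, sum_sub_distrib, sub_mul, mul_sub, sum_sub_distrib]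
      simp only [sum_boole, filter_mem_eq_inter, univ_inter, ← hnn]
      ring
    rw [e3]
    have t1 := hl' true true
    have t2 := hl' true false
    have t3 := hl' false true
    have t4 := hl' false false
    have : α ^ 4 * n ≤ α * y := by
      have := mul_le_left (not_le.1 hsmall).le hα.le
      calc α ^ 4 * n = α * (α ^ 3 * n) := by ring
        _ ≤ _ := this
    refine (abs_sub _ _).trans ((add_le_add (abs_sub _ _) (abs_sub _ _)).trans ?_)
    linarith

lemma abs_sign_bilin_le {c : V → C} {σ : V → ℝ} (hσ : ∀ x, σ x = 1 ∨ σ x = -1) {α : ℝ}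
    {η : V → V} (hη : IsPM η)
    (hα : 0 < α) (hα1 : α ≤ 1) (hs : smallDisc c α η) (hl : largeDisc c σ α η)
    (b : ℕ) (hb : 1 < b) (φ ψ : C → ℝ) :
    |∑ x, (σ x * φ (c x)) * (σ (η x) * ψ (c (η x)))
        - (∑ x, σ x * φ (c x)) * (∑ x, σ x * ψ (c x)) / nV| ≤
      4 * (6 * α * b ^ 2 + 2 / b) * (√(∑ x, φ (c x) ^ 2) * √(∑ x, ψ (c x) ^ 2)) := by
  have hcs : ∀ i, 0 ≤ cellSize c i := fun i => Nat.cast_nonneg _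
  have main := abs_bilin_le_of_discrepancy (W := signW c σ η) (μ := cellSize c)
    hcs (β := 4 * α) (by positivity)
    (signW_disc hσ hα hα1 hs hl) (fun i => ?_) (fun j => ?_) b hb φ ψ
  · rw [sum_signW] at main
    rw [sum_cell_eq c (fun i => φ i ^ 2), sum_cell_eq c (fun i => ψ i ^ 2)]
    refine main.trans (le_of_eq ?_)
    ring
  · have hdiv : cellSize c i * nV / nV ≤ cellSize c i :=
      div_le_of_le_mul₀ (by positivity) (hcs i) le_rfl
    refine (sum_le_sum fun j _ => abs_signW_le hσ c η i j).trans ?_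
    rw [sum_add_distrib, ← sum_div, ← mul_sum, sum_cellSize, sum_comm]
    have : ∑ x, ∑ j, (if c x = i then (1:ℝ) else 0) * (if c (η x) = j then 1 else 0)
        = cellSize c i := by
      rw [cellSize_eq_sum]; simp
    rw [this]; linarith
  · have hdiv : nV * cellSize c j / nV ≤ cellSize c j :=
      div_le_of_le_mul₀ (by positivity) (hcs j) (by rw [mul_comm])
    refine (sum_le_sum fun i _ => abs_signW_le hσ c η i j).trans ?_
    rw [sum_add_distrib, ← sum_div, ← sum_mul, sum_cellSize, sum_comm]
    have : ∑ x, ∑ i, (if c x = i then (1:ℝ) else 0) * (if c (η x) = j then 1 else 0)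
        = cellSize c j := by
      rw [cellSize_eq_sum]
      have : ∑ x, ∑ i, (if c x = i then (1:ℝ) else 0) * (if c (η x) = j then 1 else 0)
        = ∑ x, if c (η x) = j then (1:ℝ) else 0 := by simp
      rw [this]
      exact Equiv.sum_comp hη.1.toPerm (fun x => if c x = j then (1:ℝ) else 0)
    rw [this]; linarith

end SignedDiscrepancy

section Green

variable (G)

def adjSum (f : V → ℝ) (x : V) : ℝ := ∑ y, if G.Adj x y then f y else 0

def dg (x : V) : ℝ := G.degree x

lemma dg_nonneg (x : V) : 0 ≤ dg G x := Nat.cast_nonneg _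

lemma adjSum_const (c : ℝ) (x : V) : adjSum G (fun _ => c) x = dg G x * c := by
  rw [adjSum, ← sum_filter, sum_const, nsmul_eq_mul, dg]
  congr 2
  rw [← G.card_neighborFinset_eq_degree]
  congr 1
  ext y; simp

variable {G} in
lemma adjSum_mono {f g : V → ℝ} (h : ∀ x, f x ≤ g x) (x : V) : adjSum G f x ≤ adjSum G g x :=
  sum_le_sum fun y _ => by split_ifs; exacts [h y, le_rfl]

lemma adjSum_add (f g : V → ℝ) (x : V) :
    adjSum G (fun y => f y + g y) x = adjSum G f x + adjSum G g x := by
  simp only [adjSum, ← sum_add_distrib]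
  exact sum_congr rfl fun y _ => by split_ifs <;> simp

lemma adjSum_mul (c : ℝ) (f : V → ℝ) (x : V) :
    adjSum G (fun y => c * f y) x = c * adjSum G f x := by
  simp only [adjSum, mul_sum]
  exact sum_congr rfl fun y _ => by split_ifs <;> simp

lemma sum_mul_adjSum_comm (f g : V → ℝ) : ∑ x, f x * adjSum G g x = ∑ x, adjSum G f x * g x := by
  simp only [adjSum, mul_sum, sum_mul]
  rw [sum_comm]
  refine sum_congr rfl fun y _ => sum_congr rfl fun x _ => ?_
  simp only [G.adj_comm x y]
  split_ifs <;> simp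

/-- The killed Laplacian `D + ε - A`. -/
def lapEps (ε : ℝ) (f : V → ℝ) (x : V) : ℝ := (dg G x + ε) * f x - adjSum G f x

def lapMat (ε : ℝ) : Matrix V V ℝ :=
  Matrix.of fun x y => (if x = y then dg G x + ε else 0) - if G.Adj x y then 1 else 0

lemma lapMat_mulVec (ε : ℝ) (f : V → ℝ) : (lapMat G ε).mulVec f = lapEps G ε f := by
  funext x
  simp only [Matrix.mulVec, dotProduct, lapMat, Matrix.of_apply, lapEps, adjSum, sub_mul,
    sum_sub_distrib, ite_mul, zero_mul, one_mul]
  simp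

lemma lapMat_transpose (ε : ℝ) : (lapMat G ε).transpose = lapMat G ε := by
  ext x y
  simp only [Matrix.transpose_apply, lapMat, Matrix.of_apply, G.adj_comm y x]
  by_cases h : x = y
  · subst h; rfl
  · simp [h, Ne.symm h]

lemma nonneg_of_lapEps_nonneg {ε : ℝ} (hε : 0 < ε) {f : V → ℝ} (h : ∀ x, 0 ≤ lapEps G ε f x)
    (x : V) : 0 ≤ f x := by
  obtain ⟨z, -, hz⟩ := exists_min_image univ f ⟨x, mem_univ x⟩
  have h1 := h z
  have h2 : adjSum G (fun _ => f z) z ≤ adjSum G f z := adjSum_mono (fun y => hz y (mem_univ y)) z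
  rw [adjSum_const] at h2
  rw [lapEps] at h1
  have : 0 ≤ ε * f z := by linarith
  have := nonneg_of_mul_nonneg_right this hε
  exact this.trans (hz x (mem_univ x))

lemma lapMat_isUnit {ε : ℝ} (hε : 0 < ε) : IsUnit (lapMat G ε) := by
  rw [← Matrix.mulVec_injective_iff_isUnit]
  intro f g hfg
  simp only [lapMat_mulVec] at hfg
  have key : ∀ f g : V → ℝ, lapEps G ε f = lapEps G ε g → ∀ x, g x ≤ f x := fun f g h x => by
    have := nonneg_of_lapEps_nonneg G hε (f := fun x => f x + (-1) * g x) (fun x => by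
        have := congrFun h x
        simp only [lapEps] at this ⊢
        rw [adjSum_add, adjSum_mul]; linarith) x
    linarith
  exact funext fun x => le_antisymm (key g f hfg.symm x) (key f g hfg x)

/-- The law of the position at the first crossing: `ε (D + ε - A)⁻¹`. -/
def gQ (ε : ℝ) (x y : V) : ℝ := ε * (lapMat G ε)⁻¹ x y

local notation "Qε" => gQ G ε

lemma gQ_symm (x y : V) : Qε x y = Qε y x := by
  unfold gQ
  congr 1
  have : ((lapMat G ε)⁻¹).transpose = (lapMat G ε)⁻¹ := by
    rw [Matrix.transpose_nonsing_inv, lapMat_transpose]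
  exact (congrFun (congrFun this y) x)

lemma Qop_gQ_eq (f : V → ℝ) (x : V) : Qop Qε f x = ε * (lapMat G ε)⁻¹.mulVec f x := by
  simp only [Qop, gQ, Matrix.mulVec, dotProduct, mul_sum, mul_assoc]

lemma Qop_gQ_lapEps (hε : 0 < ε) (f : V → ℝ) (x : V) : Qop Qε (lapEps G ε f) x = ε * f x := by
  rw [Qop_gQ_eq, ← lapMat_mulVec, Matrix.mulVec_mulVec, Matrix.nonsing_inv_mul _
    ((Matrix.isUnit_iff_isUnit_det _).1 (lapMat_isUnit G hε)), Matrix.one_mulVec]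

lemma lapEps_Qop_gQ (hε : 0 < ε) (f : V → ℝ) (x : V) : lapEps G ε (Qop Qε f) x = ε * f x := by
  have : Qop Qε f = (lapMat G ε)⁻¹.mulVec (fun x => ε * f x) := by
    funext x
    rw [Qop_gQ_eq]
    simp only [Matrix.mulVec, dotProduct, mul_sum]
    exact sum_congr rfl fun y _ => by ring
  rw [this, ← lapMat_mulVec, Matrix.mulVec_mulVec, Matrix.mul_nonsing_inv _
    ((Matrix.isUnit_iff_isUnit_det _).1 (lapMat_isUnit G hε)), Matrix.one_mulVec]

lemma lapEps_gQ (hε : 0 < ε) (v x : V) :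
    lapEps G ε (fun y => Qε y v) x = if x = v then ε else 0 := by
  have := lapEps_Qop_gQ G hε (fun y => if y = v then 1 else 0) x
  have e : Qop Qε (fun y => if y = v then 1 else 0) = fun y => Qε y v := by
    funext y; simp [Qop]
  rw [e] at this
  rw [this]; simp

lemma gQ_isDS (hε : 0 < ε) : IsDS Qε where
  nonneg x y := by
    refine nonneg_of_lapEps_nonneg G hε (f := fun x => Qε x y) (fun x => ?_) x
    rw [lapEps_gQ G hε]; split_ifs; exacts [hε.le, le_rfl]
  symm := gQ_symm G
  row x := by
    have h := Qop_gQ_lapEps G hε (fun _ => 1) x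
    have e : lapEps G ε (fun _ => 1) = fun _ => ε := by funext y; rw [lapEps, adjSum_const]; ring
    rw [e, Qop, ← sum_mul, mul_comm ε 1] at h
    exact mul_right_cancel₀ hε.ne' h

lemma gQ_le_diag (hε : 0 < ε) (u v : V) : Qε v u ≤ Qε u u := by
  obtain ⟨z, -, hz⟩ := exists_max_image univ (fun x => Qε x u) ⟨u, mem_univ u⟩
  by_cases hzu : z = u
  · rw [← hzu] at hz ⊢; exact hz v (mem_univ v)
  · exfalso
    have h1 := lapEps_gQ G hε u z
    rw [if_neg hzu, lapEps] at h1
    have h2 : adjSum G (fun y => Qε y u) z ≤ adjSum G (fun _ => Qε z u) z :=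
      adjSum_mono (fun y => hz y (mem_univ y)) z
    rw [adjSum_const] at h2
    have h3 : Qε z u ≤ 0 := by
      by_contra h
      have := mul_pos hε (not_le.1 h)
      linarith
    have h4 := (gQ_isDS G hε).col u
    have h5 : ∑ x, Qε x u ≤ 0 := sum_nonpos fun x _ => (hz x (mem_univ x)).trans h3
    linarith

/-- First moment of the distance at the first crossing. -/
lemma sum_gQ_dist_le (hε : 0 < ε) (hconn : G.Connected) {Δ : ℝ} (hΔ : ∀ x, dg G x ≤ Δ) (u : V) :
    ∑ v, Qε u v * (G.dist u v : ℝ) ≤ Δ / ε := by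
  have hQ := gQ_isDS G hε
  have h := Qop_gQ_lapEps G hε (fun v => (G.dist u v : ℝ)) u
  simp only [SimpleGraph.dist_self, Nat.cast_zero, mul_zero] at h
  have h2 : ∀ v, -Δ + ε * (G.dist u v : ℝ) ≤ lapEps G ε (fun v => (G.dist u v : ℝ)) v := fun v => by
    have : adjSum G (fun v => (G.dist u v : ℝ)) v ≤ adjSum G (fun _ => (G.dist u v : ℝ) + 1) v := by
      refine sum_le_sum fun y _ => ?_
      split_ifs with hy
      · have h1 := hconn.dist_triangle (u := u) (v := v) (w := y)
        rw [SimpleGraph.dist_eq_one_iff_adj.2 hy] at h1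
        change (G.dist u y : ℝ) ≤ G.dist u v + 1
        exact_mod_cast h1
      · exact le_rfl
    rw [adjSum_const] at this
    rw [lapEps]
    have := hΔ v
    linarith
  have h3 : ∑ v, Qε u v * (-Δ + ε * (G.dist u v : ℝ)) ≤ 0 := by
    rw [← h]
    exact sum_le_sum fun v _ => mul_le_left (h2 v) (hQ.nonneg u v)
  simp only [mul_add, sum_add_distrib, ← sum_mul, hQ.row] at h3
  have e : ∑ v, Qε u v * (ε * (G.dist u v : ℝ)) = ε * ∑ v, Qε u v * (G.dist u v : ℝ) := by
    rw [mul_sum]; exact sum_congr rfl fun _ _ => by ring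
  rw [e] at h3
  rw [le_div_iff₀ hε]; linarith

/-- Signed Dirichlet energy, summed over ordered pairs. -/
def energy (s : ℝ) (f : V → ℝ) : ℝ := ∑ x, ∑ y, if G.Adj x y then (f x - s * f y) ^ 2 else 0

lemma energy_nonneg (s : ℝ) (f : V → ℝ) : 0 ≤ energy G s f :=
  sum_nonneg fun x _ => sum_nonneg fun y _ => by split_ifs; exacts [sq_nonneg _, le_rfl]

lemma energy_eq {s : ℝ} (hs : s ^ 2 = 1) (f : V → ℝ) :
    energy G s f = 2 * (∑ x, dg G x * f x ^ 2 - s * ∑ x, f x * adjSum G f x) := by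
  have e1 : ∀ x, ∑ y, (if G.Adj x y then (f x - s * f y) ^ 2 else 0)
      = dg G x * f x ^ 2 - 2 * s * (f x * adjSum G f x) + adjSum G (fun y => f y ^ 2) x := by
    intro x
    rw [← adjSum_const, adjSum, adjSum, adjSum, mul_sum, mul_sum,
      ← sum_sub_distrib, ← sum_add_distrib]
    refine sum_congr rfl fun y _ => ?_
    split_ifs
    · linear_combination f y ^ 2 * hs
    · simp
  have e2 : ∑ x, adjSum G (fun y => f y ^ 2) x = ∑ x, dg G x * f x ^ 2 := by
    have := sum_mul_adjSum_comm G (fun _ => 1) (fun y => f y ^ 2)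
    simpa [adjSum_const] using this
  rw [energy]
  simp_rw [e1]
  rw [sum_add_distrib, sum_sub_distrib, e2, ← mul_sum]
  ring

lemma sum_mul_lapEps (ε : ℝ) (f : V → ℝ) :
    ∑ x, f x * lapEps G ε f x = energy G 1 f / 2 + ε * ∑ x, f x ^ 2 := by
  rw [energy_eq G (by norm_num), one_mul, mul_sum]
  simp only [lapEps]
  have : ∑ x, f x * ((dg G x + ε) * f x - adjSum G f x)
    = ∑ x, dg G x * f x ^ 2 - ∑ x, f x * adjSum G f x + ∑ x, ε * f x ^ 2 := by
    rw [← sum_sub_distrib, ← sum_add_distrib]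
    exact sum_congr rfl fun x _ => by ring
  rw [this]; ring

lemma energy_Qop_le (hε : 0 < ε) (f : V → ℝ) : energy G 1 (Qop Qε f) ≤ ε * ∑ x, f x ^ 2 := by
  have h := sum_mul_lapEps G ε (Qop Qε f)
  simp only [lapEps_Qop_gQ G hε] at h
  have h2 : ∑ x, Qop Qε f x * (ε * f x)
      ≤ ε * ∑ x, (Qop Qε f x) ^ 2 + ε / 4 * ∑ x, f x ^ 2 := by
    rw [mul_sum, mul_sum, ← sum_add_distrib]
    refine sum_le_sum fun x _ => ?_
    nlinarith [mul_nonneg hε.le (sq_nonneg (Qop Qε f x - f x / 2))]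
  have : 0 ≤ ε * ∑ x, f x ^ 2 := mul_nonneg hε.le (sum_nonneg fun _ _ => sq_nonneg _)
  linarith

lemma energy_gQ_le (hε : 0 < ε) (u : V) :
    energy G 1 (fun x => Qε x u) ≤ 2 * ε * Qε u u := by
  have h := sum_mul_lapEps G ε (fun x => Qε x u)
  simp only [lapEps_gQ G hε, mul_ite, mul_zero, sum_ite_eq', mem_univ, if_true] at h
  have : 0 ≤ ε * ∑ x, Qε x u ^ 2 := mul_nonneg hε.le (sum_nonneg fun _ _ => sq_nonneg _)
  linarith

variable {G}

lemma sq_sub_le_walk {s : ℝ} (hs : s ^ 2 = 1) (f : V → ℝ) {u v : V} (p : G.Walk u v) :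
    (f u - s ^ p.length * f v) ^ 2 ≤
      p.length * (p.darts.map fun d => (f d.fst - s * f d.snd) ^ 2).sum := by
  induction p with
  | nil => simp
  | @cons u w v h p ih =>
    simp only [SimpleGraph.Walk.length_cons, SimpleGraph.Walk.darts_cons, List.map_cons,
      List.sum_cons, Nat.cast_add, Nat.cast_one]
    set S := (p.darts.map fun d => (f d.fst - s * f d.snd) ^ 2).sum
    have hS : 0 ≤ S := List.sum_nonneg (by
      intro x hx
      obtain ⟨d, -, rfl⟩ := List.mem_map.1 hx
      positivity)
    obtain ⟨a, ha⟩ : ∃ a, a = f u - s * f w := ⟨_, rfl⟩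
    obtain ⟨b, hb⟩ : ∃ b, b = f w - s ^ p.length * f v := ⟨_, rfl⟩
    rw [← hb] at ih
    have e : f u - s ^ (p.length + 1) * f v = a + s * b := by rw [ha, hb]; ring
    rw [e, ← ha]
    have e2 : (s * b) ^ 2 = b ^ 2 := by rw [mul_pow, hs, one_mul]
    obtain ⟨L, hL⟩ : ∃ L : ℝ, L = p.length := ⟨_, rfl⟩
    have hL0 : 0 ≤ L := by rw [hL]; positivity
    rw [← hL] at ih ⊢
    generalize s * b = B at *
    rw [← e2] at ih
    rcases hL0.eq_or_lt with h0 | h0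
    · rw [← h0] at ih ⊢
      have : B = 0 := by
        have : B ^ 2 ≤ 0 := by linarith
        exact pow_eq_zero_iff (two_ne_zero) |>.1 (le_antisymm this (sq_nonneg _))
      rw [this]; linarith
    · have : 0 ≤ L * (L * a ^ 2 + S - 2 * (a * B)) := by nlinarith [sq_nonneg (L * a - B)]
      nlinarith

def walkEdges {u v : V} (p : G.Walk u v) : Finset (V × V) := (p.darts.map fun d => d.toProd).toFinset

lemma sum_walkEdges {u v : V} {p : G.Walk u v} (hp : p.IsPath) (F : V → V → ℝ) :
    (p.darts.map fun d => F d.fst d.snd).sum = ∑ q ∈ walkEdges p, F q.1 q.2 := by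
  have hnd : (p.darts.map fun d => d.toProd).Nodup := by
    have h1 : p.darts.Nodup := by
      have := hp.isTrail.edges_nodup
      exact List.Nodup.of_map _ this
    exact h1.map (fun d1 d2 h => SimpleGraph.Dart.toProd_injective h)
  rw [walkEdges, List.sum_toFinset _ hnd, List.map_map]
  rfl

lemma mem_walkEdges {u v : V} {p : G.Walk u v} {q : V × V} (h : q ∈ walkEdges p) :
    G.Adj q.1 q.2 ∧ q.1 ∈ p.support := by
  simp only [walkEdges, List.mem_toFinset, List.mem_map] at h
  obtain ⟨d, hd, rfl⟩ := h
  exact ⟨d.adj, p.dart_fst_mem_support_of_mem_darts hd⟩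

lemma energy_eq_sum_prod (s : ℝ) (f : V → ℝ) :
    energy G s f = ∑ q : V × V, if G.Adj q.1 q.2 then (f q.1 - s * f q.2) ^ 2 else 0 := by
  rw [energy, Fintype.sum_prod_type]

lemma sq_sub_le_dist (hconn : G.Connected) (f : V → ℝ) (u v : V) :
    (f u - f v) ^ 2 ≤ G.dist u v * energy G 1 f := by
  obtain ⟨p, hp, hl⟩ := hconn.exists_path_of_dist u v
  have h := sq_sub_le_walk (s := 1) (by norm_num) f p
  rw [sum_walkEdges hp (fun a b => (f a - 1 * f b) ^ 2), hl, one_pow, one_mul] at h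
  refine h.trans (mul_le_left ?_ (Nat.cast_nonneg _))
  rw [energy_eq_sum_prod]
  calc _ = ∑ q ∈ walkEdges p, if G.Adj q.1 q.2 then (f q.1 - 1 * f q.2) ^ 2 else 0 :=
        sum_congr rfl fun q hq => by rw [if_pos (mem_walkEdges hq).1]
    _ ≤ _ := sum_le_sum_of_subset_of_nonneg (subset_univ _)
        fun q _ _ => by split_ifs; exacts [sq_nonneg _, le_rfl]

end Green

local notation "Qε" => gQ G ε

variable (G) in
def gball (x : V) (r : ℕ) : Finset V := univ.filter fun y => G.dist x y ≤ r

@[simp] lemma mem_gball {x y : V} {r : ℕ} : y ∈ gball G x r ↔ G.dist x y ≤ r := by simp [gball]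

lemma le_card_gball (hconn : G.Connected) (u : V) {l : ℕ} (hl : l + 1 ≤ nV) :
    l + 1 ≤ (gball G u l).card := by
  by_cases h : ∃ v, l < G.dist u v
  · obtain ⟨v, hv⟩ := h
    obtain ⟨p, hp, hlen⟩ := hconn.exists_path_of_dist u v
    rw [← card_range (l + 1)]
    refine card_le_card_of_injOn (fun j => p.getVert j) ?_ ?_
    · intro j hj
      simp only [coe_range, Set.mem_Iio] at hj
      simp only [mem_coe, mem_gball]
      refine (SimpleGraph.dist_le (p.take j)).trans ?_
      rw [SimpleGraph.Walk.take_length]; omega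
    · intro i hi j hj hij
      simp only [coe_range, Set.mem_Iio] at hi hj
      exact hp.getVert_injOn (by simp; omega) (by simp; omega) hij
  · push Not at h
    have : gball G u l = univ := by ext v; simp [h v]
    rw [this, card_univ]; exact hl

/-- The return probability of the killed walk is small. -/
lemma gQ_le_max (hε : 0 < ε) (hconn : G.Connected) (u v : V) :
    Qε u v ≤ max (4 * √ε) (2 / nV) := by
  have hQ := gQ_isDS G hε
  rw [gQ_symm]
  refine (gQ_le_diag G hε u v).trans ?_
  set g := Qε u u
  by_contra hcon
  rw [not_le, max_lt_iff] at hcon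
  obtain ⟨h1, h2⟩ := hcon
  have hsq := sq_sqrt hε.le
  have hgpos : 0 < g := lt_of_le_of_lt (by positivity) h1
  have h1' : 16 * ε < g ^ 2 := by
    calc 16 * ε = (4 * √ε) ^ 2 := by rw [mul_pow, hsq]; norm_num
      _ < g ^ 2 := by gcongr
  have hcard : 0 < nV := Fintype.card_pos_iff.2 ⟨u⟩
  set l := min ⌊g / (8 * ε)⌋₊ (nV - 1)
  have hl1 : l + 1 ≤ nV := by omega
  have hl2 : (l : ℝ) ≤ g / (8 * ε) :=
    (Nat.cast_le.2 (min_le_left _ _)).trans (Nat.floor_le (by positivity))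
  have hball : ∀ v ∈ gball G u l, g / 2 ≤ Qε v u := by
    intro v hv
    have a1 := sq_sub_le_dist hconn (fun x => Qε x u) u v
    have a2 := energy_gQ_le G hε u
    have a3 : (G.dist u v : ℝ) ≤ g / (8 * ε) := le_trans (by exact_mod_cast mem_gball.1 hv) hl2
    have a4 : (G.dist u v : ℝ) * energy G 1 (fun x => Qε x u) ≤ g / (8 * ε) * (2 * ε * g) :=
      mul_le_mul a3 a2 (energy_nonneg _ _ _) (by positivity)
    have a5 : g / (8 * ε) * (2 * ε * g) = (g / 2) ^ 2 := by field_simp; ring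
    rw [a5] at a4
    have := (abs_le_of_sq_le_sq' (a1.trans a4) (by positivity)).2
    change g - Qε v u ≤ g / 2 at this
    linarith
  have hsum : ((gball G u l).card : ℝ) * (g / 2) ≤ 1 := by
    rw [← hQ.col u, ← nsmul_eq_mul, ← sum_const]
    exact (sum_le_sum hball).trans
      (sum_le_sum_of_subset_of_nonneg (subset_univ _) fun x _ _ => hQ.nonneg x u)
  have hgrow : ((l : ℝ) + 1) ≤ (gball G u l).card := by exact_mod_cast le_card_gball hconn u hl1
  have hfin : ((l : ℝ) + 1) * (g / 2) ≤ 1 := le_trans (by gcongr) hsum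
  rcases min_choice ⌊g / (8 * ε)⌋₊ (nV - 1) with hm | hm
  · have : g / (8 * ε) < l + 1 := by
      change _ < ((min ⌊g / (8 * ε)⌋₊ (nV - 1) : ℕ) : ℝ) + 1
      rw [hm]; exact Nat.lt_floor_add_one _
    have : g / (8 * ε) * (g / 2) < 1 := lt_of_lt_of_le (by gcongr) hfin
    rw [div_mul_div_comm, div_lt_one (by positivity)] at this
    nlinarith
  · have e : (l : ℝ) + 1 = nV := by
      have : l + 1 = nV := by omega
      exact_mod_cast this
    rw [e] at hfin
    have hc : (0 : ℝ) < nV := by exact_mod_cast hcard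
    rw [div_lt_iff₀ hc] at h2
    linarith

/-- Partition into cells of bounded radius and of a given minimal size. -/
lemma exists_cells (hconn : G.Connected) {ρ : ℕ} (hρ : ρ + 1 ≤ nV) :
    ∃ (𝒞 : Finset V) (c : V → 𝒞), (∀ x, G.dist x (c x) ≤ 2 * ρ) ∧
      ∀ i, ((ρ + 1 : ℕ) : ℝ) ≤ cellSize c i := by
  classical
  set sep : Finset V → Prop := fun 𝒞 => ∀ x ∈ 𝒞, ∀ y ∈ 𝒞, x ≠ y → 2 * ρ < G.dist x y
  obtain ⟨𝒞, h𝒞, hmax⟩ := exists_max_image ((univ : Finset (Finset V)).filter sep) card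
    ⟨∅, by simp [sep]⟩
  have hsep := (mem_filter.1 h𝒞).2
  have hcov : ∀ x, ∃ z ∈ 𝒞, G.dist x z ≤ 2 * ρ := fun x => by
    by_contra hx
    push Not at hx
    have hx𝒞 : x ∉ 𝒞 := fun h => by have := hx x h; simp at this
    have : sep (insert x 𝒞) := fun a ha b hb hab => by
      rw [mem_insert] at ha hb
      rcases ha with rfl | ha <;> rcases hb with rfl | hb
      · exact absurd rfl hab
      · exact hx b hb
      · rw [SimpleGraph.dist_comm]; exact hx a ha
      · exact hsep a ha b hb hab
    have := hmax _ (mem_filter.2 ⟨mem_univ _, this⟩)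
    rw [card_insert_of_notMem hx𝒞] at this
    omega
  have hsel : ∀ x, ∃ z : 𝒞, G.dist x z ≤ 2 * ρ ∧ ∀ z' ∈ 𝒞, G.dist x z' ≤ ρ → (z : V) = z' := by
    intro x
    by_cases h : ∃ z ∈ 𝒞, G.dist x z ≤ ρ
    · obtain ⟨z, hz, hd⟩ := h
      refine ⟨⟨z, hz⟩, by change G.dist x z ≤ _; omega, fun z' hz' hd' => ?_⟩
      by_contra hne
      have h1 := hsep z hz z' hz' hne
      have h2 := hconn.dist_triangle (u := z) (v := x) (w := z')
      rw [SimpleGraph.dist_comm (u := z) (v := x)] at h2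
      omega
    · push Not at h
      obtain ⟨z, hz, hd⟩ := hcov x
      exact ⟨⟨z, hz⟩, hd, fun z' hz' hd' => absurd hd' (not_le.2 (h z' hz'))⟩
  choose c hc1 hc2 using hsel
  refine ⟨𝒞, c, hc1, fun i => ?_⟩
  rw [cellSize]
  refine Nat.cast_le.2 ((le_card_gball hconn (i : V) hρ).trans (card_le_card ?_))
  intro x hx
  rw [mem_gball, SimpleGraph.dist_comm] at hx
  exact mem_filter.2 ⟨mem_univ _, Subtype.ext (hc2 x i i.2 hx)⟩

/-- Comparison of a function with its values at the centres of the cells. -/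
lemma sum_sq_sub_centre_le (hconn : G.Connected) {s : ℝ} (hs : s ^ 2 = 1) {R : ℕ} {B : ℝ}
    (hB : ∀ x, ((gball G x R).card : ℝ) ≤ B) (c : V → V) (hc : ∀ x, G.dist x (c x) ≤ R)
    (f : V → ℝ) :
    ∑ x, (f x - s ^ G.dist x (c x) * f (c x)) ^ 2 ≤ R * (B * energy G s f) := by
  classical
  choose p hp hl using fun x => hconn.exists_path_of_dist x (c x)
  set F : V × V → ℝ := fun q => if G.Adj q.1 q.2 then (f q.1 - s * f q.2) ^ 2 else 0
  have hF : ∀ q, 0 ≤ F q := fun q => by simp only [F]; split_ifs; exacts [sq_nonneg _, le_rfl]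
  have h1 : ∀ x, (f x - s ^ G.dist x (c x) * f (c x)) ^ 2
      ≤ R * ∑ q : V × V, if q ∈ walkEdges (p x) then F q else 0 := by
    intro x
    have := sq_sub_le_walk hs f (p x)
    rw [sum_walkEdges (hp x) (fun a b => (f a - s * f b) ^ 2), hl] at this
    refine this.trans ?_
    have e : ∑ q ∈ walkEdges (p x), (f q.1 - s * f q.2) ^ 2
        = ∑ q : V × V, if q ∈ walkEdges (p x) then F q else 0 := by
      rw [sum_ite_mem, univ_inter]
      exact sum_congr rfl fun q hq => by simp only [F, if_pos (mem_walkEdges hq).1]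
    rw [e]
    have : (G.dist x (c x) : ℝ) ≤ R := by exact_mod_cast hc x
    refine mul_le_right this (sum_nonneg fun q _ => ?_)
    split_ifs
    exacts [hF q, le_rfl]
  refine (sum_le_sum fun x _ => h1 x).trans ?_
  rw [← mul_sum, sum_comm, energy_eq_sum_prod, mul_sum _ _ B]
  refine mul_le_left (sum_le_sum fun q _ => ?_) (Nat.cast_nonneg R)
  change ∑ x, (if q ∈ walkEdges (p x) then F q else 0) ≤ B * F q
  rw [← sum_filter, sum_const, nsmul_eq_mul]
  refine mul_le_right (le_trans ?_ (hB q.1)) (hF q)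
  refine Nat.cast_le.2 (card_le_card fun x hx => ?_)
  have hm := (mem_walkEdges (mem_filter.1 hx).2).2
  rw [mem_gball, SimpleGraph.dist_comm]
  calc G.dist x q.1 ≤ ((p x).takeUntil q.1 hm).length := SimpleGraph.dist_le _
    _ ≤ (p x).length := (p x).length_takeUntil_le_length hm
    _ ≤ R := by rw [hl]; exact hc x

/-- Centred correlation of two functions across the matching. -/
def corr (η : V → V) (f g : V → ℝ) : ℝ := ∑ x, f x * g (η x) - (∑ x, f x) * (∑ x, g x) / nV

lemma corr_add_left (η : V → V) (f f' g : V → ℝ) :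
    corr η (fun x => f x + f' x) g = corr η f g + corr η f' g := by
  simp only [corr, add_mul, sum_add_distrib]; ring

lemma corr_add_right (η : V → V) (f g g' : V → ℝ) :
    corr η f (fun x => g x + g' x) = corr η f g + corr η f g' := by
  simp only [corr, mul_add, sum_add_distrib]; ring

def nrm (f : V → ℝ) : ℝ := √(∑ x, f x ^ 2)

lemma nrm_nonneg (f : V → ℝ) : 0 ≤ nrm f := sqrt_nonneg _

lemma nrm_sq (f : V → ℝ) : nrm f ^ 2 = ∑ x, f x ^ 2 := sq_sqrt (sum_nonneg fun _ _ => sq_nonneg _)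

lemma nrm_le_iff {f : V → ℝ} {F : ℝ} (hF : 0 ≤ F) : nrm f ≤ F ↔ ∑ x, f x ^ 2 ≤ F ^ 2 :=
  sqrt_le_left hF

lemma abs_sum_mul_le (f g : V → ℝ) : |∑ x, f x * g x| ≤ nrm f * nrm g := by
  rw [← sqrt_sq_eq_abs, nrm, nrm, ← sqrt_mul (sum_nonneg fun _ _ => sq_nonneg _)]
  exact sqrt_le_sqrt (sum_mul_sq_le_sq_mul_sq _ _ _)

lemma nrm_add_le (f g : V → ℝ) : nrm (fun x => f x + g x) ≤ nrm f + nrm g := by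
  rw [nrm_le_iff (add_nonneg (nrm_nonneg f) (nrm_nonneg g))]
  have h1 := (le_abs_self _).trans (abs_sum_mul_le f g)
  have : ∑ x, (f x + g x) ^ 2 = ∑ x, f x ^ 2 + 2 * ∑ x, f x * g x + ∑ x, g x ^ 2 := by
    rw [mul_sum, ← sum_add_distrib, ← sum_add_distrib]
    exact sum_congr rfl fun _ _ => by ring
  rw [this, ← nrm_sq, ← nrm_sq]; nlinarith

lemma nrm_comp_perm {η : V → V} (hη : IsPM η) (f : V → ℝ) :
    nrm (fun x => f (η x)) = nrm f := by
  unfold nrm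
  congr 1
  exact Equiv.sum_comp hη.1.toPerm (fun x => f x ^ 2)

lemma abs_sum_le_nrm (f : V → ℝ) : |∑ x, f x| ≤ √nV * nrm f := by
  have := abs_sum_mul_le (fun _ => 1) f
  simpa [nrm] using this

lemma abs_corr_le {η : V → V} (hη : IsPM η) (f g : V → ℝ) :
    |corr η f g| ≤ 2 * (nrm f * nrm g) := by
  have h1 := abs_sum_mul_le f (fun x => g (η x))
  rw [nrm_comp_perm hη] at h1
  have hfg := mul_nonneg (nrm_nonneg f) (nrm_nonneg g)
  have h2 : |(∑ x, f x) * (∑ x, g x) / nV| ≤ nrm f * nrm g := by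
    rw [abs_div, abs_mul, abs_of_nonneg (Nat.cast_nonneg (α := ℝ) _)]
    refine div_le_of_le_mul₀ (Nat.cast_nonneg _) hfg ?_
    calc |∑ x, f x| * |∑ x, g x| ≤ (√nV * nrm f) * (√nV * nrm g) :=
          mul_le_mul (abs_sum_le_nrm f) (abs_sum_le_nrm g) (abs_nonneg _)
            (mul_nonneg (sqrt_nonneg _) (nrm_nonneg _))
      _ = (√nV * √nV) * (nrm f * nrm g) := by ring
      _ = _ := by rw [mul_self_sqrt (Nat.cast_nonneg _)]; ring
  rw [corr]
  refine (abs_sub _ _).trans ?_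
  linarith

variable (G) in
/-- Decorrelation of low energy functions across the matching. -/
def Decor (ε κ : ℝ) (η : V → V) : Prop :=
  ∀ s : ℝ, (s = 1 ∨ s = -1) → ∀ (f g : V → ℝ) (F F' : ℝ), 0 ≤ F → 0 ≤ F' →
    nrm f ≤ F → nrm g ≤ F' → energy G s f ≤ 2 * ε * F ^ 2 → energy G s g ≤ 2 * ε * F' ^ 2 →
    |corr η f g| ≤ κ * (F * F')

lemma decor_of_disc (hconn : G.Connected) {ε α B θ : ℝ} {η : V → V} (hη : IsPM η)
    {R : ℕ} (hB : ∀ x, ((gball G x R).card : ℝ) ≤ B)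
    {𝒞 : Finset V} (c : V → 𝒞) (hc : ∀ x, G.dist x (c x) ≤ R) (hα : 0 < α) (hα1 : α ≤ 1)
    (hs : smallDisc c α η)
    (hl : ∀ s : ℝ, (s = 1 ∨ s = -1) → largeDisc c (fun x => s ^ G.dist x (c x)) α η)
    (b : ℕ) (hb : 1 < b) (hθ0 : 0 ≤ θ) (hθ : R * B * (2 * ε) ≤ θ ^ 2) (hθ1 : θ ≤ 1) :
    Decor G ε (16 * (6 * α * b ^ 2 + 2 / b) + 6 * θ) η := by
  intro s hs1 f g F F' hF hF' hfF hgF hEf hEg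
  have hs2 : s ^ 2 = 1 := by rcases hs1 with h | h <;> rw [h] <;> norm_num
  set σ : V → ℝ := fun x => s ^ G.dist x (c x)
  have hσ : ∀ x, σ x = 1 ∨ σ x = -1 := fun x => by
    rcases hs1 with h | h
    · left; simp [σ, h]
    · simp only [σ, h]; exact neg_one_pow_eq_or ℝ _
  have hB0 : 0 ≤ B := by
    obtain ⟨x⟩ := hconn.nonempty
    exact le_trans (Nat.cast_nonneg _) (hB x)
  have herr : ∀ (f : V → ℝ) (F : ℝ), 0 ≤ F → energy G s f ≤ 2 * ε * F ^ 2 →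
      nrm (fun x => f x - σ x * f (c x)) ≤ θ * F := by
    intro f F hF hE
    rw [nrm_le_iff (by positivity)]
    refine (sum_sq_sub_centre_le hconn hs2 hB (fun x => (c x : V)) hc f).trans ?_
    calc R * (B * energy G s f) ≤ R * (B * (2 * ε * F ^ 2)) := by gcongr
      _ = R * B * (2 * ε) * F ^ 2 := by ring
      _ ≤ θ ^ 2 * F ^ 2 := by gcongr
      _ = (θ * F) ^ 2 := by ring
  have hmain : ∀ (f : V → ℝ) (F : ℝ), 0 ≤ F → nrm f ≤ F → energy G s f ≤ 2 * ε * F ^ 2 →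
      nrm (fun x => σ x * f (c x)) ≤ 2 * F := by
    intro f F hF hfF hE
    have h1 := nrm_add_le f (fun x => -1 * (f x - σ x * f (c x)))
    have e1 : (fun x => f x + -1 * (f x - σ x * f (c x))) = fun x => σ x * f (c x) := by
      funext x; ring
    have e2 : nrm (fun x => -1 * (f x - σ x * f (c x))) = nrm (fun x => f x - σ x * f (c x)) := by
      unfold nrm; congr 1; exact sum_congr rfl fun x _ => by ring
    rw [e1, e2] at h1
    have := herr f F hF hE
    nlinarith
  have hσsq : ∀ f : V → ℝ, nrm (fun x => σ x * f (c x)) = √(∑ x, f (c x) ^ 2) := fun f => by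
    unfold nrm
    congr 1
    refine sum_congr rfl fun x _ => ?_
    change (σ x * f (c x)) ^ 2 = _
    rcases hσ x with h | h <;> rw [h] <;> ring
  have hA := abs_sign_bilin_le hσ hη hα hα1 hs (hl s hs1) b hb (fun i => f i) (fun i => g i)
  rw [← hσsq, ← hσsq] at hA
  change |corr η (fun x => σ x * f (c x)) (fun x => σ x * g (c x))| ≤ _ at hA
  set f0 := fun x => σ x * f (c x)
  set g0 := fun x => σ x * g (c x)
  have e : corr η f g = corr η f0 g0 + corr η (fun x => f x - f0 x) g
      + corr η f0 (fun x => g x - g0 x) := by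
    have e1 := corr_add_left η f0 (fun x => f x - f0 x) g
    have e2 := corr_add_right η f0 g0 (fun x => g x - g0 x)
    simp only [add_sub_cancel] at e1 e2
    rw [show (fun x => f x) = f from rfl] at e1
    rw [show (fun x => g x) = g from rfl] at e2
    linarith
  have b1 := abs_corr_le hη (fun x => f x - f0 x) g
  have b2 := abs_corr_le hη f0 (fun x => g x - g0 x)
  have c1 := mul_le_mul (herr f F hF hEf) hgF (nrm_nonneg _) (by positivity)
  have c2 := mul_le_mul (hmain f F hF hfF hEf) (herr g F' hF' hEg) (nrm_nonneg _) (by positivity)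
  have c3 := mul_le_mul (hmain f F hF hfF hEf) (hmain g F' hF' hgF hEg) (nrm_nonneg _) (by positivity)
  have c4 : 4 * (6 * α * b ^ 2 + 2 / b) * (nrm f0 * nrm g0)
      ≤ 4 * (6 * α * b ^ 2 + 2 / b) * ((2 * F) * (2 * F')) := by gcongr
  rw [e]
  refine (abs_add_le _ _).trans ((add_le_add (abs_add_le _ _) le_rfl).trans ?_)
  linarith

lemma pr_not_decor_le (hconn : G.Connected) {ε α B θ : ℝ} {ρ : ℕ}
    (hρ : ρ + 1 ≤ nV) (hB : ∀ x, ((gball G x (2 * ρ)).card : ℝ) ≤ B)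
    (hα : 0 < α) (hα8 : α ≤ 1 / 8) (hα2 : 64 ≤ α ^ 2 * (ρ + 1 : ℕ))
    (hα400 : 400 ≤ α ^ 8 * (ρ + 1 : ℕ))
    (hMn : (ρ + 1 : ℕ) * √nV ≤ α * nV)
    (hn : 32 ≤ α ^ 4 * nV)
    (b : ℕ) (hb : 1 < b) (hθ0 : 0 ≤ θ) (hθ : (2 * ρ : ℕ) * B * (2 * ε) ≤ θ ^ 2) (hθ1 : θ ≤ 1) :
    pr (fun η => ¬ Decor G ε (16 * (6 * α * b ^ 2 + 2 / b) + 6 * θ) η) ≤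
      4 / (nV : ℝ) ^ 2 + 16 * exp (-(nV / (ρ + 1 : ℕ))) := by
  obtain ⟨𝒞, c, hc, hsize⟩ := exists_cells hconn hρ
  have hα1 : α ≤ 1 := by linarith
  have p1 := pr_not_smallDisc_le hsize hα hα8 hα2 hMn
  have p2 := fun s : ℝ => pr_not_largeDisc_le hsize (fun x => s ^ G.dist x (c x)) hα hα1 hα400 hn
  have : pr (fun η => ¬ Decor G ε (16 * (6 * α * b ^ 2 + 2 / b) + 6 * θ) η) ≤
      pr (fun η => ¬ smallDisc c α η ∨ (¬ largeDisc c (fun x => (1 : ℝ) ^ G.dist x (c x)) α η ∨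
        ¬ largeDisc c (fun x => (-1 : ℝ) ^ G.dist x (c x)) α η)) := by
    refine pr_mono fun η hη h => ?_
    by_contra hcon
    push Not at hcon
    refine h (decor_of_disc hconn hη hB c hc hα hα1 hcon.1 ?_ b hb hθ0 hθ hθ1)
    rintro s (rfl | rfl)
    exacts [hcon.2.1, hcon.2.2]
  have h3 := pr_or_le (fun η => ¬ smallDisc c α η)
    (fun η => ¬ largeDisc c (fun x => (1 : ℝ) ^ G.dist x (c x)) α η ∨
        ¬ largeDisc c (fun x => (-1 : ℝ) ^ G.dist x (c x)) α η)
  have h4 := pr_or_le (fun η => ¬ largeDisc c (fun x => (1 : ℝ) ^ G.dist x (c x)) α η)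
    (fun η => ¬ largeDisc c (fun x => (-1 : ℝ) ^ G.dist x (c x)) α η)
  have := p2 1
  have := p2 (-1)
  linarith

section Contraction

lemma Kop_eq_Qop (f : V → ℝ) : Kop Q η f = Qop Q (fun x => f (η x)) := rfl

lemma sum_comp_matching (hη : IsPM η) (f : V → ℝ) : ∑ x, f (η x) = ∑ x, f x :=
  Equiv.sum_comp (Equiv.ofBijective η hη.1.bijective) f

lemma sum_Qop (hQ : IsDS Q) (f : V → ℝ) : ∑ x, Qop Q f x = ∑ x, f x := by
  unfold Qop
  rw [sum_comm]
  refine sum_congr rfl fun a _ => ?_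
  rw [← sum_mul, hQ.col, one_mul]

lemma sum_mul_Qop_comm (hQ : IsDS Q) (f g : V → ℝ) :
    ∑ x, f x * Qop Q g x = ∑ x, Qop Q f x * g x := by
  unfold Qop
  simp_rw [mul_sum, sum_mul]
  rw [sum_comm]
  refine sum_congr rfl fun a _ => sum_congr rfl fun x _ => ?_
  rw [hQ.symm x a]; ring

lemma Qop_sq_le (hQ : IsDS Q) (f : V → ℝ) (x : V) : Qop Q f x ^ 2 ≤ Qop Q (fun y => f y ^ 2) x := by
  have h := sum_mul_sq_le_sq_mul_sq univ (fun a => √(Q x a)) (fun a => √(Q x a) * f a)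
  have e1 : ∀ a, √(Q x a) * (√(Q x a) * f a) = Q x a * f a := fun a => by
    rw [← mul_assoc, mul_self_sqrt (hQ.nonneg x a)]
  have e2 : ∀ a, √(Q x a) ^ 2 = Q x a := fun a => sq_sqrt (hQ.nonneg x a)
  simp_rw [e1, mul_pow, e2, hQ.row x, one_mul] at h
  exact h

lemma nrm_Qop_le (hQ : IsDS Q) (f : V → ℝ) : nrm (Qop Q f) ≤ nrm f := by
  refine sqrt_le_sqrt ?_
  rw [← sum_Qop hQ (fun y => f y ^ 2)]
  exact sum_le_sum fun x _ => Qop_sq_le hQ f x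

lemma nrm_Kop_le (hQ : IsDS Q) (hη : IsPM η) (f : V → ℝ) :
    nrm (Kop Q η f) ≤ nrm f := by
  rw [Kop_eq_Qop]
  exact (nrm_Qop_le hQ _).trans (nrm_comp_perm hη f).le

lemma sum_Kop (hQ : IsDS Q) (hη : IsPM η) (f : V → ℝ) :
    ∑ x, Kop Q η f x = ∑ x, f x := by
  rw [Kop_eq_Qop, sum_Qop hQ, sum_comp_matching hη]

lemma sum_Kpow (hQ : IsDS Q) (hη : IsPM η) (m : ℕ) (f : V → ℝ) :
    ∑ x, Kpow Q η m f x = ∑ x, f x := by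
  induction m with
  | zero => rw [Kpow_zero]
  | succ m ih => rw [Kpow_succ, sum_Kop hQ hη, ih]

variable (Q) in
/-- Contraction of the crossing kernel on mean zero functions. -/
def Contr (a : ℝ) (η : V → V) : Prop :=
  ∀ f : V → ℝ, ∑ x, f x = 0 → ∀ l, nrm (Kpow Q η l f) ≤ a ^ (l / 2) * nrm f

lemma contr_of_sq (hQ : IsDS Q) (hη : IsPM η) {a : ℝ} (ha : 0 ≤ a)
    (h : ∀ f : V → ℝ, ∑ x, f x = 0 → nrm (Kop Q η (Kop Q η f)) ≤ a * nrm f) :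
    Contr Q a η := by
  have key : ∀ (r : ℕ) (f : V → ℝ), ∑ x, f x = 0 → nrm (Kpow Q η (2 * r) f) ≤ a ^ r * nrm f := by
    intro r
    induction r with
    | zero => intro f _; simp [Kpow_zero]
    | succ r ih =>
      intro f hf
      rw [show 2 * (r + 1) = (2 * r + 1) + 1 by ring, Kpow_succ, Kpow_succ]
      refine (h _ (by rw [sum_Kpow hQ hη, hf])).trans ?_
      rw [pow_succ', mul_assoc]
      exact mul_le_left (ih f hf) ha
  intro f hf l
  rcases Nat.even_or_odd' l with ⟨r, h1 | h1⟩
  · rw [h1, Nat.mul_div_cancel_left _ two_pos]; exact key r f hf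
  · rw [h1, Kpow_succ, show (2 * r + 1) / 2 = r by omega]
    exact (nrm_Kop_le hQ hη _).trans (key r f hf)

lemma abs_le_nrm (f : V → ℝ) (x : V) : |f x| ≤ nrm f := by
  rw [← sqrt_sq_eq_abs]
  exact sqrt_le_sqrt
    (single_le_sum (f := fun x => f x ^ 2) (fun y _ => sq_nonneg (f y)) (mem_univ x))

variable [Nonempty V]

def avg (f : V → ℝ) : ℝ := (∑ x, f x) / nV

lemma card_pos_real : (0 : ℝ) < nV := Nat.cast_pos.2 Fintype.card_pos

lemma sum_sub_avg (f : V → ℝ) : ∑ x, (f x - avg f) = 0 := by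
  rw [sum_sub_distrib, sum_const, nsmul_eq_mul, card_univ, avg]
  field_simp
  ring

lemma nrm_sub_avg_le (f : V → ℝ) : nrm (fun x => f x - avg f) ≤ nrm f := by
  refine sqrt_le_sqrt ?_
  have h := sum_sub_avg f
  have e : ∑ x, f x ^ 2 = ∑ x, (f x - avg f) ^ 2 + 2 * avg f * ∑ x, (f x - avg f)
      + ∑ _x : V, avg f ^ 2 := by
    rw [mul_sum, ← sum_add_distrib, ← sum_add_distrib]
    exact sum_congr rfl fun x _ => by ring
  have : 0 ≤ ∑ _x : V, avg f ^ 2 := sum_nonneg fun _ _ => sq_nonneg _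
  rw [h] at e
  linarith

lemma Contr.nrm_sub_le (hQ : IsDS Q) {a : ℝ} (h : Contr Q a η) (ha : 0 ≤ a) (l : ℕ)
    (f : V → ℝ) : nrm (fun x => Kpow Q η l f x - avg f) ≤ a ^ (l / 2) * nrm f := by
  have h1 := h _ (sum_sub_avg f) l
  rw [Kpow_sub_fun, Kpow_const hQ] at h1
  exact h1.trans (mul_le_left (nrm_sub_avg_le f) (pow_nonneg ha _))

lemma Contr.abs_sub_le (hQ : IsDS Q) {a : ℝ} (h : Contr Q a η) (ha : 0 ≤ a) (l : ℕ)
    (f : V → ℝ) (x : V) : |Kpow Q η l f x - avg f| ≤ a ^ (l / 2) * nrm f :=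
  (abs_le_nrm (fun x => Kpow Q η l f x - avg f) x).trans (h.nrm_sub_le hQ ha l f)

def kap (n qm a : ℝ) (l : ℕ) : ℝ := if l < 2 then qm else 1 / n + a ^ (l / 2)

lemma kap_nonneg {n qm a : ℝ} (hn : 0 ≤ n) (hq : 0 ≤ qm) (ha : 0 ≤ a) (l : ℕ) :
    0 ≤ kap n qm a l := by
  unfold kap; split_ifs <;> positivity

lemma nrm_col_le (hQ : IsDS Q) (v : V) : nrm (fun u => Q u v) ≤ 1 := by
  rw [nrm_le_iff zero_le_one, one_pow, ← hQ.col v]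
  refine sum_le_sum fun u _ => ?_
  have h1 : Q u v ≤ 1 := by
    rw [← hQ.row u]
    exact single_le_sum (fun y _ => hQ.nonneg u y) (mem_univ v)
  nlinarith [hQ.nonneg u v]

lemma Contr.entry_le (hQ : IsDS Q) {a qm : ℝ} (h : Contr Q a η) (ha : 0 ≤ a)
    (hq : ∀ u v, Q u v ≤ qm) (l : ℕ) (v x : V) :
    Kpow Q η l (fun u => Q u v) x ≤ kap nV qm a l := by
  unfold kap
  split_ifs
  · exact Kpow_le hQ l (fun u => hq u v) x
  · have h1 := (abs_le.1 (h.abs_sub_le hQ ha l (fun u => Q u v) x)).2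
    rw [avg, hQ.col] at h1
    have h2 : a ^ (l / 2) * nrm (fun u => Q u v) ≤ a ^ (l / 2) * 1 :=
      mul_le_left (nrm_col_le hQ v) (pow_nonneg ha _)
    linarith

end Contraction

lemma contr_of_decor {κ : ℝ} (hε : 0 < ε) (hκ : 0 ≤ κ) (hη : IsPM η)
    (h : Decor G ε κ η) : Contr Qε κ η := by
  have hQ := gQ_isDS G hε
  refine contr_of_sq hQ hη hκ fun f hf => ?_
  set f1 : V → ℝ := fun x => f (η x)
  have hf1 : ∑ x, f1 x = 0 := by rw [sum_comp_matching hη f]; exact hf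
  set g := Kop Qε η (Kop Qε η f)
  have hen : ∀ f : V → ℝ, energy G 1 (Qop Qε f) ≤ 2 * ε * nrm f ^ 2 := fun f => by
    have := energy_Qop_le G hε f
    have h0 : 0 ≤ ∑ x, f x ^ 2 := sum_nonneg fun x _ => sq_nonneg _
    rw [nrm_sq]; nlinarith
  have hd := h 1 (Or.inl rfl) (Qop Qε g) (Qop Qε f1) (nrm g) (nrm f1)
    (nrm_nonneg g) (nrm_nonneg f1) (nrm_Qop_le hQ g) (nrm_Qop_le hQ f1) (hen g) (hen f1)
  have e : corr η (Qop Qε g) (Qop Qε f1) = nrm g ^ 2 := by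
    rw [corr, sum_Qop hQ f1, hf1, mul_zero, zero_div, sub_zero, nrm_sq,
      ← sum_mul_Qop_comm hQ g (fun x => Qop Qε f1 (η x))]
    exact sum_congr rfl fun x _ => by rw [sq]; rfl
  rw [e, abs_of_nonneg (sq_nonneg _), nrm_comp_perm hη f] at hd
  rcases (nrm_nonneg g).eq_or_lt with h0 | h0
  · rw [← h0]; exact mul_nonneg hκ (nrm_nonneg f)
  · refine le_of_mul_le_mul_left ?_ h0
    calc nrm g * nrm g = nrm g ^ 2 := (sq _).symm
      _ ≤ _ := hd
      _ = _ := by ring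

/-- A newly revealed partner is nearly uniform. -/
lemma sum_ext_apply_le {E : Pairs} {a : V} (ha : a ∉ touched E) {φ : V → ℝ}
    (hφ : ∀ v, 0 ≤ φ v) {c : ℝ} (hc : 0 < c)
    (hcE : c ≤ (nV : ℝ) - 2 * E.length - 1) :
    ∑ η ∈ ext E, φ (η a) ≤ (∑ v, φ v) / c * (ext E).card := by
  rw [sum_ext_reveal E a, sum_div, sum_mul]
  refine sum_le_sum fun b _ => ?_
  have h1 : ∑ η ∈ ext ((a, b) :: E), φ (η a) = (ext ((a, b) :: E)).card * φ b := by
    rw [sum_congr rfl fun η hη => by rw [(mem_ext_cons.1 hη).2], sum_const, nsmul_eq_mul]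
  have h2 := card_ext_cons_le (b := b) ha
  have h3 := (mul_le_right hcE (Nat.cast_nonneg _)).trans h2
  rw [h1, div_mul_eq_mul_div, le_div_iff₀ hc]
  nlinarith [mul_le_right h3 (hφ b)]

lemma sum_mem_eq (S : Finset V) (f : V → ℝ) : ∑ v ∈ S, f v = ∑ v, if v ∈ S then f v else 0 := by
  rw [sum_ite_mem, univ_inter]

lemma sum_touched_le {f : V → ℝ} (hf : ∀ v, 0 ≤ f v) (E : Pairs) :
    ∑ a ∈ touched E, f a ≤ (E.map fun p => f p.1 + f p.2).sum := by
  induction E with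
  | nil => simp [touched]
  | cons p E ih =>
    have hsub : touched (p :: E) ⊆ insert p.1 (insert p.2 (touched E)) := fun v hv => by
      obtain ⟨q, hq, hvq⟩ := mem_touched.1 hv
      clear hv
      rcases List.mem_cons.1 hq with rfl | hq
      · rcases hvq with h | h <;> simp [h]
      · exact mem_insert_of_mem (mem_insert_of_mem (mem_touched.2 ⟨q, hq, hvq⟩))
    have hins : ∀ (s : Finset V) (v : V), ∑ a ∈ insert v s, f a ≤ f v + ∑ a ∈ s, f a := by
      intro s v
      by_cases h : v ∈ s
      · rw [insert_eq_of_mem h]; linarith [hf v]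
      · rw [sum_insert h]
    rw [List.map_cons, List.sum_cons]
    have h1 := sum_le_sum_of_subset_of_nonneg hsub fun v _ _ => hf v
    have h2 := hins (insert p.2 (touched E)) p.1
    have h3 := hins (touched E) p.2
    linarith

lemma list_sum_map_le {ι : Type*} (E : List ι) (f : ι → ℝ) {c : ℝ} (h : ∀ p, f p ≤ c) :
    (E.map f).sum ≤ E.length * c := by
  induction E with
  | nil => simp
  | cons p E ih =>
    rw [List.map_cons, List.sum_cons, List.length_cons]
    push_cast
    linarith [h p]

/-- Concentration of `K ^ m F` uniformly in the starting point, for a deterministic `F`. -/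
lemma pr_Kpow_gt_le [Nonempty V] (hQ : IsDS Q) {a qm : ℝ} (ha : 0 ≤ a) (hq : ∀ u v, Q u v ≤ qm)
    {F : V → ℝ} (hF0 : ∀ v, 0 ≤ F v) (hF1 : ∀ v, F v ≤ 1) (x : V) (m L : ℕ) {T c : ℝ}
    (hT : 0 < T) (hc : 0 < c)
    (hcn : c ≤ (nV : ℝ) - 2 * ((L + 1) * (m + 1) : ℕ) - 1) :
    pr (fun η => Contr Q a η ∧ T < Kpow Q η (m + 1) F x) ≤
      (((L * (m + 1) : ℕ) * (2 * kap nV qm a m) +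
        ∑ l ∈ range m, 2 * kap nV qm a l + (∑ v, F v) / c) / T) ^ L := by
  classical
  have hqm : 0 ≤ qm := (hQ.nonneg x x).trans (hq x x)
  have hk := kap_nonneg (Nat.cast_nonneg nV) hqm ha
  have hβ : 0 ≤ (L * (m + 1) : ℕ) * (2 * kap nV qm a m) + ∑ l ∈ range m, 2 * kap nV qm a l :=
    add_nonneg (mul_nonneg (Nat.cast_nonneg _) (mul_nonneg two_pos.le (hk m)))
      (sum_nonneg fun l _ => mul_nonneg two_pos.le (hk l))
  have hγ : 0 ≤ (∑ v, F v) / c := div_nonneg (sum_nonneg fun v _ => hF0 v) hc.le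
  refine pr_le_of_card_le (pow_nonneg (div_nonneg (add_nonneg hβ hγ) hT.le) _) ?_
  have h := card_le_of_replica (fun η => IsPM η ∧ Contr Q a η)
    (fun η => Kpow Q η (m + 1) F x) (fun η => Kpow_nonneg hQ _ hF0 x) hβ hγ hT (m + 1) L
    (fun E η => rev Q η (fun E' u => ∑ v, Q u v * if v ∈ touched E' then 0 else F (η v)) m E x)
    ?_ ?_ ?_
  · refine le_trans (Nat.cast_le.2 (card_le_card fun η hη => ?_)) h
    simp only [mem_filter] at hη ⊢
    exact ⟨hη.1, ⟨mem_matchings.1 hη.1, hη.2.1⟩, hη.2.2⟩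
  · intro E hE η hη ⟨hpm, hcon⟩
    have hψ : ∀ l (p : V × V) u, Kpow Q η l (fun u => Q u p.1 + Q u p.2) u ≤ 2 * kap nV qm a l := by
      intro l p u
      rw [Kpow_add_fun]
      have h1 := hcon.entry_le hQ ha hq l p.1 u
      have h2 := hcon.entry_le hQ ha hq l p.2 u
      linarith
    rw [Kpow_succ', ← rev_fun (Kop Q η F) m E x]
    have h1 : ∀ (E' : Pairs) u, Kop Q η F u ≤ (E'.map fun p => Q u p.1 + Q u p.2).sum +
          ∑ v, Q u v * if v ∈ touched E' then 0 else F (η v) := by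
      intro E' u
      have h2 : Kop Q η F u ≤ ∑ v ∈ touched E', Q u v +
          ∑ v, Q u v * if v ∈ touched E' then 0 else F (η v) := by
        rw [sum_mem_eq (touched E'), ← sum_add_distrib]
        refine sum_le_sum fun v _ => ?_
        split_ifs
        · nlinarith [hQ.nonneg u v, hF1 (η v)]
        · linarith
      linarith [sum_touched_le (fun v => hQ.nonneg u v) E']
    refine (rev_mono hQ m hη (fun E' u _ _ => h1 E' u) x).trans ?_
    rw [rev_add]
    refine add_le_add_left ?_ _
    refine (rev_list_sum_le hQ (fun p u => Q u p.1 + Q u p.2) _ hψ m E x).trans ?_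
    refine add_le_add_left ?_ _
    refine (list_sum_map_le E _ fun p => hψ m p x).trans ?_
    exact mul_le_right (Nat.cast_le.2 hE) (mul_nonneg two_pos.le (hk m))
  · intro E _
    rw [add_comm m 1]
    refine isCert_rev hQ (fun η E' u => ∑ v, Q u v * if v ∈ touched E' then 0 else F (η v))
      m 1 E x fun E' u _ => ?_
    refine IsCert.sum _ (fun v => hQ.nonneg u v) fun v => ?_
    by_cases hv : v ∈ touched E'
    · exact IsCert.const _ _ le_rfl fun η _ => by rw [if_pos hv]
    · simp_rw [if_neg hv]
      exact IsCert.reveal (N := 0) v (Z := fun b _ => F b)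
        fun b => IsCert.const _ _ (hF0 b) fun _ _ => rfl
  · intro E hE
    refine sum_rev_le hQ (fun η E' u => ∑ v, Q u v * if v ∈ touched E' then 0 else F (η v))
      m E x fun E' u hE' => ?_
    rw [sum_comm]
    have hlen : (E'.length : ℝ) ≤ ((L + 1) * (m + 1) : ℕ) := by
      refine Nat.cast_le.2 ?_
      rw [hE']; nlinarith
    calc ∑ v, ∑ η ∈ ext E', Q u v * (if v ∈ touched E' then 0 else F (η v))
        ≤ ∑ v, Q u v * ((∑ v, F v) / c * (ext E').card) := by
          refine sum_le_sum fun v _ => ?_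
          rw [← mul_sum]
          refine mul_le_left ?_ (hQ.nonneg u v)
          by_cases hv : v ∈ touched E'
          · simp_rw [if_pos hv, sum_const_zero]
            exact mul_nonneg hγ (Nat.cast_nonneg _)
          · simp_rw [if_neg hv]
            exact sum_ext_apply_le hv hF0 hc (by linarith)
      _ = _ := by rw [← sum_mul, hQ.row, one_mul]

/-- Expectation of `Φ` over `k` crossings, killed on departing from `S`. -/
def avo (Q : V → V → ℝ) (η : V → V) (S : Finset V) (Φ : Pairs → V → ℝ) : ℕ → Pairs → V → ℝ
  | 0, E, x => Φ E x
  | k + 1, E, x => ∑ a, Q x a * if a ∈ S then 0 else avo Q η S Φ k ((a, η a) :: E) (η a)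

/-- Probability that one of the first `k` departures is in `T`, before any in `S`. -/
def hitp (Q : V → V → ℝ) (η : V → V) (T S : Finset V) : ℕ → V → ℝ
  | 0, _ => 0
  | k + 1, x => ∑ a, Q x a * if a ∈ T then 1 else if a ∈ S then 0 else hitp Q η T S k (η a)

lemma avo_mono_of_inv (hQ : IsDS Q) {S : Finset V} {Φ Ψ : Pairs → V → ℝ} (Inv : Pairs → V → Prop)
    (hstep : ∀ E u a, Inv E u → a ∉ S → Inv ((a, η a) :: E) (η a)) (k : ℕ) :
    ∀ {E : Pairs} {u : V}, Inv E u →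
      (∀ E' u', E'.length = E.length + k → Inv E' u' → Φ E' u' ≤ Ψ E' u') →
      avo Q η S Φ k E u ≤ avo Q η S Ψ k E u := by
  induction k with
  | zero => intro E u hI h; exact h E u rfl hI
  | succ k ih =>
    intro E u hI h
    unfold avo
    refine sum_le_sum fun a _ => mul_le_left ?_ (hQ.nonneg u a)
    split_ifs with ha
    · exact le_rfl
    · refine ih (hstep E u a hI ha) fun E' u' hl => h E' u' ?_
      rw [hl, List.length_cons]; ring

lemma avo_add (S : Finset V) (Φ Ψ : Pairs → V → ℝ) (k : ℕ) (E : Pairs) (u : V) :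
    avo Q η S (fun E u => Φ E u + Ψ E u) k E u = avo Q η S Φ k E u + avo Q η S Ψ k E u := by
  induction k generalizing E u with
  | zero => rfl
  | succ k ih =>
    unfold avo
    rw [← sum_add_distrib]
    refine sum_congr rfl fun a _ => ?_
    split_ifs
    · ring
    · rw [ih]; ring

lemma avo_fun_eq (S : Finset V) (f : V → ℝ) (k : ℕ) (E E' : Pairs) (u : V) :
    avo Q η S (fun _ => f) k E u = avo Q η S (fun _ => f) k E' u := by
  induction k generalizing E E' u with
  | zero => rfl
  | succ k ih =>
    unfold avo
    refine sum_congr rfl fun a _ => ?_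
    rw [ih ((a, η a) :: E) ((a, η a) :: E')]

lemma avo_nonneg (hQ : IsDS Q) {S : Finset V} {Φ : Pairs → V → ℝ}
    (h : ∀ E u, 0 ≤ Φ E u) (k : ℕ) (E : Pairs) (u : V) : 0 ≤ avo Q η S Φ k E u := by
  induction k generalizing E u with
  | zero => exact h E u
  | succ k ih =>
    refine sum_nonneg fun a _ => mul_nonneg (hQ.nonneg u a) ?_
    split_ifs
    exacts [le_rfl, ih _ _]

lemma sum_mul_le_of_le (hQ : IsDS Q) (u : V) {f : V → ℝ} {c : ℝ} (h : ∀ a, f a ≤ c) :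
    ∑ a, Q u a * f a ≤ c := by
  calc ∑ a, Q u a * f a ≤ ∑ a, Q u a * c := sum_le_sum fun a _ => mul_le_left (h a) (hQ.nonneg u a)
    _ = c := by rw [← sum_mul, hQ.row, one_mul]

lemma avo_le_one (hQ : IsDS Q) {S : Finset V} {Φ : Pairs → V → ℝ}
    (h : ∀ E u, Φ E u ≤ 1) (k : ℕ) (E : Pairs) (u : V) : avo Q η S Φ k E u ≤ 1 := by
  induction k generalizing E u with
  | zero => exact h E u
  | succ k ih =>
    refine sum_mul_le_of_le hQ u fun a => ?_
    split_ifs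
    exacts [zero_le_one, ih _ _]

def ind (y v : V) : ℝ := if v = y then 1 else 0

lemma ind_nonneg (y v : V) : 0 ≤ ind y v := by unfold ind; split_ifs <;> norm_num

lemma ind_le_one (y v : V) : ind y v ≤ 1 := by unfold ind; split_ifs <;> norm_num

lemma sum_mul_ind (f : V → ℝ) (v : V) : ∑ y, f y * ind y v = f v := by
  unfold ind
  simp

lemma avo_sum_ind (S : Finset V) (f : V → ℝ) (k : ℕ) (E : Pairs) (u : V) :
    ∑ y, avo Q η S (fun _ => ind y) k [] u * f y = avo Q η S (fun _ => f) k E u := by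
  rw [avo_fun_eq S f k E []]
  generalize ([] : Pairs) = E
  induction k generalizing E u with
  | zero => unfold avo; simp_rw [mul_comm _ (f _)]; exact sum_mul_ind f u
  | succ k ih =>
    unfold avo
    simp_rw [sum_mul]
    rw [sum_comm]
    refine sum_congr rfl fun a _ => ?_
    split_ifs
    · simp
    · rw [← ih (η a) ((a, η a) :: E), mul_sum]
      exact sum_congr rfl fun y _ => by ring

lemma avo_le_hitp_add (hQ : IsDS Q) (S T : Finset V) {Φ : Pairs → V → ℝ}
    (h : ∀ E u, Φ E u ≤ 1) (k : ℕ) (E : Pairs) (u : V) :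
    avo Q η S Φ k E u ≤ hitp Q η T S k u + avo Q η (S ∪ T) Φ k E u := by
  induction k generalizing E u with
  | zero => unfold avo hitp; linarith
  | succ k ih =>
    unfold avo hitp
    rw [← sum_add_distrib]
    refine sum_le_sum fun a _ => ?_
    rw [← mul_add]
    refine mul_le_left ?_ (hQ.nonneg u a)
    by_cases hT : a ∈ T
    · have h1 := avo_le_one (η := η) (S := S) hQ h k ((a, η a) :: E) (η a)
      by_cases hS : a ∈ S <;> simp [hT, hS, h1]
    · by_cases hS : a ∈ S
      · simp [hT, hS]
      · simpa [hT, hS] using ih ((a, η a) :: E) (η a)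

lemma avo_ind_eq_zero {S T : Finset V} (hTS : T ⊆ S) (hT : ∀ v, v ∉ T → η v ∉ T) {y u : V}
    (hy : y ∈ T) (hu : u ∉ T) (k : ℕ) (E : Pairs) :
    avo Q η S (fun _ => ind y) k E u = 0 := by
  induction k generalizing E u with
  | zero =>
    refine if_neg fun h : u = y => hu ?_
    rw [h]; exact hy
  | succ k ih =>
    unfold avo
    refine sum_eq_zero fun a _ => ?_
    split_ifs with ha
    · ring
    · rw [ih (hT a fun h => ha (hTS h)), mul_zero]

lemma hitp_nonneg (hQ : IsDS Q) (T S : Finset V) (k : ℕ) (u : V) : 0 ≤ hitp Q η T S k u := by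
  induction k generalizing u with
  | zero => exact le_rfl
  | succ k ih =>
    refine sum_nonneg fun a _ => mul_nonneg (hQ.nonneg u a) ?_
    split_ifs
    exacts [zero_le_one, le_rfl, ih _]

lemma hitp_le_sum_avo (hQ : IsDS Q) (T S : Finset V) (k : ℕ) (E : Pairs) (u : V) :
    hitp Q η T S k u ≤ ∑ j ∈ range k, avo Q η (S ∪ T) (fun _ u => ∑ v ∈ T, Q u v) j E u := by
  induction k generalizing E u with
  | zero => simp [hitp]
  | succ k ih =>
    rw [sum_range_succ']
    unfold hitp avo
    rw [sum_comm, sum_mem_eq T, ← sum_add_distrib]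
    refine sum_le_sum fun a _ => ?_
    rw [← mul_sum]
    by_cases hT : a ∈ T
    · simp [hT]
    · by_cases hS : a ∈ S
      · simp [hT, hS]
      · simp only [hT, hS, if_false, mem_union, or_self, add_zero]
        exact mul_le_left (ih _ _) (hQ.nonneg u a)

/-- Iterates of `f ↦ f + Q f`. -/
def psi (Q : V → V → ℝ) (k : ℕ) (φ : V → ℝ) : V → ℝ := (fun f x => f x + Qop Q f x)^[k] φ

lemma psi_succ (k : ℕ) (φ : V → ℝ) (x : V) :
    psi Q (k + 1) φ x = psi Q k φ x + Qop Q (psi Q k φ) x := by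
  rw [psi, Function.iterate_succ_apply']; rfl

lemma psi_nonneg (hQ : IsDS Q) {φ : V → ℝ} (hφ : ∀ v, 0 ≤ φ v) (k : ℕ) (x : V) :
    0 ≤ psi Q k φ x := by
  induction k generalizing x with
  | zero => exact hφ x
  | succ k ih =>
    rw [psi_succ]
    exact add_nonneg (ih x) (sum_nonneg fun a _ => mul_nonneg (hQ.nonneg x a) (ih a))

lemma sum_psi (hQ : IsDS Q) (φ : V → ℝ) (k : ℕ) : ∑ x, psi Q k φ x = 2 ^ k * ∑ x, φ x := by
  induction k with
  | zero => simp [psi]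
  | succ k ih =>
    simp_rw [psi_succ]
    rw [sum_add_distrib, sum_Qop hQ, ih]; ring

lemma touched_cons_eq (a b : V) (E : Pairs) :
    touched ((a, b) :: E) = insert a (insert b (touched E)) := by
  ext v
  simp only [mem_touched, List.mem_cons, mem_insert]
  constructor
  · rintro ⟨p, rfl | hp, h⟩
    · tauto
    · exact Or.inr (Or.inr ⟨p, hp, h⟩)
  · rintro (h | h | ⟨p, hp, h⟩)
    · exact ⟨(a, b), Or.inl rfl, Or.inl h⟩
    · exact ⟨(a, b), Or.inl rfl, Or.inr h⟩
    · exact ⟨p, Or.inr hp, h⟩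

/-- The mean growth of the set of vertices explored by a killed walk. -/
lemma sum_avo_touched_le (hQ : IsDS Q) {c : ℝ} (hc : 0 < c) {ℓ : ℕ}
    (hcn : c ≤ (nV : ℝ) - 2 * ℓ - 1) (E0 : Pairs) {S' : Finset V}
    (hS' : S' ⊆ touched E0) {φ : V → ℝ} (hφ : ∀ v, 0 ≤ φ v) (k : ℕ) :
    ∀ (E : Pairs) (u : V), (∀ p ∈ E0, p ∈ E) → u ∈ touched E \ S' → E.length + k ≤ ℓ →
    ∑ η ∈ ext E, avo Q η (touched E0) (fun E' _ => ∑ v ∈ touched E' \ S', φ v) k E u ≤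
      (∑ v ∈ touched E \ S', psi Q k φ v + (2 ^ k - 1) * (∑ v, φ v) / c) * (ext E).card := by
  induction k with
  | zero =>
    intro E u _ _ _
    unfold avo
    rw [sum_const, nsmul_eq_mul]
    simp [psi, mul_comm]
  | succ k ih =>
    intro E u hE hu hℓ
    have hΨ := psi_nonneg hQ hφ k
    have hs : 0 ≤ ∑ v, φ v := sum_nonneg fun v _ => hφ v
    have hβ : 0 ≤ (2 ^ k - 1) * (∑ v, φ v) / c :=
      div_nonneg (mul_nonneg (sub_nonneg.2 (one_le_pow₀ one_le_two)) hs) hc.le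
    set β := (2 ^ k - 1) * (∑ v, φ v) / c with hβdef
    set A := ∑ v ∈ touched E \ S', psi Q k φ v with hA
    have hstep : ∀ a, ∑ η ∈ ext E, (if a ∈ touched E0 then 0 else avo Q η (touched E0)
        (fun E' _ => ∑ v ∈ touched E' \ S', φ v) k ((a, η a) :: E) (η a)) ≤
        (A + psi Q k φ a + 2 ^ k * (∑ v, φ v) / c + β) * (ext E).card := by
      intro a
      have hA0 : 0 ≤ A := sum_nonneg fun v _ => hΨ v
      have hz : 0 ≤ 2 ^ k * (∑ v, φ v) / c := by positivity
      have hcard : (0 : ℝ) ≤ (ext E).card := Nat.cast_nonneg _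
      by_cases ha0 : a ∈ touched E0
      · simp only [ha0, if_true, sum_const_zero]
        have := hΨ a
        positivity
      simp only [ha0, if_false]
      rw [sum_ext_reveal E a]
      have hb : ∀ b, ∑ η ∈ ext ((a, b) :: E), avo Q η (touched E0)
          (fun E' _ => ∑ v ∈ touched E' \ S', φ v) k ((a, η a) :: E) (η a) ≤
          (∑ v ∈ touched ((a, b) :: E) \ S', psi Q k φ v + β) * (ext ((a, b) :: E)).card := by
        intro b
        rcases (ext ((a, b) :: E)).eq_empty_or_nonempty with he | ⟨η, hη⟩
        · simp [he]
        have hηE := mem_ext_cons.1 hη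
        have hη0 := mem_ext.2 ⟨(mem_ext.1 hηE.1).1, fun p hp => (mem_ext.1 hηE.1).2 p (hE p hp)⟩
        have hbS : b ∉ S' := fun h => apply_notMem_touched hη0 ha0 (hηE.2 ▸ hS' h)
        refine le_trans (le_of_eq (sum_congr rfl fun η' hη' => ?_))
          (ih ((a, b) :: E) b (fun p hp => List.mem_cons_of_mem _ (hE p hp)) ?_ ?_)
        · rw [(mem_ext_cons.1 hη').2]
        · rw [Finset.mem_sdiff, touched_cons_eq]
          exact ⟨by simp, hbS⟩
        · rw [List.length_cons]; omega
      refine (sum_le_sum fun b _ => hb b).trans ?_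
      have hins : ∀ (s : Finset V) (v : V), ∑ x ∈ insert v s \ S', psi Q k φ x
          ≤ psi Q k φ v + ∑ x ∈ s \ S', psi Q k φ x := by
        intro s v
        by_cases hv : v ∈ s \ S'
        · rw [insert_eq_of_mem (mem_sdiff.1 hv).1]; linarith [hΨ v]
        · rw [← sum_insert hv]
          refine Finset.sum_le_sum_of_subset_of_nonneg ?_ fun v _ _ => hΨ v
          intro x hx
          simp only [Finset.mem_sdiff, Finset.mem_insert] at hx ⊢
          tauto
      have hcards : ∑ b, ((ext ((a, b) :: E)).card : ℝ) = (ext E).card := by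
        have := sum_ext_reveal E a (fun _ => (1 : ℝ))
        simp only [Finset.sum_const, nsmul_eq_mul, mul_one] at this
        exact this.symm
      by_cases haE : a ∈ touched E
      · have : ∀ b, (∑ v ∈ touched ((a, b) :: E) \ S', psi Q k φ v + β) *
            ((ext ((a, b) :: E)).card : ℝ) ≤ (A + β) * (ext ((a, b) :: E)).card := by
          intro b
          rcases (ext ((a, b) :: E)).eq_empty_or_nonempty with he | ⟨η, hη⟩
          · simp [he]
          have hηE := mem_ext_cons.1 hη
          have hbE := hηE.2 ▸ apply_mem_touched hηE.1 haE
          rw [touched_cons_eq, insert_eq_of_mem hbE, insert_eq_of_mem haE]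
        refine (sum_le_sum fun b _ => this b).trans ?_
        rw [← mul_sum, hcards]
        refine mul_le_right ?_ hcard
        linarith [hΨ a]
      · have h1 : ∀ b, (∑ v ∈ touched ((a, b) :: E) \ S', psi Q k φ v + β) *
            ((ext ((a, b) :: E)).card : ℝ) ≤ (A + psi Q k φ a + β) * (ext ((a, b) :: E)).card
              + ∑ η ∈ ext ((a, b) :: E), psi Q k φ (η a) := by
          intro b
          have e : ∑ η ∈ ext ((a, b) :: E), psi Q k φ (η a)
              = (ext ((a, b) :: E)).card * psi Q k φ b := by
            rw [sum_congr rfl fun η hη => by rw [(mem_ext_cons.1 hη).2], sum_const, nsmul_eq_mul]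
          rw [e, touched_cons_eq, mul_comm ((ext ((a, b) :: E)).card : ℝ), ← add_mul]
          refine mul_le_right ?_ (Nat.cast_nonneg _)
          have := hins (insert b (touched E)) a
          have := hins (touched E) b
          linarith
        refine (sum_le_sum fun b _ => h1 b).trans ?_
        rw [sum_add_distrib, ← mul_sum, hcards, ← sum_ext_reveal E a]
        have hEl : (E.length : ℝ) ≤ ℓ := Nat.cast_le.2 (by omega)
        have h2 := sum_ext_apply_le haE hΨ hc (by linarith)
        rw [sum_psi hQ] at h2
        nlinarith
    unfold avo
    rw [sum_comm]
    calc ∑ a, ∑ η ∈ ext E, Q u a * (if a ∈ touched E0 then 0 else avo Q η (touched E0)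
        (fun E' _ => ∑ v ∈ touched E' \ S', φ v) k ((a, η a) :: E) (η a))
        ≤ ∑ a, Q u a * ((A + psi Q k φ a + 2 ^ k * (∑ v, φ v) / c + β) * (ext E).card) := by
          refine sum_le_sum fun a _ => ?_
          rw [← mul_sum]
          exact mul_le_left (hstep a) (hQ.nonneg u a)
      _ = (A + Qop Q (psi Q k φ) u + 2 ^ k * (∑ v, φ v) / c + β) * (ext E).card := by
          have : ∀ a, Q u a * ((A + psi Q k φ a + 2 ^ k * (∑ v, φ v) / c + β) * (ext E).card)
            = Q u a * ((A + 2 ^ k * (∑ v, φ v) / c + β) * (ext E).card) +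
              (Q u a * psi Q k φ a) * (ext E).card := fun a => by ring
          simp_rw [this]
          rw [sum_add_distrib, ← sum_mul, ← sum_mul, hQ.row, Qop]
          ring
      _ ≤ _ := by
          refine mul_le_right ?_ (Nat.cast_nonneg _)
          have h1 := single_le_sum (f := fun v => Qop Q (psi Q k φ) v)
              (fun v _ => sum_nonneg fun a _ => mul_nonneg (hQ.nonneg v a) (hΨ a)) hu
          simp_rw [psi_succ]
          rw [sum_add_distrib, ← hA]
          have : (2 ^ (k + 1) - 1) * (∑ v, φ v) / c = 2 ^ k * (∑ v, φ v) / c + β := by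
            rw [hβdef]; ring
          linarith

/-- Mean size of the set explored after crossing a fresh edge. -/
lemma sum_fresh_avo_le (hQ : IsDS Q) {c : ℝ} (hc : 0 < c) {ℓ : ℕ}
    (hcn : c ≤ (nV : ℝ) - 2 * ℓ - 1) {φ : V → ℝ} (hφ : ∀ v, 0 ≤ φ v) (k : ℕ)
    (E : Pairs) (u : V) (hE : E.length + 1 + k ≤ ℓ) :
    ∑ η ∈ ext E, ∑ a, Q u a * (if a ∈ touched E then 0 else
      avo Q η (touched ((a, η a) :: E)) (fun E' _ => ∑ v ∈ touched E' \ insert a (touched E), φ v)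
        k ((a, η a) :: E) (η a)) ≤ 2 ^ (k + 1) * (∑ v, φ v) / c * (ext E).card := by
  have hΨ := psi_nonneg hQ hφ k
  have hs : 0 ≤ ∑ v, φ v := sum_nonneg fun v _ => hφ v
  rw [sum_comm]
  have hstep : ∀ a, ∑ η ∈ ext E, (if a ∈ touched E then 0 else
      avo Q η (touched ((a, η a) :: E)) (fun E' _ => ∑ v ∈ touched E' \ insert a (touched E), φ v)
        k ((a, η a) :: E) (η a)) ≤ 2 ^ (k + 1) * (∑ v, φ v) / c * (ext E).card := by
    intro a
    by_cases ha : a ∈ touched E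
    · simp only [ha, if_true, sum_const_zero]
      positivity
    simp only [ha, if_false]
    rw [sum_ext_reveal E a]
    set β := (2 ^ k - 1) * (∑ v, φ v) / c with hβdef
    have hb : ∀ b, ∑ η ∈ ext ((a, b) :: E), avo Q η (touched ((a, η a) :: E))
        (fun E' _ => ∑ v ∈ touched E' \ insert a (touched E), φ v) k ((a, η a) :: E) (η a) ≤
        ∑ η ∈ ext ((a, b) :: E), psi Q k φ (η a) + β * (ext ((a, b) :: E)).card := by
      intro b
      rcases (ext ((a, b) :: E)).eq_empty_or_nonempty with he | hne
      · simp [he]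
      have hb1 : ¬ (b ∈ touched E ∨ a = b) := fun h => hne.ne_empty (ext_cons_eq_empty ha h)
      push Not at hb1
      have hS' : insert a (touched E) ⊆ touched ((a, b) :: E) := by
        rw [touched_cons_eq]
        exact insert_subset_insert _ (subset_insert _ _)
      have hsd : touched ((a, b) :: E) \ insert a (touched E) = {b} := by
        ext v
        rw [touched_cons_eq]
        simp only [Finset.mem_sdiff, Finset.mem_insert, Finset.mem_singleton]
        constructor
        · tauto
        · rintro rfl
          exact ⟨Or.inr (Or.inl rfl), fun h => h.elim (fun h => hb1.2 h.symm) hb1.1⟩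
      have h := sum_avo_touched_le hQ hc hcn ((a, b) :: E) hS' hφ k ((a, b) :: E) b
        (fun p hp => hp) (by rw [hsd]; simp) (by rw [List.length_cons]; omega)
      rw [hsd, sum_singleton, add_mul] at h
      refine le_trans (le_of_eq (sum_congr rfl fun η' hη' => ?_)) (h.trans (le_of_eq ?_))
      · rw [(mem_ext_cons.1 hη').2]
      · have e : ∑ η ∈ ext ((a, b) :: E), psi Q k φ (η a)
            = (ext ((a, b) :: E)).card * psi Q k φ b := by
          rw [sum_congr rfl fun η hη => by rw [(mem_ext_cons.1 hη).2], sum_const, nsmul_eq_mul]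
        rw [e, mul_comm (psi Q k φ b)]
    refine (sum_le_sum fun b _ => hb b).trans ?_
    have hcards : ∑ b, ((ext ((a, b) :: E)).card : ℝ) = (ext E).card := by
      have := sum_ext_reveal E a (fun _ => (1 : ℝ))
      simp only [sum_const, nsmul_eq_mul, mul_one] at this
      exact this.symm
    rw [sum_add_distrib, ← mul_sum, hcards, ← sum_ext_reveal E a]
    have hEl : (E.length : ℝ) ≤ ℓ := Nat.cast_le.2 (by omega)
    have h2 := sum_ext_apply_le ha hΨ hc (by linarith)
    rw [sum_psi hQ] at h2
    have h3 : 0 ≤ (∑ v, φ v) / c * ((ext E).card : ℝ) := by positivity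
    have e1 : 2 ^ (k + 1) * (∑ v, φ v) / c * ((ext E).card : ℝ)
      = 2 ^ k * (∑ v, φ v) / c * (ext E).card + β * (ext E).card
        + (∑ v, φ v) / c * (ext E).card := by rw [hβdef]; ring
    linarith
  calc _ ≤ ∑ a, Q u a * (2 ^ (k + 1) * (∑ v, φ v) / c * (ext E).card) := by
        refine sum_le_sum fun a _ => ?_
        rw [← mul_sum]
        exact mul_le_left (hstep a) (hQ.nonneg u a)
    _ = _ := by rw [← sum_mul, hQ.row, one_mul]

section Marked

/-- Sum over walks of `k` crossings, some of which are marked: a marked crossing departs from an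
unexplored vertex and its edge is never used again; the product of the weights of the marked
crossings and `w` has to be at most `wm`. -/
def pn (Q : V → V → ℝ) (η : V → V) (wm : ℝ) (f : V → ℝ) : ℕ → Pairs → Pairs → ℝ → V → ℝ
  | 0, _, _, w, u => if w ≤ wm then f u else 0
  | k + 1, E, F, w, u =>
    ∑ a, Q u a * ((if a ∈ touched F then 0 else pn Q η wm f k ((a, η a) :: E) F w (η a)) +
      if a ∈ touched E then 0 else
        pn Q η wm f k ((a, η a) :: E) ((a, η a) :: F) (w * Q u a) (η a))

variable {wm : ℝ}

lemma pn_nonneg (hQ : IsDS Q) {f : V → ℝ} (hf : ∀ v, 0 ≤ f v) (k : ℕ) (E F : Pairs) (w : ℝ)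
    (u : V) : 0 ≤ pn Q η wm f k E F w u := by
  induction k generalizing E F w u with
  | zero => unfold pn; split_ifs; exacts [hf u, le_rfl]
  | succ k ih =>
    refine sum_nonneg fun a _ => mul_nonneg (hQ.nonneg u a) (add_nonneg ?_ ?_)
    · split_ifs; exacts [le_rfl, ih _ _ _ _]
    · split_ifs; exacts [le_rfl, ih _ _ _ _]

lemma pn_sum_ind (f : V → ℝ) (k : ℕ) (E F : Pairs) (w : ℝ) (u : V) :
    ∑ y, f y * pn Q η wm (ind y) k E F w u = pn Q η wm f k E F w u := by
  induction k generalizing E F w u with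
  | zero =>
    unfold pn
    split_ifs
    · exact sum_mul_ind f u
    · simp
  | succ k ih =>
    unfold pn
    simp_rw [mul_sum]
    rw [sum_comm]
    refine sum_congr rfl fun a _ => ?_
    rw [← ih ((a, η a) :: E) F w, ← ih ((a, η a) :: E) ((a, η a) :: F) (w * Q u a)]
    split_ifs
    · simp
    · rw [zero_add, mul_sum]
      exact sum_congr rfl fun y _ => by ring
    · rw [add_zero, mul_sum]
      exact sum_congr rfl fun y _ => by ring
    · rw [← sum_add_distrib, mul_sum]
      exact sum_congr rfl fun y _ => by ring

lemma touched_cons_subset (p : V × V) (E : Pairs) : touched E ⊆ touched (p :: E) := by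
  obtain ⟨a, b⟩ := p
  rw [touched_cons_eq]
  exact (subset_insert _ _).trans (subset_insert _ _)

lemma pn_le_avo (hQ : IsDS Q) {S : Finset V} {f : V → ℝ} (hf : ∀ v, 0 ≤ f v) (k : ℕ)
    (E F : Pairs) (w : ℝ) (u : V) (hF : S ⊆ touched F) (hE : S ⊆ touched E) :
    pn Q η wm f k E F w u ≤ 2 ^ k * avo Q η S (fun _ => f) k [] u := by
  induction k generalizing E F w u with
  | zero =>
    unfold pn avo
    split_ifs
    · simp
    · simp [hf u]
  | succ k ih =>
    unfold pn avo
    rw [mul_sum]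
    refine sum_le_sum fun a _ => ?_
    have h0 := avo_nonneg (η := η) (S := S) hQ (Φ := fun _ => f) (fun _ => hf) k [] (η a)
    have h1 := ih ((a, η a) :: E) F w (η a) hF (hE.trans (touched_cons_subset _ _))
    have h2 := ih ((a, η a) :: E) ((a, η a) :: F) (w * Q u a) (η a)
      (hF.trans (touched_cons_subset _ _)) (hE.trans (touched_cons_subset _ _))
    rw [avo_fun_eq S f k [(a, η a)] [], show (2 : ℝ) ^ (k + 1) = 2 * 2 ^ k by ring,
      mul_left_comm _ (Q u a)]
    refine mul_le_left ?_ (hQ.nonneg u a)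
    have h3 : (0 : ℝ) ≤ 2 ^ k * avo Q η S (fun _ => f) k [] (η a) := by positivity
    by_cases hS : a ∈ S
    · simp [hF hS, hE hS, hS]
    · simp only [hS, if_false]
      split_ifs <;> linarith

/-- Probability that after a fresh first crossing the walk comes back to the explored set. -/
def retp (Q : V → V → ℝ) (η : V → V) (k : ℕ) (E : Pairs) (u : V) : ℝ :=
  ∑ a, Q u a * if a ∈ touched E then 0 else hitp Q η (touched E) {a, η a} k (η a)

lemma pair_union_touched (a b : V) (E : Pairs) :
    ({a, b} : Finset V) ∪ touched E = touched ((a, b) :: E) := by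
  rw [touched_cons_eq]; ext v; simp

lemma apply_mem_sdiff {E : Pairs} (hη : η ∈ ext E) {a : V} (ha : a ∉ touched E) :
    η a ∈ touched ((a, η a) :: E) \ insert a (touched E) := by
  rw [Finset.mem_sdiff, touched_cons_eq]
  refine ⟨by simp, ?_⟩
  rw [mem_insert, not_or]
  exact ⟨(mem_ext.1 hη).1.2 a, apply_notMem_touched hη ha⟩

lemma sdiff_step {E E' : Pairs} {a c : V} (hη : η ∈ ext E) (hc : c ∉ touched ((a, η a) :: E)) :
    η c ∈ touched ((c, η c) :: E') \ insert a (touched E) := by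
  rw [Finset.mem_sdiff, touched_cons_eq]
  refine ⟨by simp, ?_⟩
  rw [touched_cons_eq, mem_insert, mem_insert, not_or, not_or] at hc
  rw [mem_insert, not_or]
  have hinv := (mem_ext.1 hη).1.1
  exact ⟨fun h => hc.2.1 (by rw [← h, hinv]), apply_notMem_touched hη hc.2.2⟩

lemma sum_retp_le (hQ : IsDS Q) {c : ℝ} (hc : 0 < c) {ℓ : ℕ}
    (hcn : c ≤ (nV : ℝ) - 2 * ℓ - 1) (k : ℕ)
    (E : Pairs) (u : V) (hE : E.length + 1 + k ≤ ℓ) :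
    ∑ η ∈ ext E, retp Q η k E u ≤ 2 ^ (k + 1) * (2 * ℓ) / c * (ext E).card := by
  set φ : V → ℝ := fun x => ∑ v ∈ touched E, Q x v with hφdef
  have hφ : ∀ v, 0 ≤ φ v := fun v => sum_nonneg fun w _ => hQ.nonneg v w
  have hsum : ∑ v, φ v ≤ 2 * ℓ := by
    rw [hφdef, sum_comm]
    simp_rw [hQ.col]
    rw [sum_const, nsmul_eq_mul, mul_one]
    have := card_touched_le E
    have h2 : (touched E).card ≤ 2 * ℓ := by omega
    calc ((touched E).card : ℝ) ≤ ((2 * ℓ : ℕ) : ℝ) := Nat.cast_le.2 h2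
      _ = _ := by push_cast; ring
  have hpt : ∀ η ∈ ext E, retp Q η k E u ≤ ∑ j ∈ range k, ∑ a, Q u a * (if a ∈ touched E then 0 else
        avo Q η (touched ((a, η a) :: E))
          (fun E' _ => ∑ v ∈ touched E' \ insert a (touched E), φ v) j ((a, η a) :: E) (η a)) := by
    intro η hη
    unfold retp
    rw [sum_comm]
    refine sum_le_sum fun a _ => ?_
    rw [← mul_sum]
    refine mul_le_left ?_ (hQ.nonneg u a)
    split_ifs with ha
    · simp
    refine (hitp_le_sum_avo hQ _ _ k ((a, η a) :: E) (η a)).trans ?_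
    rw [pair_union_touched]
    refine sum_le_sum fun j _ => ?_
    refine avo_mono_of_inv hQ (fun E' u' => u' ∈ touched E' \ insert a (touched E)) ?_ j
      (apply_mem_sdiff hη ha) ?_
    · intro E' u' c _ hc
      exact sdiff_step hη hc
    · intro E' u' _ hu'
      exact single_le_sum (f := φ) (fun v _ => hφ v) hu'
  refine (sum_le_sum hpt).trans ?_
  rw [sum_comm]
  have hj : ∀ j ∈ range k, ∑ η ∈ ext E, ∑ a, Q u a * (if a ∈ touched E then 0 else
        avo Q η (touched ((a, η a) :: E))
          (fun E' _ => ∑ v ∈ touched E' \ insert a (touched E), φ v) j ((a, η a) :: E) (η a)) ≤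
        2 ^ j * (2 * (2 * ℓ) / c * (ext E).card) := by
    intro j hj
    have := mem_range.1 hj
    refine (sum_fresh_avo_le hQ hc hcn hφ j E u (by omega)).trans ?_
    rw [← mul_assoc]
    refine mul_le_right ?_ (Nat.cast_nonneg _)
    rw [← mul_div_assoc, pow_succ]
    rw [← mul_assoc]
    gcongr
  refine (sum_le_sum hj).trans ?_
  rw [← sum_mul]
  have h2 : ∑ j ∈ range k, (2 : ℝ) ^ j ≤ 2 ^ k := by rw [geom_sum_eq (by norm_num)]; norm_num
  calc _ ≤ (2 : ℝ) ^ k * (2 * (2 * ℓ) / c * (ext E).card) := by gcongr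
    _ = _ := by ring

/-- Mean overlap of two walks which leave `u` through distinct fresh edges. -/
lemma sum_cross_le (hQ : IsDS Q) {c : ℝ} (hc : 0 < c) {ℓ : ℕ}
    (hcn : c ≤ (nV : ℝ) - 2 * ℓ - 1) (k : ℕ)
    (E : Pairs) (u : V) (hE : E.length + 2 * k + 2 ≤ ℓ) :
    ∑ η ∈ ext E, ∑ a, Q u a * (if a ∈ touched E then 0 else
      ∑ a', Q u a' * if a' ∈ insert a (touched E) then 0 else
        ∑ y, avo Q η {a, η a} (fun _ => ind y) k [] (η a) *
          avo Q η {a', η a'} (fun _ => ind y) k [] (η a')) ≤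
      2 ^ (k + 1) * (4 * ℓ + 1) / c * (ext E).card := by
  have hφ := hQ.nonneg u
  have hret0 : ∀ (η : V → V) (E' : Pairs), 0 ≤ retp Q η k E' u := fun η E' => by
    refine sum_nonneg fun a _ => mul_nonneg (hφ a) ?_
    split_ifs
    exacts [le_rfl, hitp_nonneg hQ _ _ _ _]
  have hpt : ∀ η ∈ ext E, ∑ a, Q u a * (if a ∈ touched E then 0 else
      ∑ a', Q u a' * if a' ∈ insert a (touched E) then 0 else
        ∑ y, avo Q η {a, η a} (fun _ => ind y) k [] (η a) *
          avo Q η {a', η a'} (fun _ => ind y) k [] (η a')) ≤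
      retp Q η k E u +
      ∑ a, Q u a * (if a ∈ touched E then 0 else avo Q η (touched ((a, η a) :: E))
          (fun E' _ => ∑ v ∈ touched E' \ insert a (touched E), Q u v) k ((a, η a) :: E) (η a)) +
      rev Q η (fun E' _ => retp Q η k E' u) (k + 1) E u := by
    intro η hη
    unfold retp rev
    rw [← sum_add_distrib, ← sum_add_distrib]
    refine sum_le_sum fun a _ => ?_
    rw [← mul_add, ← mul_add]
    refine mul_le_left ?_ (hφ a)
    have hrev0 := rev_nonneg (η := η) hQ (Φ := fun E' _ => retp Q η k E' u)
      (fun E' _ => hret0 η E') k ((a, η a) :: E) (η a)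
    split_ifs with ha
    · simpa [retp] using hrev0
    set H : V → ℝ := fun y => ∑ a', Q u a' * if a' ∈ insert a (touched E) then 0 else
      avo Q η {a', η a'} (fun _ => ind y) k [] (η a') with hH
    have hH1 : ∀ y, H y ≤ 1 := fun y => by
      refine sum_mul_le_of_le hQ u fun a' => ?_
      split_ifs
      exacts [zero_le_one, avo_le_one hQ (fun _ v => ind_le_one y v) _ _ _]
    have e1 : ∑ a', Q u a' * (if a' ∈ insert a (touched E) then 0 else
        ∑ y, avo Q η {a, η a} (fun _ => ind y) k [] (η a) *
          avo Q η {a', η a'} (fun _ => ind y) k [] (η a'))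
        = avo Q η {a, η a} (fun _ => H) k ((a, η a) :: E) (η a) := by
      rw [← avo_sum_ind {a, η a} H k ((a, η a) :: E) (η a), hH]
      simp_rw [mul_sum]
      rw [sum_comm]
      refine sum_congr rfl fun a' _ => ?_
      split_ifs
      · simp
      · rw [mul_sum]
        exact sum_congr rfl fun y _ => by ring
    rw [e1, add_assoc]
    refine (avo_le_hitp_add hQ {a, η a} (touched E) (fun _ v => hH1 v) k _ _).trans ?_
    rw [pair_union_touched]
    refine add_le_add le_rfl ?_
    have hle : avo Q η (touched ((a, η a) :: E)) (fun _ => H) k ((a, η a) :: E) (η a) ≤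
        avo Q η (touched ((a, η a) :: E)) (fun E' _ =>
          ∑ v ∈ touched E' \ insert a (touched E), Q u v + retp Q η k E' u) k
            ((a, η a) :: E) (η a) := by
      refine avo_mono_of_inv hQ (fun E' u' => u' ∈ touched E' \ insert a (touched E) ∧ η ∈ ext E')
        ?_ k ⟨apply_mem_sdiff hη ha, mem_ext_cons_self hη⟩ ?_
      · intro E' u' c hI hc
        exact ⟨sdiff_step hη hc, mem_ext_cons_self hI.2⟩
      · intro E' y _ hI
        rw [hH]
        simp only
        rw [sum_mem_eq (touched E' \ insert a (touched E))]
        unfold retp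
        rw [← sum_add_distrib]
        refine sum_le_sum fun a' _ => ?_
        have hh0 := mul_nonneg (hφ a') (hitp_nonneg (η := η) hQ (touched E') {a', η a'} k (η a'))
        by_cases h1 : a' ∈ insert a (touched E)
        · simp only [h1, if_true, mul_zero]
          refine add_nonneg ?_ ?_
          · split_ifs; exacts [hφ a', le_rfl]
          · split_ifs
            · simp
            · exact hh0
        by_cases h2 : a' ∈ touched E'
        · simp only [h1, h2, if_false, if_true, Finset.mem_sdiff, not_false_eq_true, and_self,
            mul_zero, add_zero]
          exact mul_le_of_le_one_right (hφ a') (avo_le_one hQ (fun _ v => ind_le_one y v) _ _ _)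
        · simp only [h1, h2, if_false, Finset.mem_sdiff, false_and, zero_add]
          refine mul_le_left ?_ (hφ a')
          refine (avo_le_hitp_add hQ {a', η a'} (touched E') (fun _ v => ind_le_one y v)
            k _ _).trans (le_of_eq ?_)
          rw [avo_ind_eq_zero (subset_union_right) (fun v hv => apply_notMem_touched hI.2 hv)
            (mem_sdiff.1 hI.1).1 (apply_notMem_touched hI.2 h2), add_zero]
    refine hle.trans ?_
    rw [avo_add]
    refine add_le_add le_rfl ?_
    clear_value H
    clear hle e1 hH1 hH hrev0
    generalize (a, η a) :: E = E2
    generalize touched E2 = S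
    generalize η a = z
    clear ha hη
    generalize hk : k = k'
    have : ∀ j (E2 : Pairs) z, avo Q η S (fun E' _ => retp Q η k E' u) j E2 z ≤
        rev Q η (fun E' _ => retp Q η k E' u) j E2 z := by
      intro j
      induction j with
      | zero => intro E2 z; exact le_rfl
      | succ j ih =>
        intro E2 z
        refine sum_le_sum fun b _ => mul_le_left ?_ (hQ.nonneg z b)
        split_ifs
        · exact rev_nonneg hQ (fun E' _ => hret0 η E') _ _ _
        · exact ih _ _
    subst hk
    exact this k E2 z
  refine (sum_le_sum hpt).trans ?_
  rw [sum_add_distrib, sum_add_distrib]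
  have h1 := sum_retp_le hQ hc hcn k E u (by omega)
  have h2 := sum_fresh_avo_le hQ hc hcn hφ k E u (by omega)
  rw [hQ.row] at h2
  have h3 := sum_rev_le hQ (fun η E' _ => retp Q η k E' u) (k + 1)
    (γ := 2 ^ (k + 1) * (2 * ℓ) / c) E u (fun E' _ hE' => sum_retp_le hQ hc hcn k E' u (by omega))
  refine (add_le_add (add_le_add h1 h2) h3).trans (le_of_eq ?_)
  ring

/-- Second moment bound for the number of marked walks. -/
lemma sum_pn_sq_le (hQ : IsDS Q) {c : ℝ} (hc : 0 < c) {ℓ : ℕ}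
    (hcn : c ≤ (nV : ℝ) - 2 * ℓ - 1) (hwm : 0 ≤ wm) (k0 k : ℕ) (hk : k ≤ k0) :
    ∀ (E F : Pairs) (w : ℝ) (u : V), touched F ⊆ touched E → 0 ≤ w → E.length + 2 * k + 2 ≤ ℓ →
    w * ∑ η ∈ ext E, ∑ y, pn Q η wm (ind y) k E F w u ^ 2 ≤
      4 ^ k * (wm + w * k * (2 ^ k0 * (4 * ℓ + 1) / c)) * (ext E).card := by
  set X : ℝ := 2 ^ k0 * (4 * ℓ + 1) / c with hX
  have hX0 : 0 ≤ X := by positivity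
  induction k with
  | zero =>
    intro E F w u _ hw _
    have : ∀ η : V → V, ∑ y, pn Q η wm (ind y) 0 E F w u ^ 2 = if w ≤ wm then 1 else 0 := by
      intro η
      unfold pn ind
      split_ifs <;> simp
    simp_rw [this]
    rw [sum_const, nsmul_eq_mul]
    have hcard : (0 : ℝ) ≤ (ext E).card := Nat.cast_nonneg _
    split_ifs with h
    · simp only [pow_zero, Nat.cast_zero, mul_zero, zero_mul, add_zero, one_mul, mul_one]
      gcongr
    · simp only [pow_zero, Nat.cast_zero, mul_zero, zero_mul, add_zero, one_mul]
      positivity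
  | succ k ih =>
    intro E F w u hFE hw hℓ
    have ih := ih (by omega)
    have hcard : (0 : ℝ) ≤ (ext E).card := Nat.cast_nonneg _
    have hq := hQ.nonneg u
    have hq1 : ∀ a, Q u a ≤ 1 := fun a => by
      rw [← hQ.row u]; exact single_le_sum (fun b _ => hq b) (mem_univ a)
    have hrv : ∀ (a : V) (F' : V → Pairs) (w' : ℝ), 0 ≤ w' →
        (∀ b, touched (F' b) ⊆ touched ((a, b) :: E)) →
        w' * ∑ η ∈ ext E, ∑ y, pn Q η wm (ind y) k ((a, η a) :: E) (F' (η a)) w' (η a) ^ 2 ≤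
          4 ^ k * (wm + w' * k * X) * (ext E).card := by
      intro a F' w' hw' hF'
      have hcc : ((ext E).card : ℝ) = ∑ b, ((ext ((a, b) :: E)).card : ℝ) := by
        have := sum_ext_reveal E a (fun _ => (1 : ℝ))
        simpa only [sum_const, nsmul_eq_mul, mul_one] using this
      rw [sum_ext_reveal E a, hcc, mul_sum, mul_sum]
      refine sum_le_sum fun b _ => ?_
      refine le_trans (le_of_eq (congrArg _ (sum_congr rfl fun η' hη' => ?_)))
        (ih ((a, b) :: E) (F' b) w' b (hF' b) hw' (by rw [List.length_cons]; omega))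
      rw [(mem_ext_cons.1 hη').2]
    set NB : (V → V) → V → V → ℝ := fun η a y => if a ∈ touched F then 0 else
      pn Q η wm (ind y) k ((a, η a) :: E) F w (η a) with hNB
    set NG : (V → V) → V → V → ℝ := fun η a y => if a ∈ touched E then 0 else
      pn Q η wm (ind y) k ((a, η a) :: E) ((a, η a) :: F) (w * Q u a) (η a) with hNG
    have hpn : ∀ η y, pn Q η wm (ind y) (k + 1) E F w u
        = ∑ a, Q u a * NB η a y + ∑ a, Q u a * NG η a y := by
      intro η y
      rw [← sum_add_distrib]
      exact sum_congr rfl fun a _ => mul_add _ _ _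
    have hNG0 : ∀ η a y, 0 ≤ NG η a y := fun η a y => by
      simp only [hNG]
      split_ifs
      exacts [le_rfl, pn_nonneg hQ (ind_nonneg y) _ _ _ _ _]
    have hB : ∀ η y, (∑ a, Q u a * NB η a y) ^ 2 ≤ ∑ a, Q u a *
        pn Q η wm (ind y) k ((a, η a) :: E) F w (η a) ^ 2 := by
      intro η y
      refine (Qop_sq_le hQ (fun a => NB η a y) u).trans ?_
      refine sum_le_sum fun a _ => mul_le_left ?_ (hq a)
      simp only [hNB]
      split_ifs
      · simp; positivity
      · exact le_rfl
    have hNGA : ∀ η a a', a' ≠ a → ∑ y, NG η a y * NG η a' y ≤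
        4 ^ k * if a ∈ touched E then 0 else if a' ∈ insert a (touched E) then 0 else
        ∑ y, avo Q η {a, η a} (fun _ => ind y) k [] (η a) *
          avo Q η {a', η a'} (fun _ => ind y) k [] (η a') := by
      intro η a a' hne
      simp only [hNG]
      by_cases ha : a ∈ touched E
      · simp [ha]
      by_cases ha' : a' ∈ touched E
      · simp [ha']
      simp only [ha, ha', if_false, mem_insert, hne, or_self]
      rw [mul_sum]
      refine sum_le_sum fun y _ => ?_
      have hsub : ∀ b (L : Pairs), ({b, η b} : Finset V) ⊆ touched ((b, η b) :: L) := by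
        intro b L
        rw [touched_cons_eq]; intro v; simp; tauto
      have h1 := pn_le_avo (η := η) (wm := wm) hQ (ind_nonneg y) k ((a, η a) :: E)
        ((a, η a) :: F) (w * Q u a) (η a) (hsub a F) (hsub a E)
      have h2 := pn_le_avo (η := η) (wm := wm) hQ (ind_nonneg y) k ((a', η a') :: E)
        ((a', η a') :: F) (w * Q u a') (η a') (hsub a' F) (hsub a' E)
      have h0 := avo_nonneg (η := η) (S := {a, η a}) hQ (Φ := fun _ => ind y)
        (fun _ => ind_nonneg y) k [] (η a)
      refine (mul_le_mul h1 h2 (pn_nonneg hQ (ind_nonneg y) _ _ _ _ _) (by positivity)).trans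
        (le_of_eq ?_)
      rw [show (4 : ℝ) ^ k = 2 ^ k * 2 ^ k by rw [← mul_pow]; norm_num]
      ring
    have hG : ∀ η, ∑ y, (∑ a, Q u a * NG η a y) ^ 2 ≤
        ∑ a, Q u a * (Q u a * ∑ y, pn Q η wm (ind y) k ((a, η a) :: E) ((a, η a) :: F)
          (w * Q u a) (η a) ^ 2) +
        4 ^ k * ∑ a, Q u a * (if a ∈ touched E then 0 else
          ∑ a', Q u a' * if a' ∈ insert a (touched E) then 0 else
            ∑ y, avo Q η {a, η a} (fun _ => ind y) k [] (η a) *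
              avo Q η {a', η a'} (fun _ => ind y) k [] (η a')) := by
      intro η
      have e : ∑ y, (∑ a, Q u a * NG η a y) ^ 2
          = ∑ a, Q u a * ∑ a', Q u a' * ∑ y, NG η a y * NG η a' y := by
        simp_rw [sq, sum_mul_sum, mul_sum]
        rw [sum_comm]
        refine sum_congr rfl fun a _ => ?_
        rw [sum_comm]
        refine sum_congr rfl fun a' _ => sum_congr rfl fun y _ => by ring
      rw [e, mul_sum, ← sum_add_distrib]
      refine sum_le_sum fun a _ => ?_
      rw [mul_left_comm (4 ^ k), ← mul_add]
      refine mul_le_left ?_ (hq a)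
      have hterm : ∀ a', Q u a' * ∑ y, NG η a y * NG η a' y ≤
          (if a = a' then Q u a * ∑ y, pn Q η wm (ind y) k ((a, η a) :: E) ((a, η a) :: F)
            (w * Q u a) (η a) ^ 2 else 0) +
          4 ^ k * (if a ∈ touched E then 0 else Q u a' * if a' ∈ insert a (touched E) then 0 else
            ∑ y, avo Q η {a, η a} (fun _ => ind y) k [] (η a) *
              avo Q η {a', η a'} (fun _ => ind y) k [] (η a')) := by
        intro a'
        by_cases hne : a = a'
        · subst hne
          simp only [if_true, mem_insert_self, mul_zero, ite_self, add_zero]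
          refine mul_le_left (sum_le_sum fun y _ => ?_) (hq a)
          simp only [hNG]
          split_ifs
          · rw [mul_zero]; positivity
          · rw [sq]
        · rw [if_neg hne, zero_add]
          have := mul_le_left (hNGA η a a' (Ne.symm hne)) (hq a')
          refine this.trans (le_of_eq ?_)
          split_ifs <;> ring
      refine (sum_le_sum fun a' _ => hterm a').trans (le_of_eq ?_)
      rw [sum_add_distrib, sum_ite_eq, if_pos (mem_univ a), ← mul_sum]
      split_ifs <;> simp
    have hcross := sum_cross_le hQ hc hcn k E u (by omega)
    have hBs : w * ∑ η ∈ ext E, ∑ y, (∑ a, Q u a * NB η a y) ^ 2 ≤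
        4 ^ k * (wm + w * k * X) * (ext E).card := by
      have h1 : ∑ η ∈ ext E, ∑ y, (∑ a, Q u a * NB η a y) ^ 2 ≤ ∑ a, Q u a *
          ∑ η ∈ ext E, ∑ y, pn Q η wm (ind y) k ((a, η a) :: E) F w (η a) ^ 2 := by
        have e : ∑ a, Q u a * ∑ η ∈ ext E, ∑ y, pn Q η wm (ind y) k ((a, η a) :: E) F w (η a) ^ 2
            = ∑ η ∈ ext E, ∑ y, ∑ a, Q u a * pn Q η wm (ind y) k ((a, η a) :: E) F w (η a) ^ 2 := by
          simp_rw [mul_sum]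
          rw [sum_comm]
          exact sum_congr rfl fun η _ => sum_comm
        rw [e]
        exact sum_le_sum fun η _ => sum_le_sum fun y _ => hB η y
      refine (mul_le_left h1 hw).trans ?_
      rw [mul_sum]
      refine le_trans (le_of_eq (sum_congr rfl fun a _ => mul_left_comm _ _ _))
        (sum_mul_le_of_le hQ u fun a => hrv a (fun _ => F) w hw
          fun b => hFE.trans (touched_cons_subset _ _))
    have hdg : w * ∑ η ∈ ext E, ∑ a, Q u a * (Q u a * ∑ y, pn Q η wm (ind y) k ((a, η a) :: E)
          ((a, η a) :: F) (w * Q u a) (η a) ^ 2) ≤ 4 ^ k * (wm + w * k * X) * (ext E).card := by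
      rw [sum_comm, mul_sum]
      refine le_trans (le_of_eq (sum_congr rfl fun a _ => ?_))
        (sum_mul_le_of_le hQ u (f := fun a => (w * Q u a) * ∑ η ∈ ext E, ∑ y, pn Q η wm (ind y) k
          ((a, η a) :: E) ((a, η a) :: F) (w * Q u a) (η a) ^ 2) fun a => ?_)
      · rw [← mul_sum, ← mul_sum]; ring
      · refine (hrv a (fun b => (a, b) :: F) (w * Q u a) (mul_nonneg hw (hq a)) fun b => ?_).trans ?_
        · rw [touched_cons_eq, touched_cons_eq]
          exact insert_subset_insert _ (insert_subset_insert _ hFE)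
        · have : w * Q u a * k * X ≤ w * k * X := by
            have := mul_le_left (hq1 a) (show 0 ≤ w * k * X by positivity)
            linarith
          gcongr
    have htot : ∑ η ∈ ext E, ∑ y, pn Q η wm (ind y) (k + 1) E F w u ^ 2 ≤
        2 * (∑ η ∈ ext E, ∑ y, (∑ a, Q u a * NB η a y) ^ 2) +
        2 * (∑ η ∈ ext E, ∑ a, Q u a * (Q u a * ∑ y, pn Q η wm (ind y) k ((a, η a) :: E)
          ((a, η a) :: F) (w * Q u a) (η a) ^ 2) +
          4 ^ k * (2 ^ (k + 1) * (4 * ℓ + 1) / c * (ext E).card)) := by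
      have h1 : ∀ η, ∑ y, pn Q η wm (ind y) (k + 1) E F w u ^ 2 ≤
          2 * ∑ y, (∑ a, Q u a * NB η a y) ^ 2 + 2 * ∑ y, (∑ a, Q u a * NG η a y) ^ 2 := by
        intro η
        rw [mul_sum, mul_sum, ← sum_add_distrib]
        refine sum_le_sum fun y _ => ?_
        rw [hpn]
        nlinarith [sq_nonneg (∑ a, Q u a * NB η a y - ∑ a, Q u a * NG η a y)]
      refine (sum_le_sum fun η _ => h1 η).trans ?_
      rw [sum_add_distrib, ← mul_sum, ← mul_sum]
      refine add_le_add le_rfl (mul_le_left ?_ zero_le_two)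
      refine (sum_le_sum fun η _ => hG η).trans ?_
      rw [sum_add_distrib, ← mul_sum]
      exact add_le_add le_rfl (by gcongr)
    have hXk : 2 ^ k * (4 * ℓ + 1) / c ≤ X := by
      rw [hX]
      have : (2 : ℝ) ^ k ≤ 2 ^ k0 := pow_le_pow_right₀ one_le_two (by omega)
      gcongr
    have h5 := mul_le_left htot hw
    have h6 : w * (4 ^ k * (4 * (2 ^ k * (4 * ℓ + 1) / c) * (ext E).card)) ≤
        w * (4 ^ k * (4 * X * (ext E).card)) := by gcongr
    have e1 : 4 ^ (k + 1) * (wm + w * ((k + 1 : ℕ) : ℝ) * X) * ((ext E).card : ℝ)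
      = 4 * (4 ^ k * (wm + w * k * X) * (ext E).card) + w * (4 ^ k * (4 * X * (ext E).card)) := by
      push_cast; ring
    have e2 : w * (4 ^ k * (4 * (2 ^ k * (4 * ℓ + 1) / c) * ((ext E).card : ℝ)))
      = w * (2 * (4 ^ k * (2 ^ (k + 1) * (4 * ℓ + 1) / c * (ext E).card))) := by ring
    rw [e1]
    rw [e2] at h6
    linarith

lemma IsCert.add {E : Pairs} {N : ℕ} {Z Z' : (V → V) → ℝ} (h : IsCert E N Z)
    (h' : IsCert E N Z') : IsCert E N (fun η => Z η + Z' η) := by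
  intro X hX M hM
  simp_rw [add_mul]
  rw [sum_add_distrib, sum_add_distrib, mul_add]
  exact add_le_add (h X hX M hM) (h' X hX M hM)

lemma isCert_pn (hQ : IsDS Q) (f : (V → V) → V → ℝ) (k N : ℕ) (E0 E F : Pairs) (w : ℝ)
    (u : V) (h : ∀ E' v, E'.length = E0.length + k → IsCert E' N (fun η => f η v)) :
    IsCert E0 (N + k) (fun η => pn Q η wm (f η) k E F w u) := by
  induction k generalizing E0 E F w u with
  | zero =>
    unfold pn
    split_ifs
    · exact h E0 u rfl
    · exact IsCert.const _ _ le_rfl fun _ _ => rfl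
  | succ k ih =>
    refine IsCert.sum univ (hQ.nonneg u) fun a => ?_
    refine IsCert.reveal a (Z := fun b η => (if a ∈ touched F then 0 else
      pn Q η wm (f η) k ((a, b) :: E) F w b) + if a ∈ touched E then 0 else
        pn Q η wm (f η) k ((a, b) :: E) ((a, b) :: F) (w * Q u a) b) fun b => ?_
    have h' : ∀ E' v, E'.length = ((a, b) :: E0).length + k → IsCert E' N (fun η => f η v) :=
      fun E' v hE' => h E' v (by simp at hE'; omega)
    refine IsCert.add ?_ ?_
    · split_ifs
      · exact IsCert.const _ _ le_rfl fun _ _ => rfl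
      · exact ih _ _ _ _ _ h'
    · split_ifs
      · exact IsCert.const _ _ le_rfl fun _ _ => rfl
      · exact ih _ _ _ _ _ h'

lemma isCert_pn_sq (hQ : IsDS Q) (k : ℕ) (E0 E F : Pairs) (w : ℝ) (u : V) :
    IsCert E0 (k + k) (fun η => ∑ y, pn Q η wm (ind y) k E F w u ^ 2) := by
  have h := isCert_pn (wm := wm) hQ (fun η y => pn Q η wm (ind y) k E F w u) k k E0 E F w u
    fun E' v _ => by
      have := isCert_pn (wm := wm) hQ (fun _ => ind v) k 0 E' E F w u fun E'' v' _ =>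
        IsCert.const _ _ (ind_nonneg v v') fun _ _ => rfl
      rwa [zero_add] at this
  refine h.congr fun η _ => ?_
  rw [← pn_sum_ind]
  exact sum_congr rfl fun y _ => sq _

end Marked

/-- Sums of an additive functional along the chain concentrate once the averages `K ^ j h`
are nearly constant for `j ≥ m`. -/
lemma variance_le_of_averaging (hQ : IsDS Q) {h : V → ℝ} {hb H δ c2 : ℝ} {m k : ℕ}
    (h0 : ∀ v, 0 ≤ h v) (hH : ∀ v, h v ≤ H) (hδ0 : 0 ≤ δ) (hδ1 : δ ≤ 1) (hb0 : 0 ≤ hb)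
    (hbH : hb ≤ H) (hm1 : 1 ≤ m)
    (hm : ∀ j, m ≤ j → ∀ v, |Kpow Q η j h v - hb| ≤ δ * hb)
    {e q : ℕ → V → ℝ} (he0 : ∀ v, e 0 v = 0) (he : ∀ j u, e (j + 1) u = h u + Kop Q η (e j) u)
    (hq0 : ∀ v, q 0 v = 0)
    (hq : ∀ j u M, (∀ v, e (j + 1) v ≤ M) → (∀ v, e j v ≤ M) →
      q (j + 1) u ≤ c2 + 2 * h u * M + Kop Q η (q j) u)
    (hmk : m * H ≤ δ * (k * hb)) (hc2 : c2 ≤ δ * (k * hb ^ 2)) (u : V) :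
    q k u - 2 * (k * hb) * e k u + (k * hb) ^ 2 ≤ 22 * δ * (k * hb) ^ 2 := by
  have hH0 := hb0.trans hbH
  have hsum : ∀ j u, e j u = ∑ l ∈ range j, Kpow Q η l h u := fun j => by
    induction j with
    | zero => intro u; simp [he0]
    | succ j ih =>
      intro u
      rw [he, sum_range_succ', Kpow_zero, add_comm]
      have : e j = fun u => ∑ l ∈ range j, Kpow Q η l h u := funext ih
      rw [this, Kop_sum]
      simp_rw [Kpow_succ]
  have hK : ∀ j v, Kpow Q η j h v ≤ (1 + δ) * hb + if j < m then H else 0 := fun j v => by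
    split_ifs with hj
    · have := Kpow_le (η := η) hQ j hH v
      nlinarith
    · have := (abs_le.1 (hm j (not_lt.1 hj) v)).2
      linarith
  have hK' : ∀ j v, (1 - δ) * hb - (if j < m then H else 0) ≤ Kpow Q η j h v := fun j v => by
    split_ifs with hj
    · have := Kpow_nonneg (η := η) hQ j h0 v
      nlinarith
    · have := (abs_le.1 (hm j (not_lt.1 hj) v)).1
      linarith
  have hcount : ∀ j : ℕ, ∑ l ∈ range j, (if l < m then H else 0) ≤ m * H := fun j => by
    rw [← sum_filter, sum_const, nsmul_eq_mul]
    refine mul_le_right (Nat.cast_le.2 ?_) hH0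
    refine (card_le_card (t := range m) fun l hl => ?_).trans (card_range m).le
    exact mem_range.2 (mem_filter.1 hl).2
  set M : ℕ → ℝ := fun j => (1 + δ) * hb * j + m * H with hM
  have heM : ∀ j v, e j v ≤ M j := fun j v => by
    rw [hsum]
    refine (sum_le_sum fun l _ => hK l v).trans ?_
    rw [sum_add_distrib, sum_const, nsmul_eq_mul, card_range]
    have := hcount j
    simp only [hM]
    linarith
  have hMs : ∀ j, M j ≤ M (j + 1) := fun j => by
    simp only [hM]
    push_cast
    nlinarith [mul_nonneg (by linarith : 0 ≤ 1 + δ) hb0]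
  have hqk : ∀ j u, q j u ≤ j * c2 + 2 * ∑ l ∈ range j, M (j - l) * Kpow Q η l h u := fun j => by
    induction j with
    | zero => intro u; simp [hq0]
    | succ j ih =>
      intro u
      refine (hq j u (M (j + 1)) (heM _) fun v => (heM j v).trans (hMs j)).trans ?_
      have h1 := Kop_mono (η := η) hQ ih u
      have h2 : Kop Q η (fun u => j * c2 + 2 * ∑ l ∈ range j, M (j - l) * Kpow Q η l h u) u
          = j * c2 + 2 * ∑ l ∈ range j, M (j - l) * Kpow Q η (l + 1) h u := by
        rw [Kop_add, Kop_const hQ, Kop_mul, Kop_sum]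
        simp_rw [Kop_mul, Kpow_succ]
      rw [h2] at h1
      rw [sum_range_succ', Kpow_zero, Nat.sub_zero]
      simp_rw [Nat.succ_sub_succ_eq_sub]
      push_cast
      linarith
  have hM0 : ∀ j, 0 ≤ M j := by intro j; simp only [hM]; positivity
  have hMk : ∀ l ∈ range k, M (k - l) ≤ M k := fun l _ => by
    simp only [hM]
    have : ((k - l : ℕ) : ℝ) ≤ k := Nat.cast_le.2 (Nat.sub_le _ _)
    have := mul_le_left this (mul_nonneg (by linarith : 0 ≤ 1 + δ) hb0)
    linarith
  have hS : ∑ l ∈ range k, M (k - l) * Kpow Q η l h u ≤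
      (1 + δ) * hb * ((1 + δ) * hb * (k * (k + 1) / 2) + k * (m * H)) + M k * (m * H) := by
    calc ∑ l ∈ range k, M (k - l) * Kpow Q η l h u
        ≤ ∑ l ∈ range k, (M (k - l) * ((1 + δ) * hb) + M k * if l < m then H else 0) := by
          refine sum_le_sum fun l hl => ?_
          refine (mul_le_left (hK l u) (hM0 _)).trans ?_
          rw [mul_add]
          refine add_le_add le_rfl (mul_le_right (hMk l hl) ?_)
          split_ifs; exacts [hH0, le_rfl]
      _ = (∑ l ∈ range k, M (k - l)) * ((1 + δ) * hb) +
          M k * ∑ l ∈ range k, (if l < m then H else 0) := by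
          rw [sum_add_distrib, sum_mul, mul_sum]
      _ ≤ _ := by
          have e1 : ∑ l ∈ range k, M (k - l) = (1 + δ) * hb * (k * (k + 1) / 2) + k * (m * H) := by
            have : ∑ l ∈ range k, M (k - l) = ∑ l ∈ range k, M (l + 1) := by
              rw [← sum_range_reflect]
              refine sum_congr rfl fun l hl => ?_
              have := mem_range.1 hl
              congr 1; omega
            rw [this]
            simp only [hM]
            have h3 : ∀ j : ℕ, ∑ l ∈ range j, ((1 + δ) * hb * ((l + 1 : ℕ) : ℝ) + m * H)
                = (1 + δ) * hb * (j * (j + 1) / 2) + j * (m * H) := by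
              intro j
              induction j with
              | zero => simp
              | succ j ih => rw [sum_range_succ, ih]; push_cast; ring
            exact h3 k
          rw [e1]
          have := mul_le_left (hcount k) (hM0 k)
          linarith
  have hek : (1 - 2 * δ) * (k * hb) ≤ e k u := by
    rw [hsum]
    have h1 := sum_le_sum (s := range k) fun l _ => hK' l u
    rw [sum_sub_distrib, sum_const, nsmul_eq_mul, card_range] at h1
    have := hcount k
    nlinarith
  have hq1 := hqk k u
  set Y : ℝ := k * hb with hY
  have hY0 : 0 ≤ Y := by positivity
  have hW0 : 0 ≤ (m : ℝ) * H := by positivity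
  have hbW : hb ≤ m * H := by
    have : (1 : ℝ) ≤ m := Nat.one_le_cast.2 hm1
    nlinarith
  have hbY := hbW.trans hmk
  have hkc : k * c2 ≤ δ * Y ^ 2 := by
    have := mul_le_left hc2 (Nat.cast_nonneg (α := ℝ) k)
    calc k * c2 ≤ k * (δ * (k * hb ^ 2)) := this
      _ = _ := by rw [hY]; ring
  set W : ℝ := m * H with hWdef
  have hMkY : M k = (1 + δ) * Y + W := by simp only [hM]; rw [hY]; ring
  have e3 : (1 + δ) * hb * ((1 + δ) * hb * (k * (k + 1) / 2) + k * W) + M k * W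
      = (1 + δ) ^ 2 / 2 * (Y ^ 2 + hb * Y) + (1 + δ) * Y * W + ((1 + δ) * Y + W) * W := by
    rw [hMkY, hY]; ring
  rw [e3] at hS
  have i1 : hb * Y ≤ δ * Y ^ 2 := by nlinarith
  have i2 : Y * W ≤ δ * Y ^ 2 := by nlinarith
  have i3 : W * W ≤ δ * Y ^ 2 := by
    have : W ≤ Y := hmk.trans (by nlinarith)
    nlinarith
  have hs1 : (1 + δ) ^ 2 ≤ 1 + 3 * δ := by nlinarith
  have hZ : 0 ≤ δ * Y ^ 2 := by positivity
  have j1 : (1 + δ) ^ 2 * (Y ^ 2 + hb * Y) ≤ (1 + 3 * δ) * (Y ^ 2 + δ * Y ^ 2) := by gcongr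
  have j2 : (1 + δ) * (Y * W) ≤ 2 * (δ * Y ^ 2) := by nlinarith
  nlinarith

/-- Expectation of a functional of the first `k` departure points. -/
def pl (Q : V → V → ℝ) (η : V → V) : ℕ → V → (List V → ℝ) → ℝ
  | 0, _, Φ => Φ []
  | k + 1, u, Φ => ∑ a, Q u a * pl Q η k (η a) fun as => Φ (a :: as)

def endp (η : V → V) : V → List V → V
  | u, [] => u
  | _, a :: as => endp η (η a) as

lemma pl_mono (hQ : IsDS Q) (k : ℕ) (u : V) {Φ Ψ : List V → ℝ} (h : ∀ as, Φ as ≤ Ψ as) :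
    pl Q η k u Φ ≤ pl Q η k u Ψ := by
  induction k generalizing u Φ Ψ with
  | zero => exact h []
  | succ k ih =>
    exact sum_le_sum fun a _ => mul_le_left (ih (η a) fun as => h _) (hQ.nonneg u a)

lemma pl_add (k : ℕ) (u : V) (Φ Ψ : List V → ℝ) :
    pl Q η k u (fun as => Φ as + Ψ as) = pl Q η k u Φ + pl Q η k u Ψ := by
  induction k generalizing u Φ Ψ with
  | zero => rfl
  | succ k ih =>
    unfold pl
    rw [← sum_add_distrib]
    exact sum_congr rfl fun a _ => by rw [ih, mul_add]

lemma pl_mul (k : ℕ) (u : V) (c : ℝ) (Φ : List V → ℝ) :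
    pl Q η k u (fun as => c * Φ as) = c * pl Q η k u Φ := by
  induction k generalizing u Φ with
  | zero => rfl
  | succ k ih =>
    unfold pl
    rw [mul_sum]
    exact sum_congr rfl fun a _ => by rw [ih]; ring

lemma pl_const (hQ : IsDS Q) (k : ℕ) (u : V) (c : ℝ) : pl Q η k u (fun _ => c) = c := by
  induction k generalizing u with
  | zero => rfl
  | succ k ih => simp only [pl, ih]; rw [← sum_mul, hQ.row, one_mul]

lemma pl_sum {ι : Type*} (s : Finset ι) (k : ℕ) (u : V) (Φ : ι → List V → ℝ) :
    pl Q η k u (fun as => ∑ i ∈ s, Φ i as) = ∑ i ∈ s, pl Q η k u (Φ i) := by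
  induction k generalizing u Φ with
  | zero => rfl
  | succ k ih =>
    unfold pl
    rw [sum_comm]
    exact sum_congr rfl fun a _ => by rw [ih, mul_sum]

lemma pl_nonneg (hQ : IsDS Q) (k : ℕ) (u : V) {Φ : List V → ℝ} (h : ∀ as, 0 ≤ Φ as) :
    0 ≤ pl Q η k u Φ := by
  have := pl_mono (η := η) hQ k u h
  rwa [pl_const hQ] at this

lemma pl_endp (f : V → ℝ) (k : ℕ) (u : V) :
    pl Q η k u (fun as => f (endp η u as)) = Kpow Q η k f u := by
  induction k generalizing u with
  | zero => rfl
  | succ k ih =>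
    rw [Kpow_succ]
    exact sum_congr rfl fun a _ => by rw [← ih]; rfl

/-- Whether the steps of a walk can be marked in the way counted by `pn`. -/
def markable (Q : V → V → ℝ) (η : V → V) (wm : ℝ) : List V → Pairs → Pairs → ℝ → V → Prop
  | [], _, _, w, _ => w ≤ wm
  | a :: as, E, F, w, u =>
    (a ∉ touched F ∧ markable Q η wm as ((a, η a) :: E) F w (η a)) ∨
      (a ∉ touched E ∧ markable Q η wm as ((a, η a) :: E) ((a, η a) :: F) (w * Q u a) (η a))

open Classical in
lemma pl_markable_le_pn (hQ : IsDS Q) (wm : ℝ) {f : V → ℝ} (hf : ∀ v, 0 ≤ f v) (k : ℕ)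
    (E F : Pairs) (w : ℝ) (u : V) :
    pl Q η k u (fun as => if markable Q η wm as E F w u then f (endp η u as) else 0) ≤
      pn Q η wm f k E F w u := by
  induction k generalizing E F w u with
  | zero => exact le_of_eq (if_congr Iff.rfl rfl rfl)
  | succ k ih =>
    refine sum_le_sum fun a _ => mul_le_left ?_ (hQ.nonneg u a)
    have h1 := ih ((a, η a) :: E) F w (η a)
    have h2 := ih ((a, η a) :: E) ((a, η a) :: F) (w * Q u a) (η a)
    refine (pl_mono hQ k (η a) (Ψ := fun as =>
      (if a ∈ touched F then 0 else if markable Q η wm as ((a, η a) :: E) F w (η a) then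
        f (endp η (η a) as) else 0) +
      (if a ∈ touched E then 0 else if markable Q η wm as ((a, η a) :: E) ((a, η a) :: F)
        (w * Q u a) (η a) then f (endp η (η a) as) else 0)) fun as => ?_).trans ?_
    · have h3 := hf (endp η (η a) as)
      simp only [markable, endp]
      by_cases hF : a ∈ touched F <;> by_cases hE : a ∈ touched E <;>
        by_cases m1 : markable Q η wm as ((a, η a) :: E) F w (η a) <;>
        by_cases m2 : markable Q η wm as ((a, η a) :: E) ((a, η a) :: F) (w * Q u a) (η a) <;>
        simp [hF, hE, m1, m2, h3]
    · rw [pl_add]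
      refine add_le_add ?_ ?_
      · split_ifs
        · rw [pl_const hQ]
        · exact h1
      · split_ifs
        · rw [pl_const hQ]
        · exact h2

/-- Product of the weights of the steps whose edge is crossed only once. -/
def gw (Q : V → V → ℝ) (η : V → V) : List V → Pairs → V → ℝ
  | [], _, _ => 1
  | a :: as, O, u => (if a ∉ touched O ∧ a ∉ as ∧ η a ∉ as then Q u a else 1) *
      gw Q η as ((a, η a) :: O) (η a)

lemma markable_of_gw_le {wm : ℝ} {T : Finset V} (as : List V) :
    ∀ (O E F : Pairs) (w : ℝ) (u : V), (∀ c ∈ as, c ∉ T) → (∀ c ∈ as, c ∉ touched F) →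
      touched E ⊆ touched O ∪ T → w * gw Q η as O u ≤ wm → markable Q η wm as E F w u := by
  induction as with
  | nil => intro O E F w u _ _ _ h; simpa [gw, markable] using h
  | cons a as ih =>
    intro O E F w u hT hF hE hw
    have hsub : touched ((a, η a) :: E) ⊆ touched ((a, η a) :: O) ∪ T := by
      rw [touched_cons_eq, touched_cons_eq, insert_union, insert_union]
      exact insert_subset_insert _ (insert_subset_insert _ hE)
    have hT' : ∀ c ∈ as, c ∉ T := fun c hc => hT c (List.mem_cons_of_mem _ hc)
    have hF' : ∀ c ∈ as, c ∉ touched F := fun c hc => hF c (List.mem_cons_of_mem _ hc)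
    unfold gw at hw
    unfold markable
    split_ifs at hw with hg
    · right
      refine ⟨fun h => ?_, ih ((a, η a) :: O) _ _ _ _ hT' ?_ hsub (by rwa [mul_assoc])⟩
      · rcases mem_union.1 (hE h) with h | h
        · exact hg.1 h
        · exact hT a List.mem_cons_self h
      · intro c hc h
        rw [touched_cons_eq, mem_insert, mem_insert] at h
        rcases h with rfl | rfl | h
        · exact hg.2.1 hc
        · exact hg.2.2 hc
        · exact hF' c hc h
    · left
      rw [one_mul] at hw
      exact ⟨hF a List.mem_cons_self, ih ((a, η a) :: O) _ _ _ _ hT' hF' hsub hw⟩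

open Classical in
lemma pl_hit_le (hQ : IsDS Q) (T : Finset V) (k : ℕ) (u : V) :
    pl Q η k u (fun as => if ∃ c ∈ as, c ∈ T then 1 else 0) ≤
      ∑ j ∈ range k, ∑ v ∈ T, Kpow Q η j (fun u => Q u v) u := by
  induction k generalizing u with
  | zero => simp [pl]
  | succ k ih =>
    rw [sum_range_succ']
    unfold pl
    have h1 : ∀ a, pl Q η k (η a) (fun as => if ∃ c ∈ a :: as, c ∈ T then 1 else 0) ≤
        (if a ∈ T then 1 else 0) + pl Q η k (η a) (fun as => if ∃ c ∈ as, c ∈ T then 1 else 0) := by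
      intro a
      rw [← pl_const (η := η) hQ k (η a) (if a ∈ T then 1 else 0), ← pl_add]
      refine pl_mono hQ k (η a) fun as => ?_
      by_cases ha : a ∈ T <;> by_cases h : ∃ c ∈ as, c ∈ T <;> simp [ha, h]
    refine (sum_le_sum fun a _ => mul_le_left
      ((h1 a).trans (add_le_add le_rfl (ih (η a)))) (hQ.nonneg u a)).trans (le_of_eq ?_)
    simp_rw [mul_add]
    rw [sum_add_distrib, add_comm]
    congr 1
    · simp_rw [mul_sum]
      rw [sum_comm]
      refine sum_congr rfl fun j _ => ?_
      rw [sum_comm]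
      refine sum_congr rfl fun v _ => ?_
      rw [Kpow_succ]; rfl
    · rw [sum_mem_eq]
      simp

/-- The law after `i` crossings from `u` dominates a measure of mass `1 - d` which is spread out
in the sense that its squared `ℓ²` norm is at most `θ`. -/
def SpreadAt (Q : V → V → ℝ) (η : V → V) (i : ℕ) (d θ : ℝ) (u : V) : Prop :=
  ∃ ν : V → ℝ, (∀ y, 0 ≤ ν y) ∧ (∀ y, ν y ≤ Kpow Q η i (ind y) u) ∧ 1 - d ≤ ∑ y, ν y ∧
    ∑ y, ν y ^ 2 ≤ θ

open Classical in
lemma spreadAt_of_pn (hQ : IsDS Q) {wm d1 d2 θ : ℝ} {i : ℕ} {E : Pairs} {u : V}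
    (h1 : pl Q η i u (fun as => if wm < gw Q η as [] u then 1 else 0) ≤ d1)
    (h2 : pl Q η i u (fun as => if ∃ c ∈ as, c ∈ touched E then 1 else 0) ≤ d2)
    (h3 : ∑ y, pn Q η wm (ind y) i E E 1 u ^ 2 ≤ θ) : SpreadAt Q η i (d1 + d2) θ u := by
  set ν : V → ℝ := fun y => pl Q η i u
    (fun as => if markable Q η wm as E E 1 u then ind y (endp η u as) else 0) with hν
  have hν0 : ∀ y, 0 ≤ ν y := fun y => pl_nonneg hQ i u fun as => by
    split_ifs; exacts [ind_nonneg _ _, le_rfl]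
  refine ⟨ν, hν0, fun y => ?_, ?_, ?_⟩
  · rw [← pl_endp]
    refine pl_mono hQ i u fun as => ?_
    split_ifs; exacts [le_rfl, ind_nonneg _ _]
  · have e : ∑ y, ν y = pl Q η i u (fun as => if markable Q η wm as E E 1 u then 1 else 0) := by
      rw [hν, ← pl_sum]
      congr 1
      funext as
      split_ifs
      · have := sum_mul_ind (fun _ : V => (1 : ℝ)) (endp η u as)
        simpa using this
      · simp
    have h4 : (1 : ℝ) ≤ pl Q η i u (fun as => if markable Q η wm as E E 1 u then 1 else 0) +
        (pl Q η i u (fun as => if ∃ c ∈ as, c ∈ touched E then 1 else 0) +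
        pl Q η i u (fun as => if wm < gw Q η as [] u then 1 else 0)) := by
      rw [← pl_add, ← pl_add]
      refine le_trans (pl_const (η := η) hQ i u 1).ge (pl_mono hQ i u fun as => ?_)
      by_cases a1 : ∃ c ∈ as, c ∈ touched E
      · rw [if_pos a1]
        have : (0 : ℝ) ≤ if markable Q η wm as E E 1 u then 1 else 0 := by split_ifs <;> norm_num
        have : (0 : ℝ) ≤ if wm < gw Q η as [] u then 1 else 0 := by split_ifs <;> norm_num
        linarith
      · by_cases a2 : wm < gw Q η as [] u
        · rw [if_pos a2, if_neg a1]
          have : (0 : ℝ) ≤ if markable Q η wm as E E 1 u then 1 else 0 := by split_ifs <;> norm_num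
          linarith
        · rw [if_pos, if_neg a1, if_neg a2]
          · norm_num
          · push Not at a1
            refine markable_of_gw_le (T := touched E) as [] E E 1 u a1 a1 subset_union_right ?_
            rw [one_mul]; exact not_lt.1 a2
    rw [e]; linarith
  · refine le_trans (sum_le_sum fun y _ => pow_le_pow_left₀ (hν0 y) ?_ 2) h3
    exact pl_markable_le_pn hQ wm (ind_nonneg y) i E E 1 u

open Classical in
/-- From every starting point, most of the mass after `m` crossings sits at points from which
the walk spreads out. -/
lemma pr_spread_le [Nonempty V] (hQ : IsDS Q) {a qm : ℝ} (ha : 0 ≤ a) (hq : ∀ u v, Q u v ≤ qm)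
    (x : V) (m i L : ℕ) {wm d1 d2 θ T c : ℝ} (hwm : 0 ≤ wm) (hd2 : 0 < d2) (hθ : 0 < θ)
    (hT : 0 < T) (hc : 0 < c)
    (hcn : c ≤ (nV : ℝ) - 2 * ((L + 1) * (m + 2 * i) + 2 * i + 2 : ℕ) - 1) :
    pr (fun η => (Contr Q a η ∧
        ∀ u, pl Q η i u (fun as => if wm < gw Q η as [] u then 1 else 0) ≤ d1) ∧
        T < Kpow Q η m (fun u => if SpreadAt Q η i (d1 + d2) θ u then 0 else 1) x) ≤
      ((((L * (m + 2 * i) : ℕ) * (∑ j ∈ range i, 2 * kap nV qm a (m + j)) +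
        ∑ l ∈ range m, ∑ j ∈ range i, 2 * kap nV qm a (l + j)) / d2 +
        4 ^ i * (wm + i * (2 ^ i * (4 * ((L + 1) * (m + 2 * i) + 2 * i + 2 : ℕ) + 1) / c)) / θ)
          / T) ^ L := by
  set n : ℝ := (nV : ℝ) with hn
  set ℓ : ℕ := (L + 1) * (m + 2 * i) + 2 * i + 2 with hℓ
  have hqm := (hQ.nonneg x x).trans (hq x x)
  have hk := kap_nonneg (Nat.cast_nonneg nV) hqm ha
  set β : ℝ := ((L * (m + 2 * i) : ℕ) * (∑ j ∈ range i, 2 * kap n qm a (m + j)) +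
        ∑ l ∈ range m, ∑ j ∈ range i, 2 * kap n qm a (l + j)) / d2 with hβdef
  set γ : ℝ := 4 ^ i * (wm + i * (2 ^ i * (4 * (ℓ : ℕ) + 1) / c)) / θ with hγdef
  have hkk : ∀ l, 0 ≤ ∑ j ∈ range i, 2 * kap n qm a (l + j) := fun l =>
    sum_nonneg fun j _ => mul_nonneg two_pos.le (hk _)
  have hβ : 0 ≤ β := div_nonneg (add_nonneg (mul_nonneg (Nat.cast_nonneg _) (hkk m))
    (sum_nonneg fun l _ => hkk l)) hd2.le
  have hγ : 0 ≤ γ := by rw [hγdef]; positivity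
  set D : (V → V) → V → ℝ := fun η u => if SpreadAt Q η i (d1 + d2) θ u then 0 else 1 with hD
  have hD0 : ∀ η u, 0 ≤ D η u := fun η u => by simp only [hD]; split_ifs <;> norm_num
  refine pr_le_of_card_le (pow_nonneg (div_nonneg (add_nonneg hβ hγ) hT.le) _) ?_
  have h := card_le_of_replica (fun η => IsPM η ∧ Contr Q a η ∧
        ∀ u, pl Q η i u (fun as => if wm < gw Q η as [] u then 1 else 0) ≤ d1)
    (fun η => Kpow Q η m (D η) x) (fun η => Kpow_nonneg hQ _ (hD0 η) x) hβ hγ hT (m + 2 * i) L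
    (fun E η => rev Q η (fun E' u => ∑ z ∈ {θ⁻¹}, z * ∑ y, pn Q η wm (ind y) i E' E' 1 u ^ 2) m E x)
    ?_ ?_ ?_
  · refine le_trans (Nat.cast_le.2 (card_le_card fun η hη => ?_)) h
    simp only [mem_filter] at hη ⊢
    exact ⟨hη.1, ⟨mem_matchings.1 hη.1, hη.2.1⟩, hη.2.2⟩
  · intro E hE η hη ⟨hpm, hcon, hgw⟩
    set ψ : V × V → V → ℝ := fun p u => d2⁻¹ * ∑ j ∈ range i,
      Kpow Q η j (fun u => Q u p.1 + Q u p.2) u with hψdef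
    have hψ : ∀ l (p : V × V) u, Kpow Q η l (ψ p) u
        ≤ d2⁻¹ * ∑ j ∈ range i, 2 * kap n qm a (l + j) := by
      intro l p u
      simp only [hψdef]
      rw [Kpow_mul, Kpow_sum]
      refine mul_le_left (sum_le_sum fun j _ => ?_) (inv_nonneg.2 hd2.le)
      have e : Kpow Q η l (Kpow Q η j fun u => Q u p.1 + Q u p.2) u
          = Kpow Q η (l + j) (fun u => Q u p.1 + Q u p.2) u := by rw [Kpow_add]
      refine le_trans (le_of_eq e) ?_
      rw [Kpow_add_fun]
      have h1 := hcon.entry_le hQ ha hq (l + j) p.1 u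
      have h2 := hcon.entry_le hQ ha hq (l + j) p.2 u
      simp only
      linarith
    rw [← rev_fun (D η) m E x]
    have h1 : ∀ (E' : Pairs) u, D η u ≤ (E'.map fun p => ψ p u).sum +
          ∑ z ∈ {θ⁻¹}, z * ∑ y, pn Q η wm (ind y) i E' E' 1 u ^ 2 := by
      intro E' u
      rw [sum_singleton]
      set hit := pl Q η i u (fun as => if ∃ c ∈ as, c ∈ touched E' then 1 else 0) with hhit
      have hhit0 : 0 ≤ hit := pl_nonneg hQ i u fun as => by split_ifs <;> norm_num
      have hS0 : 0 ≤ ∑ y, pn Q η wm (ind y) i E' E' 1 u ^ 2 := sum_nonneg fun y _ => sq_nonneg _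
      have h2 : hit ≤ (E'.map fun p => ∑ j ∈ range i,
          Kpow Q η j (fun u => Q u p.1 + Q u p.2) u).sum := by
        refine (pl_hit_le hQ (touched E') i u).trans ?_
        rw [sum_comm]
        refine (sum_touched_le (f := fun v => ∑ j ∈ range i, Kpow Q η j (fun u => Q u v) u)
          (fun v => sum_nonneg fun j _ => Kpow_nonneg hQ j (fun u => hQ.nonneg u v) u)
          E').trans (le_of_eq ?_)
        congr 1
        refine List.map_congr_left fun p _ => ?_
        rw [← sum_add_distrib]
        refine sum_congr rfl fun j _ => ?_
        rw [Kpow_add_fun]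
      have e : (E'.map fun p => ψ p u).sum = d2⁻¹ * (E'.map fun p => ∑ j ∈ range i,
          Kpow Q η j (fun u => Q u p.1 + Q u p.2) u).sum := by
        rw [← List.sum_map_mul_left]
      rw [e]
      have h3 := mul_le_left h2 (inv_nonneg.2 hd2.le)
      have h4 : 0 ≤ θ⁻¹ * ∑ y, pn Q η wm (ind y) i E' E' 1 u ^ 2 := by positivity
      have h5 : 0 ≤ d2⁻¹ * hit := by positivity
      simp only [hD]
      split_ifs with hs
      · linarith
      by_cases c1 : hit ≤ d2
      · by_cases c2 : ∑ y, pn Q η wm (ind y) i E' E' 1 u ^ 2 ≤ θ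
        · exact absurd (spreadAt_of_pn hQ (hgw u) c1 c2) hs
        · have : 1 ≤ θ⁻¹ * ∑ y, pn Q η wm (ind y) i E' E' 1 u ^ 2 := by
            rw [inv_mul_eq_div, le_div_iff₀ hθ]; linarith
          linarith
      · have : 1 ≤ d2⁻¹ * hit := by rw [inv_mul_eq_div, le_div_iff₀ hd2]; linarith
        linarith
    refine (rev_mono hQ m hη (fun E' u _ _ => h1 E' u) x).trans ?_
    rw [rev_add]
    refine add_le_add_left ?_ _
    refine (rev_list_sum_le hQ ψ _ hψ m E x).trans ?_
    rw [hβdef, add_div]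
    refine add_le_add ?_ (le_of_eq ?_)
    · refine (list_sum_map_le E _ fun p => hψ m p x).trans ?_
      have : (E.length : ℝ) ≤ (L * (m + 2 * i) : ℕ) := Nat.cast_le.2 hE
      refine (mul_le_right this (mul_nonneg (inv_nonneg.2 hd2.le) (hkk m))).trans (le_of_eq ?_)
      rw [div_eq_mul_inv]; ring
    · rw [← mul_sum, div_eq_mul_inv, mul_comm]
  · intro E _
    rw [show m + 2 * i = (i + i) + m by ring]
    refine isCert_rev hQ (fun η E' u => ∑ z ∈ {θ⁻¹}, z * ∑ y, pn Q η wm (ind y) i E' E' 1 u ^ 2)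
      m (i + i) E x fun E' u _ => ?_
    simp_rw [sum_singleton]
    have := IsCert.sum (E := E') (N := i + i) (q := fun _ : Unit => θ⁻¹) univ
      (fun _ => inv_nonneg.2 hθ.le) (Z := fun _ η => ∑ y, pn Q η wm (ind y) i E' E' 1 u ^ 2)
      fun _ => isCert_pn_sq hQ i E' E' E' 1 u
    simpa using this
  · intro E hE
    refine sum_rev_le hQ (fun η E' u => ∑ z ∈ {θ⁻¹}, z * ∑ y, pn Q η wm (ind y) i E' E' 1 u ^ 2)
      m E x fun E' u hE' => ?_
    simp_rw [sum_singleton]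
    rw [← mul_sum]
    have := sum_pn_sq_le hQ hc hcn hwm i i le_rfl E' E' 1 u (fun v hv => hv) zero_le_one
      (by rw [hE', hℓ]; nlinarith)
    rw [one_mul, one_mul] at this
    rw [hγdef, inv_mul_eq_div, div_le_iff₀ hθ]
    refine this.trans (le_of_eq ?_)
    field_simp

def info (Q : V → V → ℝ) (u a : V) : ℝ := -log (Q u a)

def ent (Q : V → V → ℝ) (u : V) : ℝ := ∑ a, Q u a * info Q u a

def tot (Q : V → V → ℝ) (η : V → V) : List V → V → ℝ
  | [], _ => 0
  | a :: as, u => info Q u a + tot Q η as (η a)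

/-- Information along the crossings which contribute to `gw`. -/
def gi (Q : V → V → ℝ) (η : V → V) : List V → Pairs → V → ℝ
  | [], _, _ => 0
  | a :: as, O, u => (if a ∉ touched O ∧ a ∉ as ∧ η a ∉ as then info Q u a else 0) +
      gi Q η as ((a, η a) :: O) (η a)

lemma IsDS.le_one (hQ : IsDS Q) (u a : V) : Q u a ≤ 1 := by
  rw [← hQ.row u]
  exact single_le_sum (fun b _ => hQ.nonneg u b) (mem_univ a)

lemma info_nonneg (hQ : IsDS Q) (u a : V) : 0 ≤ info Q u a :=
  neg_nonneg.2 (log_nonpos (hQ.nonneg u a) (hQ.le_one u a))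

lemma ent_nonneg (hQ : IsDS Q) (u : V) : 0 ≤ ent Q u :=
  sum_nonneg fun a _ => mul_nonneg (hQ.nonneg u a) (info_nonneg hQ u a)

lemma tot_nonneg (hQ : IsDS Q) (as : List V) : ∀ u, 0 ≤ tot Q η as u := by
  induction as with
  | nil => intro u; exact le_rfl
  | cons a as ih => intro u; exact add_nonneg (info_nonneg hQ u a) (ih _)

lemma log_gw (as : List V) : ∀ (O : Pairs) (u : V), gw Q η as O u ≠ 0 →
    log (gw Q η as O u) = -gi Q η as O u := by
  induction as with
  | nil => intro O u _; simp [gw, gi]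
  | cons a as ih =>
    intro O u h
    rw [gw] at h
    have h1 := left_ne_zero_of_mul h
    have h2 := right_ne_zero_of_mul h
    rw [gw, gi, log_mul h1 h2, ih _ _ h2]
    split_ifs
    · simp only [info]; ring
    · simp

lemma mul_info_le (hQ : IsDS Q) (u a : V) : Q u a * info Q u a ≤ 2 * √(Q u a) := by
  rcases (hQ.nonneg u a).eq_or_lt with h | h
  · simp [← h]
  have hs := sqrt_pos.2 h
  have h1 := log_le_sub_one_of_pos (inv_pos.2 hs)
  rw [log_inv, log_sqrt h.le] at h1
  have h2 : info Q u a ≤ 2 * (√(Q u a))⁻¹ := by unfold info; linarith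
  calc Q u a * info Q u a ≤ Q u a * (2 * (√(Q u a))⁻¹) := mul_le_left h2 h.le
    _ = 2 * √(Q u a) := by
        rw [← div_eq_mul_inv, mul_div_assoc', div_eq_iff hs.ne']
        nlinarith [mul_self_sqrt h.le]

lemma Kpow_sq_le (hQ : IsDS Q) (l : ℕ) (f : V → ℝ) (x : V) :
    Kpow Q η l f x ^ 2 ≤ Kpow Q η l (fun y => f y ^ 2) x := by
  induction l generalizing x with
  | zero => exact le_rfl
  | succ l ih =>
    rw [Kpow_succ, Kpow_succ]
    refine le_trans ?_ (Kop_mono hQ ih x)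
    simpa only [Kop_eq_Qop] using Qop_sq_le hQ (fun y => Kpow Q η l f (η y)) x

lemma Kpow_mul_info_le (hQ : IsDS Q) {κ : ℕ → ℝ}
    (hκ : ∀ l v x, Kpow Q η l (fun u => Q u v) x ≤ κ l) (l : ℕ) (v x : V) :
    Kpow Q η l (fun u => Q u v * info Q u v) x ≤ 2 * √(κ l) := by
  have h1 := Kpow_mono (η := η) hQ l (fun u => mul_info_le hQ u v) x
  rw [Kpow_mul] at h1
  have h2 := Kpow_sq_le (η := η) hQ l (fun u => √(Q u v)) x
  have h3 : Kpow Q η l (fun u => √(Q u v)) x ≤ √(κ l) := by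
    refine le_sqrt_of_sq_le (h2.trans ?_)
    simp only [sq_sqrt (hQ.nonneg _ _)]
    exact hκ l v x
  exact h1.trans (mul_le_left h3 zero_le_two)

lemma tot_sub_gi_cons_le (hQ : IsDS Q) (a : V) (as : List V) (O : Pairs) (u : V) :
    tot Q η (a :: as) u - gi Q η (a :: as) O u ≤ (info Q u a * (if a ∈ touched O then 1 else 0) +
        info Q u a * (if ∃ c ∈ as, c ∈ ({a, η a} : Finset V) then 1 else 0)) +
      (tot Q η as (η a) - gi Q η as ((a, η a) :: O) (η a)) := by
  have h0 := info_nonneg hQ u a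
  rw [tot, gi]
  have : info Q u a - (if a ∉ touched O ∧ a ∉ as ∧ η a ∉ as then info Q u a else 0) ≤
      info Q u a * (if a ∈ touched O then 1 else 0) +
        info Q u a * (if ∃ c ∈ as, c ∈ ({a, η a} : Finset V) then 1 else 0) := by
    by_cases h1 : a ∈ touched O
    · simp only [h1, not_true_eq_false, false_and, if_false, if_true, mul_one, sub_zero]
      split_ifs <;> simp [h0]
    · by_cases h2 : ∃ c ∈ as, c ∈ ({a, η a} : Finset V)
      · rw [if_neg h1, if_pos h2]
        split_ifs <;> simp [h0]
      · have h3 : a ∉ as ∧ η a ∉ as := by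
          push Not at h2
          exact ⟨fun h => h2 a h (by simp), fun h => h2 (η a) h (by simp)⟩
        rw [if_neg h1, if_neg h2, if_pos ⟨h1, h3⟩]
        simp
  linarith

lemma pl_tot_sub_gi_le (hQ : IsDS Q) {κ s : ℕ → ℝ} {H : ℝ} (hκ0 : ∀ l, 0 ≤ κ l)
    (hs0 : ∀ l, 0 ≤ s l) (hH : ∀ u, ent Q u ≤ H) (hH0 : 0 ≤ H)
    (hκ : ∀ l v x, Kpow Q η l (fun u => Q u v) x ≤ κ l)
    (hs : ∀ l v x, Kpow Q η l (fun u => Q u v * info Q u v) x ≤ s l) (i k : ℕ) (hki : k ≤ i)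
    (O : Pairs) (u : V) :
    pl Q η k u (fun as => tot Q η as u - gi Q η as O u) ≤ k * (2 * ∑ j ∈ range i, (H * κ j + s j)) +
      ∑ j ∈ range k, ∑ v ∈ touched O, Kpow Q η j (fun u => Q u v * info Q u v) u := by
  induction k generalizing O u with
  | zero => simp [pl, tot, gi]
  | succ k ih =>
    have hki' : k ≤ i := by omega
    set C := 2 * ∑ j ∈ range i, (H * κ j + s j) with hC
    let ψ : V → V → ℝ := fun v u => Q u v * info Q u v
    have hψ0 : ∀ v u, 0 ≤ ψ v u := fun v u => mul_nonneg (hQ.nonneg u v) (info_nonneg hQ u v)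
    have hstep : ∀ a, pl Q η k (η a) (fun as => tot Q η (a :: as) u - gi Q η (a :: as) O u) ≤
        info Q u a * (if a ∈ touched O then 1 else 0) + info Q u a * (2 * ∑ j ∈ range k, κ j) +
        (k * C + (∑ j ∈ range k, ∑ v ∈ touched O, Kpow Q η j (ψ v) (η a) +
          2 * ∑ j ∈ range k, s j)) := by
      intro a
      refine (pl_mono hQ k (η a) fun as => tot_sub_gi_cons_le hQ a as O u).trans ?_
      rw [pl_add, pl_add, pl_const hQ, pl_mul]
      have h1 : pl Q η k (η a) (fun as => if ∃ c ∈ as, c ∈ ({a, η a} : Finset V) then 1 else 0)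
          ≤ 2 * ∑ j ∈ range k, κ j := by
        refine (pl_hit_le hQ _ k (η a)).trans ?_
        rw [mul_sum]
        refine sum_le_sum fun j _ => ?_
        refine (sum_le_card_nsmul _ _ _ fun v _ => hκ j v (η a)).trans ?_
        rw [nsmul_eq_mul]
        refine mul_le_right ?_ (hκ0 j)
        exact_mod_cast card_le_two
      have h2 := ih hki' ((a, η a) :: O) (η a)
      have h3 : ∑ j ∈ range k, ∑ v ∈ touched ((a, η a) :: O), Kpow Q η j (ψ v) (η a) ≤
          ∑ j ∈ range k, ∑ v ∈ touched O, Kpow Q η j (ψ v) (η a) +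
          2 * ∑ j ∈ range k, s j := by
        rw [mul_sum, ← sum_add_distrib]
        refine sum_le_sum fun j _ => ?_
        have hp : ∀ v, 0 ≤ Kpow Q η j (ψ v) (η a) := fun v => Kpow_nonneg hQ j (hψ0 v) _
        have hins : ∀ (b : V) (S : Finset V), ∑ v ∈ insert b S, Kpow Q η j (ψ v) (η a) ≤
            s j + ∑ v ∈ S, Kpow Q η j (ψ v) (η a) := by
          intro b S
          by_cases hb : b ∈ S
          · rw [insert_eq_of_mem hb]; linarith [hs0 j]
          · rw [sum_insert hb]
            have := hs j b (η a)
            simp only [ψ]; linarith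
        rw [touched_cons_eq]
        linarith [hins a (insert (η a) (touched O)), hins (η a) (touched O)]
      have h4 := mul_le_left h1 (info_nonneg hQ u a)
      linarith
    have hsum : pl Q η (k + 1) u (fun as => tot Q η as u - gi Q η as O u) ≤
        ∑ a, Q u a * (info Q u a * (if a ∈ touched O then 1 else 0) +
          info Q u a * (2 * ∑ j ∈ range k, κ j) +
        (k * C + (∑ j ∈ range k, ∑ v ∈ touched O, Kpow Q η j (ψ v) (η a) +
          2 * ∑ j ∈ range k, s j))) :=
      sum_le_sum fun a _ => mul_le_left (hstep a) (hQ.nonneg u a)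
    refine hsum.trans ?_
    have e1 : ∑ a, Q u a * (info Q u a * (if a ∈ touched O then 1 else 0) +
          info Q u a * (2 * ∑ j ∈ range k, κ j) +
        (k * C + (∑ j ∈ range k, ∑ v ∈ touched O, Kpow Q η j (ψ v) (η a) +
          2 * ∑ j ∈ range k, s j))) =
        ∑ v ∈ touched O, ψ v u + ent Q u * (2 * ∑ j ∈ range k, κ j) + k * C +
        ∑ j ∈ range k, ∑ v ∈ touched O, Kpow Q η (j + 1) (ψ v) u + 2 * ∑ j ∈ range k, s j := by
      have e2 : ∑ j ∈ range k, ∑ v ∈ touched O, Kpow Q η (j + 1) (ψ v) u =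
          ∑ a, Q u a * ∑ j ∈ range k, ∑ v ∈ touched O, Kpow Q η j (ψ v) (η a) := by
        simp_rw [Kpow_succ, Kop, mul_sum]
        rw [sum_comm (s := univ)]
        exact sum_congr rfl fun j _ => sum_comm
      have e3 : ∑ v ∈ touched O, ψ v u =
          ∑ a, Q u a * (info Q u a * (if a ∈ touched O then 1 else 0)) := by
        rw [sum_mem_eq (touched O)]
        exact sum_congr rfl fun a _ => by simp only [ψ]; split_ifs <;> ring
      have e4 : ent Q u * (2 * ∑ j ∈ range k, κ j) =
          ∑ a, Q u a * (info Q u a * (2 * ∑ j ∈ range k, κ j)) := by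
        rw [ent, sum_mul]; exact sum_congr rfl fun a _ => by ring
      have e5 : k * C = ∑ a, Q u a * (k * C) := by rw [← sum_mul, hQ.row, one_mul]
      have e6 : 2 * ∑ j ∈ range k, s j = ∑ a, Q u a * (2 * ∑ j ∈ range k, s j) := by
        rw [← sum_mul, hQ.row, one_mul]
      rw [e2, e3, e4]
      conv_rhs => rw [e5, e6]
      simp only [← sum_add_distrib]
      exact sum_congr rfl fun a _ => by ring
    rw [e1, sum_range_succ']
    have hκk : 0 ≤ ∑ j ∈ range k, κ j := sum_nonneg fun j _ => hκ0 j
    have hsub := range_subset_range.2 hki'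
    have f1 : ent Q u * (2 * ∑ j ∈ range k, κ j) ≤ 2 * (H * ∑ j ∈ range k, κ j) := by
      nlinarith [mul_le_right (hH u) hκk]
    have f2 : 2 * (H * ∑ j ∈ range k, κ j) + 2 * ∑ j ∈ range k, s j ≤ C := by
      rw [← mul_add, mul_sum, ← sum_add_distrib]
      refine mul_le_left ?_ zero_le_two
      exact sum_le_sum_of_subset_of_nonneg hsub fun j _ _ =>
        add_nonneg (mul_nonneg hH0 (hκ0 j)) (hs0 j)
    simp only [Kpow_zero]
    push_cast
    linarith

lemma pl_tot_variance_le (hQ : IsDS Q) {hb H H2 δ : ℝ} {m k : ℕ} (hH : ∀ u, ent Q u ≤ H)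
    (hH2 : ∀ u, ∑ a, Q u a * info Q u a ^ 2 ≤ H2) (hδ0 : 0 ≤ δ) (hδ1 : δ ≤ 1) (hb0 : 0 ≤ hb)
    (hbH : hb ≤ H) (hm1 : 1 ≤ m)
    (hm : ∀ j, m ≤ j → ∀ v, |Kpow Q η j (ent Q) v - hb| ≤ δ * hb)
    (hmk : m * H ≤ δ * (k * hb)) (hc2 : H2 ≤ δ * (k * hb ^ 2)) (u : V) :
    pl Q η k u (fun as => (tot Q η as u - k * hb) ^ 2) ≤ 22 * δ * (k * hb) ^ 2 := by
  have key := variance_le_of_averaging (η := η) hQ (h := ent Q)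
    (e := fun j u => pl Q η j u (fun as => tot Q η as u))
    (q := fun j u => pl Q η j u (fun as => tot Q η as u ^ 2)) (ent_nonneg hQ) hH hδ0 hδ1 hb0 hbH
    hm1 hm (c2 := H2) (k := k) (fun v => rfl) ?_ (fun v => by simp [pl, tot]) ?_ hmk hc2 u
  · refine le_trans (le_of_eq ?_) key
    have : (fun as => (tot Q η as u - k * hb) ^ 2) =
        fun as => (tot Q η as u ^ 2 + (-(2 * (k * hb))) * tot Q η as u) + (k * hb) ^ 2 := by
      funext as; ring
    rw [this, pl_add, pl_add, pl_mul, pl_const hQ]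
    ring
  · intro j u
    change ∑ a, Q u a * pl Q η j (η a) (fun as => info Q u a + tot Q η as (η a)) = _
    simp only [pl_add, pl_const hQ, mul_add, sum_add_distrib]
    rfl
  · intro j u M _ hM
    change ∑ a, Q u a * pl Q η j (η a) (fun as => (info Q u a + tot Q η as (η a)) ^ 2) ≤ _
    have e : ∀ a, pl Q η j (η a) (fun as => (info Q u a + tot Q η as (η a)) ^ 2) =
        info Q u a ^ 2 + 2 * info Q u a * pl Q η j (η a) (fun as => tot Q η as (η a)) +
          pl Q η j (η a) (fun as => tot Q η as (η a) ^ 2) := by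
      intro a
      have : (fun as => (info Q u a + tot Q η as (η a)) ^ 2) =
          fun as => info Q u a ^ 2 + 2 * info Q u a * tot Q η as (η a) + tot Q η as (η a) ^ 2 := by
        funext as; ring
      rw [this, pl_add, pl_add, pl_mul, pl_const hQ]
    have le : ∑ a, Q u a * pl Q η j (η a) (fun as => (info Q u a + tot Q η as (η a)) ^ 2) ≤
        ∑ a, (Q u a * info Q u a ^ 2 + 2 * (Q u a * info Q u a) * M +
          Q u a * pl Q η j (η a) (fun as => tot Q η as (η a) ^ 2)) := by
      refine sum_le_sum fun a _ => ?_
      rw [e]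
      have := mul_le_left (hM (η a)) (mul_nonneg (hQ.nonneg u a) (info_nonneg hQ u a))
      linarith
    refine le.trans ?_
    rw [sum_add_distrib, sum_add_distrib, ← sum_mul, ← mul_sum]
    have := hH2 u
    simp only [Kop, ent]
    linarith

open Classical in
/-- With high quenched probability the information is close to its mean. -/
lemma pl_tot_dev_le (hQ : IsDS Q) {hb H H2 δ y : ℝ} {m k : ℕ} (hH : ∀ u, ent Q u ≤ H)
    (hH2 : ∀ u, ∑ a, Q u a * info Q u a ^ 2 ≤ H2) (hδ0 : 0 ≤ δ) (hδ1 : δ ≤ 1) (hb0 : 0 ≤ hb)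
    (hbH : hb ≤ H) (hm1 : 1 ≤ m)
    (hm : ∀ j, m ≤ j → ∀ v, |Kpow Q η j (ent Q) v - hb| ≤ δ * hb)
    (hmk : m * H ≤ δ * (k * hb)) (hc2 : H2 ≤ δ * (k * hb ^ 2)) (hy : 0 < y) (u : V) :
    pl Q η k u (fun as => if y ≤ |tot Q η as u - k * hb| then 1 else 0) ≤
      22 * δ * (k * hb) ^ 2 / y ^ 2 := by
  rw [le_div_iff₀ (by positivity), mul_comm, ← pl_mul]
  refine (pl_mono hQ k u fun as => ?_).trans
    (pl_tot_variance_le hQ hH hH2 hδ0 hδ1 hb0 hbH hm1 hm hmk hc2 u)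
  split_ifs with h
  · rw [mul_one, ← sq_abs (tot Q η as u - k * hb)]
    exact pow_le_pow_left₀ hy.le h 2
  · rw [mul_zero]; exact sq_nonneg _

open Classical in
/-- Quenched bound for the probability that the new crossings carry little information. -/
lemma pl_gw_gt_le (hQ : IsDS Q) {κ : ℕ → ℝ} {hb H H2 δ y wm : ℝ} {m k : ℕ} (hκ0 : ∀ l, 0 ≤ κ l)
    (hκ : ∀ l v x, Kpow Q η l (fun u => Q u v) x ≤ κ l) (hH : ∀ u, ent Q u ≤ H)
    (hH2 : ∀ u, ∑ a, Q u a * info Q u a ^ 2 ≤ H2) (hδ0 : 0 ≤ δ) (hδ1 : δ ≤ 1) (hb0 : 0 ≤ hb)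
    (hbH : hb ≤ H) (hm1 : 1 ≤ m)
    (hm : ∀ j, m ≤ j → ∀ v, |Kpow Q η j (ent Q) v - hb| ≤ δ * hb)
    (hmk : m * H ≤ δ * (k * hb)) (hc2 : H2 ≤ δ * (k * hb ^ 2)) (hy : 0 < y) (hwm : 0 < wm)
    (hgap : -log wm + 2 * y ≤ k * hb) (u : V) :
    pl Q η k u (fun as => if wm < gw Q η as [] u then 1 else 0) ≤ 22 * δ * (k * hb) ^ 2 / y ^ 2 +
        k * (2 * ∑ j ∈ range k, (H * κ j + 2 * √(κ j))) / y := by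
  have hbad := pl_tot_sub_gi_le (η := η) hQ (s := fun l => 2 * √(κ l)) hκ0
    (fun l => by positivity) hH (hb0.trans hbH) hκ (Kpow_mul_info_le hQ hκ) k k le_rfl [] u
  have h2 : pl Q η k u (fun as => y⁻¹ * (tot Q η as u - gi Q η as [] u)) ≤
      k * (2 * ∑ j ∈ range k, (H * κ j + 2 * √(κ j))) / y := by
    rw [pl_mul, div_eq_inv_mul]
    refine mul_le_left (hbad.trans ?_) (inv_nonneg.2 hy.le)
    simp [touched]
  have h1 := pl_tot_dev_le (η := η) hQ hH hH2 hδ0 hδ1 hb0 hbH hm1 hm hmk hc2 hy u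
  refine le_trans ?_ (add_le_add h1 h2)
  rw [← pl_add]
  refine pl_mono hQ k u fun as => ?_
  have hgi : ∀ (as : List V) (O : Pairs) (u : V), gi Q η as O u ≤ tot Q η as u := by
    intro as
    induction as with
    | nil => intro O u; exact le_rfl
    | cons a as ih =>
      intro O u
      rw [gi, tot]
      refine add_le_add ?_ (ih _ _)
      split_ifs
      exacts [le_rfl, info_nonneg hQ u a]
  have hnn := mul_nonneg (inv_nonneg.2 hy.le) (sub_nonneg.2 (hgi as [] u))
  by_cases hw : wm < gw Q η as [] u
  · rw [if_pos hw]
    have h3 := log_le_log hwm hw.le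
    rw [log_gw as [] u (hwm.trans hw).ne'] at h3
    by_cases h4 : y ≤ |tot Q η as u - k * hb|
    · rw [if_pos h4]; linarith
    · rw [if_neg h4, zero_add]
      have h5 := (abs_lt.1 (not_le.1 h4)).1
      rw [← div_eq_inv_mul, le_div_iff₀ hy]
      linarith
  · rw [if_neg hw]
    split_ifs <;> linarith

lemma sum_range_inv_sq_le (N : ℕ) : ∑ r ∈ range N, (1 : ℝ) / ((r : ℝ) + 1) ^ 2 ≤ 2 := by
  have key : ∀ N : ℕ, ∑ r ∈ range (N + 1), (1 : ℝ) / ((r : ℝ) + 1) ^ 2 ≤ 2 - 1 / ((N : ℝ) + 1) := by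
    intro N
    induction N with
    | zero => norm_num
    | succ N ih =>
      rw [sum_range_succ]
      have : 1 / ((N : ℝ) + 1 + 1) ^ 2 ≤ 1 / ((N : ℝ) + 1) - 1 / ((N : ℝ) + 1 + 1) := by
        rw [div_sub_div _ _ (by positivity) (by positivity), div_le_div_iff₀
          (by positivity) (by positivity)]
        nlinarith
      push_cast
      linarith
  rcases N with _ | N
  · simp
  · refine (key N).trans ?_
    have : (0 : ℝ) ≤ 1 / ((N : ℝ) + 1) := by positivity
    linarith

/-- Summability of inverse powers of the distance under polynomial growth. -/
lemma sum_inv_pow_dist_le {C0 : ℝ} {D0 : ℕ}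
    (hball : ∀ (x : V) (r : ℕ), ((gball G x r).card : ℝ) ≤ C0 * ((r : ℝ) + 1) ^ D0) (u : V) :
    ∑ v, (1 : ℝ) / ((G.dist u v : ℝ) + 1) ^ (D0 + 2) ≤ 2 * C0 := by
  obtain ⟨N, hN⟩ : ∃ N, ∀ v, G.dist u v < N := ⟨univ.sup (fun v => G.dist u v) + 1, fun v =>
      Nat.lt_succ_of_le (le_sup (f := fun v => G.dist u v) (mem_univ v))⟩
  have hC0 : 0 ≤ C0 := by
    have := hball u 0
    simp only [Nat.cast_zero, zero_add, one_pow, mul_one] at this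
    exact (Nat.cast_nonneg _).trans this
  rw [← sum_fiberwise_of_maps_to (t := range N) (g := fun v => G.dist u v)
    (fun v _ => mem_range.2 (hN v))]
  calc ∑ r ∈ range N, ∑ v ∈ univ.filter (fun v => G.dist u v = r),
        (1 : ℝ) / ((G.dist u v : ℝ) + 1) ^ (D0 + 2)
      ≤ ∑ r ∈ range N, C0 * (1 / ((r : ℝ) + 1) ^ 2) := by
        refine sum_le_sum fun r _ => ?_
        have e : ∑ v ∈ univ.filter (fun v => G.dist u v = r),
            (1 : ℝ) / ((G.dist u v : ℝ) + 1) ^ (D0 + 2) =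
            ((univ.filter (fun v => G.dist u v = r)).card : ℝ) *
              (1 / ((r : ℝ) + 1) ^ (D0 + 2)) := by
          rw [← nsmul_eq_mul, ← sum_const]
          exact sum_congr rfl fun v hv => by rw [(mem_filter.1 hv).2]
        have hc : ((univ.filter (fun v => G.dist u v = r)).card : ℝ) ≤ C0 * ((r : ℝ) + 1) ^ D0 := by
          refine le_trans (Nat.cast_le.2 (card_le_card fun v hv => ?_)) (hball u r)
          rw [mem_gball]; exact (mem_filter.1 hv).2.le
        rw [e]
        refine (mul_le_right hc (by positivity)).trans (le_of_eq ?_)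
        rw [pow_add]
        field_simp
    _ ≤ 2 * C0 := by
        rw [← mul_sum]
        nlinarith [sum_range_inv_sq_le N]

lemma mul_log_sq_le {q w : ℝ} (hq : 0 ≤ q) (hq1 : q ≤ 1) (hw : 0 < w) :
    q * log q ^ 2 ≤ q * (2 * log w) ^ 2 + 16 * w := by
  rcases hq.eq_or_lt with h | h
  · rw [← h]; simp [hw.le]
  rcases le_or_gt (w ^ 2) q with h1 | h1
  · have h2 := log_le_log (by positivity) h1
    rw [log_pow] at h2
    push_cast at h2
    have h3 := log_nonpos hq hq1
    have h4 : log q ^ 2 ≤ (2 * log w) ^ 2 := by nlinarith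
    nlinarith
  · have hs := sqrt_pos.2 (sqrt_pos.2 h)
    have h2 := log_le_sub_one_of_pos (inv_pos.2 hs)
    rw [log_inv, log_sqrt (sqrt_nonneg q), log_sqrt hq] at h2
    have h3 : -log q ≤ 4 * (√(√q))⁻¹ := by linarith
    have h3' : 0 ≤ -log q := by linarith [log_nonpos hq hq1]
    have h4 : log q ^ 2 ≤ 16 * (√q)⁻¹ := by
      have := pow_le_pow_left₀ h3' h3 2
      rw [mul_pow, inv_pow, sq_sqrt (sqrt_nonneg q), neg_sq] at this
      linarith
    have h5 : q * (16 * (√q)⁻¹) = 16 * √q := by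
      have := mul_self_sqrt hq
      field_simp
      nlinarith [sqrt_pos.2 h]
    have h6 := sqrt_le_iff.2 ⟨hw.le, h1.le⟩
    have h7 := mul_le_left h4 hq
    nlinarith [mul_nonneg hq (sq_nonneg (2 * log w))]

lemma log_add_one_sq_le {ε d : ℝ} (hε : 0 < ε) (hε1 : ε ≤ 1) (hd : 0 ≤ d) :
    log (d + 1) ^ 2 ≤ 2 * log (1 / ε) ^ 2 + 8 * (ε * d) := by
  have h0 : 0 ≤ log (d + 1) := log_nonneg (by linarith)
  have hεd : 0 ≤ ε * d := by positivity
  have h1 : log (d + 1) ≤ log (1 / ε) + log (1 + ε * d) := by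
    rw [← log_mul (by positivity) (by positivity)]
    refine log_le_log (by linarith) ?_
    rw [mul_add, ← mul_assoc, one_div, inv_mul_cancel₀ hε.ne', one_mul, mul_one]
    have : 1 ≤ ε⁻¹ := (one_le_inv₀ hε).2 hε1
    linarith
  have h2 : log (1 + ε * d) ^ 2 ≤ 4 * (ε * d) := by
    have h3 := log_le_sub_one_of_pos (sqrt_pos.2 (show 0 < 1 + ε * d by linarith))
    rw [log_sqrt (by linarith)] at h3
    have h4 : 0 ≤ log (1 + ε * d) := log_nonneg (by linarith)
    have h5 : (√(1 + ε * d) - 1) ^ 2 ≤ ε * d := by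
      have := sq_sqrt (show 0 ≤ 1 + ε * d by linarith)
      have : 1 ≤ √(1 + ε * d) := one_le_sqrt.2 (by linarith)
      nlinarith
    nlinarith
  nlinarith [sq_nonneg (log (1 / ε) - log (1 + ε * d))]

lemma sum_gQ_info_sq_le {Δ C0 : ℝ} {D0 : ℕ} (hε : 0 < ε) (hε1 : ε ≤ 1) (hconn : G.Connected)
    (hΔ : ∀ x, dg G x ≤ Δ)
    (hball : ∀ (x : V) (r : ℕ), ((gball G x r).card : ℝ) ≤ C0 * ((r : ℝ) + 1) ^ D0) (u : V) :
    ∑ a, Qε u a * info Qε u a ^ 2 ≤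
      (2 * (D0 + 2)) ^ 2 * (2 * log (1 / ε) ^ 2 + 8 * Δ) + 32 * C0 := by
  have hQ := gQ_isDS G hε
  have hpt : ∀ a, Qε u a * info Qε u a ^ 2 ≤
      (2 * (D0 + 2)) ^ 2 * (Qε u a * (2 * log (1 / ε) ^ 2) +
        8 * ε * (Qε u a * (G.dist u a : ℝ))) +
      16 * (1 / ((G.dist u a : ℝ) + 1) ^ (D0 + 2)) := by
    intro a
    have hd : (0 : ℝ) ≤ G.dist u a := Nat.cast_nonneg _
    have h1 := mul_log_sq_le (hQ.nonneg u a) (hQ.le_one u a)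
      (w := 1 / ((G.dist u a : ℝ) + 1) ^ (D0 + 2)) (by positivity)
    have h2 := log_add_one_sq_le hε hε1 hd
    rw [info, neg_sq]
    refine h1.trans (add_le_add_left ?_ _)
    rw [one_div, log_inv, log_pow]
    push_cast
    have h3 : (2 * -(((D0 : ℝ) + 2) * log ((G.dist u a : ℝ) + 1))) ^ 2 =
        (2 * (D0 + 2)) ^ 2 * log ((G.dist u a : ℝ) + 1) ^ 2 := by ring
    rw [h3]
    have h4 := mul_le_left h2 (mul_nonneg (sq_nonneg (2 * ((D0 : ℝ) + 2))) (hQ.nonneg u a))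
    linarith
  refine (sum_le_sum fun a _ => hpt a).trans ?_
  rw [sum_add_distrib, ← mul_sum, sum_add_distrib, ← sum_mul, hQ.row, ← mul_sum, ← mul_sum, one_mul]
  have h1 := sum_gQ_dist_le G hε hconn hΔ u
  have h2 : 8 * ε * ∑ a, Qε u a * (G.dist u a : ℝ) ≤ 8 * Δ := by
    rw [le_div_iff₀ hε] at h1; linarith
  have h3 := sum_inv_pow_dist_le hball u
  have h4 : (0 : ℝ) ≤ (2 * (D0 + 2)) ^ 2 := sq_nonneg _
  have h5 := mul_le_left h2 h4
  linarith

lemma ent_sq_le {Q : V → V → ℝ} (hQ : IsDS Q) (u : V) :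
    ent Q u ^ 2 ≤ ∑ a, Q u a * info Q u a ^ 2 := Qop_sq_le hQ (fun a => info Q u a) u

lemma le_ent {Q : V → V → ℝ} (hQ : IsDS Q) {qm : ℝ} (hq : ∀ u v, Q u v ≤ qm) (u : V) :
    -log qm ≤ ent Q u := by
  have : ∑ a, Q u a * -log qm ≤ ent Q u := by
    refine sum_le_sum fun a _ => ?_
    rcases (hQ.nonneg u a).eq_or_lt with h | h
    · simp [← h]
    · exact mul_le_left (neg_le_neg (log_le_log h (hq u a))) h.le
  rwa [← sum_mul, hQ.row, one_mul] at this

section Time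
variable (G) (ε) (η : V → V)

def Aop (f : V → ℝ) (x : V) : ℝ := adjSum G f x / (dg G x + ε)

def Bop (f : V → ℝ) (x : V) : ℝ := ε * f (η x) / (dg G x + ε)

/-- The transition operator of the walk on the augmented graph. -/
def Pop (f : V → ℝ) (x : V) : ℝ := Aop G ε f x + Bop G ε η f x

def Pit (t : ℕ) (f : V → ℝ) : V → ℝ := (Pop G ε η)^[t] f

/-- Green operator of the walk killed at the first crossing of a matching edge. -/
def Nop (f : V → ℝ) (x : V) : ℝ := ε⁻¹ * Qop Qε (fun y => (dg G y + ε) * f y) x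

def crossMean : V → ℝ := Nop G ε fun _ => 1

def crossSum : ℕ → V → ℝ
  | 0, _ => 0
  | J + 1, x => crossMean G ε x + Kop Qε η (crossSum J) x

def crossSq : ℕ → V → ℝ
  | 0, _ => 0
  | J + 1, x => Nop G ε (fun y => 2 * crossSum G ε η (J + 1) y - 1) x + Kop Qε η (crossSq J) x

/-- Mean square deviation of the time of the `J`-th crossing from `c`. -/
def crossDev (J : ℕ) (c : ℝ) (x : V) : ℝ := crossSq G ε η J x - 2 * c * crossSum G ε η J x + c ^ 2

/-- Probability that fewer than `J` crossings have been made by time `r`. -/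
def late : ℕ → ℕ → V → ℝ
  | 0, _, _ => 0
  | _ + 1, 0, _ => 1
  | J + 1, r + 1, x => Aop G ε (late (J + 1) r) x + Bop G ε η (late J r) x

variable {G ε η}

lemma Aop_mono (hε : 0 < ε) {f g : V → ℝ} (h : ∀ x, f x ≤ g x) (x : V) :
    Aop G ε f x ≤ Aop G ε g x :=
  div_le_div_of_nonneg_right (adjSum_mono h x) (add_nonneg (dg_nonneg G x) hε.le)

lemma Bop_mono (hε : 0 < ε) {f g : V → ℝ} (h : ∀ x, f x ≤ g x) (x : V) :
    Bop G ε η f x ≤ Bop G ε η g x :=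
  div_le_div_of_nonneg_right (mul_le_left (h _) hε.le) (add_nonneg (dg_nonneg G x) hε.le)

lemma Pop_mono (hε : 0 < ε) {f g : V → ℝ} (h : ∀ x, f x ≤ g x) (x : V) :
    Pop G ε η f x ≤ Pop G ε η g x := add_le_add (Aop_mono hε h x) (Bop_mono hε h x)

lemma Aop_add (f g : V → ℝ) (x : V) :
    Aop G ε (fun y => f y + g y) x = Aop G ε f x + Aop G ε g x := by
  simp only [Aop, adjSum_add, add_div]

lemma Bop_add (f g : V → ℝ) (x : V) :
    Bop G ε η (fun y => f y + g y) x = Bop G ε η f x + Bop G ε η g x := by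
  simp only [Bop, mul_add, add_div]

lemma Aop_mul (c : ℝ) (f : V → ℝ) (x : V) : Aop G ε (fun y => c * f y) x = c * Aop G ε f x := by
  simp only [Aop, adjSum_mul, mul_div_assoc]

lemma Bop_mul (c : ℝ) (f : V → ℝ) (x : V) : Bop G ε η (fun y => c * f y) x = c * Bop G ε η f x := by
  simp only [Bop]; ring

lemma Pop_const (hε : 0 < ε) (c : ℝ) (x : V) : Pop G ε η (fun _ => c) x = c := by
  have := add_pos_of_nonneg_of_pos (dg_nonneg G x) hε
  simp only [Pop, Aop, Bop, adjSum_const]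
  field_simp

lemma Pit_succ (t : ℕ) (f : V → ℝ) : Pit G ε η (t + 1) f = Pop G ε η (Pit G ε η t f) :=
  Function.iterate_succ_apply' _ _ _

lemma Nop_eq (hε : 0 < ε) (f : V → ℝ) (x : V) : Nop G ε f x = f x + Aop G ε (Nop G ε f) x := by
  have hD := add_pos_of_nonneg_of_pos (dg_nonneg G x) hε
  have h := lapEps_Qop_gQ G hε (fun y => (dg G y + ε) * f y) x
  have e : Aop G ε (Nop G ε f) x =
      ε⁻¹ * adjSum G (Qop Qε fun y => (dg G y + ε) * f y) x / (dg G x + ε) := by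
    rw [Aop, ← adjSum_mul]; rfl
  rw [e, Nop]
  rw [lapEps] at h
  field_simp
  linarith

lemma Qop_gQ_step (hε : 0 < ε) (f : V → ℝ) (x : V) : Qop Qε f x =
    ε * f x / (dg G x + ε) + Aop G ε (Qop Qε f) x := by
  have hD := add_pos_of_nonneg_of_pos (dg_nonneg G x) hε
  have h := lapEps_Qop_gQ G hε f x
  rw [lapEps] at h
  rw [Aop]
  field_simp
  linarith

lemma Kop_gQ_step (hε : 0 < ε) (f : V → ℝ) (x : V) : Kop Qε η f x =
    Bop G ε η f x + Aop G ε (Kop Qε η f) x := by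
  rw [Kop_eq_Qop, Qop_gQ_step hε]; rfl

lemma Nop_mono (hε : 0 < ε) {f g : V → ℝ} (h : ∀ x, f x ≤ g x) (x : V) :
    Nop G ε f x ≤ Nop G ε g x := by
  refine mul_le_left (sum_le_sum fun y _ => ?_) (inv_nonneg.2 hε.le)
  exact mul_le_left (mul_le_left (h y)
    (add_nonneg (dg_nonneg G y) hε.le)) ((gQ_isDS G hε).nonneg x y)

lemma Nop_const (c : ℝ) (x : V) : Nop G ε (fun _ => c) x = c * crossMean G ε x := by
  simp only [crossMean, Nop, Qop, mul_sum]
  exact sum_congr rfl fun y _ => by ring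

lemma one_le_crossMean (hε : 0 < ε) (x : V) : 1 ≤ crossMean G ε x := by
  have hQ := gQ_isDS G hε
  have : ε⁻¹ * ∑ y, Qε x y * ε ≤ crossMean G ε x := by
    refine mul_le_left (sum_le_sum fun y _ => ?_) (inv_nonneg.2 hε.le)
    exact mul_le_left (by linarith [dg_nonneg G y]) (hQ.nonneg x y)
  rw [← sum_mul, hQ.row, one_mul, inv_mul_cancel₀ hε.ne'] at this
  exact this

lemma crossSum_nonneg (hε : 0 < ε) (J : ℕ) : ∀ x, 0 ≤ crossSum G ε η J x := by
  induction J with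
  | zero => intro x; exact le_rfl
  | succ J ih =>
    intro x
    exact add_nonneg (zero_le_one.trans (one_le_crossMean hε x)) (Kop_nonneg (gQ_isDS G hε) ih x)

lemma one_le_crossSum (hε : 0 < ε) (J : ℕ) (x : V) : 1 ≤ crossSum G ε η (J + 1) x :=
  le_add_of_le_of_nonneg (one_le_crossMean hε x)
    (Kop_nonneg (gQ_isDS G hε) (crossSum_nonneg hε J) x)

lemma crossSq_nonneg (hε : 0 < ε) (J : ℕ) : ∀ x, 0 ≤ crossSq G ε η J x := by
  induction J with
  | zero => intro x; exact le_rfl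
  | succ J ih =>
    intro x
    refine add_nonneg ?_ (Kop_nonneg (gQ_isDS G hε) ih x)
    have := Nop_mono (G := G) hε (f := fun _ => 0)
      (fun y => show (0 : ℝ) ≤ 2 * crossSum G ε η (J + 1) y - 1 by
        linarith [one_le_crossSum (G := G) (η := η) hε J y]) x
    rwa [Nop_const, zero_mul] at this

lemma crossDev_succ (hε : 0 < ε) (J : ℕ) (c : ℝ) (x : V) : crossDev G ε η (J + 1) c x =
    Aop G ε (crossDev G ε η (J + 1) (c - 1)) x + Bop G ε η (crossDev G ε η J (c - 1)) x := by
  have he : crossSum G ε η (J + 1) x =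
      1 + Aop G ε (crossSum G ε η (J + 1)) x + Bop G ε η (crossSum G ε η J) x := by
    have e : Aop G ε (crossSum G ε η (J + 1)) x = Aop G ε (crossMean G ε) x +
        Aop G ε (Kop Qε η (crossSum G ε η J)) x := Aop_add _ _ x
    rw [e]
    have h1 := Nop_eq (G := G) hε (fun _ => 1) x
    have h2 := Kop_gQ_step (G := G) (η := η) hε (crossSum G ε η J) x
    change crossMean G ε x = 1 + Aop G ε (crossMean G ε) x at h1
    rw [crossSum]; linarith
  have hq : crossSq G ε η (J + 1) x = 2 * crossSum G ε η (J + 1) x - 1 +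
      Aop G ε (crossSq G ε η (J + 1)) x + Bop G ε η (crossSq G ε η J) x := by
    have e : Aop G ε (crossSq G ε η (J + 1)) x =
        Aop G ε (Nop G ε (fun y => 2 * crossSum G ε η (J + 1) y - 1)) x +
        Aop G ε (Kop Qε η (crossSq G ε η J)) x := Aop_add _ _ x
    rw [e]
    have h1 := Nop_eq (G := G) hε (fun y => 2 * crossSum G ε η (J + 1) y - 1) x
    have h2 := Kop_gQ_step (G := G) (η := η) hε (crossSq G ε η J) x
    rw [crossSq]; linarith
  have e1 : ∀ I, crossDev G ε η I (c - 1) = fun y => crossSq G ε η I y +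
      (-(2 * (c - 1)) * crossSum G ε η I y + (c - 1) ^ 2) := by
    intro I; funext y; rw [crossDev]; ring
  have h1 := Pop_const (G := G) (η := η) hε ((c - 1) ^ 2) x
  rw [Pop] at h1
  rw [e1, e1, Aop_add, Aop_add, Aop_mul, Bop_add, Bop_add, Bop_mul, crossDev]
  linear_combination hq - 2 * (c - 1) * he - h1

lemma sq_le_crossDev (hε : 0 < ε) (J : ℕ) {c : ℝ} (hc : c ≤ 0) (x : V) :
    c ^ 2 ≤ crossDev G ε η J c x := by
  have h1 := crossSq_nonneg (G := G) (η := η) hε J x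
  have h2 := crossSum_nonneg (G := G) (η := η) hε J x
  rw [crossDev]; nlinarith

lemma Pop_le_of_le (hε : 0 < ε) {f g : V → ℝ} {c : ℝ} (hf : ∀ y, c ≤ f y) (hg : ∀ y, c ≤ g y)
    (x : V) : c ≤ Aop G ε f x + Bop G ε η g x := by
  have := Pop_const (G := G) (η := η) hε c x
  rw [← this]
  exact add_le_add (Aop_mono hε hf x) (Bop_mono hε hg x)

lemma crossDev_nonneg (hε : 0 < ε) (J : ℕ) (c : ℝ) (x : V) : 0 ≤ crossDev G ε η J c x := by
  have key : ∀ (k : ℕ) (J : ℕ) (c : ℝ), c ≤ k → ∀ x, 0 ≤ crossDev G ε η J c x := fun k => by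
    induction k with
    | zero => intro J c hc x
              exact (sq_nonneg c).trans (sq_le_crossDev hε J (by simpa using hc) x)
    | succ k ih =>
      intro J c hc x
      rcases J with _ | J
      · simp only [crossDev, crossSq, crossSum]; nlinarith [sq_nonneg c]
      · rw [crossDev_succ hε]
        have hc' : c - 1 ≤ k := by push_cast at hc; linarith
        exact Pop_le_of_le hε (ih _ _ hc') (ih _ _ hc') x
  obtain ⟨k, hk⟩ := exists_nat_ge c
  exact key k J c hk x

lemma late_zero (r : ℕ) : late G ε η 0 r = fun _ => 0 := by funext x; cases r <;> rfl

lemma late_mul_le (hε : 0 < ε) (J r : ℕ) {c : ℝ} (hc : c ≤ r + 1) (x : V) :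
    late G ε η J r x * (r + 1 - c) ^ 2 ≤ crossDev G ε η J c x := by
  induction r generalizing J c x with
  | zero =>
    rcases J with _ | J
    · rw [late_zero, zero_mul]; exact crossDev_nonneg hε 0 c x
    · rw [crossDev_succ hε, late, one_mul]
      simp only [Nat.cast_zero, zero_add] at hc ⊢
      rw [show (1 - c) ^ 2 = (c - 1) ^ 2 by ring]
      exact Pop_le_of_le hε (fun y => sq_le_crossDev hε _ (by linarith) y)
        (fun y => sq_le_crossDev hε _ (by linarith) y) x
  | succ r ih =>
    rcases J with _ | J
    · rw [late_zero, zero_mul]; exact crossDev_nonneg hε 0 c x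
    · push_cast at hc ⊢
      have hc' : c - 1 ≤ r + 1 := by linarith
      rw [crossDev_succ hε, late, add_mul, mul_comm (Aop _ _ _ _), mul_comm (Bop _ _ _ _ _),
        ← Aop_mul, ← Bop_mul]
      refine add_le_add (Aop_mono hε (fun y => ?_) x) (Bop_mono hε (fun y => ?_) x)
      · have := ih (J + 1) hc' y
        rw [show (r : ℝ) + 1 - (c - 1) = r + 1 + 1 - c by ring, mul_comm] at this
        exact this
      · have := ih J hc' y
        rw [show (r : ℝ) + 1 - (c - 1) = r + 1 + 1 - c by ring, mul_comm] at this
        exact this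

lemma one_sub_late_succ (hε : 0 < ε) (J r : ℕ) (x : V) : 1 - late G ε η (J + 1) (r + 1) x =
    Aop G ε (fun y => 1 - late G ε η (J + 1) r y) x + Bop G ε η (fun y => 1 - late G ε η J r y) x := by
  have e : ∀ f : V → ℝ, (fun y => 1 - f y) = fun y => 1 + (-1) * f y := fun f => by funext y; ring
  have h1 := Pop_const (G := G) (η := η) hε 1 x
  rw [Pop] at h1
  rw [e, e, Aop_add, Bop_add, Aop_mul, Bop_mul, late]
  linarith

lemma one_sub_late_mul_le (hε : 0 < ε) (J r : ℕ) {c : ℝ} (hc : r ≤ c) (x : V) :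
    (1 - late G ε η J r x) * (c - r) ^ 2 ≤ crossDev G ε η J c x := by
  have h0 : ∀ (r : ℕ) (c : ℝ), (r : ℝ) ≤ c → ∀ x, (1 - late G ε η 0 r x) * (c - r) ^ 2 ≤
      crossDev G ε η 0 c x := by
    intro r c hc x
    simp only [late_zero, crossDev, crossSq, crossSum]
    nlinarith
  induction r generalizing J c x with
  | zero =>
    rcases J with _ | J
    · exact h0 0 c hc x
    · rw [late, sub_self, zero_mul]; exact crossDev_nonneg hε _ c x
  | succ r ih =>
    rcases J with _ | J
    · exact h0 _ c hc x
    · push_cast at hc ⊢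
      have hc' : r ≤ c - 1 := by linarith
      rw [crossDev_succ hε, one_sub_late_succ hε, add_mul, mul_comm (Aop _ _ _ _),
        mul_comm (Bop _ _ _ _ _), ← Aop_mul, ← Bop_mul]
      refine add_le_add (Aop_mono hε (fun y => ?_) x) (Bop_mono hε (fun y => ?_) x)
      · have := ih (J + 1) hc' y
        rw [show c - 1 - (r : ℝ) = c - (r + 1) by ring, mul_comm] at this
        exact this
      · have := ih J hc' y
        rw [show c - 1 - (r : ℝ) = c - (r + 1) by ring, mul_comm] at this
        exact this

lemma crossDev_le (hε : 0 < ε) {τ H δ : ℝ} {m k : ℕ} (hH : ∀ v, crossMean G ε v ≤ H)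
    (hδ0 : 0 ≤ δ) (hδ1 : δ ≤ 1) (hτ0 : 0 ≤ τ) (hτH : τ ≤ H) (hm1 : 1 ≤ m)
    (hm : ∀ j, m ≤ j → ∀ v, |Kpow Qε η j (crossMean G ε) v - τ| ≤ δ * τ)
    (hmk : m * H ≤ δ * (k * τ)) (x : V) :
    crossDev G ε η k (k * τ) x ≤ 22 * δ * (k * τ) ^ 2 := by
  refine variance_le_of_averaging (gQ_isDS G hε) (c2 := 0) (h := crossMean G ε)
    (e := crossSum G ε η) (q := crossSq G ε η)
    (fun v => zero_le_one.trans (one_le_crossMean hε v)) hH hδ0 hδ1 hτ0 hτH hm1 hm (fun _ => rfl)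
    (fun _ _ => rfl) (fun _ => rfl) (fun j u M hM _ => ?_) hmk (by positivity) x
  rw [crossSq]
  refine add_le_add_left ?_ _
  have := Nop_mono (G := G) hε (fun y => show 2 * crossSum G ε η (j + 1) y - 1 ≤ 2 * M by
    linarith [hM y]) u
  rw [Nop_const] at this
  linarith

/-- Decomposition of the walk at the `J`-th crossing. -/
lemma abs_Pit_le (hε : 0 < ε) {f F : V → ℝ} (hf : ∀ t x, |Pit G ε η t f x| ≤ 1) {s0 t : ℕ}
    (hF0 : ∀ x, 0 ≤ F x) (hF : ∀ s, s0 ≤ s → s ≤ t → ∀ x, |Pit G ε η s f x| ≤ F x) (J r : ℕ)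
    (hr : r + s0 ≤ t) (x : V) :
    |Pit G ε η (r + s0) f x| ≤ late G ε η J r x + Kpow Qε η J F x := by
  induction r generalizing J x with
  | zero =>
    rcases J with _ | J
    · rw [late_zero, zero_add, zero_add]; exact hF _ le_rfl (by omega) x
    · rw [late]
      exact (hf _ x).trans (le_add_of_nonneg_right (Kpow_nonneg (gQ_isDS G hε) _ hF0 x))
  | succ r ih =>
    rcases J with _ | J
    · rw [late_zero, zero_add]; exact hF _ (by omega) hr x
    · rw [show r + 1 + s0 = (r + s0) + 1 by ring, Pit_succ, late, Kpow_succ, Kop_gQ_step hε,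
        ← Kpow_succ]
      have hA : ∀ y, |Pit G ε η (r + s0) f y| ≤ late G ε η (J + 1) r y +
          Kpow Qε η (J + 1) F y := fun y => ih (J + 1) (by omega) y
      have hB : ∀ y, |Pit G ε η (r + s0) f y| ≤ late G ε η J r y + Kpow Qε η J F y :=
        fun y => ih J (by omega) y
      have a1 := Aop_mono (G := G) hε (fun y => (le_abs_self _).trans (hA y)) x
      have b1 := Bop_mono (G := G) (η := η) hε (fun y => (le_abs_self _).trans (hB y)) x
      have a2 := Aop_mono (G := G) hε (fun y => (neg_abs_le _).trans' (neg_le_neg (hA y))) x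
      have b2 := Bop_mono (G := G) (η := η) hε
        (fun y => (neg_abs_le _).trans' (neg_le_neg (hB y))) x
      have e : ∀ f : V → ℝ, (fun y => -f y) = fun y => (-1) * f y := fun f => by funext y; ring
      rw [e (fun y => late G ε η (J + 1) r y + Kpow Qε η (J + 1) F y), Aop_mul] at a2
      rw [e (fun y => late G ε η J r y + Kpow Qε η J F y), Bop_mul] at b2
      rw [Aop_add] at a1 a2
      rw [Bop_add] at b1 b2
      rw [Pop, abs_le]
      constructor <;> linarith

end Time

section Gap
variable (G) (ε)

/-- The inner product weighted by the degrees of the augmented graph. -/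
def dip (f g : V → ℝ) : ℝ := ∑ x, (dg G x + ε) * (f x * g x)

variable {G ε}

local notation "ip" => dip G ε

lemma dip_comm (f g : V → ℝ) : ip f g = ip g f := sum_congr rfl fun x _ => by ring

lemma dip_add_left (f f' g : V → ℝ) :
    ip (fun x => f x + f' x) g = ip f g + ip f' g := by
  simp only [dip, ← sum_add_distrib]
  exact sum_congr rfl fun x _ => by ring

lemma dip_mul_left (c : ℝ) (f g : V → ℝ) : ip (fun x => c * f x) g = c * ip f g := by
  simp only [dip, mul_sum]
  exact sum_congr rfl fun x _ => by ring

lemma dip_add_right (f g g' : V → ℝ) :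
    ip f (fun x => g x + g' x) = ip f g + ip f g' := by
  rw [dip_comm, dip_add_left, dip_comm g, dip_comm g']

lemma dip_mul_right (c : ℝ) (f g : V → ℝ) : ip f (fun x => c * g x) = c * ip f g := by
  rw [dip_comm, dip_mul_left, dip_comm g]

lemma dip_self_nonneg (hε : 0 < ε) (f : V → ℝ) : 0 ≤ ip f f :=
  sum_nonneg fun x _ => mul_nonneg (add_nonneg (dg_nonneg G x) hε.le) (mul_self_nonneg _)

lemma dip_abs_abs_le (hε : 0 < ε) (f g : V → ℝ) : ∑ x, (dg G x + ε) * (|f x| * |g x|) ≤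
    √(ip f f) * √(ip g g) := by
  have hD : ∀ x, 0 ≤ dg G x + ε := fun x => add_nonneg (dg_nonneg G x) hε.le
  have h := sum_mul_le_sqrt_mul_sqrt univ
    (fun x => √(dg G x + ε) * |f x|) (fun x => √(dg G x + ε) * |g x|)
  have e : ∀ f : V → ℝ, ∑ x, (√(dg G x + ε) * |f x|) ^ 2 = ip f f := fun f =>
    sum_congr rfl fun x _ => by rw [mul_pow, sq_sqrt (hD x), sq_abs, sq]
  rw [e, e] at h
  refine le_trans (le_of_eq (sum_congr rfl fun x _ => ?_)) h
  rw [show √(dg G x + ε) * |f x| * (√(dg G x + ε) * |g x|) =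
    (√(dg G x + ε) * √(dg G x + ε)) * (|f x| * |g x|) by ring, mul_self_sqrt (hD x)]

lemma mul_Pop (hε : 0 < ε) (f : V → ℝ) (x : V) :
    (dg G x + ε) * Pop G ε η f x = adjSum G f x + ε * f (η x) := by
  have hD := add_pos_of_nonneg_of_pos (dg_nonneg G x) hε
  rw [Pop, Aop, Bop]; field_simp

lemma dip_Pop (hε : 0 < ε) (f g : V → ℝ) : ip f (Pop G ε η g) =
    ∑ x, f x * adjSum G g x + ε * ∑ x, f x * g (η x) := by
  rw [dip, mul_sum, ← sum_add_distrib]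
  refine sum_congr rfl fun x _ => ?_
  linear_combination f x * mul_Pop (G := G) (η := η) hε g x

lemma dip_Pop_comm (hε : 0 < ε) (hη : IsPM η) (f g : V → ℝ) :
    ip f (Pop G ε η g) = ip (Pop G ε η f) g := by
  rw [dip_comm (Pop G ε η f), dip_Pop hε, dip_Pop hε, sum_mul_adjSum_comm]
  have : ∑ x, f x * g (η x) = ∑ x, g x * f (η x) := by
    rw [← sum_comp_matching hη]
    exact sum_congr rfl fun x _ => by rw [hη.1 x, mul_comm]
  rw [this]
  congr 1
  exact sum_congr rfl fun x _ => mul_comm _ _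

lemma dip_one_Pop (hε : 0 < ε) (hη : IsPM η) (f : V → ℝ) :
    ip (fun _ => 1) (Pop G ε η f) = ip (fun _ => 1) f := by
  rw [dip_Pop_comm hε hη]
  congr 1
  funext x; exact Pop_const hε 1 x

lemma Pop_add (f g : V → ℝ) : Pop G ε η (fun y => f y + g y) =
    fun x => Pop G ε η f x + Pop G ε η g x := by
  funext x; simp only [Pop, Aop_add, Bop_add]; ring

lemma Pop_mul (c : ℝ) (f : V → ℝ) : Pop G ε η (fun y => c * f y) = fun x => c * Pop G ε η f x := by
  funext x; simp only [Pop, Aop_mul, Bop_mul]; ring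

lemma dip_sub_dip_Pop (hε : 0 < ε) {s : ℝ} (hs : s ^ 2 = 1) (f : V → ℝ) :
    ip f f - s * ip f (Pop G ε η f) =
      energy G s f / 2 + ε * (∑ x, f x ^ 2 - s * ∑ x, f x * f (η x)) := by
  rw [dip_Pop hε, energy_eq G hs]
  have : ip f f = ∑ x, dg G x * f x ^ 2 + ε * ∑ x, f x ^ 2 := by
    rw [dip, mul_sum, ← sum_add_distrib]
    exact sum_congr rfl fun x _ => by ring
  rw [this]; ring

/-- Two-sided spectral gap in quadratic form. -/
lemma gap_form (hε : 0 < ε) (hε1 : ε ≤ 1) {κ Δ : ℝ} (hΔ0 : 0 ≤ Δ) (hΔ : ∀ x, dg G x ≤ Δ)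
    (hκ : κ ≤ 1 / 2) (hη : IsPM η) (h : Decor G ε κ η) {s : ℝ}
    (hs : s = 1 ∨ s = -1) (f : V → ℝ) (hf : s = 1 → ∑ x, f x = 0) :
    ε / (2 * (Δ + 1)) * ip f f ≤ ip f f - s * ip f (Pop G ε η f) := by
  have hs2 : s ^ 2 = 1 := by rcases hs with h | h <;> rw [h] <;> norm_num
  rw [dip_sub_dip_Pop hε hs2]
  have hdn : ip f f ≤ (Δ + 1) * ∑ x, f x ^ 2 := by
    rw [dip, mul_sum]
    refine sum_le_sum fun x _ => ?_
    nlinarith [hΔ x, mul_self_nonneg (f x)]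
  have h1 : ε / (2 * (Δ + 1)) * ip f f ≤ ε / 2 * ∑ x, f x ^ 2 := by
    refine (mul_le_left hdn (by positivity)).trans (le_of_eq ?_)
    field_simp
  refine h1.trans ?_
  have hcs : |∑ x, f x * f (η x)| ≤ ∑ x, f x ^ 2 := by
    have := abs_sum_mul_le f (fun x => f (η x))
    rw [nrm_comp_perm hη f, ← sq, nrm_sq] at this
    exact this
  have hE := energy_nonneg G s f
  rcases le_or_gt (energy G s f) (2 * ε * nrm f ^ 2) with hc | hc
  · have h2 := h s hs f f (nrm f) (nrm f) (nrm_nonneg f) (nrm_nonneg f) le_rfl le_rfl hc hc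
    rw [← sq, nrm_sq] at h2
    have h3 : |corr η f f| ≤ 1 / 2 * ∑ x, f x ^ 2 := h2.trans (by gcongr)
    have h4 : s * ∑ x, f x * f (η x) ≤ 1 / 2 * ∑ x, f x ^ 2 := by
      rw [corr] at h3
      rcases hs with h | h
      · rw [hf h] at h3
        rw [h, one_mul]
        simp only [zero_mul, zero_div, sub_zero] at h3
        exact (le_abs_self _).trans h3
      · rw [h]
        have h5 : 0 ≤ (∑ x, f x) * (∑ x, f x) / (nV : ℝ) :=
          div_nonneg (mul_self_nonneg _) (Nat.cast_nonneg _)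
        linarith [neg_abs_le (∑ x, f x * f (η x) - (∑ x, f x) * (∑ x, f x) / (nV : ℝ))]
    nlinarith
  · rw [nrm_sq] at hc
    have h4 : s * ∑ x, f x * f (η x) ≤ ∑ x, f x ^ 2 := by
      rcases hs with h | h
      · rw [h, one_mul]; exact (le_abs_self _).trans hcs
      · rw [h]; linarith [neg_abs_le (∑ x, f x * f (η x))]
    nlinarith

lemma abs_dip_Pop_le [Nonempty V] (hε : 0 < ε) (hε1 : ε ≤ 1) {κ Δ : ℝ} (hΔ0 : 0 ≤ Δ)
    (hΔ : ∀ x, dg G x ≤ Δ) (hκ : κ ≤ 1 / 2) (hη : IsPM η) (h : Decor G ε κ η)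
    (f : V → ℝ) (hf : ip (fun _ => 1) f = 0) :
    |ip f (Pop G ε η f)| ≤ (1 - ε / (2 * (Δ + 1))) * ip f f := by
  rw [abs_le]
  constructor
  · have := gap_form hε hε1 hΔ0 hΔ hκ hη h (s := -1) (Or.inr rfl) f (fun h => by norm_num at h)
    linarith
  · set c := avg f
    have hfc : ∑ x, (f x + -c) = 0 := by simpa only [sub_eq_add_neg] using sum_sub_avg f
    have h1 := gap_form hε hε1 hΔ0 hΔ hκ hη h (s := 1) (Or.inl rfl) (fun x => f x + -c)
      (fun _ => hfc)
    have hconst : ∀ g : V → ℝ, ip (fun _ => -c) g = -c * ip (fun _ => 1) g := fun g => by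
      rw [← dip_mul_left]; simp
    have hP : Pop G ε η (fun x => f x + -c) = fun x => Pop G ε η f x + -c := by
      rw [Pop_add]; funext x; rw [Pop_const hε]
    have hPf := dip_one_Pop (G := G) hε hη f
    have e1 : ip (fun x => f x + -c) (fun x => f x + -c) =
        ip f f + c ^ 2 * ip (fun _ => 1) (fun _ => 1) := by
      rw [dip_add_left, dip_add_right, dip_add_right, hconst, hconst, dip_comm f (fun _ => -c), hconst,
        hf, dip_comm (fun _ => 1) (fun _ => -c), hconst]
      ring
    have e2 : ip (fun x => f x + -c) (Pop G ε η (fun x => f x + -c)) =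
        ip f (Pop G ε η f) + c ^ 2 * ip (fun _ => 1) (fun _ => 1) := by
      rw [hP, dip_add_left, dip_add_right, dip_add_right, hconst, hconst, hPf, hf,
        dip_comm f (fun _ => -c), hconst, hf, dip_comm (fun _ => 1) (fun _ => -c), hconst]
      ring
    rw [e1, e2] at h1
    have h2 : 0 ≤ ε / (2 * (Δ + 1)) * (c ^ 2 * ip (fun _ => 1) (fun _ => 1)) :=
      mul_nonneg (by positivity) (mul_nonneg (sq_nonneg c) (dip_self_nonneg hε _))
    linarith

lemma dip_Pop_self_le [Nonempty V] (hε : 0 < ε) (hε1 : ε ≤ 1) {κ Δ : ℝ} (hΔ0 : 0 ≤ Δ)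
    (hΔ : ∀ x, dg G x ≤ Δ) (hκ : κ ≤ 1 / 2) (hη : IsPM η) (h : Decor G ε κ η)
    (f : V → ℝ) (hf : ip (fun _ => 1) f = 0) :
    ip (Pop G ε η f) (Pop G ε η f) ≤ (1 - ε / (2 * (Δ + 1))) * ip f f := by
  set γ := ε / (2 * (Δ + 1)) with hγ
  have hγ0 : 0 < γ := by positivity
  have hγ1 : γ ≤ 1 / 2 := by rw [hγ, div_le_iff₀ (by positivity)]; nlinarith
  have hform := fun f hf => abs_dip_Pop_le (G := G) hε hε1 hΔ0 hΔ hκ hη h f hf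
  have hPf : ip (fun _ => 1) (Pop G ε η f) = 0 := by rw [dip_one_Pop hε hη, hf]
  set g := Pop G ε η f with hg
  set X := ip f f
  set Y := ip g g
  have hX : 0 ≤ X := dip_self_nonneg hε f
  have expand : ∀ l : ℝ, ip (fun x => f x + l * g x) (fun x => f x + l * g x) =
      X + 2 * l * ip f g + l ^ 2 * Y := by
    intro l
    rw [dip_add_left, dip_add_right, dip_add_right, dip_mul_left, dip_mul_left, dip_mul_right,
      dip_mul_right, dip_comm g f]
    ring
  have expandP : ∀ l : ℝ, ip (fun x => f x + l * g x) (Pop G ε η (fun x => f x + l * g x)) =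
      ip f (Pop G ε η f) + 2 * l * Y + l ^ 2 * ip g (Pop G ε η g) := by
    intro l
    rw [Pop_add, Pop_mul, dip_add_left, dip_add_right, dip_add_right, dip_mul_left, dip_mul_left,
      dip_mul_right, dip_mul_right, dip_Pop_comm hε hη f g, ← hg]
    ring
  have hz : ∀ l : ℝ, ip (fun _ => 1) (fun x => f x + l * g x) = 0 := by
    intro l; rw [dip_add_right, dip_mul_right, hf, hPf]; ring
  have hpol : ∀ l : ℝ, 4 * l * Y ≤ (1 - γ) * (2 * X + 2 * (l ^ 2 * Y)) := fun l => by
    have h1 := (abs_le.1 (hform _ (hz l))).2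
    have h2 := (abs_le.1 (hform _ (hz (-l)))).1
    rw [expand, expandP] at h1 h2
    linarith
  have hρ : 0 < 1 - γ := by linarith
  have h1 := hpol (1 - γ)⁻¹
  have h2 := inv_mul_cancel₀ hρ.ne'
  have h3 : Y ≤ (1 - γ) ^ 2 * X := by
    have h4 : 4 * Y ≤ (1 - γ) ^ 2 * (2 * X) + 2 * Y := by
      calc 4 * Y = (4 * (1 - γ)⁻¹ * Y) * (1 - γ) := by linear_combination (-4 * Y) * h2
        _ ≤ (1 - γ) * (2 * X + 2 * ((1 - γ)⁻¹ ^ 2 * Y)) * (1 - γ) := mul_le_right h1 hρ.le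
        _ = _ := by linear_combination 2 * Y * ((1 - γ)⁻¹ * (1 - γ) + 1) * h2
    linarith
  nlinarith [mul_nonneg hγ0.le hX, mul_nonneg (mul_nonneg hγ0.le hρ.le) hX]

end Gap

/-- Abel summation for a convex decreasing sequence. -/
lemma sum_mul_second_diff_le (x : ℕ → ℝ) (h0 : ∀ s, 0 ≤ x s) (hd : ∀ s, x (s + 1) ≤ x s) (M : ℕ) :
    ∑ s ∈ range M, ((s : ℝ) + 1) * (x s - 2 * x (s + 1) + x (s + 2)) ≤ x 0 := by
  have key : ∑ s ∈ range M, ((s : ℝ) + 1) * (x s - 2 * x (s + 1) + x (s + 2)) +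
      M * (x M - x (M + 1)) + x M = x 0 := by
    induction M with
    | zero => simp
    | succ M ih =>
      rw [sum_range_succ]
      push_cast
      linear_combination ih
  have h1 := mul_nonneg (Nat.cast_nonneg M) (sub_nonneg.2 (hd M))
  linarith [h0 M]

lemma sum_geom_le (x : ℕ → ℝ) (h0 : ∀ s, 0 ≤ x s) {γ : ℝ} (hd : ∀ s, x (s + 1) ≤ (1 - γ) * x s)
    (M : ℕ) : γ * ∑ s ∈ range M, x s ≤ x 0 := by
  have key : γ * ∑ s ∈ range M, x s + x M ≤ x 0 := by
    induction M with
    | zero => simp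
    | succ M ih =>
      rw [sum_range_succ]
      linarith [hd M]
  linarith [h0 M]

/-- An `L²` maximal inequality for the walk after the relaxation time. -/
lemma exists_maximal [Nonempty V] (hε : 0 < ε) (hε1 : ε ≤ 1) {κ Δ : ℝ} (hΔ0 : 0 ≤ Δ)
    (hΔ : ∀ x, dg G x ≤ Δ) (hκ : κ ≤ 1 / 2) (hη : IsPM η) (h : Decor G ε κ η)
    (f : V → ℝ) (hf : dip G ε (fun _ => 1) f = 0) {s0 T : ℕ} (hs0 : 1 ≤ s0) (hT : s0 ≤ T) {ω : ℝ}
    (hω : 1 ≤ ω) (hωs : ω ≤ ε / (2 * (Δ + 1)) * s0) :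
    ∃ W : V → ℝ, (∀ s, s0 ≤ s → s ≤ T → ∀ x, Pit G ε η s f x ^ 2 ≤ W x) ∧
      ∑ x, (dg G x + ε) * W x ≤ 4 / √ω * dip G ε f f := by
  set γ := ε / (2 * (Δ + 1)) with hγ
  have hγ0 : 0 < γ := by positivity
  let a : ℕ → V → ℝ := fun s => Pit G ε η s f
  let x : ℕ → ℝ := fun s => dip G ε (a s) (a s)
  have ha : ∀ s, a (s + 1) = Pop G ε η (a s) := fun s => Pit_succ s f
  have hmean : ∀ s, dip G ε (fun _ => 1) (a s) = 0 := fun s => by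
    induction s with
    | zero => exact hf
    | succ s ih => rw [ha, dip_one_Pop hε hη, ih]
  have hx0 : ∀ s, 0 ≤ x s := fun s => dip_self_nonneg hε _
  have hxd : ∀ s, x (s + 1) ≤ (1 - γ) * x s := fun s => by
    change dip G ε (a (s + 1)) (a (s + 1)) ≤ _
    rw [ha]
    exact dip_Pop_self_le hε hε1 hΔ0 hΔ hκ hη h (a s) (hmean s)
  have hxm : ∀ s, x (s + 1) ≤ x s := fun s =>
    (hxd s).trans (by nlinarith [hx0 s])
  have hanti := antitone_nat_of_succ_le hxm
  let b : ℕ → V → ℝ := fun s y => a s y + (-1) * a (s + 2) y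
  have hy : ∀ s, dip G ε (b s) (b s) = x s - 2 * x (s + 1) + x (s + 2) := fun s => by
    have e : dip G ε (a s) (a (s + 2)) = x (s + 1) := by rw [ha (s + 1), dip_Pop_comm hε hη, ← ha]
    simp only [b]
    rw [dip_add_left, dip_add_right, dip_add_right, dip_mul_left, dip_mul_left, dip_mul_right,
      dip_mul_right, dip_comm (a (s + 2)) (a s), e]
    simp only [x]; ring
  let W : V → ℝ := fun y => (a T y ^ 2 + a (T + 1) y ^ 2) +
    ∑ s ∈ Finset.Ico s0 T, (|b s y| * |a s y| + |b s y| * |a (s + 2) y|)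
  refine ⟨W, ?_, ?_⟩
  · have key : ∀ k s, s0 ≤ s → s + k = T + 1 → ∀ y, a s y ^ 2 ≤ (a T y ^ 2 + a (T + 1) y ^ 2) +
        ∑ s ∈ Finset.Ico s T, (|b s y| * |a s y| + |b s y| * |a (s + 2) y|) := by
      intro k
      induction k using Nat.strong_induction_on with
      | _ k ih =>
        intro s hs hk y
        have hnn : ∀ I : Finset ℕ, 0 ≤ ∑ s ∈ I, (|b s y| * |a s y| + |b s y| * |a (s + 2) y|) :=
          fun I => sum_nonneg fun s _ => by positivity
        rcases k with _ | _ | k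
        · obtain rfl : s = T + 1 := by omega
          linarith [hnn (Finset.Ico (T + 1) T), sq_nonneg (a T y)]
        · obtain rfl : s = T := by omega
          linarith [hnn (Finset.Ico s s), sq_nonneg (a (s + 1) y)]
        · have h1 := ih k (by omega) (s + 2) (by omega) (by omega) y
          have h2 : a s y ^ 2 ≤ a (s + 2) y ^ 2 +
              (|b s y| * |a s y| + |b s y| * |a (s + 2) y|) := by
            have e : a s y ^ 2 = a (s + 2) y ^ 2 + (b s y * a s y + b s y * a (s + 2) y) := by
              simp only [b]; ring
            rw [← abs_mul, ← abs_mul]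
            linarith [le_abs_self (b s y * a s y), le_abs_self (b s y * a (s + 2) y)]
          have h3 : ∑ s ∈ Finset.Ico (s + 2) T, (|b s y| * |a s y| + |b s y| * |a (s + 2) y|) ≤
              ∑ s ∈ Finset.Ico (s + 1) T, (|b s y| * |a s y| + |b s y| * |a (s + 2) y|) :=
            sum_le_sum_of_subset_of_nonneg
              (Finset.Ico_subset_Ico_left (by omega)) fun s _ _ => by positivity
          rw [sum_eq_sum_Ico_succ_bot (by omega : s < T)]
          linarith
    intro s hs hsT y
    refine (key (T + 1 - s) s hs (by omega) y).trans ?_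
    refine add_le_add le_rfl (sum_le_sum_of_subset_of_nonneg
      (Finset.Ico_subset_Ico_left hs) fun s _ _ => by positivity)
  · have hsum : ∑ y, (dg G y + ε) * W y ≤ (x T + x (T + 1)) +
        ∑ s ∈ Finset.Ico s0 T, 2 * (√(x s - 2 * x (s + 1) + x (s + 2)) * √(x s)) := by
      have e : ∑ y, (dg G y + ε) * W y = (x T + x (T + 1)) +
          ∑ s ∈ Finset.Ico s0 T, (∑ y, (dg G y + ε) * (|b s y| * |a s y|) +
            ∑ y, (dg G y + ε) * (|b s y| * |a (s + 2) y|)) := by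
        simp only [W, x, dip, mul_add, mul_sum, sum_add_distrib, sq]
        rw [sum_comm, sum_comm (s := univ)]
      rw [e]
      refine add_le_add le_rfl (sum_le_sum fun s _ => ?_)
      have h1 := dip_abs_abs_le (G := G) hε (b s) (a s)
      have h2 := dip_abs_abs_le (G := G) hε (b s) (a (s + 2))
      rw [hy] at h1 h2
      have h3 := sqrt_le_sqrt (hanti (by omega : s ≤ s + 2))
      have h4 := mul_le_left h3 (sqrt_nonneg (x s - 2 * x (s + 1) + x (s + 2)))
      simp only [x] at h1 h2 h4 ⊢
      linarith
    have hs0r : (0 : ℝ) < s0 := Nat.cast_pos.2 hs0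
    have hyn : ∀ s, 0 ≤ x s - 2 * x (s + 1) + x (s + 2) := fun s => by
      rw [← hy]; exact dip_self_nonneg hε _
    have hgeo := fun M => sum_geom_le x hx0 hxd M
    have hIco : ∀ g : ℕ → ℝ, (∀ s, 0 ≤ g s) →
        ∑ s ∈ Finset.Ico s0 T, g s ≤ ∑ s ∈ range T, g s := fun g hg =>
      sum_le_sum_of_subset_of_nonneg
        (by rw [range_eq_Ico]; exact Finset.Ico_subset_Ico_left (Nat.zero_le _))
        fun s _ _ => hg s
    have hω0 : 0 < ω := by linarith
    have hxT : ω * x T ≤ x 0 := by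
      have h1 : T * x T ≤ ∑ s ∈ range T, x s := by
        have := card_nsmul_le_sum (range T) x (x T) (fun s hs => hanti (mem_range.1 hs).le)
        rwa [card_range, nsmul_eq_mul] at this
      have h2 := hgeo T
      have h3 := hωs.trans (mul_le_left (Nat.cast_le.2 hT) hγ0.le)
      nlinarith [hx0 T, mul_le_left h1 hγ0.le, mul_le_right h3 (hx0 T)]
    have hcs : ∑ s ∈ Finset.Ico s0 T, √(x s - 2 * x (s + 1) + x (s + 2)) *
        √(x s) ≤ x 0 / √ω := by
      have h1 := sum_mul_le_sqrt_mul_sqrt (Finset.Ico s0 T)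
        (fun s => √(((s : ℝ) + 1) * (x s - 2 * x (s + 1) + x (s + 2))))
        (fun s => √(x s / ((s : ℝ) + 1)))
      have e1 : ∀ s : ℕ, √(((s : ℝ) + 1) * (x s - 2 * x (s + 1) + x (s + 2))) *
          √(x s / ((s : ℝ) + 1)) =
          √(x s - 2 * x (s + 1) + x (s + 2)) * √(x s) := by
        intro s
        have hs : (0 : ℝ) < (s : ℝ) + 1 := by positivity
        rw [sqrt_mul hs.le, sqrt_div (hx0 s)]
        field_simp
      simp only [e1] at h1
      refine h1.trans ?_
      have h2 : ∑ s ∈ Finset.Ico s0 T,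
          √(((s : ℝ) + 1) * (x s - 2 * x (s + 1) + x (s + 2))) ^ 2 ≤ x 0 := by
        have hp : ∀ s : ℕ, 0 ≤ ((s : ℝ) + 1) * (x s - 2 * x (s + 1) + x (s + 2)) := fun s =>
          mul_nonneg (by positivity) (hyn s)
        simp only [fun s : ℕ => sq_sqrt (hp s)]
        exact (hIco _ hp).trans (sum_mul_second_diff_le x hx0 hxm T)
      have h3 : ∑ s ∈ Finset.Ico s0 T, √(x s / ((s : ℝ) + 1)) ^ 2 ≤ x 0 / ω := by
        have hp : ∀ s : ℕ, 0 ≤ x s / ((s : ℝ) + 1) := fun s => div_nonneg (hx0 s) (by positivity)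
        simp only [fun s : ℕ => sq_sqrt (hp s)]
        have h4 : ∑ s ∈ Finset.Ico s0 T, x s / ((s : ℝ) + 1) ≤
            ∑ s ∈ Finset.Ico s0 T, (s0 : ℝ)⁻¹ * x s := by
          refine sum_le_sum fun s hs => ?_
          rw [← div_eq_inv_mul]
          refine div_le_div_of_nonneg_left (hx0 s) hs0r ?_
          have : (s0 : ℝ) ≤ s := Nat.cast_le.2 (mem_Ico.1 hs).1
          linarith
        refine h4.trans ?_
        rw [← mul_sum, ← div_eq_inv_mul, div_le_div_iff₀ hs0r hω0]
        have h5 := hIco x hx0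
        have h6 : 0 ≤ ∑ s ∈ Finset.Ico s0 T, x s := sum_nonneg fun s _ => hx0 s
        have h7 := hgeo T
        calc (∑ s ∈ Finset.Ico s0 T, x s) * ω ≤ (∑ s ∈ Finset.Ico s0 T, x s) * (γ * s0) :=
              mul_le_left hωs h6
          _ = γ * (∑ s ∈ Finset.Ico s0 T, x s) * s0 := by ring
          _ ≤ x 0 * s0 := mul_le_right ((mul_le_left h5 hγ0.le).trans h7) hs0r.le
      refine (mul_le_mul (sqrt_le_sqrt h2) (sqrt_le_sqrt h3) (sqrt_nonneg _)
        (sqrt_nonneg _)).trans (le_of_eq ?_)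
      rw [sqrt_div (hx0 0), mul_div_assoc', mul_self_sqrt (hx0 0)]
    have hsω : √ω ≤ ω := by rw [sqrt_le_left hω0.le]; nlinarith
    have hsω0 := sqrt_pos.2 hω0
    have hxT' : x T ≤ x 0 / √ω := by
      rw [le_div_iff₀ hsω0]
      nlinarith [mul_le_left hsω (hx0 T)]
    refine hsum.trans ?_
    rw [← mul_sum]
    have : (4 / √ω * dip G ε f f) = 4 * (x 0 / √ω) := by
      rw [div_mul_eq_mul_div, mul_div_assoc]; rfl
    rw [this]
    linarith [hxm T]

lemma starMatrix_mulVec (f : V → ℝ) : (starMatrix G η ε).mulVec f = Pop G ε η f := by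
  funext x
  have e : ε * f (η x) = ∑ y, ε * (if η x = y then 1 else 0) * f y := by simp
  rw [Pop, Aop, Bop, e, adjSum, ← add_div, ← sum_add_distrib, sum_div]
  refine sum_congr rfl fun y _ => ?_
  simp only [starMatrix, dg]
  split_ifs <;> ring

lemma starMatrix_pow_mulVec (t : ℕ) (f : V → ℝ) :
    (starMatrix G η ε ^ t).mulVec f = Pit G ε η t f := by
  induction t with
  | zero => simp [Pit]
  | succ t ih => rw [pow_succ', ← Matrix.mulVec_mulVec, ih, starMatrix_mulVec, Pit_succ]

lemma Pit_const (hε : 0 < ε) (t : ℕ) (c : ℝ) : Pit G ε η t (fun _ => c) = fun _ => c := by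
  induction t with
  | zero => rfl
  | succ t ih => rw [Pit_succ, ih]; funext x; exact Pop_const hε c x

lemma Pit_mono (hε : 0 < ε) (t : ℕ) {f g : V → ℝ} (h : ∀ x, f x ≤ g x) (x : V) :
    Pit G ε η t f x ≤ Pit G ε η t g x := by
  induction t generalizing x with
  | zero => exact h x
  | succ t ih => rw [Pit_succ, Pit_succ]; exact Pop_mono hε ih x

lemma Pit_abs_le_one (hε : 0 < ε) {f : V → ℝ} (hf : ∀ x, |f x| ≤ 1) (t : ℕ) (x : V) :
    |Pit G ε η t f x| ≤ 1 := by
  have h1 := Pit_mono (G := G) (η := η) hε t (fun x => (abs_le.1 (hf x)).1) x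
  have h2 := Pit_mono (G := G) (η := η) hε t (fun x => (abs_le.1 (hf x)).2) x
  rw [Pit_const hε] at h1 h2
  exact abs_le.2 ⟨h1, h2⟩

lemma Pit_eq_sum (t : ℕ) (f : V → ℝ) (x : V) :
    Pit G ε η t f x = ∑ y, (starMatrix G η ε ^ t) x y * f y := by
  rw [← starMatrix_pow_mulVec]; rfl

lemma starPi_eq (x : V) : starPi G ε x = (dg G x + ε) / ∑ y, (dg G y + ε) := by
  rw [starPi, sum_add_distrib, sum_const, nsmul_eq_mul, card_univ, mul_comm ε]
  congr 2
  have := G.sum_degrees_eq_twice_card_edges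
  unfold dg
  rw [← Nat.cast_sum, this]
  push_cast; rfl

lemma sum_starPi [Nonempty V] (hε : 0 < ε) : ∑ x, starPi G ε x = 1 := by
  simp_rw [starPi_eq]
  rw [← sum_div]
  exact div_self (sum_pos (fun x _ => add_pos_of_nonneg_of_pos (dg_nonneg G x) hε)
    univ_nonempty).ne'

lemma starPi_nonneg (hε : 0 < ε) (x : V) : 0 ≤ starPi G ε x := by
  rw [starPi_eq]
  exact div_nonneg (add_nonneg (dg_nonneg G x) hε.le)
    (sum_nonneg fun x _ => add_nonneg (dg_nonneg G x) hε.le)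

lemma mixedAt_of_abs_Pit_le [Nonempty V] (hε : 0 < ε) {t : ℕ} {b : ℝ}
    (h : ∀ f : V → ℝ, (∀ x, |f x| ≤ 1) → dip G ε (fun _ => 1) f = 0 → ∀ x, |Pit G ε η t f x| ≤ b) :
    mixedAt (starMatrix G η ε) (starPi G ε) b t := by
  intro x
  set p : V → ℝ := fun y => (starMatrix G η ε ^ t) x y
  let g : V → ℝ := fun y => if 0 ≤ p y - starPi G ε y then 1 else -1
  have hg : ∀ y, |g y| ≤ 1 := fun y => by simp only [g]; split_ifs <;> simp
  set c := ∑ y, starPi G ε y * g y with hc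
  have hc1 : |c| ≤ 1 := by
    rw [← sum_starPi (G := G) hε]
    refine (abs_sum_le_sum_abs _ _).trans (sum_le_sum fun y _ => ?_)
    rw [abs_mul, abs_of_nonneg (starPi_nonneg hε y)]
    exact mul_le_of_le_one_right (starPi_nonneg hε y) (hg y)
  have hZ := sum_pos (fun x _ => add_pos_of_nonneg_of_pos (dg_nonneg G x) hε) univ_nonempty
  have hp1 : ∑ y, p y = 1 := by
    have := congrFun (Pit_const (G := G) (η := η) hε t 1) x
    rw [Pit_eq_sum] at this
    simpa using this
  have hf := h (fun y => (g y - c) / 2) (fun y => by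
    have h1 := abs_le.1 (hg y)
    have h2 := abs_le.1 hc1
    exact abs_le.2 ⟨by linarith, by linarith⟩) (by
    have e : dip G ε (fun _ => 1) (fun y => (g y - c) / 2) =
        ((∑ y, (dg G y + ε)) * ∑ y, starPi G ε y * g y - (∑ y, (dg G y + ε)) * c) / 2 := by
      simp_rw [starPi_eq]
      rw [mul_sum, sum_mul _ _ c, ← sum_sub_distrib, sum_div, dip]
      refine sum_congr rfl fun y _ => ?_
      field_simp
    rw [e, ← hc]; simp) x
  have e : Pit G ε η t (fun y => (g y - c) / 2) x = 2⁻¹ * ∑ y, |p y - starPi G ε y| := by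
    rw [Pit_eq_sum]
    have e1 : ∑ y, |p y - starPi G ε y| = ∑ y, p y * g y - c := by
      rw [hc, ← sum_sub_distrib]
      refine sum_congr rfl fun y _ => ?_
      simp only [g]
      split_ifs with h0
      · rw [abs_of_nonneg h0]; ring
      · rw [abs_of_nonpos (not_le.1 h0).le]; ring
    have e2 : ∑ y, p y * ((g y - c) / 2) = (∑ y, p y * g y - (∑ y, p y) * c) / 2 := by
      rw [sum_mul, ← sum_sub_distrib, sum_div]
      exact sum_congr rfl fun y _ => by ring
    change ∑ y, p y * ((g y - c) / 2) = _
    rw [e2, e1, hp1]; ring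
  rw [e] at hf
  exact (le_abs_self _).trans hf

lemma le_of_mixedAt [Nonempty V] (hε : 0 < ε) {t : ℕ} {θ : ℝ}
    (h : mixedAt (starMatrix G η ε) (starPi G ε) θ t) (S : Finset V) (x : V) :
    1 - Pit G ε η t (fun y => if y ∈ S then 0 else 1) x - ∑ y ∈ S, starPi G ε y ≤ θ := by
  refine le_trans ?_ (h x)
  have hp1 : ∑ y, (starMatrix G η ε ^ t) x y = 1 := by
    have := congrFun (Pit_const (G := G) (η := η) hε t 1) x
    rw [Pit_eq_sum] at this
    simpa using this
  have e : 1 - Pit G ε η t (fun y => if y ∈ S then 0 else 1) x - ∑ y ∈ S, starPi G ε y =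
      ∑ y, ((starMatrix G η ε ^ t) x y - starPi G ε y) * (if y ∈ S then 2⁻¹ else -2⁻¹) := by
    have e1 : (1 : ℝ) = 2⁻¹ * ∑ y, (starMatrix G η ε ^ t) x y + 2⁻¹ * ∑ y, starPi G ε y := by
      rw [hp1, sum_starPi hε]; norm_num
    rw [Pit_eq_sum, sum_mem_eq S]
    refine (congrArg (fun z : ℝ => z - _ - _) e1).trans ?_
    rw [mul_sum, mul_sum, ← sum_add_distrib, ← sum_sub_distrib, ← sum_sub_distrib]
    refine sum_congr rfl fun y _ => ?_
    split_ifs <;> ring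
  rw [e, mul_sum]
  refine sum_le_sum fun y _ => (le_abs_self _).trans ?_
  rw [abs_mul, mul_comm]
  split_ifs <;> norm_num

lemma SpreadAt.Kpow_add_le [Nonempty V] {Q : V → V → ℝ} (hQ : IsDS Q) {a d θ : ℝ} (ha : 0 ≤ a)
    (h : Contr Q a η) {i : ℕ} {u : V} (hs : SpreadAt Q η i d θ u) (j : ℕ) {F : V → ℝ}
    (hF0 : ∀ x, 0 ≤ F x) (hF1 : ∀ x, F x ≤ 1) :
    Kpow Q η (i + j) F u ≤ d + avg F + √(θ * nV) * a ^ (j / 2) := by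
  obtain ⟨ν, h0, hle, hm, hsq⟩ := hs
  set H := Kpow Q η j F
  have hH1 : ∀ x, H x ≤ 1 := Kpow_le hQ j hF1
  have hn := card_pos_real (V := V)
  have havg : 0 ≤ avg F := div_nonneg (sum_nonneg fun x _ => hF0 x) hn.le
  have e : ∀ g : V → ℝ, Kpow Q η i g u = ∑ y, g y * Kpow Q η i (ind y) u := fun g => by
    have e1 : g = fun v => ∑ y, g y * ind y v := by funext v; rw [sum_mul_ind]
    conv_lhs => rw [e1]
    rw [Kpow_sum]
    exact sum_congr rfl fun y _ => congrFun (Kpow_mul i (g y) (ind y)) u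
  have e1 : ∑ y, Kpow Q η i (ind y) u = 1 := by
    have := e (fun _ => 1)
    rw [Kpow_const hQ] at this
    simpa using this.symm
  have hν1 : ∑ y, ν y ≤ 1 := e1 ▸ sum_le_sum fun y _ => hle y
  have s1 : Kpow Q η i H u ≤ ∑ y, ν y * H y + d := by
    rw [e H]
    have : ∑ y, H y * Kpow Q η i (ind y) u - ∑ y, ν y * H y ≤
        ∑ y, (Kpow Q η i (ind y) u - ν y) := by
      rw [← sum_sub_distrib]
      refine sum_le_sum fun y _ => ?_
      nlinarith [hle y, hH1 y]
    rw [sum_sub_distrib, e1] at this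
    linarith
  have s2 : ∑ y, ν y * (H y - avg F) ≤ √θ * nrm (fun x => H x - avg F) := by
    have hcs := sum_mul_sq_le_sq_mul_sq univ ν (fun y => H y - avg F)
    refine le_sqrt_of_sq_le hcs |>.trans ?_
    rw [sqrt_mul (sum_nonneg fun y _ => sq_nonneg _)]
    exact mul_le_right (sqrt_le_sqrt hsq) (sqrt_nonneg _)
  have s3 := h.nrm_sub_le hQ ha j F
  have s4 : nrm F ≤ √nV := by
    refine sqrt_le_sqrt ?_
    have : ∑ x, F x ^ 2 ≤ ∑ _x : V, (1 : ℝ) := sum_le_sum fun x _ => by nlinarith [hF0 x, hF1 x]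
    simpa using this
  have s5 : ∑ y, ν y * H y = ∑ y, ν y * (H y - avg F) + (∑ y, ν y) * avg F := by
    rw [sum_mul, ← sum_add_distrib]
    exact sum_congr rfl fun y _ => by ring
  have hθ : 0 ≤ θ := (sum_nonneg fun y _ => sq_nonneg _).trans hsq
  rw [Kpow_add, sqrt_mul hθ]
  have s6 : √θ * nrm (fun x => H x - avg F) ≤ √θ * √nV * a ^ (j / 2) := by
    rw [mul_assoc, mul_comm (√(nV : ℝ))]
    exact mul_le_left (s3.trans (mul_le_left s4 (by positivity))) (sqrt_nonneg _)
  nlinarith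

open Classical in
/-- Mixing by the time at which sufficiently many crossings have been made. -/
lemma mixedAt_of_spread [Nonempty V] (hε : 0 < ε) (hε1 : ε ≤ 1) {κ Δ : ℝ} (hΔ0 : 0 ≤ Δ)
    (hΔ : ∀ x, dg G x ≤ Δ) (hdeg : ∀ x, 1 ≤ dg G x) (hκ0 : 0 ≤ κ) (hκ : κ ≤ 1 / 2)
    (hη : IsPM η)
    (h : Decor G ε κ η) {m i j r s0 : ℕ} {pL d θ T ω : ℝ}
    (hL : ∀ x, late G ε η (m + (i + j)) r x ≤ pL)
    (hsp : ∀ x, Kpow Qε η m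
      (fun u => if SpreadAt Qε η i d θ u then 0 else 1) x ≤ T) (hd : 0 ≤ d)
    (hs0 : 1 ≤ s0) (hω : 1 ≤ ω) (hωs : ω ≤ ε / (2 * (Δ + 1)) * s0) :
    mixedAt (starMatrix G η ε) (starPi G ε) (pL + T + d + √(θ * nV) * κ ^ (j / 2) +
        √(4 / √ω * (Δ + 1))) (r + s0) := by
  have hQ := gQ_isDS G hε
  have hC := contr_of_decor hε hκ0 hη h
  have hn := card_pos_real (V := V)
  refine mixedAt_of_abs_Pit_le hε fun f hf1 hf x => ?_
  obtain ⟨W, hW, hWs⟩ := exists_maximal hε hε1 hΔ0 hΔ hκ hη h f hf hs0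
    (le_add_self : s0 ≤ r + s0) hω hωs
  have hW0 : ∀ x, 0 ≤ W x := fun x => (sq_nonneg _).trans (hW s0 le_rfl le_add_self x)
  set F : V → ℝ := fun x => min 1 (√(W x)) with hF
  have hF0 : ∀ x, 0 ≤ F x := fun x => le_min zero_le_one (sqrt_nonneg _)
  have hF1 : ∀ x, F x ≤ 1 := fun x => min_le_left _ _
  have hPF := abs_Pit_le (F := F) hε (Pit_abs_le_one hε hf1) hF0
    (fun s h1 h2 x => le_min (Pit_abs_le_one hε hf1 s x) (abs_le_sqrt (hW s h1 h2 x)))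
    (m + (i + j)) r le_rfl x
  have havg : avg F ≤ √(4 / √ω * (Δ + 1)) := by
    refine le_sqrt_of_sq_le ?_
    have h1 : (∑ x, F x) ^ 2 ≤ nV * ∑ x, F x ^ 2 := sq_sum_le_card_mul_sum_sq
    have h2 : ∑ x, F x ^ 2 ≤ ∑ x, (dg G x + ε) * W x := by
      refine sum_le_sum fun x _ => ?_
      have : F x ^ 2 ≤ W x := by
        rw [← sq_sqrt (hW0 x)]
        exact pow_le_pow_left₀ (hF0 x) (min_le_right _ _) 2
      nlinarith [hdeg x, hW0 x]
    have h3 : dip G ε f f ≤ (Δ + 1) * nV := by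
      have : dip G ε f f ≤ ∑ _x : V, (Δ + 1) := sum_le_sum fun x _ => by
        have := abs_le.1 (hf1 x)
        have : f x * f x ≤ 1 := by nlinarith
        nlinarith [hΔ x, hdeg x]
      rwa [sum_const, nsmul_eq_mul, card_univ, mul_comm] at this
    rw [avg, div_pow, div_le_iff₀ (by positivity)]
    have h4 : ∑ x, F x ^ 2 ≤ 4 / √ω * ((Δ + 1) * nV) := h2.trans (hWs.trans (by gcongr))
    calc _ ≤ _ := h1
      _ ≤ _ := mul_le_left h4 hn.le
      _ = _ := by ring
  set B := d + avg F + √(θ * nV) * κ ^ (j / 2) with hB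
  have hB0 : 0 ≤ B := add_nonneg (add_nonneg hd
    (div_nonneg (sum_nonneg fun x _ => hF0 x) hn.le)) (by positivity)
  have hK : Kpow Qε η (m + (i + j)) F x ≤ T + B := by
    rw [Kpow_add]
    have h1 : ∀ u, Kpow Qε η (i + j) F u ≤
        (if SpreadAt Qε η i d θ u then 0 else 1) + B := by
      intro u
      split_ifs with hu
      · rw [zero_add]; exact hu.Kpow_add_le hQ hκ0 hC j hF0 hF1
      · linarith [Kpow_le (η := η) hQ (i + j) hF1 u]
    have h2 := Kpow_mono (η := η) hQ m h1 x
    rw [Kpow_add_fun, Kpow_const hQ] at h2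
    linarith [hsp x]
  linarith [hL x]

section Lower
variable (G) (ε) (η : V → V)

/-- Vertices within distance `R` of the endpoint of a walk with at most `j` crossings and total
information at most `ι`. -/
def Reach (R : ℕ) : ℕ → V → ℝ → V → Prop
  | 0, u, ι, y => 0 ≤ ι ∧ G.dist u y ≤ R
  | j + 1, u, ι, y => (0 ≤ ι ∧ G.dist u y ≤ R) ∨
      ∃ a, 0 < Qε u a ∧ Reach R j (η a) (ι - info Qε u a) y

variable {G ε η}

lemma Reach.nonneg (hε : 0 < ε) {R j : ℕ} {u y : V} {ι : ℝ} (h : Reach G ε η R j u ι y) :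
    0 ≤ ι := by
  induction j generalizing u ι with
  | zero => exact h.1
  | succ j ih =>
    rcases h with h | ⟨a, -, h⟩
    · exact h.1
    · linarith [ih h, info_nonneg (gQ_isDS G hε) u a]

open Classical in
lemma card_reach_le (hε : 0 < ε) {R : ℕ} {B : ℝ} (hB : ∀ x, ((gball G x R).card : ℝ) ≤ B)
    (j : ℕ) (u : V) (ι : ℝ) :
    ((univ.filter fun y => Reach G ε η R j u ι y).card : ℝ) ≤ (j + 1) * exp ι * B := by
  have hQ := gQ_isDS G hε
  have hB0 := (Nat.cast_nonneg _).trans (hB u)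
  have hball : ∀ (u : V) (ι : ℝ), 0 ≤ ι → ((gball G u R).card : ℝ) ≤ exp ι * B :=
    fun u ι hι => (hB u).trans (le_mul_of_one_le_left hB0 (one_le_exp hι))
  induction j generalizing u ι with
  | zero =>
    by_cases hι : 0 ≤ ι
    · refine (Nat.cast_le.2 (card_le_card fun y hy => ?_)).trans ((hball u ι hι).trans (by simp))
      exact mem_gball.2 (mem_filter.1 hy).2.2
    · rw [filter_false_of_mem fun y _ h => hι h.1]; simp; positivity
  | succ j ih =>
    by_cases hι : 0 ≤ ι
    · have hsub : (univ.filter fun y => Reach G ε η R (j + 1) u ι y) ⊆ gball G u R ∪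
          (univ.filter fun a => 0 < Qε u a).biUnion fun a =>
            univ.filter fun y => Reach G ε η R j (η a) (ι - info Qε u a) y := by
        intro y hy
        rcases (mem_filter.1 hy).2 with h | ⟨a, ha, h⟩
        · exact mem_union_left _ (mem_gball.2 h.2)
        · exact mem_union_right _ (mem_biUnion.2 ⟨a, by simp [ha], by simp [h]⟩)
      have h1 := (card_le_card hsub).trans ((card_union_le _ _).trans
        (Nat.add_le_add_left card_biUnion_le _))
      refine (Nat.cast_le (α := ℝ).2 h1).trans ?_
      rw [Nat.cast_add, Nat.cast_sum]
      have h2 : ∑ a ∈ univ.filter (fun a => 0 < Qε u a), (((univ.filter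
          fun y => Reach G ε η R j (η a) (ι - info Qε u a) y).card : ℕ) : ℝ) ≤
          ∑ a, Qε u a * ((j + 1) * exp ι * B) := by
        rw [sum_filter]
        refine sum_le_sum fun a _ => ?_
        split_ifs with ha
        · refine (ih (η a) _).trans_eq ?_
          rw [info, sub_neg_eq_add, exp_add, exp_log ha]; ring
        · exact mul_nonneg (hQ.nonneg u a) (by positivity)
      rw [← sum_mul, hQ.row, one_mul] at h2
      have := hball u ι hι
      push_cast
      linarith
    · rw [filter_false_of_mem fun y _ h => hι (h.nonneg hε)]; simp; positivity

lemma late_le_one (hε : 0 < ε) (J r : ℕ) (x : V) : late G ε η J r x ≤ 1 := by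
  induction r generalizing J x with
  | zero => rcases J with _ | J <;> simp [late]
  | succ r ih =>
    rcases J with _ | J
    · simp [late]
    · rw [← Pop_const (G := G) (η := η) hε 1 x]
      exact add_le_add (Aop_mono hε (ih _) x) (Bop_mono hε (ih _) x)

lemma Aop_iterate_eq_zero {u : V} {R : ℕ} {f : V → ℝ} (hf : ∀ w, G.dist u w ≤ R → f w = 0)
    (hconn : G.Connected) (t : ℕ) (w : V) (h : G.dist u w + t ≤ R) : (Aop G ε)^[t] f w = 0 := by
  induction t generalizing w with
  | zero => exact hf w h
  | succ t ih =>
    rw [Function.iterate_succ_apply', Aop, adjSum, sum_eq_zero, zero_div]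
    intro y _
    split_ifs with hy
    · refine ih y ?_
      have := hconn.dist_triangle (u := u) (v := w) (w := y)
      rw [SimpleGraph.dist_eq_one_iff_adj.2 hy] at this
      omega
    · rfl

lemma Aop_iterate_le (hε : 0 < ε) {Δ : ℝ} (hΔ0 : 0 ≤ Δ) (hΔ : ∀ x, dg G x ≤ Δ) {f : V → ℝ}
    (hf : ∀ w, f w ≤ 1) (t : ℕ) (w : V) : (Aop G ε)^[t] f w ≤ (Δ / (Δ + ε)) ^ t := by
  induction t generalizing w with
  | zero => simpa using hf w
  | succ t ih =>
    rw [Function.iterate_succ_apply']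
    refine (Aop_mono hε ih w).trans ?_
    have hd := dg_nonneg G w
    rw [Aop, adjSum_const, pow_succ', mul_div_right_comm]
    refine mul_le_right ?_ (by positivity)
    rw [div_le_div_iff₀ (by positivity) (by positivity)]
    nlinarith [hΔ w]

open Classical in
lemma Pit_le_of_reach (hε : 0 < ε) (hconn : G.Connected) {Δ : ℝ} (hΔ0 : 0 ≤ Δ)
    (hΔ : ∀ x, dg G x ≤ Δ) {R : ℕ} (S : Finset V) (J : ℕ) (u : V) (ι : ℝ)
    (hS : ∀ y, Reach G ε η R J u ι y → y ∈ S) (t : ℕ) :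
    Pit G ε η t (fun y => if y ∈ S then 0 else 1) u ≤ (1 - late G ε η J t u) +
      pl Qε η J u (fun as => if ι < tot Qε η as u then 1 else 0) +
      J * (Δ / (Δ + ε)) ^ R := by
  have hQ := gQ_isDS G hε
  set f : V → ℝ := fun y => if y ∈ S then 0 else 1 with hf
  set tail := (Δ / (Δ + ε)) ^ R with htail
  have htail0 : 0 ≤ tail := by positivity
  have hf1 : ∀ x, |f x| ≤ 1 := fun x => by simp only [hf]; split_ifs <;> simp
  have hPit1 : ∀ t x, Pit G ε η t f x ≤ 1 := fun t x => (abs_le.1 (Pit_abs_le_one hε hf1 t x)).2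
  have hpl0 : ∀ J u (ι : ℝ),
      0 ≤ pl Qε η J u (fun as => if ι < tot Qε η as u then 1 else 0) :=
    fun J u ι => pl_nonneg hQ _ _ fun as => by split_ifs <;> norm_num
  induction J generalizing u ι t with
  | zero =>
    rw [late_zero]
    have := hPit1 t u
    have := hpl0 0 u ι
    simp only [Nat.cast_zero, zero_mul]
    linarith
  | succ J ih =>
    rcases lt_or_ge ι 0 with hι | hι
    · have e : (fun as : List V => if ι < tot Qε η as u then (1 : ℝ) else 0) = fun _ => 1 := by
        funext as; rw [if_pos (hι.trans_le (tot_nonneg hQ as u))]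
      rw [e, pl_const hQ]
      have := late_le_one (G := G) (η := η) hε (J + 1) t u
      have := hPit1 t u
      have : 0 ≤ ((J + 1 : ℕ) : ℝ) * tail := by positivity
      linarith
    set F : V → ℝ := fun a => if 0 < Qε u a then
      pl Qε η J (η a) (fun as =>
        if ι - info Qε u a < tot Qε η as (η a) then 1 else 0) + J * tail else 1 with hF
    have hF0 : ∀ a, 0 ≤ F a := fun a => by
      simp only [hF]; split_ifs
      · have := hpl0 J (η a) (ι - info Qε u a); positivity
      · exact zero_le_one
    set χ : V → ℝ := fun w => if G.dist u w ≤ R then 0 else 1 with hχ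
    have inner : ∀ t w, Pit G ε η t f w ≤
        (Aop G ε)^[t] χ w + (1 - late G ε η (J + 1) t w) + Qop Qε F w := by
      intro t
      induction t with
      | zero =>
        intro w
        have h0 : 0 ≤ Qop Qε F w := sum_nonneg fun a _ => mul_nonneg (hQ.nonneg w a) (hF0 a)
        have h1 : f w ≤ χ w := by
          simp only [hf, hχ]
          by_cases hw : G.dist u w ≤ R
          · rw [if_pos hw, if_pos (hS w (Or.inl ⟨hι, hw⟩))]
          · rw [if_neg hw]; split_ifs <;> norm_num
        have h2 : late G ε η (J + 1) 0 w = 1 := rfl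
        change f w ≤ χ w + (1 - late G ε η (J + 1) 0 w) + _
        rw [h2]; linarith
      | succ t iht =>
        intro w
        have hD := add_pos_of_nonneg_of_pos (dg_nonneg G w) hε
        rw [Pit_succ, Pop, one_sub_late_succ hε, Function.iterate_succ_apply', Qop_gQ_step hε]
        have hA := Aop_mono (G := G) hε iht w
        rw [Aop_add, Aop_add] at hA
        have hb : Pit G ε η t f (η w) ≤ (1 - late G ε η J t (η w)) + F w := by
          simp only [hF]
          split_ifs with hw
          · have := ih (η w) (ι - info Qε u w) (fun y hy => hS y (Or.inr ⟨w, hw, hy⟩)) t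
            linarith
          · linarith [hPit1 t (η w), late_le_one (G := G) (η := η) hε J t (η w)]
        have hB : Bop G ε η (Pit G ε η t f) w ≤ Bop G ε η (fun y => 1 - late G ε η J t y) w +
            ε * F w / (dg G w + ε) := by
          rw [Bop, Bop, ← add_div, ← mul_add]
          exact div_le_div_of_nonneg_right (by gcongr) hD.le
        linarith
    have hχt : (Aop G ε)^[t] χ u ≤ tail := by
      rcases le_or_gt t R with ht | ht
      · rw [Aop_iterate_eq_zero (R := R) (fun w hw => if_pos hw) hconn t u (by simpa using ht)]
        exact htail0
      · refine (Aop_iterate_le hε hΔ0 hΔ (fun w => ?_) t u).trans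
          (pow_le_pow_of_le_one (by positivity) (div_le_one_of_le₀ (by linarith) (by linarith)) ht.le)
        simp only [hχ]; split_ifs <;> norm_num
    have hQF : Qop Qε F u ≤ pl Qε η (J + 1) u
        (fun as => if ι < tot Qε η as u then 1 else 0) + J * tail := by
      have e : (J : ℝ) * tail = ∑ a, Qε u a * (J * tail) := by rw [← sum_mul, hQ.row, one_mul]
      rw [e, pl, ← sum_add_distrib]
      refine sum_le_sum fun a _ => ?_
      rcases (hQ.nonneg u a).eq_or_lt with h0 | h0
      · rw [← h0]; simp
      · simp only [hF]
        rw [if_pos h0, ← mul_add]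
        simp only [tot, sub_lt_iff_lt_add']
        exact le_rfl
    have := inner t u
    push_cast
    linarith

open Classical in
lemma le_of_mixedAt_of_reach [Nonempty V] (hε : 0 < ε) (hε1 : ε ≤ 1) (hconn : G.Connected) {Δ : ℝ}
    (hΔ0 : 0 ≤ Δ) (hΔ : ∀ x, dg G x ≤ Δ) (hdeg : ∀ x, 1 ≤ dg G x) {R : ℕ} {B : ℝ}
    (hB : ∀ x, ((gball G x R).card : ℝ) ≤ B) {t : ℕ} {θ : ℝ}
    (h : mixedAt (starMatrix G η ε) (starPi G ε) θ t) (k : ℕ) (ι : ℝ) (x : V) :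
    1 - ((1 - late G ε η k t x) +
      pl Qε η k x (fun as => if ι < tot Qε η as x then 1 else 0) +
      k * (Δ / (Δ + ε)) ^ R) - (k + 1) * exp ι * B * (Δ + 1) / nV ≤ θ := by
  set S := univ.filter fun y => Reach G ε η R k x ι y with hS
  have h1 := le_of_mixedAt hε h S x
  have h2 := Pit_le_of_reach (η := η) (R := R) hε hconn hΔ0 hΔ S k x ι (fun y hy => by simp [hS, hy]) t
  have hn := card_pos_real (V := V)
  have h3 : ∑ y ∈ S, starPi G ε y ≤ (k + 1) * exp ι * B * (Δ + 1) / nV := by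
    have : ∀ y ∈ S, starPi G ε y ≤ (Δ + 1) / nV := fun y _ => by
      rw [starPi_eq]
      refine div_le_div₀ (by positivity) (by linarith [hΔ y]) hn ?_
      have : ∑ _y : V, (1 : ℝ) ≤ ∑ y, (dg G y + ε) := sum_le_sum fun y _ => by linarith [hdeg y]
      simpa using this
    refine (sum_le_card_nsmul S _ _ this).trans ?_
    rw [nsmul_eq_mul, mul_div_assoc]
    exact mul_le_right (card_reach_le hε hB k x ι) (by positivity)
  linarith

end Lower

lemma kap_le {n qm s w : ℝ} (hs0 : 0 ≤ s) (hs1 : s ≤ 1) (hq : qm ≤ s ^ 2) (hw0 : 0 ≤ w)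
    (hw : 1 / n ≤ w) (l : ℕ) : kap n qm (s ^ 4) l ≤ w + s ^ (l + 1) := by
  unfold kap
  split_ifs with hl
  · exact hq.trans ((pow_le_pow_of_le_one hs0 hs1 (by omega : l + 1 ≤ 2)).trans (by linarith))
  · rw [← pow_mul]
    exact add_le_add hw (pow_le_pow_of_le_one hs0 hs1 (by omega))

lemma sum_pow_le {s : ℝ} (hs0 : 0 ≤ s) (hs1 : s ≤ 1 / 2) (m i : ℕ) :
    ∑ j ∈ range i, s ^ (m + j + 1) ≤ 2 * s ^ (m + 1) := by
  have h : ∀ i, ∑ j ∈ range i, s ^ j ≤ 2 - 2 * s ^ i := fun i => by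
    induction i with
    | zero => simp
    | succ i ih =>
      rw [sum_range_succ, pow_succ]
      nlinarith [pow_nonneg hs0 i]
  have e : ∑ j ∈ range i, s ^ (m + j + 1) = s ^ (m + 1) * ∑ j ∈ range i, s ^ j := by
    rw [mul_sum]; exact sum_congr rfl fun j _ => by ring
  rw [e, mul_comm]
  exact mul_le_right ((h i).trans (by linarith [pow_nonneg hs0 i])) (by positivity)

lemma sum_kap_le {n qm s w : ℝ} (hs0 : 0 ≤ s) (hs1 : s ≤ 1 / 2) (hq : qm ≤ s ^ 2) (hw0 : 0 ≤ w)
    (hw : 1 / n ≤ w) (m i : ℕ) :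
    ∑ j ∈ range i, 2 * kap n qm (s ^ 4) (m + j) ≤ 2 * i * w + 4 * s ^ (m + 1) := by
  have h1 : ∑ j ∈ range i, 2 * kap n qm (s ^ 4) (m + j) ≤
      ∑ j ∈ range i, (2 * w + 2 * s ^ (m + j + 1)) := sum_le_sum fun j _ => by
    linarith [kap_le hs0 (by linarith : s ≤ 1) hq hw0 hw (m + j)]
  have e : ∑ j ∈ range i, (2 * w + 2 * s ^ (m + j + 1)) =
      i * (2 * w) + 2 * ∑ j ∈ range i, s ^ (m + j + 1) := by
    simp [sum_add_distrib, mul_sum]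
  linarith [sum_pow_le hs0 hs1 m i]

lemma half_pow_le {q : ℝ} (hq0 : 0 ≤ q) {d n : ℝ} (hn : 0 < n) (hq : q ≤ 1 - d) {L : ℕ}
    (hL : 3 * log n ≤ d * L) : n * q ^ L ≤ 1 / n ^ 2 := by
  have h1 : q ^ L ≤ exp (-d) ^ L := pow_le_pow_left₀ hq0 (hq.trans (by
    linarith [add_one_le_exp (-d)])) L
  have h2 : exp (-d) ^ L ≤ exp (-(3 * log n)) := by
    rw [← exp_nat_mul]; exact exp_le_exp.2 (by linarith)
  have h3 : exp (-(3 * log n)) = 1 / n ^ 3 := by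
    rw [exp_neg, mul_comm, exp_mul, exp_log hn, one_div]; norm_cast
  rw [h3] at h2
  refine (mul_le_left (h1.trans h2) hn.le).trans_eq ?_
  field_simp

lemma pow_le_of_half_pow {n x : ℝ} (hn : 0 < n) (h : n * x ≤ 1 / n ^ 2) : x ≤ 1 / n ^ 3 := by
  rw [le_div_iff₀ (by positivity)] at h ⊢
  linarith

set_option maxHeartbeats 1000000 in
/-- Uniform convergence of `K ^ m F` to the mean of `F`, with high probability. -/
lemma pr_Kpow_dev_le [Nonempty V] (hQ : IsDS Q) {qm s w z M d : ℝ} (hs0 : 0 ≤ s) (hs1 : s ≤ 1 / 2)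
    (hq : ∀ u v, Q u v ≤ qm) (hqs : qm ≤ s ^ 2) (hw : 1 / (nV : ℝ) ≤ w)
    {m L : ℕ} (hm1 : 1 ≤ m) (hm : m ≤ M) (hL1 : 1 ≤ L) (hL : L ≤ M) (hsm : s ^ m ≤ w) (hsz : s ≤ z)
    (hMw : M ^ 3 * w ≤ z) (hd0 : 0 < d) (hd1 : d ≤ 1) (hz : 40 * z ≤ d)
    (hLn : 12 * log nV ≤ d * L)
    {F : V → ℝ} (hF0 : ∀ v, 0 ≤ F v) (hF1 : ∀ v, F v ≤ 1) :
    pr (fun η => Contr Q (s ^ 4) η ∧ ¬ ∀ x, |Kpow Q η m F x - avg F| ≤ d) ≤ 2 / (nV : ℝ) ^ 2 := by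
  obtain ⟨m, rfl⟩ : ∃ m', m = m' + 1 := ⟨m - 1, by omega⟩
  set n : ℝ := (nV : ℝ) with hn
  have hn0 : 0 < n := card_pos_real
  have hw0 : 0 ≤ w := le_trans (by positivity) hw
  have hL1' : (1 : ℝ) ≤ L := Nat.one_le_cast.2 hL1
  have hM1 : 1 ≤ M := hL1'.trans hL
  push_cast at hm
  have hMw2 : M ^ 2 * w ≤ z := (mul_le_right (pow_le_pow_right₀ hM1 (by norm_num)) hw0).trans hMw
  have hMw1 : M * w ≤ z := by
    refine le_trans (mul_le_right ?_ hw0) hMw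
    simpa using pow_le_pow_right₀ hM1 (by norm_num : 1 ≤ 3)
  have hnw : 1 ≤ w * n := by rwa [div_le_iff₀ hn0] at hw
  set c := n - 5 * M ^ 2 with hc
  have hM2 : M ^ 2 ≤ z * n := by nlinarith [sq_nonneg M]
  have hcn : n / 2 ≤ c := by nlinarith
  have hcn' : c ≤ n - 2 * (((L + 1) * (m + 1) : ℕ) : ℝ) - 1 := by
    push_cast
    have : ((L : ℝ) + 1) * (m + 1) ≤ (2 * M) * M :=
      mul_le_mul (by linarith) hm (by positivity) (by linarith)
    nlinarith
  have key : ∀ F : V → ℝ, (∀ v, 0 ≤ F v) → (∀ v, F v ≤ 1) → ∀ x,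
      pr (fun η => Contr Q (s ^ 4) η ∧ avg F + d < Kpow Q η (m + 1) F x) ≤ 1 / n ^ 3 := by
    intro F hF0 hF1 x
    have ha0 : 0 ≤ avg F := div_nonneg (sum_nonneg fun x _ => hF0 x) hn0.le
    have ha1 : avg F ≤ 1 := by
      rw [avg, div_le_one hn0]
      have : ∑ x, F x ≤ ∑ _x : V, (1 : ℝ) := sum_le_sum fun x _ => hF1 x
      simpa using this
    have hb := pr_Kpow_gt_le hQ (a := s ^ 4) (by positivity) hq hF0 hF1 x m L (T := avg F + d)
      (c := c) (by linarith) (by linarith) hcn'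
    have hqm : 0 ≤ qm := (hQ.nonneg x x).trans (hq x x)
    have hk0 := kap_nonneg hn0.le hqm (pow_nonneg hs0 4)
    have hk := kap_le hs0 (by linarith : s ≤ 1) hqs hw0 hw m
    have hk2 := sum_kap_le hs0 hs1 hqs hw0 hw 0 m
    simp only [zero_add, pow_one] at hk2
    have e1 : ((L * (m + 1) : ℕ) : ℝ) * (2 * kap n qm (s ^ 4) m) ≤ 4 * z := by
      push_cast
      have : (L : ℝ) * (m + 1) ≤ M * M := mul_le_mul hL hm (by positivity) (by linarith)
      have := mul_le_mul this (by linarith : 2 * kap n qm (s ^ 4) m ≤ 4 * w)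
        (by linarith [hk0 m]) (by positivity)
      nlinarith
    have e2 : (∑ v, F v) / c ≤ avg F + 10 * z := by
      have : ∑ v, F v = avg F * n := by rw [avg, ← hn]; field_simp
      rw [this, div_le_iff₀ (by linarith)]
      nlinarith [mul_nonneg (sub_nonneg.2 ha1) (sq_nonneg M)]
    have e3 : 2 * (m : ℝ) * w ≤ 2 * z := by nlinarith
    have hnum : (((L * (m + 1) : ℕ) : ℝ) * (2 * kap n qm (s ^ 4) m) +
        ∑ l ∈ range m, 2 * kap n qm (s ^ 4) l + (∑ v, F v) / c) / (avg F + d) ≤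
        1 - d / 4 := by
      rw [div_le_iff₀ (add_pos_of_nonneg_of_pos ha0 hd0)]
      have h1 : d * avg F ≤ d * 1 := mul_le_left ha1 hd0.le
      have h2 : d * d ≤ d * 1 := mul_le_left hd1 hd0.le
      refine (add_le_add (add_le_add e1 (hk2.trans (add_le_add e3
        (mul_le_left hsz zero_le_four)))) e2).trans ?_
      clear * - h1 h2 hz
      linarith
    have hnn : 0 ≤ (((L * (m + 1) : ℕ) : ℝ) * (2 * kap n qm (s ^ 4) m) +
        ∑ l ∈ range m, 2 * kap n qm (s ^ 4) l + (∑ v, F v) / c) / (avg F + d) := by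
      refine div_nonneg (add_nonneg (add_nonneg (mul_nonneg (Nat.cast_nonneg _) ?_)
        (sum_nonneg fun l _ => ?_))
        (div_nonneg (sum_nonneg fun x _ => hF0 x) (by linarith))) (by linarith)
      exacts [mul_nonneg two_pos.le (hk0 _), mul_nonneg two_pos.le (hk0 _)]
    refine hb.trans ?_
    have h3 : 3 * log n ≤ d / 4 * L := by clear * - hLn; linarith
    generalize (((L * (m + 1) : ℕ) : ℝ) * (2 * kap n qm (s ^ 4) m) +
        ∑ l ∈ range m, 2 * kap n qm (s ^ 4) l + (∑ v, F v) / c) / (avg F + d) = q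
      at hnum hnn ⊢
    exact pow_le_of_half_pow hn0 (half_pow_le hnn hn0 hnum h3)
  have hsub : pr (fun η => Contr Q (s ^ 4) η ∧ ¬ ∀ x, |Kpow Q η (m + 1) F x - avg F| ≤ d) ≤
      pr (fun η => (∃ x ∈ univ, Contr Q (s ^ 4) η ∧ avg F + d < Kpow Q η (m + 1) F x) ∨
        ∃ x ∈ univ, Contr Q (s ^ 4) η ∧
          avg (fun v => 1 - F v) + d < Kpow Q η (m + 1) (fun v => 1 - F v) x) := by
    refine pr_mono fun η _ h => ?_
    obtain ⟨hC, h⟩ := h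
    push Not at h
    obtain ⟨x, hx⟩ := h
    have e : avg (fun v => 1 - F v) = 1 - avg F := by rw [avg, sum_sub_distrib, avg, sub_div]; simp
    rcases lt_abs.1 hx with h | h
    · exact Or.inl ⟨x, mem_univ x, hC, by linarith⟩
    · refine Or.inr ⟨x, mem_univ x, hC, ?_⟩
      rw [e, Kpow_sub_fun, Kpow_const hQ]
      linarith
  refine hsub.trans ((pr_or_le _ _).trans ?_)
  have h1 := pr_exists_le_mul univ _ fun x _ => key F hF0 hF1 x
  have h2 := pr_exists_le_mul univ _ fun x _ => key (fun v => 1 - F v)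
    (fun v => by linarith [hF1 v]) (fun v => by linarith [hF0 v]) x
  have e : ((univ : Finset V).card : ℝ) * (1 / n ^ 3) = 1 / n ^ 2 := by
    rw [card_univ, ← hn]; field_simp
  rw [e] at h1 h2
  calc _ ≤ 1 / n ^ 2 + 1 / n ^ 2 := add_le_add h1 h2
    _ = _ := by ring

set_option maxHeartbeats 1000000 in
open Classical in
lemma pr_not_spread_le [Nonempty V] (hQ : IsDS Q) {qm s w z M d d1 wm θ : ℝ} (hs0 : 0 ≤ s)
    (hs1 : s ≤ 1 / 2) (hq : ∀ u v, Q u v ≤ qm) (hqs : qm ≤ s ^ 2)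
    (hw : 1 / (nV : ℝ) ≤ w) {m i L : ℕ} (hm : m ≤ M) (hi : i ≤ M) (hL1 : 1 ≤ L)
    (hL : L ≤ M) (hsm : s ^ m ≤ w) (hsz : s ≤ z) (hMw : M ^ 3 * w ≤ z) (hd0 : 0 < d) (hd1 : d ≤ 1)
    (hz : 60 * z ≤ d ^ 2) (hLn : 12 * log nV ≤ L) (hwm : 0 ≤ wm) (hθ : 0 < θ)
    (hγ : 8 ^ i * (wm + 82 * M ^ 3 / nV) ≤ z * θ) :
    pr (fun η => (Contr Q (s ^ 4) η ∧
        ∀ u, pl Q η i u (fun as => if wm < gw Q η as [] u then 1 else 0) ≤ d1) ∧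
        ¬ ∀ x, Kpow Q η m (fun u => if SpreadAt Q η i (d1 + d) θ u then 0 else 1) x ≤ d) ≤
      1 / (nV : ℝ) ^ 2 := by
  set n : ℝ := (nV : ℝ) with hn
  have hn0 : 0 < n := card_pos_real
  have hw0 : 0 ≤ w := le_trans (by positivity) hw
  have hL1' : (1 : ℝ) ≤ L := Nat.one_le_cast.2 hL1
  have hM1 : 1 ≤ M := hL1'.trans hL
  have hMw2 : M ^ 2 * w ≤ z := (mul_le_right (pow_le_pow_right₀ hM1 (by norm_num)) hw0).trans hMw
  have hnw : 1 ≤ w * n := by rwa [div_le_iff₀ hn0] at hw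
  set ℓ : ℕ := (L + 1) * (m + 2 * i) + 2 * i + 2 with hℓ
  have hℓM : (ℓ : ℝ) ≤ 10 * M ^ 2 := by
    rw [hℓ]; push_cast
    have : ((L : ℝ) + 1) * (m + 2 * i) ≤ (2 * M) * (3 * M) :=
      mul_le_mul (by linarith) (by linarith) (by positivity) (by linarith)
    nlinarith
  have hM2 : M ^ 2 ≤ z * n := by nlinarith [sq_nonneg M]
  have hz0 : 0 ≤ z := hs0.trans hsz
  have hz60 : 60 * z ≤ 1 := hz.trans (by nlinarith)
  have key : ∀ x, pr (fun η => (Contr Q (s ^ 4) η ∧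
        ∀ u, pl Q η i u (fun as => if wm < gw Q η as [] u then 1 else 0) ≤ d1) ∧
        d < Kpow Q η m (fun u => if SpreadAt Q η i (d1 + d) θ u then 0 else 1) x) ≤ 1 / n ^ 3 := by
    intro x
    have hqm : 0 ≤ qm := (hQ.nonneg x x).trans (hq x x)
    have hk0 := kap_nonneg hn0.le hqm (pow_nonneg hs0 4)
    have hb := pr_spread_le hQ (a := s ^ 4) (by positivity) hq x m i L (d1 := d1) (c := n / 2) hwm
      hd0 hθ hd0 (by positivity) (by nlinarith)
    refine hb.trans ?_
    rw [← hn, ← hℓ]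
    set S1 := ∑ j ∈ range i, 2 * kap n qm (s ^ 4) (m + j)
    set S2 := ∑ l ∈ range m, ∑ j ∈ range i, 2 * kap n qm (s ^ 4) (l + j)
    have hS1 : S1 ≤ 6 * (M * w) := by
      have h1 := sum_kap_le hs0 hs1 hqs hw0 hw m i
      have h2 : s ^ (m + 1) ≤ w := (pow_le_pow_of_le_one hs0 (by linarith) (by omega)).trans hsm
      have h3 : (i : ℝ) * w ≤ M * w := mul_le_right hi hw0
      have h4 : w ≤ M * w := le_mul_of_one_le_left hw0 hM1
      linarith
    have hS2 : S2 ≤ 10 * z := by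
      have h1 : S2 ≤ ∑ l ∈ range m, (2 * i * w + 4 * s ^ (0 + l + 1)) :=
        sum_le_sum fun l _ => by simpa using sum_kap_le hs0 hs1 hqs hw0 hw l i
      have e : ∑ l ∈ range m, (2 * i * w + 4 * s ^ (0 + l + 1)) =
          m * (2 * i * w) + 4 * ∑ l ∈ range m, s ^ (0 + l + 1) := by
        simp [sum_add_distrib, mul_sum]
      rw [e] at h1
      have h2 := sum_pow_le hs0 hs1 0 m
      rw [zero_add, pow_one] at h2
      have h3 : (m : ℝ) * (2 * i * w) ≤ 2 * z := by
        have : (m : ℝ) * i ≤ M * M := mul_le_mul hm hi (by positivity) (by linarith)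
        nlinarith
      linarith
    have hS10 : 0 ≤ S1 := sum_nonneg fun j _ => mul_nonneg two_pos.le (hk0 _)
    have hS20 : 0 ≤ S2 := sum_nonneg fun l _ =>
      sum_nonneg fun j _ => mul_nonneg two_pos.le (hk0 _)
    have hβ : ((L * (m + 2 * i) : ℕ) : ℝ) * S1 + S2 ≤ 28 * z := by
      push_cast
      have : (L : ℝ) * (m + 2 * i) ≤ M * (3 * M) :=
        mul_le_mul hL (by linarith) (by positivity) (by linarith)
      nlinarith
    have hγ' : 4 ^ i * (wm + i * (2 ^ i * (4 * (ℓ : ℝ) + 1) / (n / 2))) ≤ z * θ := by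
      refine le_trans ?_ hγ
      have e8 : (8 : ℝ) ^ i = 4 ^ i * 2 ^ i := by rw [← mul_pow]; norm_num
      have h21 : (1 : ℝ) ≤ 2 ^ i := one_le_pow₀ (by norm_num)
      rw [e8, mul_assoc]
      refine mul_le_left ?_ (by positivity)
      rw [mul_add (2 ^ i) wm]
      refine add_le_add (le_mul_of_one_le_left hwm h21) ?_
      have : (i : ℝ) * (4 * ℓ + 1) ≤ M * (41 * M ^ 2) :=
        mul_le_mul hi (by nlinarith) (by positivity) (by linarith)
      rw [show (i : ℝ) * (2 ^ i * (4 * (ℓ : ℝ) + 1) / (n / 2)) =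
        2 ^ i * ((i * (4 * (ℓ : ℝ) + 1)) * 2 / n) by field_simp]
      refine mul_le_left (div_le_div_of_nonneg_right (by linarith) hn0.le) (by positivity)
    have hnum : ((((L * (m + 2 * i) : ℕ) : ℝ) * S1 + S2) / d +
        4 ^ i * (wm + i * (2 ^ i * (4 * (ℓ : ℝ) + 1) / (n / 2))) / θ) / d ≤ 1 - 1 / 4 := by
      have hd2 : d ^ 2 = d * d := sq d
      have h1 : (((L * (m + 2 * i) : ℕ) : ℝ) * S1 + S2) / d ≤ 28 * d / 60 := by
        rw [div_le_iff₀ hd0]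
        refine hβ.trans ?_
        clear * - hz hd2
        linarith
      have h2 : 4 ^ i * (wm + i * (2 ^ i * (4 * (ℓ : ℝ) + 1) / (n / 2))) / θ ≤ d / 60 := by
        rw [div_le_iff₀ hθ]
        refine hγ'.trans (mul_le_right ?_ hθ.le)
        clear * - hz hd1 hd0
        nlinarith
      rw [div_le_iff₀ hd0]
      refine (add_le_add h1 h2).trans ?_
      clear * - hd0
      linarith
    have hnn : 0 ≤ ((((L * (m + 2 * i) : ℕ) : ℝ) * S1 + S2) / d +
        4 ^ i * (wm + i * (2 ^ i * (4 * (ℓ : ℝ) + 1) / (n / 2))) / θ) / d := by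
      clear_value S1 S2
      positivity
    have h3 : 3 * log n ≤ 1 / 4 * L := by clear * - hLn; linarith
    exact pow_le_of_half_pow hn0 (half_pow_le hnn hn0 hnum h3)
  have h1 := pr_exists_le_mul univ _ fun x _ => key x
  have e : ((univ : Finset V).card : ℝ) * (1 / n ^ 3) = 1 / n ^ 2 := by
    rw [card_univ, ← hn]; field_simp
  rw [e] at h1
  refine le_trans (pr_mono fun η _ h => ?_) h1
  obtain ⟨hC, h⟩ := h
  push Not at h
  obtain ⟨x, hx⟩ := h
  exact ⟨x, mem_univ x, hC, hx⟩

/-- Decorrelation with high probability, all scales being powers of `u`. -/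
lemma pr_not_decor_le_of_pow (hconn : G.Connected) {ε C0 u : ℝ} {D : ℕ} (hε0 : 0 < ε) (hu : 64 ≤ u)
    (hC0 : 0 ≤ C0) (hC : 8 * C0 * 5 ^ D ≤ u) (hε : ε * u ^ (480 * (D + 1)) ≤ 1)
    (hn : u ^ 600 ≤ nV)
    (hball : ∀ (x : V) (r : ℕ), ((gball G x r).card : ℝ) ≤ C0 * ((r : ℝ) + 1) ^ D) :
    pr (fun η => ¬ Decor G ε (u⁻¹ ^ 4) η) ≤ 4 / (nV : ℝ) ^ 2 + 16 / √nV := by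
  set n : ℝ := (nV : ℝ) with hn'
  have hu0 : 0 < u := by linarith
  have hu1 : 1 ≤ u := by linarith
  have hn0 := lt_of_lt_of_le (by positivity) hn
  have hpw : ∀ {k l : ℕ}, k ≤ l → u ^ k ≤ u ^ l := fun h => pow_le_pow_right₀ hu1 h
  have hmul : ∀ k l : ℕ, l = k + 1 → 64 * u ^ k ≤ u ^ l := fun k l h => by
    rw [h, pow_succ']; exact mul_le_right hu (by positivity)
  obtain ⟨ρ, hρ1, hρ2⟩ : ∃ ρ : ℕ, u ^ 240 ≤ ρ ∧ (ρ : ℝ) ≤ u ^ 240 + 1 :=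
    ⟨⌈u ^ 240⌉₊, Nat.le_ceil _, (Nat.ceil_lt_add_one (by positivity)).le⟩
  obtain ⟨b, hb1, hb2⟩ : ∃ b : ℕ, u ^ 8 ≤ b ∧ (b : ℝ) ≤ u ^ 8 + 1 :=
    ⟨⌈u ^ 8⌉₊, Nat.le_ceil _, (Nat.ceil_lt_add_one (by positivity)).le⟩
  have h1k : ∀ k : ℕ, 1 ≤ u ^ k := fun k => one_le_pow₀ hu1
  have hρ3 : ((ρ + 1 : ℕ) : ℝ) ≤ 3 * u ^ 240 := by push_cast; linarith [h1k 240]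
  have hρ4 : u ^ 240 ≤ ((ρ + 1 : ℕ) : ℝ) := by push_cast; linarith
  have hsn : u ^ 300 ≤ √n := le_sqrt_of_sq_le (by rw [← pow_mul]; exact hn)
  have hsq := mul_self_sqrt hn0.le
  have hα : (u⁻¹ ^ 24) * u ^ 24 = 1 := by rw [← mul_pow, inv_mul_cancel₀ hu0.ne', one_pow]
  set α := u⁻¹ ^ 24 with hαd
  have hα0 : 0 < α := by positivity
  have hαp : ∀ k l : ℕ, α ^ k * u ^ (24 * k + l) = u ^ l := fun k l => by
    rw [pow_add, ← mul_assoc, pow_mul, ← mul_pow, hα, one_pow, one_mul]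
  have hMn : ((ρ + 1 : ℕ) : ℝ) * √n ≤ α * n := by
    have h1 : ((ρ + 1 : ℕ) : ℝ) ≤ α * √n := by
      have h2 : α * u ^ 265 ≤ α * √n := mul_le_left ((hpw (by norm_num)).trans hsn) hα0.le
      have h3 : α * u ^ 265 = u ^ 241 := by simpa using hαp 1 241
      linarith [hmul 240 241 rfl, h1k 240]
    calc _ ≤ α * √n * √n := mul_le_right h1 (sqrt_nonneg _)
      _ = α * n := by rw [mul_assoc, hsq]
  have hα1 : α ≤ 1 / 8 := by nlinarith [h1k 23, hmul 23 24 rfl]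
  have hstep : ∀ k l : ℕ, ∀ X : ℝ, 24 * k + 2 ≤ l → u ^ l ≤ X → 400 ≤ α ^ k * X := by
    intro k l X hl hX
    have h2 : α ^ k * u ^ (24 * k + 2) ≤ α ^ k * X :=
      mul_le_left ((hpw hl).trans hX) (by positivity)
    rw [hαp] at h2
    nlinarith
  have hρn : ρ + 1 ≤ nV := by
    rw [← Nat.cast_le (α := ℝ)]
    have h1 := (h1k 300).trans hsn
    have h2 := le_mul_of_one_le_right (by positivity) h1
    nlinarith
  set B : ℝ := C0 * (((2 * ρ : ℕ) : ℝ) + 1) ^ D with hB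
  have hθ : ((2 * ρ : ℕ) : ℝ) * B * (2 * ε) ≤ (u⁻¹ ^ 100) ^ 2 := by
    have h1 : ((2 * ρ : ℕ) : ℝ) ≤ 4 * u ^ 240 := by push_cast; linarith [h1k 240]
    have h2 : ((2 * ρ : ℕ) : ℝ) + 1 ≤ 5 * u ^ 240 := by linarith [h1k 240]
    have h3 : B ≤ C0 * (5 * u ^ 240) ^ D := by rw [hB]; gcongr
    have e : u ^ (480 * (D + 1)) = (u ^ 240) ^ (D + 1) * (u ^ 240) ^ (D + 1) := by
      rw [← pow_mul, ← pow_add, show 480 * (D + 1) = 240 * (D + 1) + 240 * (D + 1) by ring]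
    have h4 : ε * (u ^ 240) ^ (D + 1) * u ^ 240 ≤ 1 := by
      refine le_trans ?_ hε
      rw [e, ← mul_assoc]
      exact mul_le_left (le_self_pow₀ (h1k 240) (by omega)) (by positivity)
    have h5 : ((2 * ρ : ℕ) : ℝ) * B * (2 * ε) ≤ 4 * u ^ 240 * (C0 * (5 * u ^ 240) ^ D) * (2 * ε) := by
      gcongr
    have h6 : 4 * u ^ 240 * (C0 * (5 * u ^ 240) ^ D) * (2 * ε) =
        (8 * C0 * 5 ^ D) * (ε * (u ^ 240) ^ (D + 1)) := by rw [mul_pow]; ring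
    have h7 : (8 * C0 * 5 ^ D) * (ε * (u ^ 240) ^ (D + 1)) ≤ u ^ 40 * (ε * (u ^ 240) ^ (D + 1)) :=
      mul_le_right (hC.trans (le_self_pow₀ hu1 (by norm_num))) (by positivity)
    have h8 : u ^ 200 * (u ^ 40 * (ε * (u ^ 240) ^ (D + 1))) ≤ 1 := by
      refine le_trans (le_of_eq ?_) h4; ring
    rw [← pow_mul, inv_pow, ← one_div, le_div_iff₀ (by positivity)]
    refine le_trans ?_ h8
    rw [mul_comm]
    exact mul_le_left (h5.trans (h6.le.trans h7)) (by positivity)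
  have main := pr_not_decor_le hconn hρn (fun x => hball x (2 * ρ)) hα0 hα1
    (by linarith [hstep 2 240 _ (by norm_num) hρ4]) (hstep 8 240 _ (by norm_num) hρ4) hMn
    (by linarith [hstep 4 600 n (by norm_num) hn]) b
    (by rw [← Nat.cast_lt (α := ℝ)]; push_cast; linarith [hmul 7 8 rfl, h1k 7])
    (by positivity) hθ (pow_le_one₀ (by positivity) (inv_le_one_of_one_le₀ hu1))
  have hκ : 16 * (6 * α * (b : ℝ) ^ 2 + 2 / b) + 6 * u⁻¹ ^ 100 ≤ u⁻¹ ^ 4 := by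
    have h8 : u⁻¹ ^ 8 * u ^ 8 = 1 := by rw [← mul_pow, inv_mul_cancel₀ hu0.ne', one_pow]
    have hi1 : u⁻¹ ≤ 1 / 64 := by rw [← one_div]; gcongr
    have h1 : α * (b : ℝ) ^ 2 ≤ 4 * u⁻¹ ^ 8 := by
      have : (b : ℝ) ^ 2 ≤ (2 * u ^ 8) ^ 2 := by gcongr; linarith [h1k 8]
      calc α * (b : ℝ) ^ 2 ≤ α * (2 * u ^ 8) ^ 2 := by gcongr
        _ = 4 * u⁻¹ ^ 8 * (u⁻¹ ^ 8 * u ^ 8) ^ 2 := by rw [hαd]; ring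
        _ = _ := by rw [h8]; ring
    have h2 : 2 / (b : ℝ) ≤ 2 * u⁻¹ ^ 8 := by
      rw [div_le_iff₀ (by linarith [h1k 8])]
      nlinarith [mul_le_left hb1 (by positivity : 0 ≤ u⁻¹ ^ 8)]
    have h3 : u⁻¹ ^ 100 ≤ u⁻¹ ^ 8 := pow_le_pow_of_le_one (by positivity) (by linarith) (by norm_num)
    have h4 : u⁻¹ ^ 8 ≤ (1 / 64) ^ 4 * u⁻¹ ^ 4 := by
      rw [show u⁻¹ ^ 8 = u⁻¹ ^ 4 * u⁻¹ ^ 4 by ring]; gcongr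
    have h5 : 0 ≤ u⁻¹ ^ 4 := by positivity
    norm_num only at h4 ⊢
    linarith
  refine (pr_mono fun η _ h h' => h fun s hs f g F F' hF hF' h1 h2 h3 h4 =>
    (h' s hs f g F F' hF hF' h1 h2 h3 h4).trans (mul_le_right hκ (by positivity))).trans
    (main.trans (add_le_add le_rfl ?_))
  · rw [show (16 : ℝ) / √n = 16 * (1 / √n) by ring]
    refine mul_le_left ?_ (by norm_num)
    have hs0 := sqrt_pos.2 hn0
    have h1 : √n ≤ n / ((ρ + 1 : ℕ) : ℝ) := by
      rw [le_div_iff₀ (by positivity)]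
      nlinarith
    rw [exp_neg, ← one_div]
    refine one_div_le_one_div_of_le hs0 (h1.trans ?_)
    linarith [add_one_le_exp (n / ((ρ + 1 : ℕ) : ℝ))]

/-- After `m` steps, averages of `F` are within a factor `1 ± c` of its mean. -/
def Ergodic {V : Type*} [Fintype V] (Q : V → V → ℝ) (η : V → V) (m : ℕ) (F : V → ℝ) (c : ℝ) : Prop :=
  ∀ j, m ≤ j → ∀ x, |Kpow Q η j F x - avg F| ≤ c * avg F

/-- The number of steps after which averages have converged. -/
def burn (g ℓ Λ : ℝ) : ℕ := ⌈Λ / (g * ℓ)⌉₊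

lemma sum_sq_add_sqrt_le {w σ H : ℝ} (hw0 : 0 ≤ w) (hσ0 : 0 ≤ σ) (hw : w ≤ 1 / 2) (hσ : σ ≤ 1 / 2)
    (hH : 2 ≤ H) (k : ℕ) :
    ∑ j ∈ range k, (H * (w + σ ^ (j + 1)) ^ 2 + 2 * √((w + σ ^ (j + 1)) ^ 2)) ≤
      2 * H * (k * w + 2 * σ) := by
  have h1 := sum_pow_le hσ0 hσ 0 k
  simp only [zero_add, pow_one] at h1
  calc _ ≤ ∑ j ∈ range k, 2 * H * (w + σ ^ (j + 1)) := sum_le_sum fun j _ => by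
        have h2 : σ ^ (j + 1) ≤ σ := pow_le_of_le_one hσ0 (by linarith) (by omega)
        have h3 : 0 ≤ w + σ ^ (j + 1) := by positivity
        rw [sqrt_sq h3]
        have h4 : (w + σ ^ (j + 1)) ^ 2 ≤ w + σ ^ (j + 1) := by nlinarith
        nlinarith [mul_le_left h4 (by linarith : 0 ≤ H)]
    _ = 2 * H * (k * w + ∑ j ∈ range k, σ ^ (j + 1)) := by rw [← mul_sum, sum_add_distrib]; simp
    _ ≤ _ := by gcongr

/-- The quantitative assumptions under which the walk on `G*` mixes at precision `δ`: the parameter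
`g` is a large constant, `ℓ` is a small multiple of `log (1 / ε)` and `Λ = log |V|`. -/
structure Regime {V : Type*} [Fintype V] [DecidableEq V] (G : SimpleGraph V) [DecidableRel G.Adj]
    (D : ℕ) (Δ C0 C δ ρ g ε ℓ Λ : ℝ) : Prop where
  conn : G.Connected
  one_le_dg : ∀ x, 1 ≤ dg G x
  dg_le : ∀ x, dg G x ≤ Δ
  ball : ∀ (x : V) (r : ℕ), ((gball G x r).card : ℝ) ≤ C0 * ((r : ℝ) + 1) ^ D
  C0_nonneg : 0 ≤ C0
  le_C : Δ + 1 ≤ C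
  le_C' : 8 * C0 * 5 ^ D ≤ C
  le_C'' : C0 * (3 * (Δ + 1)) ^ D * (Δ + 1) ≤ C
  le_C_sq : (2 * (D + 2) : ℝ) ^ 2 * (2 * (960 * (D + 1)) ^ 2 + 8 * Δ) + 32 * C0 ≤ C ^ 2
  δ_pos : 0 < δ
  δ_le : δ ≤ 1
  ρ_eq : 64 * C * ρ = δ
  g_eq : 2000 * C ^ 2 = δ * ρ ^ 2 * g
  card_eq : (Fintype.card V : ℝ) = exp Λ
  ε_eq : ε = exp (-(960 * (D + 1) * ℓ))
  le_ℓ : g ^ 9 ≤ ℓ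
  le_Λ : g ^ 9 * ℓ ≤ Λ
  le_exp : g ^ 9 * Λ ^ (D + 3) ≤ exp (Λ / g)

namespace Regime
variable {D : ℕ} {Δ C0 C δ ρ g ℓ Λ : ℝ} (R : Regime G D Δ C0 C δ ρ g ε ℓ Λ)
include R

lemma nonempty : Nonempty V := R.conn.nonempty

lemma one_le_Δ : 1 ≤ Δ := (R.one_le_dg R.nonempty.some).trans (R.dg_le _)

lemma C_ge : 960 * ((D : ℝ) + 1) ≤ C := by
  have h1 := R.one_le_Δ
  refine le_of_sq_le_sq ?_ (by linarith [R.le_C])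
  have hD : (0 : ℝ) ≤ D := D.cast_nonneg
  have h2 : (1 : ℝ) ≤ (2 * (D + 2)) ^ 2 := one_le_pow₀ (by linarith)
  have h3 : (0 : ℝ) ≤ 2 * (960 * (D + 1)) ^ 2 + 8 * Δ := by positivity
  nlinarith [R.le_C_sq, R.C0_nonneg, mul_le_right h2 h3, sq_nonneg (960 * ((D : ℝ) + 1))]

lemma ρ_pos : 0 < ρ := by
  have := R.C_ge; have := R.ρ_eq; have := R.δ_pos
  by_contra! h
  nlinarith [(D.cast_nonneg : (0 : ℝ) ≤ D)]

lemma basic : 960 ≤ C ∧ ρ ≤ 1 / 64 ∧ 2000 ≤ g ∧ C ≤ g ∧ 1 ≤ ρ * g ∧ 1 ≤ δ * g := by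
  have hρ := R.ρ_pos
  have hC : 960 ≤ C := by linarith [R.C_ge, (D.cast_nonneg : (0 : ℝ) ≤ D)]
  have hδ := R.δ_pos
  have h1 := R.ρ_eq
  have h2 := R.g_eq
  have h3 := R.δ_le
  have hρ1 : ρ ≤ 1 / 64 := by nlinarith
  have hg : 0 < g := by
    by_contra! h
    nlinarith [mul_nonneg (mul_nonneg hδ.le (sq_nonneg ρ)) (neg_nonneg.2 h)]
  have h4 : 1 ≤ ρ * g := by
    have : δ * ρ ^ 2 * g ≤ ρ * g := mul_le_right (by nlinarith) hg.le
    nlinarith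
  have h5 : 2000 * C ^ 2 ≤ g := by rw [h2]; exact mul_le_of_le_one_left hg.le (by nlinarith)
  exact ⟨hC, hρ1, by nlinarith, by nlinarith, h4, by nlinarith⟩

lemma le_ℓ' {c : ℝ} (k : ℕ) (hk : k ≤ 9) (h : c ≤ g ^ k) : c ≤ ℓ :=
  h.trans ((pow_le_pow_right₀ (by linarith [R.basic.2.2.1]) hk).trans R.le_ℓ)

lemma ℓ_ge : 2000 ≤ ℓ := R.le_ℓ' 1 (by norm_num) (by simpa using R.basic.2.2.1)

lemma le_Λ' {c : ℝ} (k : ℕ) (hk : k ≤ 9) (h : c ≤ g ^ k) : c * ℓ ≤ Λ :=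
  (mul_le_right (h.trans (pow_le_pow_right₀ (by linarith [R.basic.2.2.1]) hk))
    (by linarith [R.ℓ_ge])).trans R.le_Λ

lemma Λ_ge : 2000 * ℓ ≤ Λ := R.le_Λ' 1 (by norm_num) (by simpa using R.basic.2.2.1)

lemma small {c κ : ℝ} {p : ℕ} (k : ℕ) (hk : k ≤ 9)
    (h : c ≤ g ^ k) (hp : p ≤ D + 3) (hκ : 1 ≤ κ * g) : c * Λ ^ p ≤ exp (κ * Λ) := by
  have hg := R.basic.2.2.1
  have hΛ : 1 ≤ Λ := by linarith [R.Λ_ge, R.ℓ_ge]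
  have h1 := mul_le_mul (h.trans (pow_le_pow_right₀ (by linarith) hk)) (pow_le_pow_right₀ hΛ hp)
      (by positivity) (by positivity)
  refine h1.trans (R.le_exp.trans (exp_le_exp.2 ?_))
  rw [div_le_iff₀ (by linarith)]
  nlinarith

lemma ε_pos : 0 < ε := R.ε_eq ▸ exp_pos _

lemma ε_le : ε ≤ 1 := by
  have := R.ℓ_ge
  rw [R.ε_eq, exp_le_one_iff, neg_nonpos]; positivity

lemma pr_not_decor : pr (fun η => ¬ Decor G ε (exp (-(2 * ℓ)) ^ 4) η) ≤
      4 / (nV : ℝ) ^ 2 + 16 / √nV := by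
  have hℓ := R.ℓ_ge
  have h1 := add_one_le_exp (2 * ℓ)
  have hC := R.le_ℓ' 1 (by norm_num) (by simpa using R.basic.2.2.2.1)
  rw [exp_neg]
  refine pr_not_decor_le_of_pow R.conn R.ε_pos (by linarith) R.C0_nonneg (by linarith [R.le_C'])
    ?_ ?_ R.ball
  · rw [R.ε_eq, ← exp_nat_mul, ← exp_add, exp_le_one_iff]
    push_cast; linarith
  · rw [R.card_eq, ← exp_nat_mul]
    exact exp_le_exp.2 (by push_cast; linarith [R.Λ_ge])

lemma gQ_le (u v : V) : Qε u v ≤ exp (-(2 * ℓ)) ^ 2 := by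
  have hℓ := R.ℓ_ge
  have h4 : 4 ≤ exp ℓ := by linarith [add_one_le_exp ℓ]
  rw [← exp_nat_mul]
  have hD : (0 : ℝ) ≤ D * ℓ := by positivity
  refine (gQ_le_max R.ε_pos R.conn u v).trans (max_le ?_ ?_)
  · rw [R.ε_eq, sqrt_eq_rpow, ← exp_mul]
    refine (mul_le_right h4 (exp_pos _).le).trans ?_
    rw [← exp_add]
    exact exp_le_exp.2 (by push_cast; linarith)
  · rw [R.card_eq, div_eq_mul_inv, ← exp_neg]
    refine (mul_le_right (by linarith : 2 ≤ exp ℓ) (exp_pos _).le).trans ?_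
    rw [← exp_add]
    exact exp_le_exp.2 (by push_cast; linarith [R.Λ_ge])

lemma info_sq_le (u : V) : ∑ a, Qε u a * info Qε u a ^ 2 ≤ (C * ℓ) ^ 2 := by
  refine (sum_gQ_info_sq_le R.ε_pos R.ε_le R.conn R.dg_le R.ball u).trans ?_
  have e : log (1 / ε) = 960 * (D + 1) * ℓ := by rw [R.ε_eq, one_div, log_inv, log_exp]; ring
  have h1 : 1 ≤ ℓ ^ 2 := one_le_pow₀ (by linarith [R.ℓ_ge])
  have h2 := mul_le_right R.le_C_sq (sq_nonneg ℓ)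
  rw [e]
  have h3 : (0 : ℝ) ≤ (2 * (D + 2)) ^ 2 * (8 * Δ) + 32 * C0 := by
    have := R.one_le_Δ; have := R.C0_nonneg; positivity
  nlinarith

lemma le_ent' (u : V) : ℓ ≤ ent Qε u := by
  refine le_trans ?_ (le_ent (gQ_isDS G R.ε_pos) R.gQ_le u)
  rw [← exp_nat_mul, log_exp]; push_cast; linarith [R.ℓ_ge]

lemma ent_le (u : V) : ent Qε u ≤ C * ℓ :=
  le_of_sq_le_sq ((ent_sq_le (gQ_isDS G R.ε_pos) u).trans (R.info_sq_le u))
    (mul_nonneg (by linarith [R.basic.1]) (by linarith [R.ℓ_ge]))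

lemma crossMean_mem (x : V) : ε⁻¹ ≤ crossMean G ε x ∧ crossMean G ε x ≤ C * ε⁻¹ := by
  have hQ := gQ_isDS G R.ε_pos
  have hε := inv_pos.2 R.ε_pos
  have key : ∀ c : ℝ, ∑ y, Qε x y * c = c := fun c => by rw [← sum_mul, hQ.row, one_mul]
  rw [mul_comm C]
  refine ⟨le_mul_of_one_le_right hε.le ((key 1).symm.trans_le (sum_le_sum fun y _ =>
    mul_le_left ?_ (hQ.nonneg x y))), mul_le_left
    ((sum_le_sum fun y _ => mul_le_left ?_ (hQ.nonneg x y)).trans_eq (key C))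
    hε.le⟩
  · linarith [mul_one (dg G y + ε), R.one_le_dg y, R.ε_pos]
  · linarith [mul_one (dg G y + ε), R.dg_le y, R.ε_le, R.le_C]

lemma burn_mem : 1 ≤ burn g ℓ Λ ∧ Λ ≤ burn g ℓ Λ * (g * ℓ) ∧ burn g ℓ Λ * (g * ℓ) ≤ 2 * Λ := by
  have hg := R.basic.2.2.1
  have hℓ := R.ℓ_ge
  have hgℓ : 0 < g * ℓ := by positivity
  have hΛ := R.le_Λ' 1 (by norm_num) (pow_one g).ge
  have h1 := Nat.le_ceil (Λ / (g * ℓ))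
  have h2 := (Nat.ceil_lt_add_one (div_nonneg (by linarith : 0 ≤ Λ) hgℓ.le)).le
  rw [div_add_one hgℓ.ne', le_div_iff₀ hgℓ] at h2
  rw [div_le_iff₀ hgℓ] at h1
  exact ⟨Nat.ceil_pos.2 (div_pos (by linarith) hgℓ), h1, h2.trans (by linarith)⟩

lemma exp_le_z : exp (-(2 * ℓ)) ≤ 1 / (60 * g ^ 2) := by
  have hg := R.basic.2.2.1
  have h1 : 60 * g ^ 2 ≤ ℓ := R.le_ℓ' 3 (by norm_num) (by nlinarith [sq_nonneg g])
  rw [exp_neg, ← one_div]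
  exact one_div_le_one_div_of_le (by positivity) (by linarith [add_one_le_exp (2 * ℓ), R.ℓ_ge])

lemma scales : 1 / (nV : ℝ) ≤ exp (-(2 / g * Λ)) ∧ burn g ℓ Λ ≤ 13 * g * Λ ∧
    1 ≤ ⌈12 * g * Λ⌉₊ ∧ (⌈12 * g * Λ⌉₊ : ℝ) ≤ 13 * g * Λ ∧
    exp (-(2 * ℓ)) ^ burn g ℓ Λ ≤ exp (-(2 / g * Λ)) ∧
    (13 * g * Λ) ^ 3 * exp (-(2 / g * Λ)) ≤ 1 / (60 * g ^ 2) := by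
  have hg := R.basic.2.2.1
  have hℓ := R.ℓ_ge
  have hΛ := R.Λ_ge
  obtain ⟨-, h1, h2⟩ := R.burn_mem
  have h2g : 2 / g ≤ 1 := by rw [div_le_one (by linarith)]; linarith
  have hgΛ : 1 ≤ g * Λ := by nlinarith
  refine ⟨?_, ?_, Nat.ceil_pos.2 (by linarith), ?_, ?_, ?_⟩
  · rw [R.card_eq, one_div, ← exp_neg]
    exact exp_le_exp.2 (neg_le_neg (mul_le_of_le_one_left (by linarith) h2g))
  · have : (burn g ℓ Λ : ℝ) * 1 ≤ burn g ℓ Λ * (g * ℓ) :=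
      mul_le_left (by nlinarith) (Nat.cast_nonneg _)
    nlinarith
  · linarith [Nat.ceil_lt_add_one (by linarith : 0 ≤ 12 * g * Λ)]
  · rw [← exp_nat_mul, exp_le_exp, div_mul_eq_mul_div, mul_neg, neg_le_neg_iff,
      div_le_iff₀ (by linarith)]
    linarith
  · have h := R.small (c := 131820 * g ^ 5) (κ := 2 / g) (p := 3) 7 (by norm_num)
      ((mul_le_right (by nlinarith : 131820 ≤ g ^ 2) (by positivity)).trans_eq (by ring)) (by omega) (by field_simp; norm_num)
    rw [exp_neg, ← div_eq_mul_inv, div_le_div_iff₀ (exp_pos _) (by positivity)]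
    linarith

lemma avg_mem {F : V → ℝ} {a b : ℝ} (h1 : ∀ v, a ≤ F v) (h2 : ∀ v, F v ≤ b) :
    a ≤ avg F ∧ avg F ≤ b := by
  have := R.nonempty
  have hn : 0 < (nV : ℝ) := card_pos_real
  rw [avg, le_div_iff₀ hn, div_le_iff₀ hn]
  have e : ∀ c : ℝ, ∑ _v : V, c = c * nV := fun c => by simp [mul_comm]
  exact ⟨(e a).symm.trans_le (sum_le_sum fun v _ => h1 v),
    (sum_le_sum fun v _ => h2 v).trans_eq (e b)⟩

/-- Averages of a function with comparable values converge, with high probability. -/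
lemma pr_not_ergodic {F : V → ℝ} {b : ℝ} (hb : 0 < b) (h1 : ∀ v, b ≤ F v) (h2 : ∀ v, F v ≤ C * b) :
    pr (fun η => Contr Qε (exp (-(2 * ℓ)) ^ 4) η ∧
      ¬ Ergodic Qε η (burn g ℓ Λ) F (4 * C ^ 2 / g)) ≤ 2 / (nV : ℝ) ^ 2 := by
  have := R.nonempty
  obtain ⟨hC, -, hg, -⟩ := R.basic
  have hQ := gQ_isDS G R.ε_pos
  have hCb : 0 < C * b := by positivity
  obtain ⟨hw, hm, hL1, hL, hsm, hMw⟩ := R.scales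
  have hz := R.exp_le_z
  have hg0 : 0 < g := by linarith
  have hz1 : 40 * (1 / (60 * g ^ 2)) ≤ 1 / g := by
    rw [mul_one_div, div_le_div_iff₀ (by positivity) hg0]; nlinarith
  have hz2 : 1 / (60 * g ^ 2) ≤ 1 / 2 := one_div_le_one_div_of_le two_pos (by nlinarith)
  have hg1 : 1 / g ≤ 1 := by rw [div_le_one hg0]; linarith
  refine le_trans (pr_mono fun η _ h => ⟨h.1, fun h' => h.2 fun j hj x => ?_⟩)
    (pr_Kpow_dev_le hQ (exp_pos _).le (hz.trans hz2) R.gQ_le le_rfl hw R.burn_mem.1 hm hL1 hL hsm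
      hz hMw (by positivity) hg1 hz1 ?_ (F := fun v => (C * b)⁻¹ * F v)
      (fun v => mul_nonneg (by positivity) (hb.le.trans (h1 v))) fun v => ?_)
  · rw [R.card_eq, log_exp, one_div_mul_eq_div, le_div_iff₀ hg0]
    linarith [Nat.le_ceil (12 * g * Λ)]
  · rw [inv_mul_le_one₀ hCb]; exact h2 v
  · obtain ⟨ha, -⟩ := R.avg_mem h1 h2
    have hm : ∀ x, |Kpow Qε η (burn g ℓ Λ) F x - avg F| ≤ 4 * C ^ 2 / g * avg F := fun x => by
      have h3 := h' x
      have e : avg (fun v => (C * b)⁻¹ * F v) = (C * b)⁻¹ * avg F := by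
        rw [avg, ← mul_sum, avg, mul_div_assoc]
      rw [Kpow_mul, e, ← mul_sub, abs_mul, abs_of_pos (inv_pos.2 hCb), inv_mul_le_iff₀ hCb] at h3
      refine h3.trans ?_
      rw [mul_one_div, div_mul_eq_mul_div]
      refine div_le_div_of_nonneg_right ?_ hg0.le
      nlinarith
    obtain ⟨k, rfl⟩ := Nat.exists_eq_add_of_le' hj
    rw [Kpow_add, abs_le]
    constructor
    · linarith [le_Kpow hQ (η := η) k (fun y => sub_le_of_abs_sub_le_left (hm y)) x]
    · linarith [Kpow_le hQ (η := η) k (fun y => sub_le_iff_le_add.1 (abs_le.1 (hm y)).2) x]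

/-- The numerical conditions for the concentration estimates over `k` steps. -/
lemma count {hb τ : ℝ} (h1 : ℓ ≤ hb) (h2 : hb ≤ C * ℓ) (h3 : ε⁻¹ ≤ τ) {k : ℕ}
    (hk : Λ / 2 ≤ k * hb) : 0 ≤ 4 * C ^ 2 / g ∧ 4 * C ^ 2 / g ≤ 1 ∧
      burn g ℓ Λ * (C * ℓ) ≤ 4 * C ^ 2 / g * (k * hb) ∧
      (C * ℓ) ^ 2 ≤ 4 * C ^ 2 / g * (k * hb ^ 2) ∧
      burn g ℓ Λ * (C * ε⁻¹) ≤ 4 * C ^ 2 / g * (k * τ) := by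
  obtain ⟨hC, hρ1, hg, -⟩ := R.basic
  have hℓ := R.ℓ_ge
  have hg0 : 0 < g := by linarith
  have hε := inv_pos.2 R.ε_pos
  obtain ⟨-, -, hm⟩ := R.burn_mem
  have hgℓ := R.le_Λ' 1 (by norm_num) (pow_one g).ge
  have hδ := mul_le_one₀ R.δ_le (sq_nonneg ρ) (by nlinarith [R.ρ_pos])
  have hΛ := R.Λ_ge
  refine ⟨by positivity, by rw [div_le_one hg0]; nlinarith [R.g_eq], ?_⟩
  simp only [div_mul_eq_mul_div, le_div_iff₀ hg0]
  refine ⟨?_, ?_, ?_⟩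
  · have h := mul_le_left hm (by positivity : 0 ≤ C)
    have h' := mul_le_left hk (by positivity : 0 ≤ 4 * C ^ 2)
    have := mul_le_right (by nlinarith : C ≤ C ^ 2) (by linarith : 0 ≤ Λ)
    linarith
  · have h : g * ℓ / 2 * ℓ ≤ k * hb * hb := mul_le_mul (by linarith) h1 (by positivity) (by linarith)
    nlinarith [mul_le_left h (by positivity : 0 ≤ 4 * C ^ 2), sq_nonneg (C * ℓ)]
  · have h : (burn g ℓ Λ : ℝ) * g * ℓ ≤ 4 * k * C * ℓ := by
      nlinarith [mul_le_left h2 (Nat.cast_nonneg k : (0 : ℝ) ≤ k)]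
    have h' := le_of_mul_le_mul_right h (by linarith)
    have := mul_le_mul h' h3 hε.le (by positivity)
    nlinarith

lemma error_eq : 4 * C ^ 2 / g = δ * ρ ^ 2 / 500 ∧ 1 / g ≤ δ / 2000 ∧ 960 * (64 * ρ) ≤ δ := by
  obtain ⟨hC, hρ1, hg, -⟩ := R.basic
  have h := R.g_eq
  have hρ := R.ρ_pos
  have hρ2 : ρ ^ 2 ≤ 1 := by nlinarith
  refine ⟨by rw [div_eq_div_iff] <;> linarith, ?_, by nlinarith [R.ρ_eq]⟩
  rw [div_le_div_iff₀ (by linarith) (by norm_num)]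
  nlinarith [mul_le_left hρ2 (by nlinarith [R.δ_pos] : 0 ≤ δ * g)]

lemma ent_avg : ℓ ≤ avg (ent Qε) ∧ avg (ent Qε) ≤ C * ℓ := R.avg_mem R.le_ent' R.ent_le

lemma cross_avg : ε⁻¹ ≤ avg (crossMean G ε) ∧ avg (crossMean G ε) ≤ C * ε⁻¹ :=
  R.avg_mem (fun v => (R.crossMean_mem v).1) fun v => (R.crossMean_mem v).2

lemma C_mul_le : C * ℓ ≤ ρ * Λ := by
  obtain ⟨hC, -, hg, hCg, hρ, -⟩ := R.basic
  have hℓ := R.ℓ_ge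
  have h : C * g * ℓ ≤ Λ := R.le_Λ' 2 (by norm_num) (by nlinarith)
  nlinarith [mul_le_left hρ (by positivity : 0 ≤ C * ℓ), R.ρ_pos]

lemma ceil_mem {hb a : ℝ} (h1 : ℓ ≤ hb) (h2 : hb ≤ C * ℓ) (ha : 0 ≤ a) :
    a * Λ ≤ ⌈a * Λ / hb⌉₊ * hb ∧ ⌈a * Λ / hb⌉₊ * hb ≤ (a + ρ) * Λ := by
  have hb0 : 0 < hb := by linarith [R.ℓ_ge]
  have hΛ : 0 ≤ Λ := by linarith [R.ℓ_ge, R.Λ_ge]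
  have h3 := Nat.le_ceil (a * Λ / hb)
  have h4 := (Nat.ceil_lt_add_one (by positivity : 0 ≤ a * Λ / hb)).le
  rw [div_le_iff₀ hb0] at h3
  rw [div_add_one hb0.ne', le_div_iff₀ hb0] at h4
  exact ⟨h3, by linarith [R.C_mul_le]⟩

lemma entry_le (hc : Contr Qε (exp (-(2 * ℓ)) ^ 4) η) (l : ℕ) (v x : V) :
    Kpow Qε η l (fun u => Qε u v) x ≤ (exp (-(Λ / g)) + exp (-ℓ) ^ (l + 1)) ^ 2 := by
  have := R.nonempty
  refine (hc.entry_le (gQ_isDS G R.ε_pos) (by positivity) R.gQ_le l v x).trans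
    ((kap_le (exp_pos _).le (exp_le_one_iff.2 (by linarith [R.ℓ_ge])) le_rfl
      (exp_pos _).le R.scales.1 l).trans ?_)
  have h1 : exp (-(2 / g * Λ)) = exp (-(Λ / g)) ^ 2 := by
    rw [← exp_nat_mul]; congr 1; push_cast; ring
  have h2 : exp (-(2 * ℓ)) ^ (l + 1) = (exp (-ℓ) ^ (l + 1)) ^ 2 := by
    rw [show -(2 * ℓ) = (2 : ℕ) * -ℓ by push_cast; ring, exp_nat_mul, ← pow_mul, ← pow_mul, mul_comm]
  rw [h1, h2]
  nlinarith [exp_pos (-(Λ / g)), pow_pos (exp_pos (-ℓ)) (l + 1)]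

set_option maxHeartbeats 400000 in
/-- Walks with `(1 - ρ) Λ / hb` jumps are unlikely to have large weight. -/
lemma pl_weight_le (hc : Contr Qε (exp (-(2 * ℓ)) ^ 4) η)
    (he : Ergodic Qε η (burn g ℓ Λ) (ent Qε) (4 * C ^ 2 / g)) (u : V) :
    pl Qε η ⌈(1 - ρ) * Λ / avg (ent Qε)⌉₊ u
      (fun as => if exp (-((1 - 2 * ρ) * Λ)) < gw Qε η as [] u then 1 else 0) ≤
      δ / 5 := by
  obtain ⟨hC, hρ1, hg, hCg, hρg, -⟩ := R.basic
  have hρ := R.ρ_pos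
  have hℓ := R.ℓ_ge
  have hΛ := R.Λ_ge
  obtain ⟨hb1, hb2⟩ := R.ent_avg
  obtain ⟨hk1, hk2⟩ := R.ceil_mem hb1 hb2 (by linarith : 0 ≤ 1 - ρ)
  obtain ⟨e1, e2, -⟩ := R.error_eq
  set hb := avg (ent Qε)
  set k := ⌈(1 - ρ) * Λ / hb⌉₊
  obtain ⟨c1, c2, c3, c4, -⟩ := R.count hb1 hb2 le_rfl (k := k) (by nlinarith)
  refine (pl_gw_gt_le (gQ_isDS G R.ε_pos) (fun l => sq_nonneg _) (R.entry_le hc) R.ent_le R.info_sq_le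
    c1 c2 (by linarith) hb2 R.burn_mem.1 he c3 c4 (y := ρ * Λ / 2) (by nlinarith) (exp_pos _)
    (by rw [log_exp]; linarith) u).trans ?_
  have hk0 : (0 : ℝ) ≤ k := k.cast_nonneg
  have hhb : 0 ≤ hb := by linarith
  have hΛ0 : 0 < Λ := by linarith
  have t1 : 22 * (4 * C ^ 2 / g) * (k * hb) ^ 2 / (ρ * Λ / 2) ^ 2 ≤ 88 / 500 * δ := by
    have : (k * hb) ^ 2 ≤ Λ ^ 2 := pow_le_pow_left₀ (by positivity) (by linarith) 2
    rw [div_le_iff₀ (by positivity), e1]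
    have hδ := R.δ_pos
    calc 22 * (δ * ρ ^ 2 / 500) * (k * hb) ^ 2 ≤ 22 * (δ * ρ ^ 2 / 500) * Λ ^ 2 :=
          mul_le_left this (by positivity)
      _ = _ := by ring
  set w' := exp (-(Λ / g)) with hw'
  set σ := exp (-ℓ) with hσ
  have hw0 : 0 < w' := exp_pos _
  have hσ0 : 0 < σ := exp_pos _
  have hσ1 : 32 * g ^ 3 * σ ≤ 1 := by
    have h1 : 32 * g ^ 3 ≤ ℓ := R.le_ℓ' 4 (by norm_num) (by nlinarith [pow_pos (by linarith : 0 < g) 3])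
    rw [hσ, exp_neg, ← div_eq_mul_inv, div_le_one (exp_pos _)]
    linarith [add_one_le_exp ℓ]
  have hw1 : 16 * g ^ 3 * Λ * w' ≤ 1 / 2 := by
    have h1 := R.small (c := 32 * g ^ 3) (κ := 1 / g) (p := 1) 4 (by norm_num)
      (by nlinarith [pow_pos (by linarith : 0 < g) 3]) (by omega) (by field_simp; norm_num)
    rw [pow_one, one_div_mul_eq_div] at h1
    rw [hw', exp_neg, ← div_eq_mul_inv, div_le_iff₀ (exp_pos _)]
    linarith
  have hg3 : 1 ≤ g ^ 3 := one_le_pow₀ (by linarith)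
  have hσ2 : σ ≤ 1 / 2 := by nlinarith
  have hw2 : w' ≤ 1 / 2 := by
    have : 1 ≤ 16 * g ^ 3 * Λ := by nlinarith
    nlinarith
  have hsum := sum_sq_add_sqrt_le hw0.le hσ0.le hw2 hσ2 (by nlinarith : 2 ≤ C * ℓ) k
  have hkℓ : k * ℓ ≤ Λ := (mul_le_left hb1 hk0).trans (by linarith)
  have hkΛ : (k : ℝ) ≤ Λ := by nlinarith
  have t2 : k * (2 * ∑ j ∈ range k,
      (C * ℓ * (w' + σ ^ (j + 1)) ^ 2 + 2 * √((w' + σ ^ (j + 1)) ^ 2))) / (ρ * Λ / 2) ≤ 1 / g := by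
    rw [div_le_div_iff₀ (by positivity) (by linarith)]
    have h1 : k * w' + 2 * σ ≤ (1 / (8 * g ^ 3)) := by
      rw [le_div_iff₀ (by positivity)]
      have := mul_le_right hkΛ (by positivity : 0 ≤ 16 * g ^ 3 * w')
      linarith
    have h2 : k * ℓ * (8 * C * (k * w' + 2 * σ)) ≤ Λ * (1 / g ^ 2) := by
      refine mul_le_mul hkℓ ?_ (by positivity) (by linarith)
      refine (mul_le_mul (mul_le_left hCg (by norm_num)) h1 (by positivity)
        (by positivity)).trans_eq (by field_simp)
    have h3 : Λ * (1 / g ^ 2) * g ≤ ρ * Λ := by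
      rw [mul_one_div, div_mul_eq_mul_div, div_le_iff₀ (by positivity)]
      nlinarith [mul_le_left hρg (by positivity : 0 ≤ Λ * g)]
    have h4 := mul_le_left hsum (by positivity : 0 ≤ 2 * g * k)
    have h5 := mul_le_right h2 (by linarith : 0 ≤ g)
    linarith
  exact (add_le_add t1 t2).trans (by linarith [R.δ_pos])

open Classical in
/-- The walk spreads out after `(1 - ρ) Λ / hb` jumps, with high probability. -/
lemma pr_not_spread : pr (fun η => (Contr Qε (exp (-(2 * ℓ)) ^ 4) η ∧
        Ergodic Qε η (burn g ℓ Λ) (ent Qε) (4 * C ^ 2 / g)) ∧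
      ¬ ∀ x, Kpow Qε η (burn g ℓ Λ) (fun u =>
        if SpreadAt Qε η ⌈(1 - ρ) * Λ / avg (ent Qε)⌉₊ (δ / 5 + 1 / g)
          (exp (-((1 - 4 * ρ) * Λ))) u then 0 else 1) x ≤ 1 / g) ≤
      1 / (nV : ℝ) ^ 2 := by
  have := R.nonempty
  obtain ⟨hC, hρ1, hg, hCg, hρg, -⟩ := R.basic
  have hρ := R.ρ_pos
  have hℓ := R.ℓ_ge
  have hΛ := R.Λ_ge
  have hg0 : 0 < g := by linarith
  obtain ⟨hb1, hb2⟩ := R.ent_avg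
  obtain ⟨-, hk2⟩ := R.ceil_mem hb1 hb2 (by linarith : 0 ≤ 1 - ρ)
  obtain ⟨hw, hm, hL1, hL, hsm, hMw⟩ := R.scales
  have hz := R.exp_le_z
  have hΛ0 : 0 ≤ Λ := by linarith
  have hz2 : 1 / (60 * g ^ 2) ≤ 1 / 2 := one_div_le_one_div_of_le two_pos (by nlinarith)
  set k := ⌈(1 - ρ) * Λ / avg (ent Qε)⌉₊
  have hk0 : (0 : ℝ) ≤ k := k.cast_nonneg
  have hkℓ : k * ℓ ≤ Λ := (mul_le_left hb1 hk0).trans (by linarith)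
  have hkΛ : (k : ℝ) ≤ Λ := by nlinarith
  refine le_trans (pr_mono fun η _ h => ⟨⟨h.1.1, R.pl_weight_le h.1.1 h.1.2⟩, h.2⟩)
    (pr_not_spread_le (gQ_isDS G R.ε_pos) (exp_pos _).le (hz.trans hz2) R.gQ_le le_rfl hw hm
      (by nlinarith) hL1 hL hsm hz hMw (by positivity) (by rw [div_le_one hg0]; linarith)
      (by field_simp; norm_num) ?_ (exp_pos _).le (exp_pos _) ?_)
  · rw [R.card_eq, log_exp]
    nlinarith [Nat.le_ceil (12 * g * Λ)]
  · have h8 : (8 : ℝ) ^ k ≤ exp (ρ * Λ) := by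
      have h3 : 8 ≤ exp 7 := by linarith [add_one_le_exp (7 : ℝ)]
      refine (pow_le_pow_left₀ (by norm_num) h3 k).trans ?_
      rw [← exp_nat_mul, exp_le_exp]
      have h7 : 7 * g ≤ ℓ := R.le_ℓ' 2 (by norm_num) (by nlinarith)
      have : 7 ≤ ρ * ℓ := by nlinarith
      nlinarith [mul_le_left this hk0]
    have hM : 82 * (13 * g * Λ) ^ 3 ≤ exp (2 * ρ * Λ) :=
      le_trans (le_of_eq (by ring)) (R.small (c := 180154 * g ^ 3) (p := 3) 5 (by norm_num)
        ((mul_le_right (by nlinarith : 180154 ≤ g ^ 2) (by positivity)).trans_eq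
          (by ring)) (by omega) (by linarith))
    have h2 : 120 * g ^ 2 ≤ exp (ρ * Λ) := by
      simpa using R.small (c := 120 * g ^ 2) (p := 0) 3 (by norm_num) (by nlinarith) (by omega) hρg
    have hsum : exp (-((1 - 2 * ρ) * Λ)) + 82 * (13 * g * Λ) ^ 3 / nV ≤
        2 * exp (-((1 - 2 * ρ) * Λ)) := by
      rw [R.card_eq, div_eq_mul_inv, ← exp_neg]
      have := mul_le_right hM (exp_pos (-Λ)).le
      rw [← exp_add, show 2 * ρ * Λ + -Λ = -((1 - 2 * ρ) * Λ) by ring] at this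
      linarith
    refine (mul_le_mul h8 hsum (by positivity) (exp_pos _).le).trans ?_
    rw [one_div_mul_eq_div, le_div_iff₀ (by positivity)]
    have e : exp (-((1 - 4 * ρ) * Λ)) = exp (ρ * Λ) * exp (-((1 - 2 * ρ) * Λ)) * exp (ρ * Λ) := by
      rw [← exp_add, ← exp_add]; ring_nf
    rw [e]
    have := mul_le_left h2 (by positivity : 0 ≤ exp (ρ * Λ) * exp (-((1 - 2 * ρ) * Λ)))
    linarith

lemma chebyshev {a c X T : ℝ} (h : a * c ^ 2 ≤ 22 * (4 * C ^ 2 / g) * X ^ 2) (hT : 0 < T)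
    (hc : δ / 8 * T ≤ c) (hX0 : 0 ≤ X) (hX : X ≤ 2 * T) : a ≤ δ / 100 := by
  obtain ⟨e1, -, e3⟩ := R.error_eq
  have hδ := R.δ_pos
  have hρ := R.ρ_pos
  rcases le_total a 0 with ha | ha
  · linarith
  have h1 := mul_le_left (pow_le_pow_left₀ (by positivity) hc 2) ha
  rw [e1] at h
  have h2 : 22 * (δ * ρ ^ 2 / 500) * X ^ 2 ≤ 22 * (δ * ρ ^ 2 / 500) * (2 * T) ^ 2 :=
    mul_le_left (pow_le_pow_left₀ hX0 hX 2) (by positivity)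
  have h3 := mul_le_left (pow_le_pow_left₀ (by positivity) e3 2) (by positivity : 0 ≤ δ * T ^ 2)
  refine le_of_mul_le_mul_right ?_ (by positivity : 0 < δ ^ 2 * T ^ 2)
  nlinarith

lemma C_sq_le : 2000 * C ^ 2 ≤ ρ * g ∧ 2000 * C ^ 2 ≤ g := by
  obtain ⟨-, hρ1, hg, -⟩ := R.basic
  have hρ := R.ρ_pos
  have h := mul_le_right (mul_le_one₀ R.δ_le hρ.le (by linarith)) (by positivity : 0 ≤ ρ * g)
  have h2 := R.g_eq
  constructor <;> nlinarith

lemma mul_mem {T : ℝ} (hT : 0 < T) : 0 < ρ * T ∧ 61440 * (ρ * T) ≤ δ * T ∧ δ * T ≤ T :=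
  ⟨mul_pos R.ρ_pos hT, by linarith [mul_le_right R.error_eq.2.2 hT.le],
    mul_le_of_le_one_left hT.le R.δ_le⟩

abbrev time (_ : Regime G D Δ C0 C δ ρ g ε ℓ Λ) : ℝ := avg (crossMean G ε) * Λ / avg (ent Qε)

lemma time_mem : 0 < R.time ∧ ε⁻¹ * Λ ≤ R.time * (C * ℓ) := by
  have hε := inv_pos.2 R.ε_pos
  obtain ⟨hb1, hb2⟩ := R.ent_avg
  have hℓ := R.ℓ_ge
  have hΛ : 0 < Λ := by linarith [R.Λ_ge]
  have hb : 0 < avg (ent Qε) := by linarith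
  have hτ := hε.trans_le R.cross_avg.1
  have h0 : 0 < R.time := by positivity
  refine ⟨h0, le_trans ?_ (mul_le_left hb2 h0.le)⟩
  rw [div_mul_cancel₀ _ hb.ne']
  exact mul_le_right R.cross_avg.1 hΛ.le

lemma mul_cross_mem {k : ℕ} {a b : ℝ} (h1 : a * Λ ≤ k * avg (ent Qε))
    (h2 : k * avg (ent Qε) ≤ b * Λ) :
    a * R.time ≤ k * avg (crossMean G ε) ∧ k * avg (crossMean G ε) ≤ b * R.time := by
  have hb : 0 < avg (ent Qε) := by linarith [R.ent_avg.1, R.ℓ_ge]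
  have hτ := (inv_pos.2 R.ε_pos).le.trans R.cross_avg.1
  simp only [time, ← mul_div_assoc, div_le_iff₀ hb, le_div_iff₀ hb]
  constructor <;> nlinarith

lemma cross_dev (hx : Ergodic Qε η (burn g ℓ Λ) (crossMean G ε) (4 * C ^ 2 / g)) {k : ℕ}
    (hk : Λ / 2 ≤ k * avg (ent Qε)) (x : V) :
    crossDev G ε η k (k * avg (crossMean G ε)) x ≤
      22 * (4 * C ^ 2 / g) * (k * avg (crossMean G ε)) ^ 2 := by
  obtain ⟨c1, c2, -, -, c5⟩ := R.count R.ent_avg.1 R.ent_avg.2 R.cross_avg.1 hk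
  exact crossDev_le R.ε_pos (fun v => (R.crossMean_mem v).2) c1 c2
    ((inv_pos.2 R.ε_pos).le.trans R.cross_avg.1) R.cross_avg.2 R.burn_mem.1 hx c5 x

/-- The number of steps over which the walk is smoothed. -/
lemma exists_smoothing : ∃ s0 : ℕ, 1 ≤ s0 ∧ g ^ 6 ≤ ε / (2 * (Δ + 1)) * s0 ∧
    (s0 : ℝ) ≤ δ / 2 * R.time := by
  obtain ⟨hC, hρ1, hg, hCg, hρg, hδg⟩ := R.basic
  have hδ := R.δ_pos
  have hℓ := R.ℓ_ge
  have hε := inv_pos.2 R.ε_pos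
  have hΔ := R.one_le_Δ
  obtain ⟨ht, ht'⟩ := R.time_mem
  set s0 := ⌈2 * (Δ + 1) * g ^ 6 * ε⁻¹⌉₊
  have hs1 := Nat.le_ceil (2 * (Δ + 1) * g ^ 6 * ε⁻¹)
  have hg6 : 1 ≤ g ^ 6 := one_le_pow₀ (by linarith)
  refine ⟨s0, Nat.ceil_pos.2 (by positivity), ?_, ?_⟩
  · have h := mul_le_left hs1 (by have := R.ε_pos; positivity : 0 ≤ ε / (2 * (Δ + 1)))
    refine le_trans (le_of_eq ?_) h
    have := R.ε_pos.ne'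
    field_simp
  · have h1 := (Nat.ceil_lt_add_one (by positivity : 0 ≤ 2 * (Δ + 1) * g ^ 6 * ε⁻¹)).le
    have h2 : 1 ≤ ε⁻¹ := (one_le_inv₀ R.ε_pos).2 R.ε_le
    have h3 : 1 ≤ (Δ + 1) * g ^ 6 * ε⁻¹ := one_le_mul_of_one_le_of_one_le (by nlinarith) h2
    have h4 : 6 * (Δ + 1) * C * g ^ 7 * ℓ ≤ Λ := by
      refine R.le_Λ' 9 le_rfl ?_
      have : 6 * (Δ + 1) * C ≤ g ^ 2 := by nlinarith [R.le_C, R.C_sq_le.2]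
      exact (mul_le_right this (by positivity)).trans_eq (by ring)
    refine le_of_mul_le_mul_right ?_ (by positivity : 0 < C * ℓ)
    have h5 := mul_le_left ht' hδ.le
    have h6 := mul_le_left h4 (by positivity : 0 ≤ δ * ε⁻¹)
    have h7 := mul_le_left hδg (by positivity : 0 ≤ 6 * (Δ + 1) * C * g ^ 6 * ℓ * ε⁻¹)
    have h8 := mul_le_right (by linarith : (s0 : ℝ) ≤ 3 * ((Δ + 1) * g ^ 6 * ε⁻¹))
      (by positivity : 0 ≤ C * ℓ)
    linarith

lemma exp_pow_le : exp (-(2 * ℓ)) ^ 4 ≤ 1 / 2 := by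
  have hℓ := R.ℓ_ge
  rw [← exp_nat_mul]
  have h : (4 : ℕ) * -(2 * ℓ) ≤ -1 := by push_cast; linarith
  exact (exp_le_exp.2 h).trans exp_neg_one_lt_half.le

lemma sqrt_mul_pow_le {q : ℕ} (hq1 : ρ * Λ ≤ q * ℓ) : √(exp (-((1 - 4 * ρ) * Λ)) * nV) *
      (exp (-(2 * ℓ)) ^ 4) ^ (2 * q / 2) ≤ 1 / g := by
  obtain ⟨-, -, hg, -, hρg, -⟩ := R.basic
  have h2 : g ≤ exp (6 * ρ * Λ) := by
    simpa using R.small (c := g) (p := 0) 1 (by norm_num) (by simp) (by omega)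
      (by linarith : 1 ≤ 6 * ρ * g)
  rw [R.card_eq, ← exp_add, ← exp_nat_mul, ← exp_nat_mul, sqrt_eq_rpow,
    ← exp_mul, ← exp_add, Nat.mul_div_cancel_left _ two_pos]
  refine le_trans (exp_le_exp.2 (by push_cast; linarith : _ ≤ -(6 * ρ * Λ))) ?_
  rw [exp_neg, ← one_div]
  exact one_div_le_one_div_of_le (by linarith) h2

lemma sqrt_le : √(4 / √(g ^ 6) * (Δ + 1)) ≤ 1 / g := by
  obtain ⟨hC, hρ1, hg, hCg, hρg, hδg⟩ := R.basic
  rw [show g ^ 6 = (g ^ 3) ^ 2 by ring, sqrt_sq (by positivity)]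
  refine sqrt_le_iff.2 ⟨by positivity, ?_⟩
  rw [div_mul_eq_mul_div, div_pow, one_pow, div_le_div_iff₀ (by positivity) (by positivity)]
  have : 4 * (Δ + 1) ≤ g := by nlinarith [R.le_C, R.C_sq_le.2]
  nlinarith [sq_nonneg g]

open Classical in
/-- The walk is mixed at time `(1 + δ) t`. -/
lemma exists_mixedAt (hη : IsPM η) (hD : Decor G ε (exp (-(2 * ℓ)) ^ 4) η)
    (hx : Ergodic Qε η (burn g ℓ Λ) (crossMean G ε) (4 * C ^ 2 / g))
    (hsp : ∀ x, Kpow Qε η (burn g ℓ Λ) (fun u =>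
        if SpreadAt Qε η ⌈(1 - ρ) * Λ / avg (ent Qε)⌉₊ (δ / 5 + 1 / g)
          (exp (-((1 - 4 * ρ) * Λ))) u then 0 else 1) x ≤ 1 / g) :
    ∃ T : ℕ, (T : ℝ) ≤ (1 + δ) * R.time ∧ mixedAt (starMatrix G η ε) (starPi G ε) δ T := by
  have := R.nonempty
  obtain ⟨hC, hρ1, hg, hCg, hρg, hδg⟩ := R.basic
  have hδ := R.δ_pos
  have hℓ := R.ℓ_ge
  have hΛ := R.Λ_ge
  have hΛ0 : 0 < Λ := by linarith
  obtain ⟨hρΛ, hρΛ', hδΛ⟩ := R.mul_mem hΛ0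
  have hΔ := R.one_le_Δ
  have hCℓ := R.C_mul_le
  obtain ⟨hb1, hb2⟩ := R.ent_avg
  obtain ⟨hi1, hi2⟩ := R.ceil_mem hb1 hb2 (by linarith : 0 ≤ 1 - ρ)
  obtain ⟨e1, e2, e3⟩ := R.error_eq
  obtain ⟨ht, ht'⟩ := R.time_mem
  obtain ⟨hρt, hρt', hδt⟩ := R.mul_mem ht
  have hb0 : 0 ≤ avg (ent Qε) := by linarith
  have hCsq := R.C_sq_le.1
  set q := ⌈ρ * Λ / ℓ⌉₊
  have hq1 : ρ * Λ ≤ q * ℓ := (div_le_iff₀ (by linarith)).1 (Nat.le_ceil _)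
  have hq2 : q * ℓ ≤ 2 * (ρ * Λ) := by
    have h := (Nat.ceil_lt_add_one (by positivity : 0 ≤ ρ * Λ / ℓ)).le
    rw [div_add_one (by linarith), le_div_iff₀ (by linarith)] at h
    linarith [mul_le_right (by linarith : 1 ≤ C) (by linarith : 0 ≤ ℓ)]
  obtain ⟨-, -, hm⟩ := R.burn_mem
  set i := ⌈(1 - ρ) * Λ / avg (ent Qε)⌉₊
  set m := burn g ℓ Λ
  have hJ1 : 1 / 2 * Λ ≤ (m + (i + 2 * q) : ℕ) * avg (ent Qε) := by
    push_cast
    linarith [mul_nonneg (Nat.cast_nonneg (α := ℝ) m) hb0, mul_nonneg (Nat.cast_nonneg (α := ℝ) q) hb0]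
  have hJ2 : (m + (i + 2 * q) : ℕ) * avg (ent Qε) ≤ (1 + δ / 8) * Λ := by
    have h1 : m * avg (ent Qε) ≤ ρ * Λ := by
      refine (mul_le_left hb2 m.cast_nonneg).trans (le_of_mul_le_mul_right ?_ (by linarith : 0 < g))
      have := mul_le_left hm (by linarith : 0 ≤ C)
      have : 2 * C * Λ ≤ ρ * g * Λ := mul_le_right (by nlinarith) (by linarith)
      linarith
    have h2 : q * avg (ent Qε) ≤ 2 * (C * ρ * Λ) := by
      refine (mul_le_left hb2 q.cast_nonneg).trans ?_
      linarith [mul_le_left hq2 (by linarith : 0 ≤ C)]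
    have h3 : ρ * Λ ≤ C * ρ * Λ := by linarith [mul_le_right (by linarith : 1 ≤ C) hρΛ.le]
    have h4 : 64 * (C * ρ * Λ) = δ * Λ := by rw [← R.ρ_eq]; ring
    push_cast
    linarith
  obtain ⟨hJt1, hJt2⟩ := R.mul_cross_mem hJ1 hJ2
  set r := ⌊(1 + δ / 2) * R.time⌋₊
  have hr1 : (1 + δ / 2) * R.time ≤ r + 1 := (Nat.lt_floor_add_one _).le
  have hr2 : (r : ℝ) ≤ (1 + δ / 2) * R.time := Nat.floor_le (by positivity)
  have hlate : ∀ x, late G ε η (m + (i + 2 * q)) r x ≤ δ / 100 := fun x =>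
    R.chebyshev ((late_mul_le R.ε_pos _ r (by linarith) x).trans (R.cross_dev hx (by linarith) x)) ht
      (by linarith) (by linarith) (by linarith)
  obtain ⟨s0, hs0, hs1, hs2⟩ := R.exists_smoothing
  refine ⟨r + s0, by push_cast; linarith, fun x => le_trans
    (mixedAt_of_spread R.ε_pos R.ε_le (by linarith) R.dg_le R.one_le_dg (by positivity) R.exp_pow_le hη hD hlate hsp
      (by positivity) hs0 (one_le_pow₀ (by linarith)) hs1 x) ?_⟩
  linarith [R.sqrt_mul_pow_le hq1, R.sqrt_le]

/-- With high probability the walk makes at most `N` steps between jumps, and within this range it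
visits few vertices. -/
lemma exists_range {k : ℕ} (hk : k ≤ Λ) : ∃ N : ℕ, k * (Δ / (Δ + ε)) ^ N ≤ 1 / g ∧
    (k + 1) * exp ((1 - δ / 4) * Λ) * (C0 * ((N : ℝ) + 1) ^ D) * (Δ + 1) / nV ≤ 1 / g := by
  obtain ⟨hC, hρ1, hg, hCg, hρg, hδg⟩ := R.basic
  have hδ := R.δ_pos
  have hδ1 := R.δ_le
  have hℓ := R.ℓ_ge
  have hΛ := R.Λ_ge
  have hε := R.ε_pos
  have hΔ := R.one_le_Δ
  have hΛ0 : 0 < Λ := by linarith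
  have e2 := R.error_eq.2.1
  set N := ⌈(Δ + 1) * Λ * ε⁻¹⌉₊
  have hN := Nat.le_ceil ((Δ + 1) * Λ * ε⁻¹)
  have hN2 : (N : ℝ) + 1 ≤ 3 * (Δ + 1) * Λ * ε⁻¹ := by
    have h3 := (Nat.ceil_lt_add_one (by positivity : 0 ≤ (Δ + 1) * Λ * ε⁻¹)).le
    have h4 : 1 ≤ (Δ + 1) * Λ * ε⁻¹ :=
      one_le_mul_of_one_le_of_one_le (by nlinarith) ((one_le_inv₀ R.ε_pos).2 R.ε_le)
    linarith
  refine ⟨N, ?_, ?_⟩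
  · have h4 : Δ / (Δ + ε) ≤ exp (-(ε / (Δ + 1))) := by
      refine le_trans ?_ (one_sub_le_exp_neg _)
      rw [one_sub_div (by positivity), div_le_div_iff₀ (by positivity) (by positivity)]
      nlinarith [R.ε_le]
    have h5 : (Δ / (Δ + ε)) ^ N ≤ exp (-Λ) := by
      refine (pow_le_pow_left₀ (by positivity) h4 N).trans ?_
      rw [← exp_nat_mul, exp_le_exp, mul_neg, neg_le_neg_iff]
      refine le_trans (le_of_eq ?_) (mul_le_right hN (by positivity))
      field_simp
    have h6 := R.small (c := g) (p := 1) (κ := 1) 1 (by norm_num) (by simp) (by omega) (by linarith)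
    rw [pow_one, one_mul] at h6
    refine (mul_le_mul hk h5 (by positivity) hΛ0.le).trans ?_
    rw [exp_neg, ← div_eq_mul_inv, div_le_div_iff₀ (exp_pos _) (by linarith)]
    linarith
  · have h5 : C0 * ((N : ℝ) + 1) ^ D * (Δ + 1) ≤ C * Λ ^ D * exp (δ / 8 * Λ) := by
      have h6 : (ε⁻¹) ^ D ≤ exp (δ / 8 * Λ) := by
        rw [R.ε_eq, ← exp_neg, ← exp_nat_mul, exp_le_exp, neg_neg]
        have h7 : (D : ℝ) ≤ C := by linarith [R.C_ge, (D.cast_nonneg : (0 : ℝ) ≤ D)]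
        have h8 := mul_le_right (mul_le_mul h7 R.C_ge (by positivity) (by linarith))
          (by linarith : 0 ≤ ℓ)
        have h9 : 8 * C ^ 2 * g * ℓ ≤ Λ := R.le_Λ' 2 (by norm_num) (by
          have : 8 * C ^ 2 ≤ g := by linarith [R.C_sq_le.2, sq_nonneg C]
          nlinarith)
        nlinarith [mul_le_left h9 hδ.le, mul_le_left hδg (by positivity : 0 ≤ 8 * C ^ 2 * ℓ)]
      have h7 := mul_le_left (pow_le_pow_left₀ (by positivity) hN2 D) R.C0_nonneg
      calc _ ≤ C0 * (3 * (Δ + 1) * Λ * ε⁻¹) ^ D * (Δ + 1) := mul_le_right h7 (by linarith)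
        _ = C0 * (3 * (Δ + 1)) ^ D * (Δ + 1) * Λ ^ D * ε⁻¹ ^ D := by rw [mul_pow, mul_pow]; ring
        _ ≤ _ := mul_le_mul (mul_le_right R.le_C'' (by positivity)) h6 (by positivity)
            (by positivity)
    have h6 := R.small (c := 2 * C * g) (p := D + 1) (κ := δ / 8) 3 (by norm_num)
      (by nlinarith [sq_nonneg g]) (by omega) ?_
    rw [R.card_eq, div_le_div_iff₀ (exp_pos _) (by linarith), one_mul]
    have h7 : (k + 1) * exp ((1 - δ / 4) * Λ) * (C0 * ((N : ℝ) + 1) ^ D * (Δ + 1)) ≤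
        2 * Λ * exp ((1 - δ / 4) * Λ) * (C * Λ ^ D * exp (δ / 8 * Λ)) :=
      mul_le_mul (mul_le_right (by linarith) (exp_pos _).le) h5
        (by have := R.C0_nonneg; positivity) (by positivity)
    have h8 := mul_le_right h6 (by positivity : 0 ≤ exp ((1 - δ / 4) * Λ) * exp (δ / 8 * Λ))
    have h9 : exp (δ / 8 * Λ) * (exp ((1 - δ / 4) * Λ) * exp (δ / 8 * Λ)) =
        exp Λ := by rw [← exp_add, ← exp_add]; ring_nf
    rw [h9] at h8
    refine le_trans ?_ h8
    refine (le_of_eq (by ring)).trans ((mul_le_right h7 (by linarith : 0 ≤ g)).trans_eq ?_)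
    ring
    · rw [div_mul_eq_mul_div, le_div_iff₀ (by norm_num)]
      rw [div_le_div_iff₀ (by linarith) (by norm_num)] at e2
      linarith

/-- The walk is not mixed before time `(1 - δ) t`. -/
lemma not_mixedAt (he : Ergodic Qε η (burn g ℓ Λ) (ent Qε) (4 * C ^ 2 / g))
    (hx : Ergodic Qε η (burn g ℓ Λ) (crossMean G ε) (4 * C ^ 2 / g)) {T : ℕ}
    (h : mixedAt (starMatrix G η ε) (starPi G ε) (1 - δ) T) : (1 - δ) * R.time ≤ T := by
  have := R.nonempty
  by_contra! hT
  have hδ := R.δ_pos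
  have hδ1 := R.δ_le
  have hℓ := R.ℓ_ge
  have hΛ := R.Λ_ge
  have hΔ := R.one_le_Δ
  obtain ⟨hb1, hb2⟩ := R.ent_avg
  obtain ⟨hk1, hk2⟩ := R.ceil_mem hb1 hb2 (by linarith : 0 ≤ 1 - δ / 2)
  obtain ⟨e1, e2, e3⟩ := R.error_eq
  obtain ⟨ht, -⟩ := R.time_mem
  set k := ⌈(1 - δ / 2) * Λ / avg (ent Qε)⌉₊
  have hΛ0 : 0 < Λ := by linarith
  obtain ⟨hρΛ, hρΛ', hδΛ⟩ := R.mul_mem hΛ0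
  obtain ⟨hρt, hρt', hδt⟩ := R.mul_mem ht
  have hkΛ : Λ / 2 ≤ k * avg (ent Qε) := by linarith
  obtain ⟨hkt1, hkt2⟩ := R.mul_cross_mem hk1 hk2
  obtain ⟨x⟩ := R.nonempty
  have h1 := R.chebyshev ((one_sub_late_mul_le R.ε_pos _ T (by linarith) x).trans (R.cross_dev hx hkΛ x)) ht
      (by linarith) (by linarith) (by linarith)
  have h2 : pl Qε η k x
      (fun as => if (1 - δ / 4) * Λ < tot Qε η as x then 1 else 0) ≤ δ / 100 := by
    obtain ⟨c1, c2, c3, c4, -⟩ := R.count hb1 hb2 le_rfl hkΛ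
    have hQ := gQ_isDS G R.ε_pos
    have hy : 0 < δ / 8 * Λ := by positivity
    have := pl_tot_dev_le hQ R.ent_le R.info_sq_le c1 c2 (by linarith) hb2 R.burn_mem.1 he c3 c4 hy x
    refine (pl_mono hQ k x fun as => ?_).trans (R.chebyshev ((le_div_iff₀ (by positivity)).1 this)
      hΛ0 le_rfl (by linarith) (by linarith))
    split_ifs with h3 h4 <;> try norm_num
    exact h4 (le_trans (by linarith) (le_abs_self _))
  have hk : (k : ℝ) ≤ Λ := by
    linarith [mul_le_left (by linarith : 1 ≤ avg (ent Qε)) k.cast_nonneg]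
  obtain ⟨N, h3, h4⟩ := R.exists_range hk
  have h5 := le_of_mixedAt_of_reach R.ε_pos R.ε_le R.conn (by linarith) R.dg_le R.one_le_dg
    (fun x => R.ball x N) h k ((1 - δ / 4) * Λ) x
  linarith

end Regime

section

/-- Mixing happens within a factor `1 ± δ` of time `t`. -/
def MixesNear (P : Matrix V V ℝ) (stat : V → ℝ) (δ t : ℝ) : Prop :=
  (∃ T : ℕ, (T : ℝ) ≤ (1 + δ) * t ∧ mixedAt P stat δ T) ∧
    ∀ T : ℕ, mixedAt P stat (1 - δ) T → (1 - δ) * t ≤ T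

lemma MixesNear.tmix_mem {P : Matrix V V ℝ} {stat : V → ℝ} {δ t θ : ℝ} (h : MixesNear P stat δ t)
    (h1 : δ ≤ θ) (h2 : θ ≤ 1 - δ) :
    t - 1 * (δ * t) ≤ tmix P stat θ ∧ tmix P stat θ ≤ t + 1 * (δ * t) := by
  obtain ⟨⟨T, hT, hm⟩, hl⟩ := h
  have hT' : T ∈ {t | mixedAt P stat θ t} := fun x => (hm x).trans h1
  refine ⟨?_, (Nat.cast_le.2 (Nat.sInf_le hT')).trans (by linarith)⟩
  have := hl (tmix P stat θ) fun x => (Nat.sInf_mem (s := {t | mixedAt P stat θ t}) ⟨T, hT'⟩ x).trans h2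
  linarith

lemma Regime.pr_not_mixesNear {D : ℕ} {Δ C0 C δ ρ g ε ℓ Λ : ℝ} (R : Regime G D Δ C0 C δ ρ g ε ℓ Λ) :
    pr (fun η => ¬ MixesNear (starMatrix G η ε) (starPi G ε) δ R.time) ≤
      9 / (nV : ℝ) ^ 2 + 16 / √nV := by
  classical
  have hℓ := R.ℓ_ge
  refine (pr_mono fun η hη h => ?_).trans ((pr_or_le _ _).trans (add_le_add ((pr_or_le _ _).trans
    (add_le_add ((pr_or_le _ _).trans (add_le_add R.pr_not_decor
      (R.pr_not_ergodic (by linarith : 0 < ℓ) R.le_ent' R.ent_le)))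
      (R.pr_not_ergodic (inv_pos.2 R.ε_pos) (fun v => (R.crossMean_mem v).1)
        fun v => (R.crossMean_mem v).2))) R.pr_not_spread)) |>.trans (le_of_eq (by ring))
  by_contra! hn
  obtain ⟨⟨⟨h1, h2⟩, h3⟩, h4⟩ := hn
  have hc := contr_of_decor R.ε_pos (by positivity) hη h1
  exact h ⟨R.exists_mixedAt hη h1 (h3 hc) (h4 ⟨hc, h2 hc⟩), fun T => R.not_mixedAt (h2 hc) (h3 hc)⟩

lemma eval_le (p : Polynomial ℝ) {x : ℝ} (hx : 1 ≤ x) :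
    p.eval x ≤ (∑ i ∈ range (p.natDegree + 1), |p.coeff i|) * x ^ p.natDegree := by
  rw [Polynomial.eval_eq_sum_range, sum_mul]
  refine sum_le_sum fun i hi => mul_le_mul (le_abs_self _) (pow_le_pow_right₀ hx ?_)
    (by positivity) (abs_nonneg _)
  rw [mem_range] at hi; omega

lemma card_gball_le {p : Polynomial ℝ}
    (h : ∀ (x : V) (r : ℕ), 1 ≤ r → (Nat.card {y : V | G.dist x y ≤ r} : ℝ) ≤ p.eval (r : ℝ))
    (x : V) (r : ℕ) : ((gball G x r).card : ℝ) ≤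
      (∑ i ∈ range (p.natDegree + 1), |p.coeff i|) * ((r : ℝ) + 1) ^ p.natDegree := by
  have h1 := (h x (r + 1) (by omega)).trans (eval_le p (by simp))
  push_cast at h1
  refine le_trans (Nat.cast_le.2 ?_) h1
  rw [Nat.card_eq_fintype_card, Fintype.card_subtype]
  exact card_le_card fun y hy => by simp only [mem_gball] at hy; simp; omega

end

/-- A diagonal argument: the precision can be improved along a sequence. -/
lemma exists_diagonal {f : ℕ → ℕ → ℝ} (h0 : ∀ k n, 0 ≤ f k n) (h1 : ∀ k n, f k n ≤ 1)
    (h : ∀ k, Tendsto (f k) atTop (nhds 1)) :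
    ∃ κ : ℕ → ℕ, Tendsto κ atTop atTop ∧ Tendsto (fun n => f (κ n) n) atTop (nhds 1) := by
  classical
  let P : ℕ → ℕ → Prop := fun n k => 1 - 1 / ((k : ℝ) + 1) ≤ f k n
  let κ : ℕ → ℕ := fun n => Nat.findGreatest (P n) n
  have hP : ∀ n, P n (κ n) := fun n => Nat.findGreatest_spec (Nat.zero_le n) (by simp [P, h0])
  have hκ : Tendsto κ atTop atTop := tendsto_atTop.2 fun k => by
    have : 1 - 1 / ((k : ℝ) + 1) < 1 := sub_lt_self _ (by positivity)
    filter_upwards [eventually_ge_atTop k, (h k).eventually (eventually_ge_nhds this)] with n hn hk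
    exact Nat.le_findGreatest hn hk
  refine ⟨κ, hκ, tendsto_of_tendsto_of_tendsto_of_le_of_le ?_ tendsto_const_nhds hP fun n => h1 _ n⟩
  simpa using (tendsto_one_div_add_atTop_nhds_zero_nat.comp hκ).const_sub (1 : ℝ)

lemma eventually_pow_le_exp (c : ℝ) {g : ℝ} (hc : 0 < c) (hg : 0 < g) (k : ℕ) :
    ∀ᶠ x : ℝ in atTop, c * x ^ k ≤ exp (x / g) := by
  filter_upwards [(isLittleO_pow_exp_pos_mul_atTop k (inv_pos.2 hg)).bound (inv_pos.2 hc),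
    eventually_ge_atTop 0] with x hx h0
  rwa [norm_of_nonneg (by positivity), norm_of_nonneg (exp_pos _).le, inv_mul_eq_div,
    inv_mul_eq_div, le_div_iff₀' hc] at hx

end StarCutoff

open StarCutoff in
theorem stmt1 (Δ : ℕ) (p : Polynomial ℝ)
    (V : ℕ → Type) [∀ n, Fintype (V n)] [∀ n, DecidableEq (V n)]
    (G : ∀ n, SimpleGraph (V n)) [∀ n, DecidableRel (G n).Adj]
    (hconn : ∀ n, (G n).Connected)
    (heven : ∀ n, Even (Fintype.card (V n)))
    (hcard : Tendsto (fun n => Fintype.card (V n)) atTop atTop)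
    (hdeg : ∀ n (x : V n), (G n).degree x ≤ Δ)
    (hballs : ∀ n (x : V n) (r : ℕ), 1 ≤ r →
      (Nat.card {y : V n | (G n).dist x y ≤ r} : ℝ) ≤ p.eval (r : ℝ))
    (ε : ℕ → ℝ) (hε : ∀ n, ε n ∈ Set.Ioo (0 : ℝ) 1)
    (hε0 : Tendsto ε atTop (nhds 0))
    (hεpoly : Tendsto (fun n => Real.log (1 / ε n) / Real.log (Fintype.card (V n)))
      atTop (nhds 0)) :
    ∃ c' C' : ℝ, 0 < c' ∧ c' ≤ C' ∧
      ∃ t s : ℕ → ℝ,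
        (∀ n, c' * ((1 / ε n) * Real.log (Fintype.card (V n)) / Real.log (1 / ε n)) ≤ t n ∧
          t n ≤ C' * ((1 / ε n) * Real.log (Fintype.card (V n)) / Real.log (1 / ε n))) ∧
        (∀ n, 0 < t n) ∧ (∀ n, 0 ≤ s n) ∧
        Tendsto (fun n => s n / t n) atTop (nhds 0) ∧
        ∀ θ ∈ Set.Ioo (0 : ℝ) 1, ∃ cθ : ℝ,
          Tendsto (fun n => matchingProb (V n) (fun η =>
              t n - cθ * s n ≤ (tmix (starMatrix (G n) η (ε n)) (starPi (G n) (ε n)) θ : ℝ) ∧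
              (tmix (starMatrix (G n) η (ε n)) (starPi (G n) (ε n)) θ : ℝ) ≤ t n + cθ * s n))
            atTop (nhds 1) := by
  have htwo : ∀ n, 1 < Fintype.card (V n) := fun n => by
    have := (hconn n).nonempty
    obtain ⟨k, hk⟩ := heven n
    have := Fintype.card_pos (α := V n)
    omega
  have hlog : ∀ n, 0 < Real.log (Fintype.card (V n)) := fun n =>
    Real.log_pos (Nat.one_lt_cast.2 (htwo n))
  have hlogε : ∀ n, 0 < Real.log (1 / ε n) := fun n =>
    Real.log_pos ((one_lt_div (hε n).1).2 (hε n).2)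
  set D := p.natDegree
  set C0 := ∑ i ∈ Finset.range (p.natDegree + 1), |p.coeff i|
  have hC0 : 0 ≤ C0 := Finset.sum_nonneg fun i _ => abs_nonneg _
  have hD : (0 : ℝ) < 960 * (D + 1) := by positivity
  obtain ⟨C, hC1, hC2, hC3, hC4⟩ : ∃ C : ℝ, (Δ : ℝ) + 1 ≤ C ∧ 8 * C0 * 5 ^ D ≤ C ∧
      C0 * (3 * (Δ + 1)) ^ D * (Δ + 1) ≤ C ∧
      (2 * (D + 2) : ℝ) ^ 2 * (2 * (960 * (D + 1)) ^ 2 + 8 * Δ) + 32 * C0 ≤ C := by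
    obtain ⟨C, h⟩ := ({(Δ : ℝ) + 1, 8 * C0 * 5 ^ D, C0 * (3 * (Δ + 1)) ^ D * (Δ + 1),
      (2 * (D + 2) : ℝ) ^ 2 * (2 * (960 * (D + 1)) ^ 2 + 8 * Δ) + 32 * C0} : Finset ℝ).exists_le
    exact ⟨C, h _ (by simp), h _ (by simp), h _ (by simp), h _ (by simp)⟩
  have hC : 1 ≤ C := by linarith [(Δ.cast_nonneg : (0 : ℝ) ≤ Δ)]
  have hΛ := Real.tendsto_log_atTop.comp (tendsto_natCast_atTop_atTop.comp hcard)
  have hℓ : Tendsto (fun n => Real.log (1 / ε n)) atTop atTop := by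
    refine Real.tendsto_log_atTop.comp ?_
    simp only [one_div]
    exact tendsto_inv_nhdsGT_zero.comp
      (tendsto_nhdsWithin_iff.2 ⟨hε0, Eventually.of_forall fun n => (hε n).1⟩)
  have hreg : ∀ δ : ℝ, 0 < δ → δ ≤ 1 → ∃ ρ g, ∀ᶠ n in atTop, Regime (G n) D Δ C0 C δ ρ g (ε n)
      (Real.log (1 / ε n) / (960 * (D + 1))) (Real.log (Fintype.card (V n))) := fun δ hδ hδ1 => by
    set ρ := δ / (64 * C)
    set g := 2000 * C ^ 2 / (δ * ρ ^ 2)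
    have hg : 0 < g := by positivity
    refine ⟨ρ, g, ?_⟩
    have hr := hεpoly.eventually (eventually_le_nhds (by positivity : 0 < 960 * ((D : ℝ) + 1) / g ^ 9))
    filter_upwards [hℓ.eventually_ge_atTop (g ^ 9 * (960 * (D + 1))), hr,
      hΛ.eventually (eventually_pow_le_exp (g ^ 9) (by positivity) hg (D + 3))] with n h1 h2 h3
    have := Fintype.one_lt_card_iff_nontrivial.1 (htwo n)
    exact
      { conn := hconn n
        one_le_dg := fun x => Nat.one_le_cast.2 ((hconn n).preconnected.degree_pos_of_nontrivial x)
        dg_le := fun x => Nat.cast_le.2 (hdeg n x)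
        ball := card_gball_le (hballs n)
        C0_nonneg := hC0
        le_C := hC1
        le_C' := hC2
        le_C'' := hC3
        le_C_sq := hC4.trans (by nlinarith)
        δ_pos := hδ
        δ_le := hδ1
        ρ_eq := mul_div_cancel₀ _ (by positivity)
        g_eq := (mul_div_cancel₀ _ (by positivity)).symm
        card_eq := (Real.exp_log (Nat.cast_pos.2 (by linarith [htwo n]))).symm
        ε_eq := by
          rw [mul_div_cancel₀ _ hD.ne', one_div, Real.log_inv, neg_neg, Real.exp_log (hε n).1]
        le_ℓ := (le_div_iff₀ hD).2 h1
        le_Λ := by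
          rw [div_le_div_iff₀ (hlog n) (by positivity)] at h2
          rw [← mul_div_assoc, div_le_iff₀ hD]
          linarith
        le_exp := h3 }
  set τ : ℕ → ℝ := fun n => avg (crossMean (G n) (ε n)) * Real.log (Fintype.card (V n)) /
    avg (ent (gQ (G n) (ε n))) with hτ
  set X : ℕ → ℝ := fun n => (1 / ε n) * Real.log (Fintype.card (V n)) / Real.log (1 / ε n)
  have hX : ∀ n, 0 < X n := fun n => by
    have := hlog n; have := hlogε n; have := (hε n).1
    positivity
  set K : ℝ := 960 * (D + 1)
  have hKC := (div_le_self hD.le hC).trans (le_mul_of_one_le_right hD.le hC)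
  have hτX : ∀ᶠ n in atTop, max (K / C * X n) (min (K * C * X n) (τ n)) = τ n := by
    obtain ⟨ρ, g, h⟩ := hreg 1 one_pos le_rfl
    filter_upwards [h] with n R
    have hε' := inv_pos.2 (hε n).1
    have hl := hlog n
    have hlε := hlogε n
    obtain ⟨hb1, hb2⟩ := R.ent_avg
    obtain ⟨hc1, hc2⟩ := R.cross_avg
    have hb0 : 0 < Real.log (1 / ε n) / K := by positivity
    have e1 : K * C * X n = C * (ε n)⁻¹ * Real.log (Fintype.card (V n)) / (Real.log (1 / ε n) / K) := by
      simp only [X]; field_simp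
    have e2 : K / C * X n = (ε n)⁻¹ * Real.log (Fintype.card (V n)) / (C * (Real.log (1 / ε n) / K)) := by
      simp only [X]; field_simp
    rw [min_eq_right, max_eq_right]
    · rw [e2]
      exact div_le_div₀ (mul_nonneg (hε'.le.trans hc1) hl.le) (by gcongr) (hb0.trans_le hb1) hb2
    · rw [e1]
      exact div_le_div₀ (by positivity) (by gcongr) hb0 hb1
  have hgood : ∀ k : ℕ, Tendsto (fun n => pr fun η => MixesNear (starMatrix (G n) η (ε n))
      (starPi (G n) (ε n)) (1 / ((k : ℝ) + 1)) (τ n)) atTop (nhds 1) := fun k => by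
    obtain ⟨ρ, g, h⟩ := hreg (1 / ((k : ℝ) + 1)) (by positivity)
      (div_le_one_of_le₀ (by simp) (by positivity))
    have hcast : Tendsto (fun n => (Fintype.card (V n) : ℝ)) atTop atTop :=
      tendsto_natCast_atTop_atTop.comp hcard
    have hlim : Tendsto (fun n => 1 - (9 / (Fintype.card (V n) : ℝ) ^ 2 + 16 / √(Fintype.card (V n))))
        atTop (nhds 1) := by
      simpa using ((tendsto_const_nhds.div_atTop
        ((tendsto_pow_atTop two_ne_zero).comp hcast)).add (tendsto_const_nhds.div_atTop
        (Real.tendsto_sqrt_atTop.comp hcast))).const_sub (1 : ℝ)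
    refine tendsto_of_tendsto_of_tendsto_of_le_of_le' hlim tendsto_const_nhds ?_
      (Eventually.of_forall fun n => pr_le_one _)
    filter_upwards [h] with n R
    have := R.pr_not_mixesNear
    rw [pr_compl (heven n)] at this
    linarith
  obtain ⟨κ, hκ, hlim⟩ := exists_diagonal (fun _ _ => pr_nonneg _) (fun _ _ => pr_le_one _) hgood
  have hδ := tendsto_one_div_add_atTop_nhds_zero_nat (𝕜 := ℝ).comp hκ
  set t : ℕ → ℝ := fun n => max (K / C * X n) (min (K * C * X n) (τ n))
  have ht : ∀ n, 0 < t n := fun n =>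
    lt_max_of_lt_left (mul_pos (by positivity) (hX n))
  refine ⟨K / C, K * C, by positivity, hKC, t, fun n => 1 / ((κ n : ℝ) + 1) * t n,
    fun n => ⟨le_max_left _ _, max_le (mul_le_right hKC (hX n).le) (min_le_left _ _)⟩,
    ht, fun n => mul_nonneg (by positivity) (ht n).le, ?_, fun θ hθ => ⟨1, ?_⟩⟩
  · exact hδ.congr fun n => (mul_div_cancel_right₀ _ (ht n).ne').symm
  · simp only [matchingProb_eq_pr]
    refine tendsto_of_tendsto_of_tendsto_of_le_of_le' hlim tendsto_const_nhds ?_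
      (Eventually.of_forall fun n => pr_le_one _)
    filter_upwards [hτX, hδ.eventually (eventually_le_nhds hθ.1),
      hδ.eventually (eventually_le_nhds (sub_pos.2 hθ.2))] with n h1 h2 h3
    refine pr_mono fun η _ h => ?_
    simp only [t, h1]
    exact h.tmix_mem h2 (by simp only [Function.comp] at h3; linarith)
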